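/- Let c be a real number with 1 < c < 4109054/1999527 and c ≠ 2, let ε > 0 be fixed and sufficiently small, and for a sufficiently large integer N set P = N^{1/c} and τ = P^{1-c-ε}. Then R_5^{(2)}(N) := ∫_{τ}^{1-τ} S(α)^5 e(-Nα) dα ≪ N^{5/c - 1 - ε'} for some ε' > 0 (with implied constant depending only on c and ε). -/

import Mathlib

open scoped Classical
open Finset Real MeasureTheory

/-- `eC x = e(x) = e^{2πix}`. -/
noncomputable def eC (x : ℝ) : ℂ := Complex.exp ((2 * Real.pi * x : ℝ) * Complex.I)

/-- `SS c P α = S(α) = Σ_{p ≤ P} (log p) e([p^c]α)`, the sum over primes `p ≤ P`. -/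
noncomputable def SS (c P α : ℝ) : ℂ :=
  ∑ p ∈ (Finset.range (⌊P⌋₊ + 1)).filter Nat.Prime,
    (Real.log p : ℂ) * eC ((⌊(p : ℝ) ^ c⌋ : ℝ) * α)

lemma eC_add (x y : ℝ) : eC (x + y) = eC x * eC y := by
  simp only [eC, ← Complex.exp_add]; congr 1; push_cast; ring

lemma eC_zero : eC 0 = 1 := by simp [eC]

lemma norm_eC (x : ℝ) : ‖eC x‖ = 1 := by
  rw [eC, Complex.norm_exp_ofReal_mul_I]

lemma eC_neg (x : ℝ) : eC (-x) = (starRingEnd ℂ) (eC x) := by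
  simp only [eC, ← Complex.exp_conj, map_mul, Complex.conj_ofReal, Complex.conj_I]
  congr 1; push_cast; ring

lemma eC_intCast (n : ℤ) : eC n = 1 := by
  rw [eC, Complex.exp_eq_one_iff]
  exact ⟨n, by push_cast; ring⟩

lemma eC_sub (x y : ℝ) : eC (x - y) = eC x * (starRingEnd ℂ) (eC y) := by
  rw [sub_eq_add_neg, eC_add, eC_neg]

lemma hasDerivAt_eC (x : ℝ) : HasDerivAt eC (2 * π * Complex.I * eC x) x := by
  have h1 : HasDerivAt (fun y : ℝ => ((2 * π * y : ℝ) : ℂ)) ((2 * π : ℝ) : ℂ) x := by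
    have : HasDerivAt (fun y : ℝ => 2 * π * y) (2 * π) x := by
      simpa using (hasDerivAt_id x).const_mul (2 * π)
    exact this.ofReal_comp
  have h2 := (h1.mul_const Complex.I).cexp
  refine h2.congr_deriv ?_
  simp only [eC]; push_cast; ring

lemma HasDerivAt.eC_comp {f : ℝ → ℝ} {f' x : ℝ} (hf : HasDerivAt f f' x) :
    HasDerivAt (fun y => eC (f y)) (2 * π * Complex.I * f' * eC (f x)) x := by
  have h := (hasDerivAt_eC (f x)).scomp x hf
  refine h.congr_deriv ?_
  rw [Complex.real_smul]; ring

@[fun_prop]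
lemma continuous_eC : Continuous eC := by
  unfold eC; fun_prop

lemma norm_sum_eC_neg {ι : Type*} (s : Finset ι) (f : ι → ℝ) :
    ‖∑ i ∈ s, eC (-f i)‖ = ‖∑ i ∈ s, eC (f i)‖ := by
  simp_rw [eC_neg]
  rw [← map_sum, RCLike.norm_conj]

lemma norm_sum_eC_le_card {ι : Type*} (s : Finset ι) (f : ι → ℝ) :
    ‖∑ i ∈ s, eC (f i)‖ ≤ s.card := by
  refine (norm_sum_le _ _).trans ?_
  simp [norm_eC]

/-- `1 / (1 - e(x)) = (1 + i cot(πx)) / 2`. -/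
lemma one_sub_eC_mul (x : ℝ) (hx : sin (π * x) ≠ 0) :
    (1 - eC x) * ((1 / 2 : ℂ) + (cos (π * x) / sin (π * x) / 2 : ℝ) * Complex.I) = 1 := by
  have hs : (Real.sin (π * x) : ℂ) ≠ 0 := by exact_mod_cast hx
  have h2 : eC x = (cos (2 * (π * x)) : ℂ) + (sin (2 * (π * x)) : ℂ) * Complex.I := by
    rw [eC, Complex.exp_mul_I, Complex.ofReal_cos, Complex.ofReal_sin]
    push_cast; ring_nf
  rw [h2, Real.cos_two_mul, Real.sin_two_mul]
  have h3 : (cos (π * x) : ℂ) ^ 2 = 1 - (sin (π * x) : ℂ) ^ 2 := by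
    rw [← Complex.ofReal_pow, Real.cos_sq']; push_cast; ring
  rw [Complex.ofReal_sub, Complex.ofReal_mul, Complex.ofReal_pow, Complex.ofReal_mul,
    Complex.ofReal_mul, Complex.ofReal_div, Complex.ofReal_div]
  generalize ((cos (π * x) : ℝ) : ℂ) = C at *
  generalize ((sin (π * x) : ℝ) : ℂ) = S at *
  have hI := Complex.I_sq
  push_cast
  field_simp
  linear_combination (-2 * S * C ^ 2) * hI + (-2 * C * Complex.I) * h3

/-- Lower bound for `sin (πx)` away from the integers. -/
lemma two_mul_le_sin_pi {θ x : ℝ} (hθ : 0 ≤ θ) (h1 : θ ≤ x) (h2 : x ≤ 1 - θ) :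
    2 * θ ≤ sin (π * x) := by
  have hpi := Real.pi_pos
  rcases le_total x (1 / 2) with h | h
  · have := Real.mul_le_sin (x := π * x) (mul_nonneg hpi.le (by linarith)) (by nlinarith)
    calc 2 * θ ≤ 2 * x := by linarith
      _ = 2 / π * (π * x) := by field_simp
      _ ≤ _ := this
  · have := Real.mul_le_sin (x := π * (1 - x)) (mul_nonneg hpi.le (by linarith)) (by nlinarith)
    calc 2 * θ ≤ 2 * (1 - x) := by linarith
      _ = 2 / π * (π * (1 - x)) := by field_simp
      _ ≤ _ := this
      _ = sin (π - π * x) := by ring_nf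
      _ = _ := Real.sin_pi_sub _

/-- `cot(πx)` is antitone on `(0,1)`. -/
lemma cot_pi_antitone {x y : ℝ} (hx : 0 < x) (hxy : x ≤ y) (hy : y < 1) :
    cos (π * y) / sin (π * y) ≤ cos (π * x) / sin (π * x) := by
  have hpi := Real.pi_pos
  have hsx : 0 < sin (π * x) := Real.sin_pos_of_pos_of_lt_pi (by positivity) (by nlinarith)
  have hsy : 0 < sin (π * y) :=
    Real.sin_pos_of_pos_of_lt_pi (mul_pos hpi (by linarith)) (by nlinarith)
  rw [div_le_div_iff₀ hsy hsx]
  have h : 0 ≤ sin (π * y - π * x) :=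
    Real.sin_nonneg_of_nonneg_of_le_pi (by nlinarith) (by nlinarith)
  rw [Real.sin_sub] at h
  linarith

/-- Kusmin–Landau inequality, for phases whose increments are monotone and lie in `[θ, 1-θ]`. -/
lemma kusmin_landau (f : ℕ → ℝ) (N : ℕ) (θ : ℝ) (hθ : 0 < θ) (hθ2 : θ ≤ 1 / 2)
    (h1 : ∀ n, n + 1 < N → θ ≤ f (n + 1) - f n) (h2 : ∀ n, n + 1 < N → f (n + 1) - f n ≤ 1 - θ)
    (hm : ∀ n, n + 2 < N → f (n + 1) - f n ≤ f (n + 2) - f (n + 1)) :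
    ‖∑ n ∈ range N, eC (f n)‖ ≤ 2 / θ := by
  set κ : ℕ → ℝ := fun n => cos (π * (f (n + 1) - f n)) / sin (π * (f (n + 1) - f n)) / 2 with hκ
  set c : ℕ → ℂ := fun n => (1 / 2 : ℂ) + (κ n : ℂ) * Complex.I with hc
  have hsin : ∀ n, n + 1 < N → 2 * θ ≤ sin (π * (f (n + 1) - f n)) := fun n hn =>
    two_mul_le_sin_pi hθ.le (h1 n hn) (h2 n hn)
  have hκb : ∀ n, n + 1 < N → |κ n| ≤ 1 / (4 * θ) := by
    intro n hn
    have hs := hsin n hn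
    rw [hκ]
    simp only [abs_div, abs_two]
    rw [abs_of_pos (lt_of_lt_of_le (by positivity) hs), div_div, div_le_div_iff₀ (by linarith)
      (by positivity)]
    have := Real.abs_cos_le_one (π * (f (n + 1) - f n))
    nlinarith
  have hcb : ∀ n, n + 1 < N → ‖c n‖ ≤ 1 / (2 * θ) := by
    intro n hn
    calc ‖c n‖ ≤ ‖(1 / 2 : ℂ)‖ + ‖(κ n : ℂ) * Complex.I‖ := norm_add_le _ _
      _ = 1 / 2 + |κ n| := by simp
      _ ≤ 1 / (4 * θ) + 1 / (4 * θ) := by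
          refine add_le_add ?_ (hκb n hn)
          rw [div_le_div_iff₀ (by norm_num) (by positivity)]; linarith
      _ = _ := by field_simp; norm_num
  have hstep : ∀ n, n + 1 < N → eC (f n) = c n * (eC (f n) - eC (f (n + 1))) := by
    intro n hn
    have hs := hsin n hn
    have h := one_sub_eC_mul (f (n + 1) - f n) (by linarith)
    have h4 : eC (f (n + 1)) = eC (f n) * eC (f (n + 1) - f n) := by
      rw [← eC_add]; ring_nf
    rw [h4, hc]
    linear_combination (-eC (f n)) * h
  have key : ∀ m, m + 1 < N →
      ‖∑ n ∈ range (m + 1), eC (f n) + c m * eC (f (m + 1))‖ ≤ 1 / (2 * θ) + (κ 0 - κ m) := by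
    intro m
    induction m with
    | zero =>
      intro hN
      have : ∑ n ∈ range (0 + 1), eC (f n) + c 0 * eC (f (0 + 1)) = c 0 * eC (f 0) := by
        rw [zero_add, Finset.sum_range_one]
        have := hstep 0 hN
        linear_combination this
      rw [this, norm_mul, norm_eC]
      have := hcb 0 hN
      linarith
    | succ m ih =>
      intro hN
      have ih' := ih (by omega)
      have e1 : ∑ n ∈ range (m + 1 + 1), eC (f n) + c (m + 1) * eC (f (m + 1 + 1))
          = (∑ n ∈ range (m + 1), eC (f n) + c m * eC (f (m + 1)))
            + (c (m + 1) - c m) * eC (f (m + 1)) := by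
        rw [Finset.sum_range_succ]
        have := hstep (m + 1) hN
        linear_combination this
      rw [e1]
      have hanti : κ (m + 1) ≤ κ m := by
        have h5 := h1 m (by omega)
        have h6 := h2 (m + 1) hN
        have := cot_pi_antitone (x := f (m + 1) - f m) (y := f (m + 1 + 1) - f (m + 1))
          (by linarith) (hm m (by omega)) (by linarith)
        simp only [hκ]
        linarith
      have hcd : ‖c (m + 1) - c m‖ = κ m - κ (m + 1) := by
        have : c (m + 1) - c m = ((κ (m + 1) - κ m : ℝ) : ℂ) * Complex.I := by
          simp only [hc]; push_cast; ring
        rw [this, norm_mul, Complex.norm_I, mul_one, Complex.norm_real, Real.norm_eq_abs,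
          abs_of_nonpos (by linarith)]
        ring
      refine (norm_add_le _ _).trans ?_
      rw [norm_mul, norm_eC, mul_one, hcd]
      linarith
  have h1θ : 1 / (2 * θ) + 1 / (2 * θ) + 1 / (2 * θ) + 1 / (2 * θ) = 2 / θ := by
    field_simp; norm_num
  have hpos : 1 ≤ 1 / (2 * θ) := by
    rw [le_div_iff₀ (by positivity)]; linarith
  rcases Nat.lt_or_ge N 2 with hN | hN
  · refine (norm_sum_eC_le_card _ _).trans ?_
    have : ((range N).card : ℝ) ≤ 1 := by
      rw [card_range]; exact_mod_cast (by omega : N ≤ 1)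
    linarith
  · obtain ⟨m, rfl⟩ : ∃ m, N = m + 2 := ⟨N - 2, by omega⟩
    have hk := key m (by omega)
    have hk0 := abs_le.1 (hκb 0 (by omega))
    have hkm := abs_le.1 (hκb m (by omega))
    have hcm := hcb m (by omega)
    rw [Finset.sum_range_succ]
    have e2 : ∑ n ∈ range (m + 1), eC (f n) + eC (f (m + 1))
        = (∑ n ∈ range (m + 1), eC (f n) + c m * eC (f (m + 1))) - c m * eC (f (m + 1))
          + eC (f (m + 1)) := by ring
    rw [e2]
    refine (norm_add_le _ _).trans ?_
    rw [norm_eC]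
    have := norm_sub_le (∑ n ∈ range (m + 1), eC (f n) + c m * eC (f (m + 1)))
      (c m * eC (f (m + 1)))
    rw [norm_mul (c m), norm_eC, mul_one] at this
    have h7 : 1 / (4 * θ) + 1 / (4 * θ) = 1 / (2 * θ) := by field_simp; norm_num
    linarith

/-- Kusmin–Landau for a shifted interval, with increments in `[ν+θ, ν+1-θ]`. -/
lemma kusmin_landau_Ico (f : ℕ → ℝ) (a b : ℕ) (ν : ℤ) (θ : ℝ) (hθ : 0 < θ) (hθ2 : θ ≤ 1 / 2)
    (h1 : ∀ n, a ≤ n → n + 1 < b → ν + θ ≤ f (n + 1) - f n)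
    (h2 : ∀ n, a ≤ n → n + 1 < b → f (n + 1) - f n ≤ ν + 1 - θ)
    (hm : ∀ n, a ≤ n → n + 2 < b → f (n + 1) - f n ≤ f (n + 2) - f (n + 1)) :
    ‖∑ n ∈ Ico a b, eC (f n)‖ ≤ 2 / θ := by
  rw [Finset.sum_Ico_eq_sum_range]
  have h := kusmin_landau (fun n => f (a + n) - ν * n) (b - a) θ hθ hθ2
    (fun n hn => by
      have := h1 (a + n) (by omega) (by omega)
      push_cast; rw [← add_assoc]; linarith)
    (fun n hn => by
      have := h2 (a + n) (by omega) (by omega)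
      push_cast; rw [← add_assoc]; linarith)
    (fun n hn => by
      have := hm (a + n) (by omega) (by omega)
      push_cast; rw [← add_assoc, ← add_assoc]; linarith)
  have e : ∀ n : ℕ, eC (f (a + n) - ν * n) = eC (f (a + n)) := by
    intro n
    have : (ν : ℝ) * n = ((ν * n : ℤ) : ℝ) := by push_cast; ring
    rw [eC_sub, this, eC_intCast]; simp
  simpa [e] using h

/-- Second derivative test in finite-difference form. -/
lemma second_difference_test (f : ℕ → ℝ) (N : ℕ) (lam h : ℝ) (hl : 0 < lam) (hh : 1 ≤ h)
    (h1 : ∀ n, n + 2 < N → lam ≤ f (n + 2) - 2 * f (n + 1) + f n)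
    (h2 : ∀ n, n + 2 < N → f (n + 2) - 2 * f (n + 1) + f n ≤ h * lam) :
    ‖∑ n ∈ range N, eC (f n)‖ ≤ 20 * h * (N * lam ^ (1 / 2 : ℝ) + lam ^ (-(1 / 2) : ℝ)) := by
  have hs0 : 0 < √lam := Real.sqrt_pos.2 hl
  have hsq : √lam * √lam = lam := Real.mul_self_sqrt hl.le
  rw [Real.rpow_neg hl.le, ← Real.sqrt_eq_rpow]
  set θ := √lam with hθdef
  have hN0 : (0 : ℝ) ≤ N := Nat.cast_nonneg N
  rcases lt_or_ge (1 / 2) θ with hbig | hθ2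
  · refine (norm_sum_eC_le_card _ _).trans ?_
    rw [card_range]
    have : 0 ≤ θ⁻¹ := by positivity
    nlinarith [mul_nonneg hN0 (by linarith : (0:ℝ) ≤ h - 1), mul_nonneg hN0 (by linarith : 0 ≤ θ - 1 / 2),
      mul_nonneg (mul_nonneg hN0 (by linarith : (0:ℝ) ≤ h)) (by linarith : 0 ≤ θ - 1 / 2)]
  have hinv : 2 ≤ θ⁻¹ := by
    rw [le_inv_comm₀ (by norm_num) hs0]; linarith
  rcases Nat.lt_or_ge N 2 with hN | hN
  · refine (norm_sum_eC_le_card _ _).trans ?_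
    have : ((range N).card : ℝ) ≤ 1 := by
      rw [card_range]; exact_mod_cast (by omega : N ≤ 1)
    have : 0 ≤ (N : ℝ) * θ := by positivity
    nlinarith
  obtain ⟨M, rfl⟩ : ∃ M, N = M + 1 := ⟨N - 1, by omega⟩
  set D : ℕ → ℝ := fun n => f (n + 1) - f n with hD
  have hDlow : ∀ n j, n + j < M → j * lam ≤ D (n + j) - D n := by
    intro n j
    induction j with
    | zero => intro _; simp
    | succ j ih =>
      intro hj
      have a1 := ih (by omega)
      have a2 := h1 (n + j) (by omega)
      simp only [hD] at a1 ⊢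
      push_cast
      have : n + (j + 1) = n + j + 1 := by ring
      rw [this]
      linarith
  have hDup : ∀ j, j < M → D j - D 0 ≤ j * (h * lam) := by
    intro j
    induction j with
    | zero => intro _; simp
    | succ j ih =>
      intro hj
      have a1 := ih (by omega)
      have a2 := h2 j (by omega)
      simp only [hD] at a1 ⊢
      push_cast
      linarith
  have hDmono : ∀ n m, n ≤ m → m < M → D n ≤ D m := by
    intro n m hnm hm
    obtain ⟨j, rfl⟩ := Nat.exists_eq_add_of_le hnm
    have := hDlow n j hm
    have : 0 ≤ (j : ℝ) * lam := by positivity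
    linarith
  have hex : ∀ t : ℝ, ∃ n, M ≤ n ∨ t ≤ D n := fun t => ⟨M, Or.inl le_rfl⟩
  set k : ℝ → ℕ := fun t => Nat.find (hex t) with hk
  have hklt : ∀ t n, n < k t → n < M ∧ D n < t := by
    intro t n hn
    have := Nat.find_min (hex t) hn
    push Not at this
    exact this
  have hkM : ∀ t, k t ≤ M := fun t => Nat.find_min' (hex t) (Or.inl le_rfl)
  have hkge : ∀ t n, k t ≤ n → n < M → t ≤ D n := by
    intro t n hn hnM
    rcases Nat.find_spec (hex t) with h' | h'
    · exact absurd (lt_of_le_of_lt hn hnM) (not_lt.2 h')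
    · exact h'.trans (hDmono _ _ hn hnM)
  have hkmono : ∀ s t, s ≤ t → k s ≤ k t := by
    intro s t hst
    refine Nat.find_min' (hex s) ?_
    rcases Nat.find_spec (hex t) with h' | h'
    · exact Or.inl h'
    · exact Or.inr (hst.trans h')
  have hshort : ∀ s t, s ≤ t → ‖∑ n ∈ Ico (k s) (k t), eC (f n)‖ ≤ (t - s) / lam + 1 := by
    intro s t hst
    refine (norm_sum_eC_le_card _ _).trans ?_
    rw [Nat.card_Ico]
    rcases Nat.eq_or_lt_of_le (hkmono s t hst) with he | hlt
    · rw [he]; simp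
      exact add_nonneg (div_nonneg (by linarith) hl.le) zero_le_one
    · obtain ⟨j, hj⟩ := Nat.exists_eq_add_of_le (Nat.succ_le_of_lt hlt)
      have hm := hklt t (k s + j) (by omega)
      have h3 := hDlow (k s) j hm.1
      have h4 := hkge s (k s) le_rfl (by omega)
      have h5 : k t - k s = j + 1 := by omega
      rw [h5]; push_cast
      have : (j : ℝ) ≤ (t - s) / lam := by
        rw [le_div_iff₀ hl]; linarith [hm.2]
      linarith
  have hmid : ∀ ν : ℤ, ‖∑ n ∈ Ico (k (ν + θ)) (k (ν + 1 - θ)), eC (f n)‖ ≤ 2 / θ := by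
    intro ν
    refine kusmin_landau_Ico f _ _ ν θ hs0 hθ2 ?_ ?_ ?_
    · intro n hn hn2
      exact hkge _ n hn ((hklt _ _ (Nat.lt_of_succ_lt hn2)).1)
    · intro n hn hn2
      exact (hklt _ n (by omega)).2.le
    · intro n hn hn2
      exact hDmono n (n + 1) (by omega) (hklt (ν + 1 - θ) (n + 1) (by omega)).1
  have hblock : ∀ ν : ℤ, ‖∑ n ∈ Ico (k ν) (k (ν + 1)), eC (f n)‖ ≤ 5 * θ⁻¹ := by
    intro ν
    have i1 : k ν ≤ k (ν + θ) := hkmono _ _ (by linarith)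
    have i2 : k (ν + θ) ≤ k (ν + 1 - θ) := hkmono _ _ (by linarith)
    have i3 : k (ν + 1 - θ) ≤ k (ν + 1) := hkmono _ _ (by linarith)
    rw [← Finset.sum_Ico_consecutive _ (i1.trans i2) i3, ← Finset.sum_Ico_consecutive _ i1 i2]
    refine (norm_add₃_le).trans ?_
    have b1 := hshort ν (ν + θ) (by linarith)
    have b2 := hmid ν
    have b3 := hshort (ν + 1 - θ) (ν + 1) (by linarith)
    have e1 : (ν + θ - ν) / lam = θ⁻¹ := by
      rw [← hsq]; field_simp; ring
    have e2 : (ν + 1 - (ν + 1 - θ)) / lam = θ⁻¹ := by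
      rw [← hsq]; field_simp; ring
    rw [e1] at b1
    rw [e2] at b3
    rw [div_eq_mul_inv] at b2
    linarith
  have htel : ∀ (ν : ℤ) (j : ℕ),
      ‖∑ n ∈ Ico (k ν) (k ((ν + j : ℤ) : ℝ)), eC (f n)‖ ≤ j * (5 * θ⁻¹) := by
    intro ν j
    induction j with
    | zero => simp
    | succ j ih =>
      have i1 : k ν ≤ k ((ν + j : ℤ) : ℝ) := hkmono _ _ (by
        push_cast; linarith [(Nat.cast_nonneg j : (0:ℝ) ≤ j)])
      have i2 : k ((ν + j : ℤ) : ℝ) ≤ k ((ν + (j + 1 : ℕ) : ℤ) : ℝ) := hkmono _ _ (by push_cast; linarith)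
      rw [← Finset.sum_Ico_consecutive _ i1 i2]
      refine (norm_add_le _ _).trans ?_
      have := hblock (ν + j)
      have e3 : (((ν + j : ℤ) : ℝ) + 1) = ((ν + (j + 1 : ℕ) : ℤ) : ℝ) := by push_cast; ring
      rw [e3] at this
      push_cast at ih this ⊢
      linarith
  have hM1 : 1 ≤ M := by omega
  have hfl : ⌊D 0⌋ ≤ ⌊D (M - 1)⌋ := Int.floor_mono (hDmono _ _ (by omega) (by omega))
  obtain ⟨j, hj⟩ := Int.eq_ofNat_of_zero_le (sub_nonneg.2 hfl)
  have ht := htel ⌊D 0⌋ (j + 1)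
  have hk0 : k ⌊D 0⌋ = 0 := Nat.le_zero.1 (Nat.find_min' (hex _) (Or.inr (Int.floor_le _)))
  have hkJ : k ((⌊D 0⌋ + (j + 1 : ℕ) : ℤ) : ℝ) = M := by
    refine le_antisymm (hkM _) ?_
    by_contra hlt
    push Not at hlt
    have h6 := hkge ((⌊D 0⌋ + (j + 1 : ℕ) : ℤ) : ℝ) (M - 1) (by omega) (by omega)
    have h7 := Int.lt_floor_add_one (D (M - 1))
    have h8 : ((⌊D 0⌋ + (j + 1 : ℕ) : ℤ) : ℝ) = ⌊D (M - 1)⌋ + 1 := by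
      have : (⌊D 0⌋ + (j + 1 : ℕ) : ℤ) = ⌊D (M - 1)⌋ + 1 := by push_cast; omega
      rw [this]; push_cast; ring
    linarith
  rw [hk0, hkJ, ← Finset.range_eq_Ico] at ht
  rw [Finset.sum_range_succ]
  refine (norm_add_le _ _).trans ?_
  rw [norm_eC]
  have hjb : (j : ℝ) ≤ M * (h * lam) + 1 := by
    have h9 := hDup (M - 1) (by omega)
    have h10 := Int.floor_le (D (M - 1))
    have h11 := Int.lt_floor_add_one (D 0)
    have h12 : (j : ℝ) = ⌊D (M - 1)⌋ - ⌊D 0⌋ := by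
      have : ((⌊D (M - 1)⌋ - ⌊D 0⌋ : ℤ) : ℝ) = (j : ℤ) := by exact_mod_cast hj
      push_cast at this; linarith
    have h13 : ((M - 1 : ℕ) : ℝ) * (h * lam) ≤ M * (h * lam) := by
      gcongr
      omega
    linarith
  have e4 : lam * θ⁻¹ = θ := by rw [← hsq]; field_simp
  have h14 : ((j + 1 : ℕ) : ℝ) * (5 * θ⁻¹) ≤ (M * (h * lam) + 2) * (5 * θ⁻¹) := by
    gcongr; push_cast; linarith
  have h15 : (M * (h * lam) + 2) * (5 * θ⁻¹) = 5 * (M * h * θ) + 10 * θ⁻¹ := by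
    linear_combination (5 * M * h) * e4
  have h16 : (0:ℝ) ≤ M * h * θ := by positivity
  have h17 : (0:ℝ) ≤ h * θ := by positivity
  have h18 : θ⁻¹ ≤ h * θ⁻¹ := by nlinarith
  push_cast
  nlinarith

/-- The Weyl–van der Corput shift inequality. -/
lemma weyl_shift (a : ℕ → ℂ) (N Q : ℕ) :
    (Q : ℝ) * ‖∑ n ∈ range N, a n‖ ^ 2 ≤
      2 * (N + Q) * ∑ d ∈ range Q,
        ‖∑ n ∈ range (N - d), a (n + d) * (starRingEnd ℂ) (a n)‖ := by
  rcases Nat.eq_zero_or_pos Q with rfl | hQ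
  · simp
  set B : ℕ → ℝ := fun d => ‖∑ n ∈ range (N - d), a (n + d) * (starRingEnd ℂ) (a n)‖ with hB
  set c : ℕ → ℕ → ℂ := fun m q => if q ≤ m ∧ m - q < N then a (m - q) else 0 with hc
  have hcol : ∀ q ∈ range Q, ∑ m ∈ range (N + Q), c m q = ∑ n ∈ range N, a n := by
    intro q hq
    rw [mem_range] at hq
    rw [hc, ← Finset.sum_filter]
    refine Finset.sum_nbij' (fun m => m - q) (fun n => n + q) ?_ ?_ ?_ ?_ ?_
    all_goals simp only [mem_filter, mem_range]
    · intro m hm; exact hm.2.2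
    · intro n hn; omega
    · intro m hm; omega
    · intro n hn; omega
    · intro m hm; trivial
  have hpair : ∀ q q', q ≤ q' → q' < Q →
      ∑ m ∈ range (N + Q), c m q * (starRingEnd ℂ) (c m q') =
        ∑ n ∈ range (N - (q' - q)), a (n + (q' - q)) * (starRingEnd ℂ) (a n) := by
    intro q q' hqq hq
    have : ∀ m, c m q * (starRingEnd ℂ) (c m q') =
        if q' ≤ m ∧ m - q < N then a (m - q) * (starRingEnd ℂ) (a (m - q')) else 0 := by
      intro m
      simp only [hc]
      by_cases h1 : q' ≤ m ∧ m - q < N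
      · rw [if_pos h1, if_pos ⟨by omega, h1.2⟩, if_pos ⟨h1.1, by omega⟩]
      · rw [if_neg h1]
        by_cases h2 : q ≤ m ∧ m - q < N
        · rw [if_neg (show ¬ (q' ≤ m ∧ m - q' < N) by omega)]; simp
        · rw [if_neg h2]; simp
    simp_rw [this]
    rw [← Finset.sum_filter]
    refine Finset.sum_nbij' (fun m => m - q') (fun n => n + q') ?_ ?_ ?_ ?_ ?_
    all_goals simp only [mem_filter, mem_range]
    · intro m hm; omega
    · intro n hn; omega
    · intro m hm; omega
    · intro n hn; omega
    · intro m hm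
      rw [show m - q' + (q' - q) = m - q by omega]
  have hpn : ∀ q q', q < Q → q' < Q →
      ‖∑ m ∈ range (N + Q), c m q * (starRingEnd ℂ) (c m q')‖ ≤
        B ((q' - q) + (q - q')) := by
    intro q q' h1 h2
    rcases le_total q q' with h | h
    · rw [hpair q q' h h2, Nat.sub_eq_zero_of_le h]; simp [hB]
    · have : ∑ m ∈ range (N + Q), c m q * (starRingEnd ℂ) (c m q') =
          (starRingEnd ℂ) (∑ m ∈ range (N + Q), c m q' * (starRingEnd ℂ) (c m q)) := by
        rw [map_sum]
        refine Finset.sum_congr rfl fun m _ => ?_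
        rw [map_mul, Complex.conj_conj, mul_comm]
      rw [this, Complex.norm_conj, hpair q' q h h1, Nat.sub_eq_zero_of_le h]; simp [hB]
  have hrow : ∀ q ∈ range Q, ∑ q' ∈ range Q, B ((q' - q) + (q - q')) ≤ 2 * ∑ d ∈ range Q, B d := by
    intro q hq
    rw [mem_range] at hq
    have hBn : ∀ d, 0 ≤ B d := fun d => norm_nonneg _
    rw [← Finset.sum_range_add_sum_Ico _ hq.le, two_mul]
    refine add_le_add ?_ ?_
    · rw [show ∑ q' ∈ range q, B ((q' - q) + (q - q')) = ∑ d ∈ Ico 1 (q + 1), B d by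
        refine Finset.sum_nbij' (fun m => q - m) (fun n => q - n) ?_ ?_ ?_ ?_ ?_
        all_goals simp only [mem_Ico, mem_range]
        · intro m hm; omega
        · intro m hm; omega
        · intro m hm; omega
        · intro m hm; omega
        · intro m hm; congr 1; omega]
      refine Finset.sum_le_sum_of_subset_of_nonneg ?_ fun _ _ _ => hBn _
      intro d; simp only [mem_Ico, mem_range]; omega
    · rw [show ∑ q' ∈ Ico q Q, B ((q' - q) + (q - q')) = ∑ d ∈ range (Q - q), B d by
        refine Finset.sum_nbij' (fun m => m - q) (fun n => n + q) ?_ ?_ ?_ ?_ ?_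
        all_goals simp only [mem_Ico, mem_range]
        · intro m hm; omega
        · intro m hm; omega
        · intro m hm; omega
        · intro m hm; omega
        · intro m hm; congr 1; omega]
      refine Finset.sum_le_sum_of_subset_of_nonneg ?_ fun _ _ _ => hBn _
      intro d; simp only [mem_range]; omega
  have htot : (Q : ℂ) * ∑ n ∈ range N, a n = ∑ m ∈ range (N + Q), ∑ q ∈ range Q, c m q := by
    rw [Finset.sum_comm, Finset.sum_congr rfl hcol]; simp
  have hCS : ‖∑ m ∈ range (N + Q), ∑ q ∈ range Q, c m q‖ ^ 2 ≤
      (N + Q) * ∑ m ∈ range (N + Q), ‖∑ q ∈ range Q, c m q‖ ^ 2 := by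
    refine (pow_le_pow_left₀ (norm_nonneg _) (norm_sum_le _ _) 2).trans ?_
    have := sq_sum_le_card_mul_sum_sq (s := range (N + Q)) (f := fun m => ‖∑ q ∈ range Q, c m q‖)
    simpa using this
  have hsq : (((∑ m ∈ range (N + Q), ‖∑ q ∈ range Q, c m q‖ ^ 2 : ℝ)) : ℂ) =
      ∑ q ∈ range Q, ∑ q' ∈ range Q, ∑ m ∈ range (N + Q), c m q * (starRingEnd ℂ) (c m q') := by
    push_cast
    have : ∀ m, ((‖∑ q ∈ range Q, c m q‖ : ℂ)) ^ 2 =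
        ∑ q ∈ range Q, ∑ q' ∈ range Q, c m q * (starRingEnd ℂ) (c m q') := by
      intro m
      rw [← Complex.mul_conj', map_sum, Finset.sum_mul_sum]
    simp_rw [this]
    rw [Finset.sum_comm]
    refine Finset.sum_congr rfl fun q _ => ?_
    rw [Finset.sum_comm]
  have hbd : ∑ m ∈ range (N + Q), ‖∑ q ∈ range Q, c m q‖ ^ 2 ≤ Q * (2 * ∑ d ∈ range Q, B d) := by
    have h0 : (0:ℝ) ≤ ∑ m ∈ range (N + Q), ‖∑ q ∈ range Q, c m q‖ ^ 2 :=
      Finset.sum_nonneg fun _ _ => by positivity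
    have h1 := congrArg norm hsq
    rw [Complex.norm_real, Real.norm_of_nonneg h0] at h1
    rw [h1]
    refine (norm_sum_le _ _).trans ?_
    calc _ ≤ ∑ q ∈ range Q, (2 * ∑ d ∈ range Q, B d) := by
          refine Finset.sum_le_sum fun q hq => ?_
          refine (norm_sum_le _ _).trans (le_trans (Finset.sum_le_sum fun q' hq' => ?_) (hrow q hq))
          exact hpn q q' (mem_range.1 hq) (mem_range.1 hq')
      _ = _ := by simp
  have hfin : (Q:ℝ) * ((Q : ℝ) * ‖∑ n ∈ range N, a n‖ ^ 2) ≤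
      Q * (2 * (N + Q) * ∑ d ∈ range Q, B d) := by
    have h2 := congrArg norm htot
    rw [norm_mul, Complex.norm_natCast] at h2
    calc (Q:ℝ) * ((Q : ℝ) * ‖∑ n ∈ range N, a n‖ ^ 2) = ((Q:ℝ) * ‖∑ n ∈ range N, a n‖) ^ 2 := by ring
      _ ≤ (N + Q) * (Q * (2 * ∑ d ∈ range Q, B d)) := by
          rw [h2]
          exact hCS.trans (by gcongr)
      _ = _ := by ring
  exact le_of_mul_le_mul_left hfin (by exact_mod_cast hQ)

/-- The `k`-th difference test with exponents `s` and `κ`. -/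
def DiffTest (k : ℕ) (s κ : ℝ) : Prop :=
  ∀ h : ℝ, 1 ≤ h → ∃ C : ℝ, 0 < C ∧ ∀ (f : ℕ → ℝ) (N : ℕ) (lam : ℝ), 0 < lam →
    (∀ n, n + k < N → lam ≤ (fwdDiff 1)^[k] f n ∧ (fwdDiff 1)^[k] f n ≤ h * lam) →
    ‖∑ n ∈ range N, eC (f n)‖ ≤ C * (N * lam ^ s + (N : ℝ) ^ κ * lam ^ (-s))

lemma diffTest_two : DiffTest 2 (1 / 2) 0 := by
  intro h hh
  refine ⟨20 * h, by positivity, fun f N lam hl hf => ?_⟩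
  have e : ∀ n, (fwdDiff 1)^[2] f n = f (n + 2) - 2 * f (n + 1) + f n := by
    intro n
    simp only [Function.iterate_succ, Function.iterate_zero, Function.comp, fwdDiff, id]
    ring
  have := second_difference_test f N lam h hl hh (fun n hn => by rw [← e]; exact (hf n hn).1)
    (fun n hn => by rw [← e]; exact (hf n hn).2)
  simpa using this

lemma sum_rpow_neg_le (s : ℝ) (hs : s ≤ 1 / 2) (Q : ℕ) :
    ∑ d ∈ Ico 1 Q, (d : ℝ) ^ (-s) ≤ 2 * (Q : ℝ) ^ (1 - s) := by
  have hsqrt : ∀ Q : ℕ, ∑ d ∈ Ico 1 (Q + 1), (d : ℝ) ^ (-(1 / 2 : ℝ)) ≤ 2 * √Q := by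
    intro Q
    induction Q with
    | zero => simp
    | succ Q ih =>
      rw [Finset.sum_Ico_succ_top (by omega)]
      have hq : (0:ℝ) ≤ Q := Nat.cast_nonneg _
      rw [Real.rpow_neg (Nat.cast_nonneg _), ← Real.sqrt_eq_rpow]
      push_cast at ih ⊢
      set u := √(Q:ℝ)
      set v := √((Q:ℝ) + 1)
      have h1 : u ≤ v := Real.sqrt_le_sqrt (by linarith)
      have h0 : 0 < v := Real.sqrt_pos.2 (by linarith)
      have h2 : u ^ 2 = Q := Real.sq_sqrt hq
      have h3 : v ^ 2 = Q + 1 := Real.sq_sqrt (show (0:ℝ) ≤ (Q:ℝ) + 1 by linarith)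
      have h4 : v⁻¹ ≤ 2 * (v - u) := by
        rw [inv_le_iff_one_le_mul₀ h0]
        nlinarith
      linarith
  rcases Nat.eq_zero_or_pos Q with rfl | hQ
  · simp; positivity
  have hQ' : (0:ℝ) < Q := by exact_mod_cast hQ
  have h1 : ∀ d ∈ Ico 1 Q, (d : ℝ) ^ (-s) ≤ (Q : ℝ) ^ (1 / 2 - s) * (d : ℝ) ^ (-(1 / 2 : ℝ)) := by
    intro d hd
    rw [mem_Ico] at hd
    have hd' : (0:ℝ) < d := by exact_mod_cast hd.1
    rw [show -s = (1 / 2 - s) + (-(1 / 2 : ℝ)) by ring, Real.rpow_add hd']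
    gcongr
    exact hd.2.le
  calc _ ≤ ∑ d ∈ Ico 1 Q, (Q : ℝ) ^ (1 / 2 - s) * (d : ℝ) ^ (-(1 / 2 : ℝ)) :=
        Finset.sum_le_sum h1
    _ = (Q : ℝ) ^ (1 / 2 - s) * ∑ d ∈ Ico 1 Q, (d : ℝ) ^ (-(1 / 2 : ℝ)) := by
        rw [Finset.mul_sum]
    _ ≤ (Q : ℝ) ^ (1 / 2 - s) * (2 * √Q) := by
        gcongr
        refine le_trans (Finset.sum_le_sum_of_subset_of_nonneg ?_ fun _ _ _ => by positivity) (hsqrt Q)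
        exact Finset.Ico_subset_Ico_right (by omega)
    _ = _ := by
        rw [Real.sqrt_eq_rpow, show (1 - s) = (1 / 2 - s) + 1 / 2 by ring, Real.rpow_add hQ']
        ring

lemma fwdDiff_iterate_shift_sub (k : ℕ) (f : ℕ → ℝ) (d n : ℕ) :
    (fwdDiff 1)^[k] (fun m => f (m + d) - f m) n =
      ∑ j ∈ range d, (fwdDiff 1)^[k + 1] f (n + j) := by
  have h1 : ∀ k n, (fwdDiff 1)^[k] (fun m => f (m + d) - f m) n =
      (fwdDiff 1)^[k] f (n + d) - (fwdDiff 1)^[k] f n := by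
    intro k
    induction k with
    | zero => intro n; simp
    | succ k ih =>
      intro n
      simp only [Function.iterate_succ_apply', fwdDiff, ih]
      rw [show n + 1 + d = n + d + 1 by ring]; ring
  rw [h1]
  have h2 : ∀ j ∈ range d, (fwdDiff 1)^[k + 1] f (n + j) =
      (fwdDiff 1)^[k] f (n + (j + 1)) - (fwdDiff 1)^[k] f (n + j) := by
    intro j _
    rw [Function.iterate_succ_apply', fwdDiff, add_assoc]
  rw [Finset.sum_congr rfl h2, Finset.sum_range_sub (fun j => (fwdDiff 1)^[k] f (n + j))]
  simp

set_option maxHeartbeats 800000 in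
lemma diffTest_succ {k : ℕ} {s κ : ℝ} (hs : 0 < s) (hs2 : s ≤ 1 / 2) (hκ : 0 ≤ κ)
    (H : DiffTest k s κ) : DiffTest (k + 1) (s / (2 + 2 * s)) ((1 + κ) / 2) := by
  intro h hh
  obtain ⟨C, hC, H⟩ := H h hh
  set s' := s / (2 + 2 * s) with hs'
  have hs'0 : 0 < s' := by positivity
  have hrel : s * (1 - 2 * s') = 2 * s' := by rw [hs']; field_simp; ring
  refine ⟨√(8 + 16 * C) + 1, by positivity, fun f N lam hl hf => ?_⟩
  set S := ‖∑ n ∈ range N, eC (f n)‖ with hS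
  have hSN : S ≤ N := by simpa using norm_sum_eC_le_card (range N) f
  have hR : (0:ℝ) ≤ √(8 + 16 * C) := Real.sqrt_nonneg _
  set A := (N:ℝ) * lam ^ s' with hA
  set B := (N:ℝ) ^ ((1 + κ) / 2) * lam ^ (-s') with hB
  have hA0 : 0 ≤ A := by positivity
  have hB0 : 0 ≤ B := by positivity
  rcases Nat.eq_zero_or_pos N with rfl | hN
  · simp at hSN
    refine hSN.trans (by positivity)
  have hN1 : (1:ℝ) ≤ N := by exact_mod_cast hN
  have hN0 : (0:ℝ) < N := by linarith
  suffices S ≤ √(8 + 16 * C) * (A + B) ∨ S ≤ A + B by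
    rcases this with h1 | h1 <;> nlinarith
  rcases le_or_gt 1 lam with hl1 | hl1
  · right
    have : (1:ℝ) ≤ lam ^ s' := Real.one_le_rpow hl1 hs'0.le
    nlinarith
  set R := lam ^ (-(2 * s')) with hRd
  have hR1 : 1 ≤ R := Real.one_le_rpow_of_pos_of_le_one_of_nonpos hl hl1.le (by linarith)
  have hRsq : R = (lam ^ (-s')) ^ 2 := by
    rw [hRd, ← Real.rpow_natCast, ← Real.rpow_mul hl.le]; congr 1; push_cast; ring
  rcases lt_or_ge (N:ℝ) R with hNR | hNR
  · right
    have h1 : √N ≤ lam ^ (-s') := by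
      rw [Real.sqrt_le_left (by positivity)]; linarith
    have h2 : (N:ℝ) ^ (1 / 2 : ℝ) ≤ (N:ℝ) ^ ((1 + κ) / 2) :=
      Real.rpow_le_rpow_of_exponent_le hN1 (by linarith)
    rw [← Real.sqrt_eq_rpow] at h2
    have h3 : √(N:ℝ) * √N ≤ B := mul_le_mul h2 h1 (Real.sqrt_nonneg _) (by positivity)
    rw [Real.mul_self_sqrt hN0.le] at h3
    linarith
  left
  set Q := ⌊R⌋₊ with hQ
  have hQ1 : 1 ≤ Q := Nat.one_le_floor_iff _ |>.2 hR1
  have hQ0 : (0:ℝ) < Q := by exact_mod_cast hQ1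
  have hQR : (Q:ℝ) ≤ R := Nat.floor_le (by linarith)
  have hRQ : R ≤ 2 * Q := by
    have := Nat.lt_floor_add_one R
    have : (1:ℝ) ≤ Q := by exact_mod_cast hQ1
    linarith
  have hW := weyl_shift (fun n => eC (f n)) N Q
  have hd0 : ∀ d ∈ Ico 1 Q,
      ‖∑ n ∈ range (N - d), eC (f (n + d)) * (starRingEnd ℂ) (eC (f n))‖ ≤
        C * (N * (Q * lam) ^ s) + C * ((N:ℝ) ^ κ * lam ^ (-s)) * (d:ℝ) ^ (-s) := by
    intro d hd
    rw [mem_Ico] at hd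
    have hd' : (0:ℝ) < d := by exact_mod_cast hd.1
    simp_rw [← eC_sub]
    have := H (fun n => f (n + d) - f n) (N - d) (d * lam) (by positivity) (fun n hn => by
      rw [fwdDiff_iterate_shift_sub]
      constructor
      · calc (d:ℝ) * lam = ∑ j ∈ range d, lam := by simp
          _ ≤ _ := Finset.sum_le_sum fun j hj => (hf (n + j) (by rw [mem_range] at hj; omega)).1
      · calc _ ≤ ∑ j ∈ range d, h * lam :=
              Finset.sum_le_sum fun j hj => (hf (n + j) (by rw [mem_range] at hj; omega)).2
          _ = _ := by simp; ring)
    refine this.trans ?_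
    rw [mul_add]
    have hle : ((N - d : ℕ) : ℝ) ≤ N := by exact_mod_cast Nat.sub_le _ _
    refine add_le_add ?_ ?_
    · gcongr
      exact hd.2.le
    · rw [Real.mul_rpow hd'.le hl.le, mul_assoc C, mul_assoc, mul_comm (lam ^ (-s))]
      gcongr
  have hsum : ∑ d ∈ range Q,
      ‖∑ n ∈ range (N - d), eC (f (n + d)) * (starRingEnd ℂ) (eC (f n))‖ ≤
        N + Q * (C * (N * (Q * lam) ^ s)) + C * ((N:ℝ) ^ κ * lam ^ (-s)) * (2 * (Q:ℝ) ^ (1 - s)) := by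
    rw [Finset.range_eq_Ico, Finset.sum_eq_sum_Ico_succ_bot hQ1, add_assoc]
    refine add_le_add ?_ ?_
    · refine (norm_sum_le _ _).trans ?_
      simp [norm_eC]
    · refine (Finset.sum_le_sum hd0).trans ?_
      rw [Finset.sum_add_distrib]
      refine add_le_add ?_ ?_
      · rw [sum_const, Nat.card_Ico, nsmul_eq_mul]
        exact mul_le_mul_of_nonneg_right (by exact_mod_cast Nat.sub_le Q 1) (by positivity)
      · rw [← Finset.mul_sum]
        exact mul_le_mul_of_nonneg_left (sum_rpow_neg_le s hs2 Q) (by positivity)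
  have hpow1 : (Q * lam) ^ s ≤ lam ^ (2 * s') := by
    calc (Q * lam) ^ s ≤ (R * lam) ^ s := by gcongr
      _ = lam ^ (2 * s') := by
        rw [hRd, ← Real.rpow_add_one hl.ne', ← Real.rpow_mul hl.le]; congr 1; linarith
  have hpow2 : lam ^ (-s) * (Q:ℝ) ^ (-s) ≤ 2 * R := by
    rw [← Real.mul_rpow hl.le hQ0.le]
    have h1 : lam * R / 2 ≤ lam * Q := by nlinarith
    have h2 : (lam * Q) ^ (-s) ≤ (lam * R / 2) ^ (-s) :=
      Real.rpow_le_rpow_of_nonpos (by positivity) h1 (by linarith)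
    refine h2.trans ?_
    rw [Real.div_rpow (mul_nonneg hl.le (by linarith)) zero_le_two, Real.rpow_neg zero_le_two s,
      div_inv_eq_mul]
    have h3 : (lam * R) ^ (-s) = R := by
      rw [hRd, mul_comm, ← Real.rpow_add_one hl.ne', ← Real.rpow_mul hl.le]; congr 1; linarith
    have h4 : (2:ℝ) ^ s ≤ 2 := by
      calc (2:ℝ) ^ s ≤ 2 ^ (1:ℝ) := Real.rpow_le_rpow_of_exponent_le (by norm_num) (by linarith)
        _ = 2 := by simp
    rw [h3]; nlinarith
  have hAsq : A ^ 2 = N ^ 2 * lam ^ (2 * s') := by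
    rw [hA, mul_pow, ← Real.rpow_natCast (lam ^ s'), ← Real.rpow_mul hl.le]
    congr 2; push_cast; ring
  have hBsq : B ^ 2 = N * (N:ℝ) ^ κ * R := by
    rw [hB, mul_pow, ← hRsq, ← Real.rpow_natCast ((N:ℝ) ^ ((1 + κ) / 2)), ← Real.rpow_mul hN0.le,
      ← Real.rpow_one_add' hN0.le (by linarith)]
    congr 2; push_cast; ring
  have hinv : R⁻¹ = lam ^ (2 * s') := by rw [hRd, Real.rpow_neg hl.le, inv_inv]
  have hS2 : S ^ 2 ≤ (8 + 16 * C) * (A ^ 2 + B ^ 2) := by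
    have hQN : (Q:ℝ) ≤ N := hQR.trans hNR
    have h1 : (Q:ℝ) * S ^ 2 ≤ 4 * N * (N + Q * (C * (N * (Q * lam) ^ s)) +
        C * ((N:ℝ) ^ κ * lam ^ (-s)) * (2 * (Q:ℝ) ^ (1 - s))) := by
      exact hW.trans (mul_le_mul (by linarith) hsum (by positivity) (by positivity))
    have h2 : (Q:ℝ) ^ (1 - s) = Q * (Q:ℝ) ^ (-s) := by
      rw [sub_eq_add_neg, Real.rpow_one_add' hQ0.le (by linarith)]
    have h3 : (1:ℝ) ≤ 2 * Q * lam ^ (2 * s') := by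
      rw [← hinv, ← div_eq_mul_inv, le_div_iff₀ (by linarith)]; linarith
    have h4 : (Q:ℝ) * S ^ 2 ≤ Q * ((8 + 16 * C) * (A ^ 2 + B ^ 2)) := by
      rw [hAsq, hBsq]
      refine h1.trans ?_
      have t1 : (N:ℝ) * (N * 1) ≤ N * (N * (2 * Q * lam ^ (2 * s'))) := by gcongr
      have t2 : (N:ℝ) * (Q * (C * (N * (Q * lam) ^ s))) ≤ N * (Q * (C * (N * lam ^ (2 * s')))) := by
        gcongr
      have t3 : (N:ℝ) * (C * (N:ℝ) ^ κ * (2 * Q)) * (lam ^ (-s) * (Q:ℝ) ^ (-s)) ≤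
          (N:ℝ) * (C * (N:ℝ) ^ κ * (2 * Q)) * (2 * R) := by gcongr
      have t4 : 0 ≤ (Q:ℝ) * C * (N ^ 2 * lam ^ (2 * s')) := by positivity
      have t5 : 0 ≤ (Q:ℝ) * (N * (N:ℝ) ^ κ * R) := by positivity
      rw [h2]
      have t6 : (N:ℝ) * (C * ((N:ℝ) ^ κ * lam ^ (-s)) * (2 * (Q * (Q:ℝ) ^ (-s)))) =
          (N:ℝ) * (C * (N:ℝ) ^ κ * (2 * Q)) * (lam ^ (-s) * (Q:ℝ) ^ (-s)) := by ring
      rw [← t6] at t3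
      calc _ = 4 * ((N:ℝ) * (N * 1)) + 4 * ((N:ℝ) * (Q * (C * (N * (Q * lam) ^ s)))) +
            4 * ((N:ℝ) * (C * ((N:ℝ) ^ κ * lam ^ (-s)) * (2 * (Q * (Q:ℝ) ^ (-s))))) := by ring
        _ ≤ 4 * ((N:ℝ) * (N * (2 * Q * lam ^ (2 * s')))) +
            4 * ((N:ℝ) * (Q * (C * (N * lam ^ (2 * s'))))) +
            4 * ((N:ℝ) * (C * (N:ℝ) ^ κ * (2 * Q)) * (2 * R)) := by linarith
        _ = Q * ((8 + 16 * C) * (N ^ 2 * lam ^ (2 * s') + N * (N:ℝ) ^ κ * R)) -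
            (12 * ((Q:ℝ) * C * (N ^ 2 * lam ^ (2 * s'))) + 8 * (Q * (N * (N:ℝ) ^ κ * R))) := by
          ring
        _ ≤ _ := by linarith
    exact le_of_mul_le_mul_left h4 hQ0
  have : S ^ 2 ≤ (√(8 + 16 * C) * (A + B)) ^ 2 := by
    rw [mul_pow, Real.sq_sqrt (by positivity)]
    refine hS2.trans ?_
    gcongr
    nlinarith
  exact le_of_sq_le_sq this (by positivity)

lemma diffTest_three : DiffTest 3 (1 / 6) (1 / 2) := by
  have := diffTest_succ (by norm_num) (by norm_num) (by norm_num) diffTest_two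
  norm_num at this ⊢
  exact this

lemma diffTest_five : DiffTest 5 (1 / 30) (7 / 8) := by
  have h4 := diffTest_succ (by norm_num) (by norm_num) (by norm_num) diffTest_three
  have := diffTest_succ (by norm_num) (by norm_num) (by norm_num) h4
  norm_num at this ⊢
  exact this

/-- Iterated unit differences are bounded by bounds on the derivative of the same order. -/
lemma fwdDiff_iterate_mem_Icc {k : ℕ} {D : ℕ → ℝ → ℝ} {a b A B : ℝ}
    (hD : ∀ i < k, ∀ x ∈ Set.Icc a b, HasDerivAt (D i) (D (i + 1) x) x)
    (hk : ∀ x ∈ Set.Icc a b, D k x ∈ Set.Icc A B) (x : ℝ) (hx : a ≤ x) (hxb : x + k ≤ b) :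
    (fwdDiff 1)^[k] (D 0) x ∈ Set.Icc A B := by
  induction k generalizing D b with
  | zero => exact hk x ⟨hx, by simpa using hxb⟩
  | succ k ih =>
    rw [Function.iterate_succ_apply]
    push_cast at hxb
    refine ih (D := fun i => fwdDiff 1 (D i)) (b := b - 1) ?_ ?_ (by linarith)
    · intro i hi y hy
      have h1 := hD i (by omega) y ⟨hy.1, by linarith [hy.2]⟩
      have h2 := hD i (by omega) (y + 1) ⟨by linarith [hy.1], by linarith [hy.2]⟩
      exact (h2.comp_add_const y 1).sub h1
    · intro y hy
      have hd : ∀ z ∈ Set.Icc y (y + 1), HasDerivAt (D k) (D (k + 1) z) z := fun z hz =>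
        hD k (by omega) z ⟨by linarith [hy.1, hz.1], by linarith [hy.2, hz.2]⟩
      obtain ⟨z, hz, hz2⟩ := exists_hasDerivAt_eq_slope (D k) (D (k + 1)) (by linarith : y < y + 1)
        (fun z hz => (hd z hz).continuousAt.continuousWithinAt)
        (fun z hz => hd z ⟨hz.1.le, hz.2.le⟩)
      have : fwdDiff 1 (D k) y = D (k + 1) z := by
        rw [hz2, fwdDiff]; simp
      simp only [this]
      exact hk z ⟨by linarith [hy.1, hz.1], by linarith [hy.2, hz.2]⟩

/-- The falling factorial `c (c - 1) ⋯ (c - k + 1)`. -/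
noncomputable def fallFac (c : ℝ) (k : ℕ) : ℝ := ∏ i ∈ range k, (c - i)

lemma hasDerivAt_fallFac_rpow (c : ℝ) (i : ℕ) {x : ℝ} (hx : 0 < x) :
    HasDerivAt (fun x => fallFac c i * x ^ (c - i)) (fallFac c (i + 1) * x ^ (c - (i + 1 : ℕ))) x := by
  have := (Real.hasDerivAt_rpow_const (x := x) (p := c - i) (Or.inl hx.ne')).const_mul (fallFac c i)
  refine this.congr_deriv ?_
  have e : fallFac c (i + 1) = fallFac c i * (c - i) := Finset.prod_range_succ _ _
  rw [e]
  push_cast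
  rw [show c - (i + 1) = c - i - 1 by ring]
  ring

lemma fwdDiff_iterate_nat (k : ℕ) (f : ℝ → ℝ) (x : ℝ) (n : ℕ) :
    (fwdDiff 1)^[k] (fun m : ℕ => f (x + m)) n = (fwdDiff 1)^[k] f (x + n) := by
  induction k generalizing n with
  | zero => rfl
  | succ k ih =>
    rw [Function.iterate_succ_apply', Function.iterate_succ_apply', fwdDiff, fwdDiff, ih, ih]
    push_cast
    rw [add_assoc]

lemma sum_Ico_eC_shift (f : ℝ → ℝ) (a b : ℕ) :
    ∑ n ∈ Ico a b, eC (f n) = ∑ n ∈ range (b - a), eC (f ((a : ℝ) + n)) := by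
  rw [Finset.sum_Ico_eq_sum_range]
  push_cast
  rfl

/-- Derivative test for exponential sums with monomial phases. -/
lemma monomial_sum_bound {k : ℕ} {s κ : ℝ} (hκ : 0 ≤ κ) (H : DiffTest k s κ)
    {c : ℝ} (hck : c < k) (hp : fallFac c k ≠ 0) :
    ∃ C : ℝ, 0 < C ∧ ∀ (M γ : ℝ) (a b : ℕ), 0 < M → γ ≠ 0 → M ≤ a → (b : ℝ) ≤ 8 * M →
      ‖∑ n ∈ Ico a b, eC (γ * (n : ℝ) ^ c)‖ ≤
        C * (M * (|γ| * M ^ (c - k)) ^ s + M ^ κ * (|γ| * M ^ (c - k)) ^ (-s)) := by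
  have hh : (1:ℝ) ≤ 8 ^ (k - c) := Real.one_le_rpow (by norm_num) (by linarith)
  obtain ⟨C, hC, H⟩ := H (8 ^ (k - c)) hh
  set ρ := |fallFac c k| * 8 ^ (c - k) with hρ
  have hρ0 : 0 < ρ := mul_pos (abs_pos.2 hp) (by positivity)
  refine ⟨C * (8 * ρ ^ s + 8 ^ κ * ρ ^ (-s)), by positivity, ?_⟩
  intro M γ a b hM hγ hMa hb
  set L := |γ| * M ^ (c - k) with hL
  have hγ0 : 0 < |γ| := abs_pos.2 hγ
  have hL0 : 0 < L := by positivity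
  rcases Nat.lt_or_ge b a with hab | hab
  · rw [Finset.Ico_eq_empty (by omega)]
    simp only [sum_empty, norm_zero]; positivity
  have hpos : ∀ γ' : ℝ, γ' * fallFac c k = |γ| * |fallFac c k| →
      ‖∑ n ∈ Ico a b, eC (γ' * (n : ℝ) ^ c)‖ ≤
        C * (8 * ρ ^ s + 8 ^ κ * ρ ^ (-s)) * (M * L ^ s + M ^ κ * L ^ (-s)) := by
    intro γ' hγ'
    rw [sum_Ico_eC_shift (fun x => γ' * x ^ c)]
    have hf : ∀ n, n + k < b - a →
        ρ * L ≤ (fwdDiff 1)^[k] (fun m : ℕ => γ' * ((a:ℝ) + m) ^ c) n ∧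
        (fwdDiff 1)^[k] (fun m : ℕ => γ' * ((a:ℝ) + m) ^ c) n ≤ 8 ^ (k - c) * (ρ * L) := by
      intro n hn
      rw [fwdDiff_iterate_nat k (fun x => γ' * x ^ c) a n]
      have hn' : ((a:ℝ) + n) + k ≤ b := by
        have : a + n + k ≤ b := by omega
        exact_mod_cast this
      have := fwdDiff_iterate_mem_Icc (k := k) (a := M) (b := 8 * M)
        (D := fun i x => γ' * (fallFac c i * x ^ (c - i))) (A := ρ * L) (B := 8 ^ (k - c) * (ρ * L))
        (fun i _ x hx => (hasDerivAt_fallFac_rpow c i (hM.trans_le hx.1)).const_mul γ')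
        (fun x hx => by
          have hx0 : 0 < x := hM.trans_le hx.1
          have e1 : γ' * (fallFac c k * x ^ (c - k)) = |γ| * |fallFac c k| * x ^ (c - k) := by
            rw [← hγ']; ring
          have u1 : x ^ (c - k) ≤ M ^ (c - k) :=
            Real.rpow_le_rpow_of_nonpos hM hx.1 (by linarith)
          have u2 : (8 * M) ^ (c - k) ≤ x ^ (c - k) :=
            Real.rpow_le_rpow_of_nonpos hx0 hx.2 (by linarith)
          rw [Real.mul_rpow (by norm_num) hM.le] at u2
          simp only [e1]
          constructor
          · calc ρ * L = |γ| * |fallFac c k| * (8 ^ (c - k) * M ^ (c - k)) := by rw [hρ, hL]; ring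
              _ ≤ _ := by gcongr
          · have e2 : (8:ℝ) ^ (k - c) * 8 ^ (c - k) = 1 := by
              rw [← Real.rpow_add (by norm_num)]; simp
            calc _ ≤ |γ| * |fallFac c k| * M ^ (c - k) := by gcongr
              _ = 8 ^ (k - c) * 8 ^ (c - k) * (|γ| * |fallFac c k| * M ^ (c - k)) := by rw [e2]; ring
              _ = _ := by rw [hρ, hL]; ring)
        (a + n) (by linarith [(Nat.cast_nonneg n : (0:ℝ) ≤ n)]) (by linarith)
      simpa [fallFac] using this
    have h1 := H (fun m : ℕ => γ' * ((a:ℝ) + m) ^ c) (b - a) (ρ * L) (by positivity) hf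
    refine h1.trans ?_
    have hN : ((b - a : ℕ) : ℝ) ≤ 8 * M := by
      have : ((b - a : ℕ) : ℝ) ≤ b := by exact_mod_cast Nat.sub_le _ _
      linarith
    rw [mul_assoc C]
    refine mul_le_mul_of_nonneg_left ?_ hC.le
    rw [Real.mul_rpow hρ0.le hL0.le, Real.mul_rpow hρ0.le hL0.le]
    have v1 : ((b - a : ℕ) : ℝ) ^ κ ≤ 8 ^ κ * M ^ κ := by
      rw [← Real.mul_rpow (by norm_num) hM.le]; gcongr
    have w1 : 0 ≤ ρ ^ s * (M ^ κ * L ^ (-s)) := by positivity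
    have w2 : 0 ≤ 8 ^ κ * ρ ^ (-s) * (M * L ^ s) := by positivity
    calc _ ≤ (8 * M) * (ρ ^ s * L ^ s) + (8 ^ κ * M ^ κ) * (ρ ^ (-s) * L ^ (-s)) := by gcongr
      _ ≤ _ := by nlinarith
  rcases abs_choice (γ * fallFac c k) with h | h
  · exact hpos γ (by rw [← abs_mul, h])
  · have := hpos (-γ) (by rw [← abs_mul, h]; ring)
    simp_rw [neg_mul] at this
    rwa [norm_sum_eC_neg] at this

lemma fallFac_three_ne_zero {c : ℝ} (hc1 : 1 < c) (hc3 : c ≠ 2) : fallFac c 3 ≠ 0 := by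
  simp only [fallFac, Finset.prod_range_succ, Finset.prod_range_zero]
  have h0 : c ≠ 0 := by linarith
  have h1 : c - 1 ≠ 0 := by intro h; linarith
  have h2 : c - 2 ≠ 0 := sub_ne_zero.2 hc3
  simp [h0, h1, h2]

lemma fallFac_five_ne_zero {c : ℝ} (hc1 : 1 < c) (hc2 : c < 3) (hc3 : c ≠ 2) : fallFac c 5 ≠ 0 := by
  have h3 := fallFac_three_ne_zero hc1 hc3
  have h4 : c - 3 ≠ 0 := by intro h; linarith
  have h5 : c - 4 ≠ 0 := by intro h; linarith
  have : fallFac c 5 = fallFac c 3 * (c - 3) * (c - 4) := by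
    simp only [fallFac, Finset.prod_range_succ, Finset.prod_range_zero]
    push_cast; ring
  rw [this]
  exact mul_ne_zero (mul_ne_zero h3 h4) h5

lemma Ioc_eq_Ico_succ (a b : ℕ) : Ioc a b = Ico (a + 1) (b + 1) := by
  ext; simp only [mem_Ioc, mem_Ico]; omega

lemma monomial_kusmin_landau {c : ℝ} (hc : 1 < c) {X θ : ℝ} (hX : 1 ≤ X) (hθ : 0 < θ)
    (h : c * θ * X ^ (c - 1) ≤ 1 / 2) :
    ‖∑ n ∈ Ioc ⌊X / 2⌋₊ ⌊X⌋₊, eC (θ * (n : ℝ) ^ c)‖ ≤ 2 ^ c * (X ^ (1 - c) / θ) := by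
  have hc1 : 0 < c - 1 := by linarith
  have hX2 : 0 < X / 2 := by linarith
  set ϑ := c * θ * (X / 2) ^ (c - 1) with hϑ
  have hϑ0 : 0 < ϑ := by positivity
  have hϑX : ϑ ≤ c * θ * X ^ (c - 1) := by
    rw [hϑ]; gcongr; linarith
  have hslope : ∀ x y : ℝ, 0 < x → x < y →
      ∃ z ∈ Set.Ioo x y, θ * y ^ c - θ * x ^ c = (y - x) * (c * θ * z ^ (c - 1)) := by
    intro x y hx hxy
    have hd : ∀ z ∈ Set.Icc x y, HasDerivAt (fun z => θ * z ^ c) (c * θ * z ^ (c - 1)) z := fun z hz => by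
      have := (Real.hasDerivAt_rpow_const (x := z) (p := c) (Or.inl (hx.trans_le hz.1).ne')).const_mul θ
      exact this.congr_deriv (by ring)
    obtain ⟨z, hz, h⟩ := exists_hasDerivAt_eq_slope _ _ hxy
        (fun z hz => (hd z hz).continuousAt.continuousWithinAt)
        (fun z hz => hd z ⟨hz.1.le, hz.2.le⟩)
    refine ⟨z, hz, ?_⟩
    rw [h]
    have : y - x ≠ 0 := by linarith
    field_simp
  have hn1 : ∀ n : ℕ, ⌊X / 2⌋₊ + 1 ≤ n → X / 2 < n := fun n hn => (Nat.floor_lt hX2.le).1 hn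
  have hn2 : ∀ n : ℕ, n < ⌊X⌋₊ + 1 → (n : ℝ) ≤ X := fun n hn =>
    (Nat.le_floor_iff (by linarith)).1 (by omega)
  rw [Ioc_eq_Ico_succ]
  have key := kusmin_landau_Ico (fun n : ℕ => θ * (n : ℝ) ^ c) (⌊X / 2⌋₊ + 1) (⌊X⌋₊ + 1) 0 ϑ hϑ0
    (hϑX.trans h) ?_ ?_ ?_
  · refine key.trans ?_
    rw [hϑ, Real.div_rpow (by linarith) (by norm_num), div_le_iff₀ (by positivity),
      show (1 - c) = -(c - 1) by ring, Real.rpow_neg (by linarith)]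
    have e2 : (2:ℝ) ^ c = 2 * 2 ^ (c - 1) := by
      rw [← Real.rpow_one_add' (by norm_num) (by linarith)]; congr 1; ring
    have p1 : (2:ℝ) ^ (c - 1) ≠ 0 := by positivity
    have p2 : X ^ (c - 1) ≠ 0 := by positivity
    rw [e2]
    field_simp
    exact hc.le
  · intro n hn hn'
    have a1 := hn1 n hn
    obtain ⟨z, hz, e⟩ := hslope n (n + 1) (by linarith) (by linarith)
    push_cast
    rw [e, hϑ]
    simp only [zero_add, add_sub_cancel_left, one_mul]
    have : X / 2 ≤ z := by linarith [hz.1]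
    gcongr
  · intro n hn hn'
    have a1 := hn1 n hn
    have a2 := hn2 (n + 1) hn'
    obtain ⟨z, hz, e⟩ := hslope n (n + 1) (by linarith) (by linarith)
    push_cast at a2 ⊢
    rw [e]
    simp only [zero_add, add_sub_cancel_left, one_mul]
    have h1 : z ≤ X := by linarith [hz.2]
    have h2 : 0 ≤ z := by linarith [hz.1]
    have : c * θ * z ^ (c - 1) ≤ c * θ * X ^ (c - 1) := by gcongr
    linarith
  · intro n hn hn'
    have a1 := hn1 n hn
    obtain ⟨z, hz, e⟩ := hslope n (n + 1) (by linarith) (by linarith)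
    obtain ⟨z', hz', e'⟩ := hslope (n + 1) (n + 2) (by linarith) (by linarith)
    push_cast
    rw [e, e']
    have h1 : z ≤ z' := by linarith [hz.2, hz'.1]
    have h2 : 0 ≤ z := by linarith [hz.1]
    have : c * θ * z ^ (c - 1) ≤ c * θ * z' ^ (c - 1) := by gcongr
    linarith

/-- Bound for the smooth Weyl sum over a dyadic block. -/
lemma dyadic_weyl_sum_bound {c : ℝ} (hc1 : 1 < c) (hc2 : c ≤ 21 / 10) (hc3 : c ≠ 2) :
    ∃ C : ℝ, 0 < C ∧ ∀ X θ : ℝ, 1 ≤ X → θ ≠ 0 → |θ| ≤ 1 →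
      ‖∑ n ∈ Ioc ⌊X / 2⌋₊ ⌊X⌋₊, eC (θ * (n : ℝ) ^ c)‖ ≤
        C * (min X (X ^ (1 - c) / |θ|) + X ^ (17 / 20 : ℝ)) := by
  obtain ⟨C, hC, H⟩ := monomial_sum_bound (by norm_num) diffTest_three
    (c := c) (by push_cast; linarith) (fallFac_three_ne_zero hc1 hc3)
  have h2c : (1:ℝ) ≤ 2 ^ c := Real.one_le_rpow (by norm_num) (by linarith)
  refine ⟨2 ^ c + 10 * C, by positivity, fun X θ hX hθ hθ1 => ?_⟩
  have hX0 : 0 < X := by linarith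
  have hθ0 : 0 < |θ| := abs_pos.2 hθ
  have hmin : 0 ≤ min X (X ^ (1 - c) / |θ|) := by positivity
  have hXp : 0 ≤ X ^ (17 / 20 : ℝ) := by positivity
  rcases le_or_gt (c * |θ| * X ^ (c - 1)) (1 / 2) with h | h
  · have hT : ‖∑ n ∈ Ioc ⌊X / 2⌋₊ ⌊X⌋₊, eC (θ * (n : ℝ) ^ c)‖ ≤ 2 ^ c * (X ^ (1 - c) / |θ|) := by
      have := monomial_kusmin_landau hc1 hX hθ0 h
      rcases abs_choice θ with h' | h'
      · rwa [h'] at this ⊢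
      · rw [h'] at this ⊢
        simp_rw [neg_mul] at this
        rwa [norm_sum_eC_neg] at this
    have hT2 : ‖∑ n ∈ Ioc ⌊X / 2⌋₊ ⌊X⌋₊, eC (θ * (n : ℝ) ^ c)‖ ≤ X := by
      refine (norm_sum_eC_le_card _ _).trans ?_
      rw [Nat.card_Ioc]
      refine le_trans ?_ (Nat.floor_le hX0.le)
      exact_mod_cast Nat.sub_le _ _
    have : ‖∑ n ∈ Ioc ⌊X / 2⌋₊ ⌊X⌋₊, eC (θ * (n : ℝ) ^ c)‖ ≤ 2 ^ c * min X (X ^ (1 - c) / |θ|) := by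
      rw [mul_min_of_nonneg _ _ (by linarith)]
      exact le_min (by nlinarith) hT
    nlinarith
  · have hX2 : 0 < X / 2 := by linarith
    rw [Ioc_eq_Ico_succ]
    refine (H (X / 2) θ _ _ hX2 hθ ?_ ?_).trans ?_
    · push_cast; exact (Nat.lt_floor_add_one _).le
    · push_cast
      have := Nat.floor_le hX0.le
      linarith
    push_cast
    set L := |θ| * (X / 2) ^ (c - 3) with hL
    have u1 : L ≤ 4 * X ^ (c - 3) := by
      calc L ≤ 1 * (X / 2) ^ (c - 3) := by rw [hL]; gcongr
        _ = 2 ^ (3 - c) * X ^ (c - 3) := by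
          rw [one_mul, Real.div_rpow hX0.le (by norm_num), show (3 - c) = -(c - 3) by ring,
            Real.rpow_neg (by norm_num)]; ring
        _ ≤ 2 ^ (2:ℝ) * X ^ (c - 3) := by
          gcongr
          · norm_num
          · linarith
        _ = _ := by norm_num
    have u2 : X ^ (-2 : ℝ) / 5 ≤ L := by
      have v1 : X ^ (c - 3) ≤ (X / 2) ^ (c - 3) :=
        Real.rpow_le_rpow_of_nonpos hX2 (by linarith) (by linarith)
      have v2 : X ^ (1 - c) / 5 ≤ |θ| := by
        rw [show (1 - c) = -(c - 1) by ring, Real.rpow_neg hX0.le]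
        have : 0 < X ^ (c - 1) := by positivity
        rw [div_le_iff₀ (by norm_num), inv_le_iff_one_le_mul₀ this]
        nlinarith
      calc X ^ (-2 : ℝ) / 5 = X ^ (1 - c) / 5 * X ^ (c - 3) := by
            rw [div_mul_eq_mul_div, ← Real.rpow_add hX0]; congr 2; ring
        _ ≤ L := by rw [hL]; gcongr
    have hL0 : 0 < L := by positivity
    have t1 : X / 2 * L ^ (1 / 6 : ℝ) ≤ 2 * X ^ (17 / 20 : ℝ) := by
      calc X / 2 * L ^ (1 / 6 : ℝ) ≤ X / 2 * (4 * X ^ (c - 3)) ^ (1 / 6 : ℝ) := by gcongr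
        _ = 4 ^ (1 / 6 : ℝ) / 2 * X ^ (1 + (c - 3) * (1 / 6)) := by
          rw [Real.mul_rpow (by norm_num) (by positivity), ← Real.rpow_mul hX0.le,
            Real.rpow_add hX0, Real.rpow_one]; ring
        _ ≤ 4 ^ (1:ℝ) / 2 * X ^ (17 / 20 : ℝ) := by
          gcongr
          · norm_num
          · norm_num
          · linarith
        _ = _ := by norm_num
    have t2 : (X / 2) ^ (1 / 2 : ℝ) * L ^ (-(1 / 6) : ℝ) ≤ 5 * X ^ (17 / 20 : ℝ) := by
      have v3 : L ^ (-(1 / 6) : ℝ) ≤ (X ^ (-2 : ℝ) / 5) ^ (-(1 / 6) : ℝ) :=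
        Real.rpow_le_rpow_of_nonpos (by positivity) u2 (by norm_num)
      calc (X / 2) ^ (1 / 2 : ℝ) * L ^ (-(1 / 6) : ℝ) ≤
            X ^ (1 / 2 : ℝ) * (X ^ (-2 : ℝ) / 5) ^ (-(1 / 6) : ℝ) := by
            gcongr; linarith
        _ = 5 ^ (1 / 6 : ℝ) * X ^ (1 / 2 + (-2) * (-(1 / 6)) : ℝ) := by
          rw [Real.div_rpow (by positivity) (by norm_num), ← Real.rpow_mul hX0.le,
            Real.rpow_neg (by norm_num : (0:ℝ) ≤ 5), Real.rpow_add hX0]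
          field_simp
        _ ≤ 5 ^ (1 : ℝ) * X ^ (17 / 20 : ℝ) := by
          gcongr
          · norm_num
          · norm_num
          · norm_num
        _ = _ := by norm_num
    have : 0 ≤ 2 ^ c * (min X (X ^ (1 - c) / |θ|) + X ^ (17 / 20 : ℝ)) := by positivity
    have : 0 ≤ C * (min X (X ^ (1 - c) / |θ|)) := by positivity
    nlinarith

/-- One integration by parts against an oscillating exponential. -/
lemma osc_ibp {p q : ℝ} (hpq : p ≤ q) {ψ ψ₁ ψ₂ h h₁ : ℝ → ℝ}
    (hψ : ∀ t ∈ Set.Icc p q, HasDerivAt ψ (ψ₁ t) t)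
    (hψ₁ : ∀ t ∈ Set.Icc p q, HasDerivAt ψ₁ (ψ₂ t) t)
    (hh : ∀ t ∈ Set.Icc p q, HasDerivAt h (h₁ t) t)
    (c₂ : ContinuousOn ψ₂ (Set.Icc p q)) (ch : ContinuousOn h₁ (Set.Icc p q))
    (hne : ∀ t ∈ Set.Icc p q, ψ₁ t ≠ 0) :
    ‖∫ t in p..q, (h t : ℂ) * eC (ψ t)‖ ≤ |h p / ψ₁ p| + |h q / ψ₁ q| +
      ‖∫ t in p..q, ((h₁ t / ψ₁ t - h t * ψ₂ t / ψ₁ t ^ 2 : ℝ) : ℂ) * eC (ψ t)‖ := by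
  set g : ℝ → ℝ := fun t => h₁ t / ψ₁ t - h t * ψ₂ t / ψ₁ t ^ 2 with hg
  have cψ : ContinuousOn ψ (Set.Icc p q) := fun t ht => (hψ t ht).continuousAt.continuousWithinAt
  have cψ₁ : ContinuousOn ψ₁ (Set.Icc p q) := fun t ht => (hψ₁ t ht).continuousAt.continuousWithinAt
  have chh : ContinuousOn h (Set.Icc p q) := fun t ht => (hh t ht).continuousAt.continuousWithinAt
  have ceC : ContinuousOn (fun t => eC (ψ t)) (Set.Icc p q) := continuous_eC.comp_continuousOn cψ
  have cg : ContinuousOn g (Set.Icc p q) :=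
    (ch.div cψ₁ hne).sub ((chh.mul c₂).div (cψ₁.pow 2) fun t ht => pow_ne_zero 2 (hne t ht))
  have hI1 : IntervalIntegrable (fun t => (g t : ℂ) * eC (ψ t)) volume p q :=
    ((Complex.continuous_ofReal.comp_continuousOn cg).mul ceC).intervalIntegrable_of_Icc hpq
  have hI2 : IntervalIntegrable (fun t => (h t : ℂ) * eC (ψ t)) volume p q :=
    ((Complex.continuous_ofReal.comp_continuousOn chh).mul ceC).intervalIntegrable_of_Icc hpq
  have hder : ∀ t ∈ Set.uIcc p q, HasDerivAt (fun t => ((h t / ψ₁ t : ℝ) : ℂ) * eC (ψ t))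
      ((g t : ℂ) * eC (ψ t) + 2 * π * Complex.I * ((h t : ℂ) * eC (ψ t))) t := by
    intro t ht
    rw [Set.uIcc_of_le hpq] at ht
    have h1 := ((hh t ht).div (hψ₁ t ht) (hne t ht)).ofReal_comp
    have h2 := (hψ t ht).eC_comp
    refine (h1.mul h2).congr_deriv ?_
    have hn : (ψ₁ t : ℂ) ≠ 0 := by exact_mod_cast hne t ht
    simp only [hg, Pi.div_apply]
    push_cast
    field_simp
  have hFTC := intervalIntegral.integral_eq_sub_of_hasDerivAt hder (hI1.add (hI2.const_mul _))
  rw [intervalIntegral.integral_add hI1 (hI2.const_mul _), intervalIntegral.integral_const_mul] at hFTC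
  set I := ∫ t in p..q, (h t : ℂ) * eC (ψ t)
  set J := ∫ t in p..q, (g t : ℂ) * eC (ψ t)
  have h3 : ‖I‖ ≤ ‖2 * π * Complex.I * I‖ := by
    rw [norm_mul]
    have : ‖(2 * π * Complex.I : ℂ)‖ = 2 * π := by
      simp [abs_of_pos Real.pi_pos]
    rw [this]
    have := Real.pi_gt_three
    nlinarith [norm_nonneg I]
  refine h3.trans ?_
  have h4 : 2 * π * Complex.I * I = ((h q / ψ₁ q : ℝ) : ℂ) * eC (ψ q) -
      ((h p / ψ₁ p : ℝ) : ℂ) * eC (ψ p) - J := by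
    rw [← hFTC]; ring
  rw [h4]
  refine (norm_sub_le _ _).trans (add_le_add_left ((norm_sub_le _ _).trans ?_) _)
  rw [norm_mul, norm_mul, norm_eC, norm_eC, Complex.norm_real, Complex.norm_real, mul_one, mul_one,
    Real.norm_eq_abs, Real.norm_eq_abs, add_comm]

/-- A phase with three derivatives, the last two of size at most `K * lam`. -/
structure PhaseOn (p q : ℝ) (ψ ψ₁ ψ₂ ψ₃ : ℝ → ℝ) (lam K : ℝ) : Prop where
  d₁ : ∀ t ∈ Set.Icc p q, HasDerivAt ψ (ψ₁ t) t
  d₂ : ∀ t ∈ Set.Icc p q, HasDerivAt ψ₁ (ψ₂ t) t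
  d₃ : ∀ t ∈ Set.Icc p q, HasDerivAt ψ₂ (ψ₃ t) t
  cont : ContinuousOn ψ₃ (Set.Icc p q)
  b₂ : ∀ t ∈ Set.Icc p q, |ψ₂ t| ≤ K * lam
  b₃ : ∀ t ∈ Set.Icc p q, |ψ₃ t| ≤ K * lam

/-- An amplitude with two derivatives. -/
structure AmpOn (p q : ℝ) (h h₁ h₂ : ℝ → ℝ) : Prop where
  d₁ : ∀ t ∈ Set.Icc p q, HasDerivAt h (h₁ t) t
  d₂ : ∀ t ∈ Set.Icc p q, HasDerivAt h₁ (h₂ t) t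
  cont : ContinuousOn h₂ (Set.Icc p q)

lemma PhaseOn.mono {p q p' q' : ℝ} {ψ ψ₁ ψ₂ ψ₃ : ℝ → ℝ} {lam K : ℝ}
    (h : PhaseOn p q ψ ψ₁ ψ₂ ψ₃ lam K) (hp : p ≤ p') (hq : q' ≤ q) :
    PhaseOn p' q' ψ ψ₁ ψ₂ ψ₃ lam K := by
  have hs : Set.Icc p' q' ⊆ Set.Icc p q := Set.Icc_subset_Icc hp hq
  exact ⟨fun t ht => h.d₁ t (hs ht), fun t ht => h.d₂ t (hs ht), fun t ht => h.d₃ t (hs ht),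
    h.cont.mono hs, fun t ht => h.b₂ t (hs ht), fun t ht => h.b₃ t (hs ht)⟩

lemma AmpOn.mono {p q p' q' : ℝ} {h h₁ h₂ : ℝ → ℝ} (H : AmpOn p q h h₁ h₂)
    (hp : p ≤ p') (hq : q' ≤ q) : AmpOn p' q' h h₁ h₂ := by
  have hs : Set.Icc p' q' ⊆ Set.Icc p q := Set.Icc_subset_Icc hp hq
  exact ⟨fun t ht => H.d₁ t (hs ht), fun t ht => H.d₂ t (hs ht), H.cont.mono hs⟩

lemma AmpOn.continuousOn {p q : ℝ} {h h₁ h₂ : ℝ → ℝ} (H : AmpOn p q h h₁ h₂) :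
    ContinuousOn h (Set.Icc p q) := fun t ht => (H.d₁ t ht).continuousAt.continuousWithinAt

lemma PhaseOn.continuousOn {p q : ℝ} {ψ ψ₁ ψ₂ ψ₃ : ℝ → ℝ} {lam K : ℝ}
    (h : PhaseOn p q ψ ψ₁ ψ₂ ψ₃ lam K) : ContinuousOn ψ (Set.Icc p q) :=
  fun t ht => (h.d₁ t ht).continuousAt.continuousWithinAt

/-- The amplitude produced by one integration by parts, and its derivative. -/
noncomputable def ibpAmp (ψ₁ ψ₂ h h₁ : ℝ → ℝ) (t : ℝ) : ℝ := h₁ t / ψ₁ t - h t * ψ₂ t / ψ₁ t ^ 2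

noncomputable def ibpAmpDeriv (ψ₁ ψ₂ ψ₃ h h₁ h₂ : ℝ → ℝ) (t : ℝ) : ℝ :=
  h₂ t / ψ₁ t - 2 * (h₁ t * ψ₂ t / ψ₁ t ^ 2) - h t * ψ₃ t / ψ₁ t ^ 2 +
    2 * (h t * ψ₂ t ^ 2 / ψ₁ t ^ 3)

lemma hasDerivAt_ibpAmp {ψ₁ ψ₂ ψ₃ h h₁ h₂ : ℝ → ℝ} {t : ℝ} (hψ₁ : HasDerivAt ψ₁ (ψ₂ t) t)
    (hψ₂ : HasDerivAt ψ₂ (ψ₃ t) t) (hh : HasDerivAt h (h₁ t) t) (hh₁ : HasDerivAt h₁ (h₂ t) t)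
    (hne : ψ₁ t ≠ 0) :
    HasDerivAt (ibpAmp ψ₁ ψ₂ h h₁) (ibpAmpDeriv ψ₁ ψ₂ ψ₃ h h₁ h₂ t) t := by
  have := (hh₁.div hψ₁ hne).sub ((hh.mul hψ₂).div (hψ₁.pow 2) (pow_ne_zero 2 hne))
  refine this.congr_deriv ?_
  simp only [ibpAmpDeriv, Pi.mul_apply, Pi.pow_apply]
  field_simp
  ring

lemma osc_ibp_two {p q lam K : ℝ} (hpq : p ≤ q) {ψ ψ₁ ψ₂ ψ₃ h h₁ h₂ : ℝ → ℝ}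
    (Ψ : PhaseOn p q ψ ψ₁ ψ₂ ψ₃ lam K) (H : AmpOn p q h h₁ h₂)
    (hne : ∀ t ∈ Set.Icc p q, ψ₁ t ≠ 0) :
    ‖∫ t in p..q, (h t : ℂ) * eC (ψ t)‖ ≤ |h p / ψ₁ p| + |h q / ψ₁ q| +
      (|ibpAmp ψ₁ ψ₂ h h₁ p / ψ₁ p| + |ibpAmp ψ₁ ψ₂ h h₁ q / ψ₁ q| +
      ‖∫ t in p..q, ((ibpAmp ψ₁ ψ₂ (ibpAmp ψ₁ ψ₂ h h₁) (ibpAmpDeriv ψ₁ ψ₂ ψ₃ h h₁ h₂) t : ℝ) : ℂ) *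
        eC (ψ t)‖) := by
  have c₂ : ContinuousOn ψ₂ (Set.Icc p q) := fun t ht => (Ψ.d₃ t ht).continuousAt.continuousWithinAt
  have c₁ : ContinuousOn ψ₁ (Set.Icc p q) := fun t ht => (Ψ.d₂ t ht).continuousAt.continuousWithinAt
  have ch : ContinuousOn h (Set.Icc p q) := fun t ht => (H.d₁ t ht).continuousAt.continuousWithinAt
  have ch₁ : ContinuousOn h₁ (Set.Icc p q) := fun t ht => (H.d₂ t ht).continuousAt.continuousWithinAt
  have hne' : ∀ n : ℕ, ∀ t ∈ Set.Icc p q, ψ₁ t ^ n ≠ 0 := fun n t ht => pow_ne_zero n (hne t ht)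
  have hD : ContinuousOn (ibpAmpDeriv ψ₁ ψ₂ ψ₃ h h₁ h₂) (Set.Icc p q) := by
    unfold ibpAmpDeriv
    exact (((H.cont.div c₁ hne).sub (continuousOn_const.mul ((ch₁.mul c₂).div (c₁.pow 2) (hne' 2)))).sub
      ((ch.mul Ψ.cont).div (c₁.pow 2) (hne' 2))).add
      (continuousOn_const.mul ((ch.mul (c₂.pow 2)).div (c₁.pow 3) (hne' 3)))
  refine (osc_ibp hpq Ψ.d₁ Ψ.d₂ H.d₁ c₂ ch₁ hne).trans (add_le_add_right ?_ _)
  exact osc_ibp hpq Ψ.d₁ Ψ.d₂ (h := ibpAmp ψ₁ ψ₂ h h₁)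
    (fun t ht => hasDerivAt_ibpAmp (Ψ.d₂ t ht) (Ψ.d₃ t ht) (H.d₁ t ht) (H.d₂ t ht) (hne t ht)) c₂ hD hne

lemma abs_ibpAmp_le {ψ₁ ψ₂ h h₁ : ℝ → ℝ} {t y A₀ A₁ P₂ : ℝ} (hy : |(ψ₁ t)⁻¹| ≤ y)
    (h0 : |h t| ≤ A₀) (h1 : |h₁ t| ≤ A₁) (h2 : |ψ₂ t| ≤ P₂) :
    |ibpAmp ψ₁ ψ₂ h h₁ t| ≤ A₁ * y + A₀ * P₂ * y ^ 2 := by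
  have hA0 := (abs_nonneg _).trans h0
  have hA1 := (abs_nonneg _).trans h1
  have hP := (abs_nonneg _).trans h2
  rw [ibpAmp, div_eq_mul_inv, div_eq_mul_inv, ← inv_pow]
  refine (abs_sub _ _).trans ?_
  rw [abs_mul, abs_mul, abs_mul, abs_pow]
  gcongr

lemma abs_ibpAmpDeriv_le {ψ₁ ψ₂ ψ₃ h h₁ h₂ : ℝ → ℝ} {t y A₀ A₁ A₂ P₂ : ℝ} (hy : |(ψ₁ t)⁻¹| ≤ y)
    (h0 : |h t| ≤ A₀) (h1 : |h₁ t| ≤ A₁) (h2 : |h₂ t| ≤ A₂) (hp2 : |ψ₂ t| ≤ P₂)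
    (hp3 : |ψ₃ t| ≤ P₂) :
    |ibpAmpDeriv ψ₁ ψ₂ ψ₃ h h₁ h₂ t| ≤
      A₂ * y + 2 * (A₁ * P₂ * y ^ 2) + A₀ * P₂ * y ^ 2 + 2 * (A₀ * P₂ ^ 2 * y ^ 3) := by
  have hA0 := (abs_nonneg _).trans h0
  have hA1 := (abs_nonneg _).trans h1
  have hA2 := (abs_nonneg _).trans h2
  have hP := (abs_nonneg _).trans hp2
  simp only [ibpAmpDeriv, div_eq_mul_inv, ← inv_pow]
  refine (abs_add_le _ _).trans (add_le_add ((abs_sub _ _).trans (add_le_add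
    ((abs_sub _ _).trans (add_le_add ?_ ?_)) ?_)) ?_)
  · rw [abs_mul]; gcongr
  · rw [abs_mul, abs_mul, abs_mul, abs_pow, abs_two]; gcongr
  · rw [abs_mul, abs_mul, abs_pow]; gcongr
  · rw [abs_mul, abs_mul, abs_mul, abs_pow, abs_pow, abs_two]; gcongr

lemma integral_inv_sq_le {p q t₀ δ : ℝ} (hpq : p ≤ q) (hδ : 0 < δ)
    (h : ∀ t ∈ Set.Icc p q, δ ≤ |t - t₀|) :
    ContinuousOn (fun t => ((t - t₀) ^ 2)⁻¹) (Set.Icc p q) ∧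
      ∫ t in p..q, ((t - t₀) ^ 2)⁻¹ ≤ δ⁻¹ := by
  have hne : ∀ t ∈ Set.Icc p q, t - t₀ ≠ 0 := fun t ht h0 => by
    have := h t ht
    rw [h0, abs_zero] at this; linarith
  have hc : ContinuousOn (fun t => ((t - t₀) ^ 2)⁻¹) (Set.Icc p q) :=
    ContinuousOn.inv₀ (by fun_prop) fun t ht => pow_ne_zero 2 (hne t ht)
  refine ⟨hc, ?_⟩
  rw [intervalIntegral.integral_eq_sub_of_hasDerivAt (f := fun t => -(t - t₀)⁻¹)
    (fun t ht => by
      rw [Set.uIcc_of_le hpq] at ht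
      have := ((((hasDerivAt_id t).sub_const t₀).inv (hne t ht)).neg)
      refine this.congr_deriv ?_
      simp [neg_div]) (hc.intervalIntegrable_of_Icc hpq)]
  have hp := h p ⟨le_rfl, hpq⟩
  have hq := h q ⟨hpq, le_rfl⟩
  have hinv : ∀ t, δ ≤ |t - t₀| → |(t - t₀)⁻¹| ≤ δ⁻¹ := fun t ht => by
    rw [abs_inv]; gcongr
  have h1 := hinv p hp
  have h2 := hinv q hq
  rcases le_or_gt t₀ p with h3 | h3
  · have : 0 ≤ (q - t₀)⁻¹ := inv_nonneg.2 (by linarith)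
    linarith [le_abs_self (p - t₀)⁻¹]
  · have h4 : q ≤ t₀ := by
      by_contra hcon
      push Not at hcon
      exact hne t₀ ⟨h3.le, hcon.le⟩ (sub_self _)
    have : (p - t₀)⁻¹ ≤ 0 := inv_nonpos.2 (by linarith)
    linarith [neg_abs_le (q - t₀)⁻¹]

/-- Oscillatory integral without stationary point. -/
lemma osc_nonstationary {p q lam K B : ℝ} (hpq : p ≤ q) (hl : 0 < lam) (hK : 1 ≤ K)
    {ψ ψ₁ ψ₂ ψ₃ h h₁ h₂ : ℝ → ℝ} (Ψ : PhaseOn p q ψ ψ₁ ψ₂ ψ₃ lam K) (H : AmpOn p q h h₁ h₂)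
    (hB₀ : ∀ t ∈ Set.Icc p q, |h t| ≤ B) (hB₁ : ∀ t ∈ Set.Icc p q, |h₁ t| ≤ B)
    (hB₂ : ∀ t ∈ Set.Icc p q, |h₂ t| ≤ B) (hlow : ∀ t ∈ Set.Icc p q, lam ≤ |ψ₁ t|)
    (h0p : h p = 0) (h0q : h q = 0) (h1p : h₁ p = 0) (h1q : h₁ q = 0) :
    ‖∫ t in p..q, (h t : ℂ) * eC (ψ t)‖ ≤ 8 * K ^ 2 * B * (q - p) / lam ^ 2 := by
  have hne : ∀ t ∈ Set.Icc p q, ψ₁ t ≠ 0 := fun t ht h0 => by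
    have := hlow t ht
    rw [h0, abs_zero] at this; linarith
  have hB : 0 ≤ B := (abs_nonneg _).trans (hB₀ p ⟨le_rfl, hpq⟩)
  refine (osc_ibp_two hpq Ψ H hne).trans ?_
  simp only [h0p, h0q, h1p, h1q, ibpAmp, zero_div, abs_zero, zero_mul, sub_zero, zero_add]
  rw [show 8 * K ^ 2 * B * (q - p) / lam ^ 2 = (8 * K ^ 2 * B / lam ^ 2) * |q - p| by
    rw [abs_of_nonneg (by linarith)]; ring]
  refine intervalIntegral.norm_integral_le_of_norm_le_const fun t ht => ?_
  rw [Set.uIoc_of_le hpq] at ht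
  have ht' : t ∈ Set.Icc p q := ⟨ht.1.le, ht.2⟩
  rw [norm_mul, norm_eC, mul_one, Complex.norm_real, Real.norm_eq_abs]
  have hy : |(ψ₁ t)⁻¹| ≤ lam⁻¹ := by
    rw [abs_inv]; gcongr; exact hlow t ht'
  have e1 := abs_ibpAmp_le hy (hB₀ t ht') (hB₁ t ht') (Ψ.b₂ t ht')
  have e2 := abs_ibpAmpDeriv_le hy (hB₀ t ht') (hB₁ t ht') (hB₂ t ht') (Ψ.b₂ t ht') (Ψ.b₃ t ht')
  refine (abs_ibpAmp_le hy e1 e2 (Ψ.b₂ t ht')).trans ?_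
  have : (B * lam⁻¹ + 2 * (B * (K * lam) * lam⁻¹ ^ 2) + B * (K * lam) * lam⁻¹ ^ 2 +
      2 * (B * (K * lam) ^ 2 * lam⁻¹ ^ 3)) * lam⁻¹ +
      (B * lam⁻¹ + B * (K * lam) * lam⁻¹ ^ 2) * (K * lam) * lam⁻¹ ^ 2 =
      (1 + 4 * K + 3 * K ^ 2) * B / lam ^ 2 := by field_simp; ring
  rw [this]
  gcongr
  nlinarith

/-- Second derivative test for oscillatory integrals on an interval avoiding the stationary point. -/
lemma osc_side_one {p q lam K B t₀ δ : ℝ} (hpq : p ≤ q) (hl : 0 < lam) (hK : 1 ≤ K) (hδ : 0 < δ)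
    (hlδ : lam * δ ^ 2 = 1)
    {ψ ψ₁ ψ₂ ψ₃ h h₁ h₂ : ℝ → ℝ} (Ψ : PhaseOn p q ψ ψ₁ ψ₂ ψ₃ lam K) (H : AmpOn p q h h₁ h₂)
    (hB₀ : ∀ t ∈ Set.Icc p q, |h t| ≤ B) (hB₁ : ∀ t ∈ Set.Icc p q, |h₁ t| ≤ B)
    (hlow : ∀ t ∈ Set.Icc p q, lam * |t - t₀| ≤ |ψ₁ t|)
    (hδt : ∀ t ∈ Set.Icc p q, δ ≤ |t - t₀|) :
    ‖∫ t in p..q, (h t : ℂ) * eC (ψ t)‖ ≤ (2 + (q - p) + K) * B * δ := by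
  have hB : 0 ≤ B := (abs_nonneg _).trans (hB₀ p ⟨le_rfl, hpq⟩)
  have hup : ∀ t ∈ Set.Icc p q, 0 < |t - t₀| := fun t ht => hδ.trans_le (hδt t ht)
  have hne : ∀ t ∈ Set.Icc p q, ψ₁ t ≠ 0 := fun t ht h0 => by
    have := hlow t ht
    have h2 := mul_pos hl (hup t ht)
    rw [h0, abs_zero] at this; linarith
  have hy : ∀ t ∈ Set.Icc p q, |(ψ₁ t)⁻¹| ≤ (lam * |t - t₀|)⁻¹ := fun t ht => by
    have := hup t ht
    rw [abs_inv]; gcongr; exact hlow t ht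
  have hlδ' : lam⁻¹ = δ ^ 2 := by field_simp; linarith
  have hyδ : ∀ t ∈ Set.Icc p q, (lam * |t - t₀|)⁻¹ ≤ δ := fun t ht => by
    have := hδt t ht
    calc (lam * |t - t₀|)⁻¹ ≤ (lam * δ)⁻¹ := by gcongr
      _ = δ := by rw [mul_inv, hlδ']; field_simp
  have hend : ∀ t ∈ Set.Icc p q, |h t / ψ₁ t| ≤ B * δ := fun t ht => by
    rw [div_eq_mul_inv, abs_mul]
    exact mul_le_mul (hB₀ t ht) ((hy t ht).trans (hyδ t ht)) (abs_nonneg _) hB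
  have c₂ : ContinuousOn ψ₂ (Set.Icc p q) := fun t ht => (Ψ.d₃ t ht).continuousAt.continuousWithinAt
  have ch₁ : ContinuousOn h₁ (Set.Icc p q) := fun t ht => (H.d₂ t ht).continuousAt.continuousWithinAt
  refine (osc_ibp hpq Ψ.d₁ Ψ.d₂ H.d₁ c₂ ch₁ hne).trans ?_
  obtain ⟨hc, hint⟩ := integral_inv_sq_le hpq hδ hδt
  have hI : ‖∫ t in p..q, ((h₁ t / ψ₁ t - h t * ψ₂ t / ψ₁ t ^ 2 : ℝ) : ℂ) * eC (ψ t)‖ ≤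
      ∫ t in p..q, (B * δ + B * K * δ ^ 2 * ((t - t₀) ^ 2)⁻¹) := by
    refine intervalIntegral.norm_integral_le_of_norm_le hpq (Filter.Eventually.of_forall fun t ht => ?_) ?_
    · have ht' : t ∈ Set.Icc p q := ⟨ht.1.le, ht.2⟩
      rw [norm_mul, norm_eC, mul_one, Complex.norm_real, Real.norm_eq_abs]
      refine (abs_ibpAmp_le (hy t ht') (hB₀ t ht') (hB₁ t ht') (Ψ.b₂ t ht')).trans ?_
      have h1 := hyδ t ht'
      have h2 : B * (K * lam) * (lam * |t - t₀|)⁻¹ ^ 2 = B * K * δ ^ 2 * ((t - t₀) ^ 2)⁻¹ := by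
        rw [← hlδ', mul_inv, mul_pow, inv_pow |t - t₀|, sq_abs]
        field_simp
      rw [h2]
      gcongr
    · exact (continuousOn_const.add (continuousOn_const.mul hc)).intervalIntegrable_of_Icc hpq
  have hval : ∫ t in p..q, (B * δ + B * K * δ ^ 2 * ((t - t₀) ^ 2)⁻¹) ≤
      (q - p) * (B * δ) + B * K * δ ^ 2 * δ⁻¹ := by
    have i1 : IntervalIntegrable (fun _ : ℝ => B * δ) volume p q := by simp
    have i2 : IntervalIntegrable (fun t => B * K * δ ^ 2 * ((t - t₀) ^ 2)⁻¹) volume p q :=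
      (continuousOn_const.mul hc).intervalIntegrable_of_Icc hpq
    rw [intervalIntegral.integral_add i1 i2,
      intervalIntegral.integral_const, intervalIntegral.integral_const_mul, smul_eq_mul]
    gcongr
  have e3 : B * K * δ ^ 2 * δ⁻¹ = K * B * δ := by field_simp
  have := hend p ⟨le_rfl, hpq⟩
  have := hend q ⟨hpq, le_rfl⟩
  rw [e3] at hval
  linarith

/-- Oscillatory integral with amplitude vanishing to second order at the stationary point, on an
interval avoiding that point. -/
lemma osc_side_two {p q lam K B t₀ δ U : ℝ} (hpq : p ≤ q) (hl : 0 < lam) (hK : 1 ≤ K) (hδ : 0 < δ)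
    (hlδ : lam * δ ^ 2 = 1) (hU : 1 ≤ U)
    {ψ ψ₁ ψ₂ ψ₃ h h₁ h₂ : ℝ → ℝ} (Ψ : PhaseOn p q ψ ψ₁ ψ₂ ψ₃ lam K) (H : AmpOn p q h h₁ h₂)
    (hB₀ : ∀ t ∈ Set.Icc p q, |h t| ≤ B * |t - t₀| ^ 2)
    (hB₁ : ∀ t ∈ Set.Icc p q, |h₁ t| ≤ B * |t - t₀|)
    (hB₂ : ∀ t ∈ Set.Icc p q, |h₂ t| ≤ B)
    (hlow : ∀ t ∈ Set.Icc p q, lam * |t - t₀| ≤ |ψ₁ t|)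
    (hδt : ∀ t ∈ Set.Icc p q, δ ≤ |t - t₀|) (hUt : ∀ t ∈ Set.Icc p q, |t - t₀| ≤ U)
    (hp : h p = 0 ∨ |p - t₀| = δ) (hq : h q = 0 ∨ |q - t₀| = δ) :
    ‖∫ t in p..q, (h t : ℂ) * eC (ψ t)‖ ≤ 14 * K ^ 2 * U * B * δ ^ 3 := by
  have hB : 0 ≤ B := (abs_nonneg _).trans (hB₂ p ⟨le_rfl, hpq⟩)
  have hup : ∀ t ∈ Set.Icc p q, 0 < |t - t₀| := fun t ht => hδ.trans_le (hδt t ht)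
  have hne : ∀ t ∈ Set.Icc p q, ψ₁ t ≠ 0 := fun t ht h0 => by
    have := hlow t ht
    have h2 := mul_pos hl (hup t ht)
    rw [h0, abs_zero] at this; linarith
  have hlδ' : lam⁻¹ = δ ^ 2 := by field_simp; linarith
  have hy : ∀ t ∈ Set.Icc p q, |(ψ₁ t)⁻¹| ≤ (lam * |t - t₀|)⁻¹ := fun t ht => by
    have := hup t ht
    rw [abs_inv]; gcongr; exact hlow t ht
  have hyδ : ∀ t ∈ Set.Icc p q, (lam * |t - t₀|)⁻¹ ≤ δ := fun t ht => by
    have := hδt t ht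
    calc (lam * |t - t₀|)⁻¹ ≤ (lam * δ)⁻¹ := by gcongr
      _ = δ := by rw [mul_inv, hlδ']; field_simp
  have hD : ∀ t ∈ Set.Icc p q, |ibpAmp ψ₁ ψ₂ h h₁ t| ≤ 2 * K * B * δ ^ 2 := fun t ht => by
    refine (abs_ibpAmp_le (hy t ht) (hB₀ t ht) (hB₁ t ht) (Ψ.b₂ t ht)).trans ?_
    have := hup t ht
    have e : B * |t - t₀| * (lam * |t - t₀|)⁻¹ + B * |t - t₀| ^ 2 * (K * lam) *
      (lam * |t - t₀|)⁻¹ ^ 2 = (1 + K) * B * lam⁻¹ := by field_simp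
    rw [e, hlδ']
    gcongr
    linarith
  have hend : ∀ t ∈ Set.Icc p q, (h t = 0 ∨ |t - t₀| = δ) → |h t / ψ₁ t| ≤ B * δ ^ 3 := by
    intro t ht ho
    rcases ho with ho | ho
    · rw [ho]; simp; positivity
    · rw [div_eq_mul_inv, abs_mul]
      have h1 := hB₀ t ht
      rw [ho] at h1
      calc _ ≤ (B * δ ^ 2) * δ := mul_le_mul h1 ((hy t ht).trans (hyδ t ht)) (abs_nonneg _) (by positivity)
        _ = _ := by ring
  have hend2 : ∀ t ∈ Set.Icc p q, |ibpAmp ψ₁ ψ₂ h h₁ t / ψ₁ t| ≤ 2 * K * B * δ ^ 3 := by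
    intro t ht
    rw [div_eq_mul_inv, abs_mul]
    calc _ ≤ (2 * K * B * δ ^ 2) * δ :=
          mul_le_mul (hD t ht) ((hy t ht).trans (hyδ t ht)) (abs_nonneg _) (by positivity)
      _ = _ := by ring
  obtain ⟨hc, hint⟩ := integral_inv_sq_le hpq hδ hδt
  have hI : ‖∫ t in p..q, ((ibpAmp ψ₁ ψ₂ (ibpAmp ψ₁ ψ₂ h h₁) (ibpAmpDeriv ψ₁ ψ₂ ψ₃ h h₁ h₂) t : ℝ) : ℂ) *
        eC (ψ t)‖ ≤ ∫ t in p..q, 8 * K ^ 2 * U * B * δ ^ 4 * ((t - t₀) ^ 2)⁻¹ := by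
    refine intervalIntegral.norm_integral_le_of_norm_le hpq (Filter.Eventually.of_forall fun t ht => ?_) ?_
    · have ht' : t ∈ Set.Icc p q := ⟨ht.1.le, ht.2⟩
      rw [norm_mul, norm_eC, mul_one, Complex.norm_real, Real.norm_eq_abs]
      have e2 := abs_ibpAmpDeriv_le (hy t ht') (hB₀ t ht') (hB₁ t ht') (hB₂ t ht') (Ψ.b₂ t ht') (Ψ.b₃ t ht')
      refine (abs_ibpAmp_le (hy t ht') (hD t ht') e2 (Ψ.b₂ t ht')).trans ?_
      have hu := hup t ht'
      have hu' := hUt t ht'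
      rw [← sq_abs (t - t₀)]
      set u := |t - t₀|
      have e3 : (B * (lam * u)⁻¹ + 2 * (B * u * (K * lam) * (lam * u)⁻¹ ^ 2) +
          B * u ^ 2 * (K * lam) * (lam * u)⁻¹ ^ 2 +
          2 * (B * u ^ 2 * (K * lam) ^ 2 * (lam * u)⁻¹ ^ 3)) * (lam * u)⁻¹ +
          2 * K * B * δ ^ 2 * (K * lam) * (lam * u)⁻¹ ^ 2 =
          (1 + 2 * K + K * u + 4 * K ^ 2) * B * lam⁻¹ ^ 2 * (u ^ 2)⁻¹ := by
        rw [← hlδ']; field_simp; ring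
      have e4 : δ ^ 4 = lam⁻¹ ^ 2 := by rw [hlδ']; ring
      rw [e3, e4]
      have e5 : 1 + 2 * K + K * u + 4 * K ^ 2 ≤ 8 * K ^ 2 * U := by
        have k1 : K ≤ K ^ 2 := by nlinarith
        have k2 : K ^ 2 ≤ K ^ 2 * U := by nlinarith
        have k3 : K * u ≤ K * U := by gcongr
        have k4 : K * U ≤ K ^ 2 * U := by gcongr
        linarith
      gcongr
    · exact (continuousOn_const.mul hc).intervalIntegrable_of_Icc hpq
  rw [intervalIntegral.integral_const_mul] at hI
  have hval : 8 * K ^ 2 * U * B * δ ^ 4 * ∫ t in p..q, ((t - t₀) ^ 2)⁻¹ ≤ 8 * K ^ 2 * U * B * δ ^ 3 := by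
    calc _ ≤ 8 * K ^ 2 * U * B * δ ^ 4 * δ⁻¹ := by gcongr
      _ = _ := by field_simp
  refine (osc_ibp_two hpq Ψ H hne).trans ?_
  have i1 := hend p ⟨le_rfl, hpq⟩ hp
  have i2 := hend q ⟨hpq, le_rfl⟩ hq
  have i3 := hend2 p ⟨le_rfl, hpq⟩
  have i4 := hend2 q ⟨hpq, le_rfl⟩
  have hBδ : 0 ≤ B * δ ^ 3 := by positivity
  have i5 : (2 + 4 * K) * (B * δ ^ 3) ≤ (6 * K ^ 2 * U) * (B * δ ^ 3) := by
    gcongr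
    nlinarith [mul_le_mul hK hK zero_le_one (by linarith : (0:ℝ) ≤ K),
      mul_le_mul_of_nonneg_left hU (by positivity : 0 ≤ K^2)]
  linarith


/-- Splitting an integral at distance `δ` from a point. -/
lemma norm_integral_split_le {a b t₀ δ S M : ℝ} (hab : a ≤ b) (hδ : 0 < δ) {F : ℝ → ℂ}
    (hF : ContinuousOn F (Set.Icc a b)) (hS : 0 ≤ S) (hM : 0 ≤ M)
    (hside : ∀ p q, a ≤ p → p ≤ q → q ≤ b → (∀ t ∈ Set.Icc p q, δ ≤ |t - t₀|) →
      (p = a ∨ |p - t₀| = δ) → (q = b ∨ |q - t₀| = δ) → ‖∫ t in p..q, F t‖ ≤ S)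
    (hmid : ∀ t ∈ Set.Icc a b, |t - t₀| ≤ δ → ‖F t‖ ≤ M) :
    ‖∫ t in a..b, F t‖ ≤ 2 * S + 2 * δ * M := by
  set p := max a (min b (t₀ - δ)) with hp
  set q := max a (min b (t₀ + δ)) with hq
  have hap : a ≤ p := le_max_left _ _
  have hpq : p ≤ q := max_le_max le_rfl (min_le_min le_rfl (by linarith))
  have hqb : q ≤ b := max_le hab (min_le_left _ _)
  have ii : ∀ u v, a ≤ u → u ≤ v → v ≤ b → IntervalIntegrable F volume u v := fun u v h1 h2 h3 =>
    (hF.mono (Set.Icc_subset_Icc h1 h3)).intervalIntegrable_of_Icc h2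
  rw [← intervalIntegral.integral_add_adjacent_intervals (ii a p le_rfl hap (hpq.trans hqb))
    (ii p b hap (hpq.trans hqb) le_rfl),
    ← intervalIntegral.integral_add_adjacent_intervals (ii p q hap hpq hqb)
    (ii q b (hap.trans hpq) hqb le_rfl)]
  have h1 : ‖∫ t in a..p, F t‖ ≤ S := by
    rcases hap.eq_or_lt with h | h
    · rw [← h]; simpa using hS
    · have h2 : a < min b (t₀ - δ) := by
        by_contra hc
        rw [hp, max_eq_left (not_lt.1 hc)] at h; exact lt_irrefl _ h
      have h3 : p = min b (t₀ - δ) := max_eq_right h2.le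
      refine hside a p le_rfl h.le (hpq.trans hqb) (fun t ht => ?_) (Or.inl rfl) ?_
      · have : t ≤ t₀ - δ := ht.2.trans (h3.le.trans (min_le_right _ _))
        rw [abs_sub_comm]
        exact le_trans (by linarith) (le_abs_self _)
      · rw [h3]
        rcases min_choice b (t₀ - δ) with h4 | h4 <;> rw [h4]
        · exact Or.inl rfl
        · right
          rw [show t₀ - δ - t₀ = -δ by ring, abs_neg, abs_of_pos hδ]
  have h2 : ‖∫ t in q..b, F t‖ ≤ S := by
    rcases hqb.eq_or_lt with h | h
    · rw [h]; simpa using hS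
    · have h2 : t₀ + δ < b := by
        by_contra hc
        rw [hq, min_eq_left (not_lt.1 hc), max_eq_right hab] at h; exact lt_irrefl _ h
      have h3 : q = max a (t₀ + δ) := by rw [hq, min_eq_right h2.le]
      refine hside q b (hap.trans hpq) h.le le_rfl (fun t ht => ?_) ?_ (Or.inl rfl)
      · have : t₀ + δ ≤ t := le_trans ((le_max_right _ _).trans h3.ge) ht.1
        exact le_trans (by linarith) (le_abs_self _)
      · rw [h3]
        rcases max_choice a (t₀ + δ) with h4 | h4 <;> rw [h4]
        · exact Or.inl rfl
        · right
          rw [show t₀ + δ - t₀ = δ by ring, abs_of_pos hδ]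
  have h3 : ‖∫ t in p..q, F t‖ ≤ 2 * δ * M := by
    rcases hpq.eq_or_lt with h | h
    · rw [h]; simp; positivity
    · have h4 : t₀ - δ < b := by
        by_contra hc
        push Not at hc
        have e1 : p = b := by rw [hp, min_eq_left hc, max_eq_right hab]
        linarith
      have h5 : a < t₀ + δ := by
        by_contra hc
        push Not at hc
        have e1 : q = a := by rw [hq, max_eq_left ((min_le_right _ _).trans hc)]
        linarith
      have h6 : p = max a (t₀ - δ) := by rw [hp, min_eq_right h4.le]
      have h7 : q ≤ t₀ + δ := max_le h5.le (min_le_right _ _)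
      have h8 : t₀ - δ ≤ p := (le_max_right _ _).trans h6.ge
      refine (intervalIntegral.norm_integral_le_of_norm_le_const (C := M) fun t ht => ?_).trans ?_
      · rw [Set.uIoc_of_le hpq] at ht
        refine hmid t ⟨hap.trans ht.1.le, ht.2.trans hqb⟩ (abs_le.2 ⟨?_, ?_⟩) <;>
          linarith [ht.1, ht.2]
      · rw [abs_of_nonneg (by linarith), mul_comm]
        gcongr
        linarith
  calc _ ≤ S + (2 * δ * M + S) :=
        (norm_add_le _ _).trans (add_le_add h1 ((norm_add_le _ _).trans (add_le_add h3 h2)))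
    _ = _ := by ring

/-- Second derivative test for oscillatory integrals. -/
lemma osc_stationary_one {a b lam K B t₀ δ : ℝ} (hab : a ≤ b) (hl : 0 < lam) (hK : 1 ≤ K) (hδ : 0 < δ)
    (hlδ : lam * δ ^ 2 = 1)
    {ψ ψ₁ ψ₂ ψ₃ h h₁ h₂ : ℝ → ℝ} (Ψ : PhaseOn a b ψ ψ₁ ψ₂ ψ₃ lam K) (H : AmpOn a b h h₁ h₂)
    (hB₀ : ∀ t ∈ Set.Icc a b, |h t| ≤ B) (hB₁ : ∀ t ∈ Set.Icc a b, |h₁ t| ≤ B)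
    (hlow : ∀ t ∈ Set.Icc a b, lam * |t - t₀| ≤ |ψ₁ t|) :
    ‖∫ t in a..b, (h t : ℂ) * eC (ψ t)‖ ≤ 2 * (3 + (b - a) + K) * B * δ := by
  have hB : 0 ≤ B := (abs_nonneg _).trans (hB₀ a ⟨le_rfl, hab⟩)
  have hcont : ContinuousOn (fun t => (h t : ℂ) * eC (ψ t)) (Set.Icc a b) :=
    (Complex.continuous_ofReal.comp_continuousOn H.continuousOn).mul
      (continuous_eC.comp_continuousOn Ψ.continuousOn)
  have hab' : 0 ≤ b - a := by linarith
  refine (norm_integral_split_le hab hδ hcont (t₀ := t₀) (S := (2 + (b - a) + K) * B * δ) (M := B)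
    (by positivity) hB (fun p q h1 h2 h3 h4 _ _ => ?_) fun t ht _ => ?_).trans (by linarith)
  · have hs : Set.Icc p q ⊆ Set.Icc a b := Set.Icc_subset_Icc h1 h3
    refine (osc_side_one h2 hl hK hδ hlδ (Ψ.mono h1 h3) (H.mono h1 h3) (fun t ht => hB₀ t (hs ht))
      (fun t ht => hB₁ t (hs ht)) (fun t ht => hlow t (hs ht)) h4).trans ?_
    gcongr
  · rw [norm_mul, norm_eC, mul_one, Complex.norm_real]
    exact hB₀ t ht

/-- Oscillatory integral with amplitude vanishing to second order at the stationary point. -/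
lemma osc_stationary_two {a b lam K B t₀ δ U : ℝ} (hab : a ≤ b) (hl : 0 < lam) (hK : 1 ≤ K)
    (hδ : 0 < δ) (hlδ : lam * δ ^ 2 = 1) (hU : 1 ≤ U)
    {ψ ψ₁ ψ₂ ψ₃ h h₁ h₂ : ℝ → ℝ} (Ψ : PhaseOn a b ψ ψ₁ ψ₂ ψ₃ lam K) (H : AmpOn a b h h₁ h₂)
    (hB₀ : ∀ t ∈ Set.Icc a b, |h t| ≤ B * |t - t₀| ^ 2)
    (hB₁ : ∀ t ∈ Set.Icc a b, |h₁ t| ≤ B * |t - t₀|)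
    (hB₂ : ∀ t ∈ Set.Icc a b, |h₂ t| ≤ B)
    (hlow : ∀ t ∈ Set.Icc a b, lam * |t - t₀| ≤ |ψ₁ t|)
    (hUt : ∀ t ∈ Set.Icc a b, |t - t₀| ≤ U) (ha : h a = 0) (hb : h b = 0) :
    ‖∫ t in a..b, (h t : ℂ) * eC (ψ t)‖ ≤ 30 * K ^ 2 * U * B * δ ^ 3 := by
  have hB : 0 ≤ B := (abs_nonneg _).trans (hB₂ a ⟨le_rfl, hab⟩)
  have hcont : ContinuousOn (fun t => (h t : ℂ) * eC (ψ t)) (Set.Icc a b) :=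
    (Complex.continuous_ofReal.comp_continuousOn H.continuousOn).mul
      (continuous_eC.comp_continuousOn Ψ.continuousOn)
  have h1 : 1 ≤ K ^ 2 * U := by nlinarith
  refine (norm_integral_split_le hab hδ hcont (t₀ := t₀) (S := 14 * K ^ 2 * U * B * δ ^ 3)
    (M := B * δ ^ 2) (by positivity) (by positivity) (fun p q h1 h2 h3 h4 h5 h6 => ?_)
    fun t ht ht' => ?_).trans ?_
  · have hs : Set.Icc p q ⊆ Set.Icc a b := Set.Icc_subset_Icc h1 h3
    exact osc_side_two h2 hl hK hδ hlδ hU (Ψ.mono h1 h3) (H.mono h1 h3) (fun t ht => hB₀ t (hs ht))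
      (fun t ht => hB₁ t (hs ht)) (fun t ht => hB₂ t (hs ht)) (fun t ht => hlow t (hs ht)) h4
      (fun t ht => hUt t (hs ht)) (h5.imp_left (by rintro rfl; exact ha))
      (h6.imp_left (by rintro rfl; exact hb))
  · rw [norm_mul, norm_eC, mul_one, Complex.norm_real]
    refine (hB₀ t ht).trans ?_
    gcongr
  · have : 1 * (B * δ ^ 3) ≤ (K ^ 2 * U) * (B * δ ^ 3) := by gcongr
    linarith

lemma rpow_bounds {a b : ℝ} (ha : 0 < a) (e : ℝ) :
    ∃ M : ℝ, 1 ≤ M ∧ ∀ s ∈ Set.Icc a b, s ^ e ≤ M ∧ M⁻¹ ≤ s ^ e := by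
  have hc : ∀ f : ℝ, ContinuousOn (fun s : ℝ => s ^ f) (Set.Icc a b) := fun f s hs =>
    (Real.continuousAt_rpow_const s f (Or.inl (ha.trans_le hs.1).ne')).continuousWithinAt
  obtain ⟨M₁, h₁⟩ := isCompact_Icc.exists_bound_of_continuousOn (hc e)
  obtain ⟨M₂, h₂⟩ := isCompact_Icc.exists_bound_of_continuousOn (hc (-e))
  refine ⟨max 1 (max M₁ M₂), le_max_left _ _, fun s hs => ?_⟩
  have hs0 : 0 < s := ha.trans_le hs.1
  have h3 := (le_abs_self _).trans (h₁ s hs)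
  have h4 := (le_abs_self _).trans (h₂ s hs)
  refine ⟨h3.trans ((le_max_left _ _).trans (le_max_right _ _)), ?_⟩
  rw [inv_le_comm₀ (by positivity) (by positivity), ← Real.rpow_neg hs0.le]
  exact h4.trans ((le_max_right _ _).trans (le_max_right _ _))

/-- The smooth weight supported on `[a, b]`. -/
noncomputable def bump (a b t : ℝ) : ℝ := (max ((t - a) * (b - t)) 0) ^ 3

/-- The weight on its support and its derivatives. -/
noncomputable def wt (a b t : ℝ) : ℝ := ((t - a) * (b - t)) ^ 3
noncomputable def wt₁ (a b t : ℝ) : ℝ := 3 * ((t - a) * (b - t)) ^ 2 * (a + b - 2 * t)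
noncomputable def wt₂ (a b t : ℝ) : ℝ :=
  6 * ((t - a) * (b - t)) * ((a + b - 2 * t) ^ 2 - (t - a) * (b - t))
noncomputable def wt₃ (a b t : ℝ) : ℝ :=
  6 * (a + b - 2 * t) ^ 3 - 36 * ((t - a) * (b - t)) * (a + b - 2 * t)

lemma bump_eq_wt {a b t : ℝ} (ht : t ∈ Set.Icc a b) : bump a b t = wt a b t := by
  rw [bump, wt, max_eq_left (mul_nonneg (by linarith [ht.1]) (by linarith [ht.2]))]

lemma bump_eq_zero {a b t : ℝ} (hab : a ≤ b) (ht : t ∉ Set.Ioo a b) : bump a b t = 0 := by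
  rw [bump, max_eq_right, zero_pow three_ne_zero]
  by_contra! h
  rcases pos_and_pos_or_neg_and_neg_of_mul_pos h with h | h
  · exact ht ⟨by linarith, by linarith⟩
  · linarith

lemma continuous_bump (a b : ℝ) : Continuous (bump a b) := by unfold bump; fun_prop

lemma hasDerivAt_quad (a b t : ℝ) : HasDerivAt (fun t => (t - a) * (b - t)) (a + b - 2 * t) t := by
  have := ((hasDerivAt_id t).sub_const a).mul ((hasDerivAt_id t).const_sub b)
  refine this.congr_deriv ?_
  simp; ring

lemma hasDerivAt_lin (a b t : ℝ) : HasDerivAt (fun t => a + b - 2 * t) (-2) t := by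
  have := ((hasDerivAt_id t).const_mul 2).const_sub (a + b)
  refine this.congr_deriv ?_
  simp

lemma hasDerivAt_wt (a b t : ℝ) : HasDerivAt (wt a b) (wt₁ a b t) t := by
  refine ((hasDerivAt_quad a b t).pow 3).congr_deriv ?_
  simp [wt₁]

lemma hasDerivAt_wt₁ (a b t : ℝ) : HasDerivAt (wt₁ a b) (wt₂ a b t) t := by
  refine ((((hasDerivAt_quad a b t).pow 2).const_mul 3).mul (hasDerivAt_lin a b t)).congr_deriv ?_
  simp [wt₂]; ring

lemma hasDerivAt_wt₂ (a b t : ℝ) : HasDerivAt (wt₂ a b) (wt₃ a b t) t := by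
  refine (((hasDerivAt_quad a b t).const_mul 6).mul
    (((hasDerivAt_lin a b t).pow 2).sub (hasDerivAt_quad a b t))).congr_deriv ?_
  simp [wt₃]; ring

lemma continuous_wt₂ (a b : ℝ) : Continuous (wt₂ a b) := by unfold wt₂; fun_prop
lemma continuous_wt₃ (a b : ℝ) : Continuous (wt₃ a b) := by unfold wt₃; fun_prop

lemma ampOn_wt (a b : ℝ) : AmpOn a b (wt a b) (wt₁ a b) (wt₂ a b) :=
  ⟨fun t _ => hasDerivAt_wt a b t, fun t _ => hasDerivAt_wt₁ a b t, (continuous_wt₂ a b).continuousOn⟩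

lemma ampOn_wt₁ (a b : ℝ) : AmpOn a b (wt₁ a b) (wt₂ a b) (wt₃ a b) :=
  ⟨fun t _ => hasDerivAt_wt₁ a b t, fun t _ => hasDerivAt_wt₂ a b t, (continuous_wt₃ a b).continuousOn⟩

lemma wt_bounds (a b : ℝ) : ∃ B : ℝ, 1 ≤ B ∧ ∀ t ∈ Set.Icc a b, |wt a b t| ≤ B ∧ |wt₁ a b t| ≤ B ∧
    |wt₂ a b t| ≤ B := by
  obtain ⟨B₀, h₀⟩ := isCompact_Icc.exists_bound_of_continuousOn (ampOn_wt a b).continuousOn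
  obtain ⟨B₁, h₁⟩ := isCompact_Icc.exists_bound_of_continuousOn (ampOn_wt₁ a b).continuousOn
  obtain ⟨B₂, h₂⟩ := isCompact_Icc.exists_bound_of_continuousOn (s := Set.Icc a b)
    (continuous_wt₂ a b).continuousOn
  refine ⟨max 1 (max B₀ (max B₁ B₂)), le_max_left _ _, fun t ht => ⟨(h₀ t ht).trans ?_,
    (h₁ t ht).trans ?_, (h₂ t ht).trans ?_⟩⟩ <;> simp

lemma hasDerivAt_mul_rpow {c y : ℝ} (x : ℝ) {t : ℝ} (ht : 0 < t) (hy : y = x * c) (e : ℝ) (he : e = c - 1) :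
    HasDerivAt (fun t : ℝ => x * t ^ c) (y * t ^ e) t := by
  subst hy he
  have := (Real.hasDerivAt_rpow_const (p := c) (Or.inl ht.ne')).const_mul x
  refine this.congr_deriv ?_
  ring

/-- The monomial phases satisfy the derivative bounds. -/
lemma phaseOn_rpow {a b : ℝ} (ha : 0 < a) (c : ℝ) : ∃ M : ℝ, 1 ≤ M ∧ ∀ x ℓ lam K : ℝ, 0 < x →
    M * x ≤ K * lam → PhaseOn a b (fun t => x * t ^ c - ℓ * t) (fun t => x * c * t ^ (c - 1) - ℓ)
      (fun t => x * c * (c - 1) * t ^ (c - 2)) (fun t => x * c * (c - 1) * (c - 2) * t ^ (c - 3))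
      lam K := by
  obtain ⟨M₂, h1₂, h₂⟩ := rpow_bounds (b := b) ha (c - 2)
  obtain ⟨M₃, h1₃, h₃⟩ := rpow_bounds (b := b) ha (c - 3)
  set D₂ := |c * (c - 1)|
  set D₃ := |c * (c - 1) * (c - 2)|
  have hM2 : 0 ≤ D₂ * M₂ := by positivity
  have hM3 : 0 ≤ D₃ * M₃ := by positivity
  refine ⟨1 + D₂ * M₂ + D₃ * M₃, by linarith, fun x ℓ lam K hx hK => ?_⟩
  have hpos : ∀ t ∈ Set.Icc a b, 0 < t := fun t ht => ha.trans_le ht.1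
  refine ⟨fun t ht => ?_, fun t ht => ?_, fun t ht => ?_, ?_, fun t ht => ?_, fun t ht => ?_⟩
  · refine ((hasDerivAt_mul_rpow x (hpos t ht) rfl (c - 1) rfl).sub
      ((hasDerivAt_id t).const_mul ℓ)).congr_deriv (by simp)
  · exact (hasDerivAt_mul_rpow _ (hpos t ht) (by ring) _ (by ring)).sub_const ℓ
  · exact hasDerivAt_mul_rpow _ (hpos t ht) (by ring) _ (by ring)
  · exact fun t ht => (continuousAt_const.mul (Real.continuousAt_rpow_const t _
      (Or.inl (hpos t ht).ne'))).continuousWithinAt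
  · have h0 := hpos t ht
    rw [show x * c * (c - 1) = x * (c * (c - 1)) by ring, abs_mul, abs_mul, abs_of_pos hx,
      abs_of_pos (by positivity : 0 < t ^ (c - 2))]
    have := (h₂ t ht).1
    calc x * D₂ * t ^ (c - 2) ≤ x * D₂ * M₂ := by gcongr
      _ ≤ (1 + D₂ * M₂ + D₃ * M₃) * x := by nlinarith
      _ ≤ _ := hK
  · have h0 := hpos t ht
    rw [show x * c * (c - 1) * (c - 2) = x * (c * (c - 1) * (c - 2)) by ring, abs_mul, abs_mul,
      abs_of_pos hx, abs_of_pos (by positivity : 0 < t ^ (c - 3))]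
    have := (h₃ t ht).1
    calc x * D₃ * t ^ (c - 3) ≤ x * D₃ * M₃ := by gcongr
      _ ≤ (1 + D₂ * M₂ + D₃ * M₃) * x := by nlinarith
      _ ≤ _ := hK

/-- The weighted exponential integral dual to the sum over `n`. -/
noncomputable def GG (a b c ℓ x : ℝ) : ℂ := ∫ t in a..b, (wt a b t : ℂ) * eC (x * t ^ c - ℓ * t)

lemma GG_nonstationary {a b c : ℝ} (ha : 0 < a) (hab : a < b) (hc : 1 < c) : ∃ C : ℝ, 0 < C ∧
    ∀ Y x ℓ : ℝ, 0 < Y → Y ≤ x → x ≤ 2 * Y →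
      (ℓ < c * a ^ (c - 1) / 2 * Y ∨ 4 * c * b ^ (c - 1) * Y < ℓ) →
      ‖GG a b c ℓ x‖ ≤ C / (Y + |ℓ|) ^ 2 := by
  obtain ⟨M, hM, hΨ⟩ := phaseOn_rpow (b := b) ha c
  obtain ⟨B, hB, hw⟩ := wt_bounds a b
  set c₁ := c * a ^ (c - 1) / 2
  set c₂ := 4 * c * b ^ (c - 1)
  have hb : 0 < b := ha.trans hab
  have h1 : 0 < c₁ := by positivity
  have h2 : 0 < c₂ := by positivity
  have h12 : 4 * c₁ ≤ c₂ := by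
    have : a ^ (c - 1) ≤ b ^ (c - 1) := Real.rpow_le_rpow ha.le hab.le (by linarith)
    simp only [c₁, c₂]; nlinarith
  -- the lower bound for the derivative
  obtain ⟨η, hη, hη1, hη2, hη3⟩ : ∃ η : ℝ, 0 < η ∧ η * 2 ≤ c₁ ∧ η * 2 ≤ 1 / 2 ∧ 4 * η ≤ c₂ := by
    refine ⟨min (c₁ / 2) (1 / 4), by positivity, ?_, ?_, ?_⟩
    · linarith [min_le_left (c₁ / 2) (1 / 4)]
    · linarith [min_le_right (c₁ / 2) (1 / 4)]
    · linarith [min_le_left (c₁ / 2) (1 / 4)]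
  set K := max 1 (2 * M / η)
  refine ⟨8 * K ^ 2 * B * (b - a) / η ^ 2, ?_, fun Y x ℓ hY hYx hx2 hℓ => ?_⟩
  · have : 0 < b - a := by linarith
    have : 0 < K := zero_lt_one.trans_le (le_max_left _ _)
    positivity
  set lam := η * (Y + |ℓ|) with hlam
  have hl : 0 < lam := by positivity
  have hK : M * x ≤ K * lam := by
    have e1 : 2 * M / η * (η * Y) = 2 * M * Y := by field_simp
    calc M * x ≤ 2 * M * Y := by nlinarith
      _ = 2 * M / η * (η * Y) := e1.symm
      _ ≤ K * lam := by
        gcongr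
        · exact le_max_right _ _
        · exact mul_le_mul_of_nonneg_left (by linarith [abs_nonneg ℓ]) hη.le
  have := osc_nonstationary hab.le hl (le_max_left 1 (2 * M / η)) (hΨ x ℓ lam K (hY.trans_le hYx) hK)
    (ampOn_wt a b) (fun t ht => (hw t ht).1) (fun t ht => (hw t ht).2.1) (fun t ht => (hw t ht).2.2)
    (fun t ht => ?_) (by simp [wt]) (by simp [wt]) (by simp [wt₁]) (by simp [wt₁])
  · refine this.trans (le_of_eq ?_)
    rw [hlam]; simp only [K]; field_simp
  · have ht0 : 0 < t := ha.trans_le ht.1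
    have hx0 : 0 < x := hY.trans_le hYx
    have hc0 : 0 < x * c := by positivity
    have e1 : 2 * c₁ * Y ≤ x * c * t ^ (c - 1) := by
      have : a ^ (c - 1) ≤ t ^ (c - 1) := Real.rpow_le_rpow ha.le ht.1 (by linarith)
      calc 2 * c₁ * Y = Y * c * a ^ (c - 1) := by simp only [c₁]; ring
        _ ≤ _ := by gcongr
    have e2 : x * c * t ^ (c - 1) ≤ c₂ / 2 * Y := by
      have : t ^ (c - 1) ≤ b ^ (c - 1) := Real.rpow_le_rpow ht0.le ht.2 (by linarith)
      calc x * c * t ^ (c - 1) ≤ (2 * Y) * c * b ^ (c - 1) := by gcongr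
        _ = _ := by simp only [c₂]; ring
    have e3 : η * 2 * Y ≤ c₁ * Y := by gcongr
    have e4 : 4 * η * Y ≤ c₂ * Y := by gcongr
    rcases hℓ with h | h
    · refine le_trans ?_ (le_abs_self _)
      rcases abs_cases ℓ with ⟨h', _⟩ | ⟨h', _⟩ <;> rw [hlam, h'] <;> nlinarith
    · refine le_trans ?_ (neg_le_abs _)
      have : 0 < ℓ := lt_trans (by positivity) h
      rw [hlam, abs_of_pos this]
      nlinarith

/-- Lower bound for differences of powers. -/
lemma rpow_sub_lower {a b : ℝ} (ha : 0 < a) {e : ℝ} (he : 0 < e) : ∃ m : ℝ, 0 < m ∧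
    ∀ s ∈ Set.Icc a b, ∀ t ∈ Set.Icc a b, m * |t - s| ≤ |t ^ e - s ^ e| := by
  obtain ⟨M, hM, h⟩ := rpow_bounds (b := b) ha (e - 1)
  have hM0 : 0 < M := by linarith
  have key : ∀ s ∈ Set.Icc a b, ∀ t ∈ Set.Icc a b, s ≤ t → e * M⁻¹ * (t - s) ≤ t ^ e - s ^ e := by
    intro s hs t ht hst
    refine (convex_Icc a b).mul_sub_le_image_sub_of_le_deriv
      (f := fun y : ℝ => y ^ e) (fun y hy => (Real.continuousAt_rpow_const y e
        (Or.inl (ha.trans_le hy.1).ne')).continuousWithinAt) (fun y hy => ?_) (fun y hy => ?_) s hs t ht hst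
    · rw [interior_Icc] at hy
      exact (Real.hasDerivAt_rpow_const (Or.inl (ha.trans hy.1).ne')).differentiableAt.differentiableWithinAt
    · rw [interior_Icc] at hy
      rw [(Real.hasDerivAt_rpow_const (p := e) (Or.inl (ha.trans hy.1).ne')).deriv]
      have := (h y ⟨hy.1.le, hy.2.le⟩).2
      gcongr
  refine ⟨e * M⁻¹, by positivity, fun s hs t ht => ?_⟩
  rcases le_total s t with hst | hst
  · rw [abs_of_nonneg (by linarith : 0 ≤ t - s)]
    exact (key s hs t ht hst).trans (le_abs_self _)
  · rw [abs_sub_comm, abs_of_nonneg (by linarith : 0 ≤ s - t), abs_sub_comm]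
    exact (key t ht s hs hst).trans (le_abs_self _)

/-- The stationary point. -/
noncomputable def statPt (c ℓ x : ℝ) : ℝ := (ℓ / (c * x)) ^ (1 / (c - 1))

lemma statPt_rpow {c ℓ x : ℝ} (hc : 1 < c) (hℓ : 0 < ℓ) (hx : 0 < x) :
    c * x * statPt c ℓ x ^ (c - 1) = ℓ := by
  rw [statPt, ← Real.rpow_mul (by positivity), one_div, inv_mul_cancel₀ (by linarith), Real.rpow_one]
  field_simp

lemma statPt_mem {c c₁ c₂ ℓ x Y : ℝ} (hc : 1 < c) (hc₁ : 0 < c₁) (hY : 0 < Y) (hYx : Y ≤ x)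
    (hx : x ≤ 2 * Y) (h₁ : c₁ * Y ≤ ℓ) (h₂ : ℓ ≤ c₂ * Y) :
    statPt c ℓ x ∈ Set.Icc ((c₁ / (2 * c)) ^ (1 / (c - 1))) ((c₂ / c) ^ (1 / (c - 1))) := by
  have h0 : 0 < ℓ := lt_of_lt_of_le (by positivity) h₁
  have he : 0 ≤ 1 / (c - 1) := one_div_nonneg.2 (by linarith)
  have hx0 : 0 < x := hY.trans_le hYx
  constructor
  · refine Real.rpow_le_rpow (by positivity) ?_ he
    rw [div_le_div_iff₀ (by positivity) (by positivity)]
    calc c₁ * (c * x) ≤ c₁ * (c * (2 * Y)) := by gcongr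
      _ = (c₁ * Y) * (2 * c) := by ring
      _ ≤ _ := by gcongr
  · refine Real.rpow_le_rpow (by positivity) ?_ he
    rw [div_le_div_iff₀ (by positivity) (by positivity)]
    have : 0 < c₂ := by
      by_contra! h
      nlinarith
    calc ℓ * c ≤ c₂ * Y * c := by gcongr
      _ ≤ c₂ * x * c := by gcongr
      _ = _ := by ring
lemma norm_integral_mul_phase_le {a b : ℝ} (hab : a ≤ b) {ψ ψ₁ h h₁ : ℝ → ℝ}
    (hψ : ∀ t ∈ Set.Icc a b, HasDerivAt ψ (ψ₁ t) t) (cψ : ContinuousOn ψ₁ (Set.Icc a b))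
    (hh : ∀ t ∈ Set.Icc a b, HasDerivAt h (h₁ t) t) (ch : ContinuousOn h₁ (Set.Icc a b))
    (ha : h a = 0) (hb : h b = 0) :
    ‖∫ t in a..b, ((h t * ψ₁ t : ℝ) : ℂ) * eC (ψ t)‖ ≤ ‖∫ t in a..b, (h₁ t : ℂ) * eC (ψ t)‖ := by
  have c0 : ContinuousOn ψ (Set.Icc a b) := fun t ht => (hψ t ht).continuousAt.continuousWithinAt
  have c1 : ContinuousOn h (Set.Icc a b) := fun t ht => (hh t ht).continuousAt.continuousWithinAt
  have ceC : ContinuousOn (fun t => eC (ψ t)) (Set.Icc a b) := continuous_eC.comp_continuousOn c0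
  have i1 : IntervalIntegrable (fun t => ((h t * ψ₁ t : ℝ) : ℂ) * eC (ψ t)) volume a b :=
    ((Complex.continuous_ofReal.comp_continuousOn (c1.mul cψ)).mul ceC).intervalIntegrable_of_Icc hab
  have i2 : IntervalIntegrable (fun t => (h₁ t : ℂ) * eC (ψ t)) volume a b :=
    ((Complex.continuous_ofReal.comp_continuousOn ch).mul ceC).intervalIntegrable_of_Icc hab
  have hder : ∀ t ∈ Set.uIcc a b, HasDerivAt (fun t => (h t : ℂ) * eC (ψ t))
      ((h₁ t : ℂ) * eC (ψ t) + 2 * π * Complex.I * (((h t * ψ₁ t : ℝ) : ℂ) * eC (ψ t))) t := by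
    intro t ht
    rw [Set.uIcc_of_le hab] at ht
    refine ((hh t ht).ofReal_comp.mul (hψ t ht).eC_comp).congr_deriv ?_
    push_cast
    ring
  have h1 := intervalIntegral.integral_eq_sub_of_hasDerivAt hder (i2.add (i1.const_mul _))
  rw [intervalIntegral.integral_add i2 (i1.const_mul _), intervalIntegral.integral_const_mul, ha, hb] at h1
  set I := ∫ t in a..b, ((h t * ψ₁ t : ℝ) : ℂ) * eC (ψ t)
  set J := ∫ t in a..b, (h₁ t : ℂ) * eC (ψ t)
  have h2 : J = -(2 * π * Complex.I * I) := by
    simp only [Complex.ofReal_zero, zero_mul, sub_zero] at h1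
    exact eq_neg_of_add_eq_zero_left h1
  rw [h2, norm_neg, norm_mul]
  have : ‖(2 * π * Complex.I : ℂ)‖ = 2 * π := by simp [abs_of_pos Real.pi_pos]
  rw [this]
  have := Real.pi_gt_three
  nlinarith [norm_nonneg I]

/-- The second order remainder of `t ^ c` at the stationary point. -/
noncomputable def rem (c s t : ℝ) : ℝ := t ^ c - s ^ c - c * s / (c - 1) * (t ^ (c - 1) - s ^ (c - 1))
noncomputable def rem₁ (c s t : ℝ) : ℝ := c * t ^ (c - 2) * (t - s)
noncomputable def rem₂ (c s t : ℝ) : ℝ := c * (c - 1) * t ^ (c - 2) - c * (c - 2) * s * t ^ (c - 3)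

lemma hasDerivAt_rem {c s t : ℝ} (hc : 1 < c) (ht : 0 < t) : HasDerivAt (rem c s) (rem₁ c s t) t := by
  have h1 := (Real.hasDerivAt_rpow_const (p := c) (Or.inl ht.ne')).sub_const (s ^ c)
  have h2 := ((Real.hasDerivAt_rpow_const (p := c - 1) (Or.inl ht.ne')).sub_const
    (s ^ (c - 1))).const_mul (c * s / (c - 1))
  refine (h1.sub h2).congr_deriv ?_
  have e1 : t ^ (c - 1) = t ^ (c - 2) * t := by
    rw [← Real.rpow_add_one ht.ne']; congr 1; ring
  rw [show c - 1 - 1 = c - 2 by ring, e1, rem₁]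
  have : c - 1 ≠ 0 := by linarith
  field_simp

lemma hasDerivAt_rem₁ {c s t : ℝ} (ht : 0 < t) : HasDerivAt (rem₁ c s) (rem₂ c s t) t := by
  have h1 := ((Real.hasDerivAt_rpow_const (p := c - 2) (Or.inl ht.ne')).const_mul c).mul
    ((hasDerivAt_id t).sub_const s)
  refine h1.congr_deriv ?_
  have e1 : t ^ (c - 2) = t ^ (c - 3) * t := by
    rw [← Real.rpow_add_one ht.ne']; congr 1; ring
  rw [show c - 2 - 1 = c - 3 by ring, rem₂]
  simp only [id]
  rw [e1]
  ring

lemma rem_bounds {a b c : ℝ} (ha : 0 < a) (hc : 1 < c) : ∃ R : ℝ, 1 ≤ R ∧ ∀ s ∈ Set.Icc a b,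
    ∀ t ∈ Set.Icc a b, |rem c s t| ≤ R * |t - s| ^ 2 ∧ |rem₁ c s t| ≤ R * |t - s| ∧ |rem₂ c s t| ≤ R := by
  obtain ⟨M₂, hM₂, h₂⟩ := rpow_bounds (b := b) ha (c - 2)
  obtain ⟨M₃, hM₃, h₃⟩ := rpow_bounds (b := b) ha (c - 3)
  have k1 : 0 ≤ c * (c - 1) * M₂ := mul_nonneg (by nlinarith) (by linarith)
  have k2 : 0 ≤ c * |c - 2| * |b| * M₃ := by positivity
  have k3 : 0 ≤ c * M₂ := by nlinarith
  set R := 1 + c * M₂ + c * (c - 1) * M₂ + c * |c - 2| * |b| * M₃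
  have hr1 : ∀ s ∈ Set.Icc a b, ∀ t ∈ Set.Icc a b, |rem₁ c s t| ≤ R * |t - s| := by
    intro s hs t ht
    have ht0 : 0 < t := ha.trans_le ht.1
    rw [rem₁, abs_mul, abs_of_pos (by positivity)]
    have := (h₂ t ht).1
    gcongr
    have : c * t ^ (c - 2) ≤ c * M₂ := by gcongr
    simp only [R]; linarith
  refine ⟨R, by simp only [R]; linarith, fun s hs t ht => ⟨?_, hr1 s hs t ht, ?_⟩⟩
  · have hsub : Set.uIcc s t ⊆ Set.Icc a b := Set.uIcc_subset_Icc hs ht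
    have := (convex_uIcc s t).norm_image_sub_le_of_norm_hasDerivWithin_le (f := rem c s)
      (f' := rem₁ c s) (C := R * |t - s|)
      (fun y hy => (hasDerivAt_rem hc (ha.trans_le (hsub hy).1)).hasDerivWithinAt)
      (fun y hy => (hr1 s hs y (hsub hy)).trans (mul_le_mul_of_nonneg_left
        (Set.abs_sub_left_of_mem_uIcc hy) (by simp only [R]; linarith)))
      Set.left_mem_uIcc Set.right_mem_uIcc
    have e : rem c s s = 0 := by simp [rem]
    rw [e, sub_zero, Real.norm_eq_abs, Real.norm_eq_abs] at this
    calc _ ≤ _ := this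
      _ = _ := by ring
  · have ht0 : 0 < t := ha.trans_le ht.1
    have hs0 : 0 < s := ha.trans_le hs.1
    have e2 := (h₂ t ht).1
    have e3 := (h₃ t ht).1
    have e4 : |s| ≤ |b| := abs_le_abs_of_nonneg hs0.le hs.2
    rw [rem₂]
    refine (abs_sub _ _).trans ?_
    rw [abs_mul, abs_mul, abs_mul, abs_mul, abs_mul, abs_of_pos (by linarith : 0 < c - 1),
      abs_of_pos (by linarith : 0 < c), abs_of_pos (by positivity : 0 < t ^ (c - 2)),
      abs_of_pos (by positivity : 0 < t ^ (c - 3))]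
    have e5 : c * (c - 1) * t ^ (c - 2) ≤ c * (c - 1) * M₂ :=
      mul_le_mul_of_nonneg_left e2 (by nlinarith)
    have e6 : c * |c - 2| * |s| * t ^ (c - 3) ≤ c * |c - 2| * |b| * M₃ := by gcongr
    simp only [R]; linarith

set_option maxHeartbeats 1000000 in
lemma GG_stationary {a b c c₁ c₂ : ℝ} (ha : 0 < a) (hab : a < b) (hc : 1 < c) (hc₁ : 0 < c₁) :
    ∃ C : ℝ, 0 < C ∧ ∀ Y x ℓ : ℝ, 0 < Y → Y ≤ x → x ≤ 2 * Y → c₁ * Y ≤ ℓ → ℓ ≤ c₂ * Y →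
      ‖GG a b c ℓ x‖ ≤ C / √Y ∧
      ‖∫ t in a..b, ((wt a b t * (t ^ c - statPt c ℓ x ^ c) : ℝ) : ℂ) * eC (x * t ^ c - ℓ * t)‖ ≤
        C / (Y * √Y) := by
  set α := min a ((c₁ / (2 * c)) ^ (1 / (c - 1)))
  set β := max b ((c₂ / c) ^ (1 / (c - 1)))
  have hα : 0 < α := lt_min ha (by positivity)
  have hsub : Set.Icc a b ⊆ Set.Icc α β := Set.Icc_subset_Icc (min_le_left _ _) (le_max_left _ _)
  obtain ⟨m, hm, hlow⟩ := rpow_sub_lower (b := β) hα (e := c - 1) (by linarith)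
  obtain ⟨R, hR, hrem⟩ := rem_bounds (b := β) hα hc
  obtain ⟨M, hM, hΨ⟩ := phaseOn_rpow (b := b) ha c
  obtain ⟨B, hB, hw⟩ := wt_bounds a b
  obtain ⟨B₃, hB₃⟩ := isCompact_Icc.exists_bound_of_continuousOn (s := Set.Icc a b)
    (continuous_wt₃ a b).continuousOn
  set U := max 1 (β - α)
  have hU : 1 ≤ U := le_max_left _ _
  have hβ : 0 < β := (ha.trans hab).trans_le (le_max_left _ _)
  set K := max 1 (2 * M / (c * m))
  have hK1 : 1 ≤ K := le_max_left _ _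
  set q := √(c * m)
  have hq : 0 < q := Real.sqrt_pos.2 (by positivity)
  have hq2 : q ^ 2 = c * m := Real.sq_sqrt (by positivity)
  set B' := B * R * (U + 1) ^ 2 + B * R
  have hab' : 0 < b - a := by linarith
  set C₁ := 2 * (3 + (b - a) + K) * B / q
  set C₂ := 30 * K ^ 2 * U * B' / q ^ 3
  set C₃ := β * C₁ / (c - 1)
  have hc1 : 0 < c - 1 := by linarith
  have hC₁ : 0 < C₁ := by positivity
  have hC₂ : 0 < C₂ := by positivity
  have hC₃ : 0 < C₃ := by positivity
  refine ⟨C₁ + C₂ + C₃, by positivity, fun Y x ℓ hY hYx hx2 hℓ₁ hℓ₂ => ?_⟩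
  have hx : 0 < x := hY.trans_le hYx
  have hℓ : 0 < ℓ := lt_of_lt_of_le (by positivity) hℓ₁
  set s := statPt c ℓ x with hs
  have hsx : c * x * s ^ (c - 1) = ℓ := statPt_rpow hc hℓ hx
  have hsm : s ∈ Set.Icc α β := by
    have := statPt_mem hc hc₁ hY hYx hx2 hℓ₁ hℓ₂
    exact ⟨(min_le_right _ _).trans this.1, this.2.trans (le_max_right _ _)⟩
  have hs0 : 0 < s := hα.trans_le hsm.1
  set δ := (q * √Y)⁻¹
  have hsY : 0 < √Y := Real.sqrt_pos.2 hY
  have hsY2 : √Y ^ 2 = Y := Real.sq_sqrt hY.le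
  have hδ : 0 < δ := by positivity
  set lam := c * m * Y
  have hl : 0 < lam := by positivity
  have hlδ : lam * δ ^ 2 = 1 := by
    simp only [lam, δ]
    rw [inv_pow, mul_pow, hq2, hsY2, mul_inv_cancel₀ (by positivity)]
  have hKx : M * x ≤ K * lam := by
    calc M * x ≤ 2 * M * Y := by nlinarith
      _ = 2 * M / (c * m) * lam := by simp only [lam]; field_simp
      _ ≤ K * lam := by gcongr; exact le_max_right _ _
  have Ψ := hΨ x ℓ lam K hx hKx
  have hψ₁ : ∀ t, x * c * t ^ (c - 1) - ℓ = c * x * (t ^ (c - 1) - s ^ (c - 1)) := fun t => by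
    rw [← hsx]; ring
  have hlow' : ∀ t ∈ Set.Icc a b, lam * |t - s| ≤ |x * c * t ^ (c - 1) - ℓ| := fun t ht => by
    have := hlow s hsm t (hsub ht)
    have hcx : 0 < c * x := mul_pos (by linarith) hx
    rw [hψ₁, abs_mul, abs_of_pos hcx]
    calc lam * |t - s| = c * Y * (m * |t - s|) := by simp only [lam]; ring
      _ ≤ c * x * |t ^ (c - 1) - s ^ (c - 1)| := by gcongr
  have g1 : ‖GG a b c ℓ x‖ ≤ C₁ / √Y := by
    refine (osc_stationary_one hab.le hl hK1 hδ hlδ Ψ (ampOn_wt a b) (fun t ht => (hw t ht).1)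
      (fun t ht => (hw t ht).2.1) hlow').trans (le_of_eq ?_)
    simp only [C₁, δ]; field_simp
  have g2 : ‖∫ t in a..b, (wt₁ a b t : ℂ) * eC (x * t ^ c - ℓ * t)‖ ≤ C₁ / √Y := by
    refine (osc_stationary_one hab.le hl hK1 hδ hlδ Ψ (ampOn_wt₁ a b) (fun t ht => (hw t ht).2.1)
      (fun t ht => (hw t ht).2.2) hlow').trans (le_of_eq ?_)
    simp only [C₁, δ]; field_simp
  have hpos : ∀ t ∈ Set.Icc a b, 0 < t := fun t ht => ha.trans_le ht.1
  have ceC : ContinuousOn (fun t => eC (x * t ^ c - ℓ * t)) (Set.Icc a b) :=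
    continuous_eC.comp_continuousOn Ψ.continuousOn
  have cψ₁ : ContinuousOn (fun t => x * c * t ^ (c - 1) - ℓ) (Set.Icc a b) :=
    fun t ht => (Ψ.d₂ t ht).continuousAt.continuousWithinAt
  have g3 := (norm_integral_mul_phase_le hab.le Ψ.d₁ cψ₁ (fun t _ => hasDerivAt_wt a b t)
    (ampOn_wt₁ a b).continuousOn (by simp [wt]) (by simp [wt])).trans g2
  have hH : AmpOn a b (fun t => wt a b t * rem c s t) (fun t => wt₁ a b t * rem c s t + wt a b t * rem₁ c s t)
      (fun t => wt₂ a b t * rem c s t + 2 * (wt₁ a b t * rem₁ c s t) + wt a b t * rem₂ c s t) := by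
    refine ⟨fun t ht => (hasDerivAt_wt a b t).mul (hasDerivAt_rem hc (hpos t ht)), fun t ht => ?_, ?_⟩
    · refine (((hasDerivAt_wt₁ a b t).mul (hasDerivAt_rem hc (hpos t ht))).add
        ((hasDerivAt_wt a b t).mul (hasDerivAt_rem₁ (hpos t ht)))).congr_deriv ?_
      ring
    · have k0 : ContinuousOn (rem c s) (Set.Icc a b) := fun t ht =>
        (hasDerivAt_rem hc (hpos t ht)).continuousAt.continuousWithinAt
      have k1 : ContinuousOn (rem₁ c s) (Set.Icc a b) := fun t ht =>
        (hasDerivAt_rem₁ (hpos t ht)).continuousAt.continuousWithinAt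
      have k2 : ContinuousOn (rem₂ c s) (Set.Icc a b) := fun t ht =>
        ((continuousAt_const.mul (Real.continuousAt_rpow_const t _ (Or.inl (hpos t ht).ne'))).sub
        (continuousAt_const.mul (Real.continuousAt_rpow_const t _
          (Or.inl (hpos t ht).ne')))).continuousWithinAt
      exact (((continuous_wt₂ a b).continuousOn.mul k0).add
        (continuousOn_const.mul ((ampOn_wt₁ a b).continuousOn.mul k1))).add
        ((ampOn_wt a b).continuousOn.mul k2)
  have huU : ∀ t ∈ Set.Icc a b, |t - s| ≤ U := fun t ht => by
    refine le_trans (abs_le.2 ⟨?_, ?_⟩) (le_max_right _ _) <;>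
      linarith [(hsub ht).1, (hsub ht).2, hsm.1, hsm.2]
  have g4 : ‖∫ t in a..b, ((wt a b t * rem c s t : ℝ) : ℂ) * eC (x * t ^ c - ℓ * t)‖ ≤ C₂ / (Y * √Y) := by
    refine (osc_stationary_two (B := B') (U := U) (t₀ := s) hab.le hl hK1 hδ hlδ hU Ψ hH
      (fun t ht => ?_) (fun t ht => ?_) (fun t ht => ?_) hlow' huU (by simp [wt]) (by simp [wt])).trans
      (le_of_eq ?_)
    · obtain ⟨r0, r1, r2⟩ := hrem s hsm t (hsub ht)
      obtain ⟨w0, w1, w2⟩ := hw t ht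
      rw [abs_mul]
      calc |wt a b t| * |rem c s t| ≤ B * (R * |t - s| ^ 2) := by gcongr
        _ = (B * R) * |t - s| ^ 2 := by ring
        _ ≤ _ := by
          gcongr
          have : 0 ≤ B * R * (U + 1) ^ 2 := by positivity
          simp only [B']; linarith
    · obtain ⟨r0, r1, r2⟩ := hrem s hsm t (hsub ht)
      obtain ⟨w0, w1, w2⟩ := hw t ht
      have hu := huU t ht
      have hu0 := abs_nonneg (t - s)
      refine (abs_add_le _ _).trans ?_
      rw [abs_mul, abs_mul]
      calc |wt₁ a b t| * |rem c s t| + |wt a b t| * |rem₁ c s t| ≤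
          B * (R * |t - s| ^ 2) + B * (R * |t - s|) := by gcongr
        _ = (B * R * (|t - s| + 1)) * |t - s| := by ring
        _ ≤ _ := by
          gcongr
          calc B * R * (|t - s| + 1) ≤ B * R * (U + 1) := by gcongr
            _ ≤ B * R * (U + 1) ^ 2 := by gcongr; nlinarith
            _ ≤ B' := by have : 0 ≤ B * R := by positivity
                         simp only [B']; linarith
    · obtain ⟨r0, r1, r2⟩ := hrem s hsm t (hsub ht)
      obtain ⟨w0, w1, w2⟩ := hw t ht
      have hu := huU t ht
      have hu0 := abs_nonneg (t - s)
      refine (abs_add_three _ _ _).trans ?_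
      rw [abs_mul, abs_mul, abs_mul, abs_mul, abs_two]
      calc |wt₂ a b t| * |rem c s t| + 2 * (|wt₁ a b t| * |rem₁ c s t|) + |wt a b t| * |rem₂ c s t| ≤
          B * (R * |t - s| ^ 2) + 2 * (B * (R * |t - s|)) + B * R := by gcongr
        _ ≤ B * (R * U ^ 2) + 2 * (B * (R * U)) + B * R := by gcongr
        _ = B * R * (U + 1) ^ 2 := by ring
        _ ≤ B' := by
          have : 0 ≤ B * R := by positivity
          simp only [B']; linarith
    · simp only [C₂, δ]
      rw [← hsY2, Real.sqrt_sq hsY.le]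
      field_simp
  have i1 : IntervalIntegrable (fun t => ((wt a b t * rem c s t : ℝ) : ℂ) * eC (x * t ^ c - ℓ * t))
      volume a b :=
    ((Complex.continuous_ofReal.comp_continuousOn hH.continuousOn).mul ceC).intervalIntegrable_of_Icc hab.le
  have i2 : IntervalIntegrable (fun t => ((wt a b t * (x * c * t ^ (c - 1) - ℓ) : ℝ) : ℂ) *
      eC (x * t ^ c - ℓ * t)) volume a b :=
    ((Complex.continuous_ofReal.comp_continuousOn ((ampOn_wt a b).continuousOn.mul cψ₁)).mul
      ceC).intervalIntegrable_of_Icc hab.le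
  have g5 : ∫ t in a..b, ((wt a b t * (t ^ c - s ^ c) : ℝ) : ℂ) * eC (x * t ^ c - ℓ * t) =
      (∫ t in a..b, ((wt a b t * rem c s t : ℝ) : ℂ) * eC (x * t ^ c - ℓ * t)) +
      ((s / ((c - 1) * x) : ℝ) : ℂ) * ∫ t in a..b, ((wt a b t * (x * c * t ^ (c - 1) - ℓ) : ℝ) : ℂ) *
      eC (x * t ^ c - ℓ * t) := by
    rw [← intervalIntegral.integral_const_mul, ← intervalIntegral.integral_add i1 (i2.const_mul _)]
    congr 1; ext t
    have : wt a b t * (t ^ c - s ^ c) = wt a b t * rem c s t +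
        s / ((c - 1) * x) * (wt a b t * (x * c * t ^ (c - 1) - ℓ)) := by
      rw [hψ₁, rem]; field_simp; ring
    rw [this]; push_cast; ring
  refine ⟨g1.trans (by gcongr; linarith), ?_⟩
  rw [g5]
  refine (norm_add_le _ _).trans ?_
  rw [norm_mul, Complex.norm_real, Real.norm_eq_abs, abs_of_pos (by positivity)]
  calc _ ≤ C₂ / (Y * √Y) + β / ((c - 1) * Y) * (C₁ / √Y) := by
        gcongr
        exact hsm.2
    _ = (C₂ + C₃) / (Y * √Y) := by simp only [C₃]; field_simp
    _ ≤ _ := by gcongr; linarith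

lemma hasDerivAt_integral_eC_rpow {a b c : ℝ} (ha : 0 < a) (hab : a ≤ b) (ℓ : ℝ) {h : ℝ → ℝ}
    (hh : ContinuousOn h (Set.Icc a b)) (x : ℝ) :
    HasDerivAt (fun x => ∫ t in a..b, (h t : ℂ) * eC (x * t ^ c - ℓ * t))
      (2 * π * Complex.I * ∫ t in a..b, ((h t * t ^ c : ℝ) : ℂ) * eC (x * t ^ c - ℓ * t)) x := by
  have cp : ContinuousOn (fun t : ℝ => t ^ c) (Set.Icc a b) := fun t ht =>
    (Real.continuousAt_rpow_const t _ (Or.inl (ha.trans_le ht.1).ne')).continuousWithinAt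
  have ce : ∀ x : ℝ, ContinuousOn (fun t => eC (x * t ^ c - ℓ * t)) (Set.Icc a b) := fun x =>
    continuous_eC.comp_continuousOn ((continuousOn_const.mul cp).sub (by fun_prop))
  have ch := Complex.continuous_ofReal.comp_continuousOn hh
  have ch' := Complex.continuous_ofReal.comp_continuousOn (hh.mul cp)
  obtain ⟨D, hD⟩ := isCompact_Icc.exists_bound_of_continuousOn (hh.mul cp)
  have hI : Set.uIoc a b = Set.Ioc a b := Set.uIoc_of_le hab
  rw [← intervalIntegral.integral_const_mul]
  refine (intervalIntegral.hasDerivAt_integral_of_dominated_loc_of_deriv_le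
    (F := fun x t => (h t : ℂ) * eC (x * t ^ c - ℓ * t))
    (F' := fun x t => 2 * π * Complex.I * (((h t * t ^ c : ℝ) : ℂ) * eC (x * t ^ c - ℓ * t)))
    (bound := fun _ => 2 * π * D) (s := Set.univ) Filter.univ_mem ?_ ?_ ?_ ?_ (by simp) ?_).2
  · exact Filter.Eventually.of_forall fun y =>
      ((ch.mul (ce y)).mono (hI ▸ Set.Ioc_subset_Icc_self)).aestronglyMeasurable measurableSet_uIoc
  · exact (ch.mul (ce x)).intervalIntegrable_of_Icc hab
  · exact ((continuousOn_const.mul (ch'.mul (ce x))).mono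
      (hI ▸ Set.Ioc_subset_Icc_self)).aestronglyMeasurable measurableSet_uIoc
  · refine Filter.Eventually.of_forall fun t ht y _ => ?_
    rw [hI] at ht
    rw [norm_mul, norm_mul _ (eC _), norm_eC, mul_one, Complex.norm_real]
    have : ‖(2 * π * Complex.I : ℂ)‖ = 2 * π := by simp [abs_of_pos Real.pi_pos]
    rw [this]
    gcongr
    exact hD t ⟨ht.1.le, ht.2⟩
  · refine Filter.Eventually.of_forall fun t ht y _ => ?_
    have h1 : HasDerivAt (fun y : ℝ => y * t ^ c - ℓ * t) (t ^ c) y := by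
      refine (((hasDerivAt_id y).mul_const (t ^ c)).sub_const _).congr_deriv (by simp)
    refine (h1.eC_comp.const_mul (h t : ℂ)).congr_deriv ?_
    push_cast; ring

/-- The phase produced by stationary phase. -/
noncomputable def dualPhase (c ℓ x : ℝ) : ℝ :=
  -((c - 1) * c ^ (-(c / (c - 1))) * ℓ ^ (c / (c - 1))) * x ^ (1 - c / (c - 1))

lemma hasDerivAt_dualPhase {c ℓ x : ℝ} (hc : 1 < c) (hℓ : 0 < ℓ) (hx : 0 < x) :
    HasDerivAt (dualPhase c ℓ) (statPt c ℓ x ^ c) x := by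
  have hc1 : c - 1 ≠ 0 := by linarith
  refine ((Real.hasDerivAt_rpow_const (p := 1 - c / (c - 1)) (Or.inl hx.ne')).const_mul
    (-((c - 1) * c ^ (-(c / (c - 1))) * ℓ ^ (c / (c - 1))))).congr_deriv ?_
  rw [statPt, ← Real.rpow_mul (by positivity), show 1 / (c - 1) * c = c / (c - 1) by ring,
    Real.div_rpow hℓ.le (by positivity), Real.mul_rpow (by linarith) hx.le,
    show 1 - c / (c - 1) - 1 = -(c / (c - 1)) by ring, Real.rpow_neg (by linarith), Real.rpow_neg hx.le]
  have : 0 < c ^ (c / (c - 1)) := by positivity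
  field_simp
  ring

lemma dual_amplitude {a b c c₁ c₂ : ℝ} (ha : 0 < a) (hab : a < b) (hc : 1 < c) (hc₁ : 0 < c₁) :
    ∃ C : ℝ, 0 < C ∧ ∀ Y ℓ : ℝ, 0 < Y → c₁ * Y ≤ ℓ → ℓ ≤ c₂ * Y → ∃ A A' : ℝ → ℂ,
      ContinuousOn A' (Set.Icc Y (2 * Y)) ∧ ∀ x ∈ Set.Icc Y (2 * Y), HasDerivAt A (A' x) x ∧
        ‖A x‖ ≤ C ∧ ‖A' x‖ ≤ C / Y ∧ √Y * GG a b c ℓ x = A x * eC (dualPhase c ℓ x) := by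
  obtain ⟨C, hC, H⟩ := GG_stationary (c₂ := c₂) ha hab hc hc₁
  have hpi := Real.pi_gt_three
  refine ⟨7 * C, by positivity, fun Y ℓ hY h₁ h₂ => ?_⟩
  have hℓ : 0 < ℓ := lt_of_lt_of_le (by positivity) h₁
  have hsY : 0 < √Y := Real.sqrt_pos.2 hY
  have hw := (ampOn_wt a b).continuousOn
  have cp : ContinuousOn (fun t : ℝ => t ^ c) (Set.Icc a b) := fun t ht =>
    (Real.continuousAt_rpow_const t _ (Or.inl (ha.trans_le ht.1).ne')).continuousWithinAt
  have hx0 : ∀ x ∈ Set.Icc Y (2 * Y), 0 < x := fun x hx => hY.trans_le hx.1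
  have hG := fun x => hasDerivAt_integral_eC_rpow ha hab.le ℓ hw (c := c) x
  have hG1 := fun x => hasDerivAt_integral_eC_rpow ha hab.le ℓ (hw.mul cp) (c := c) x
  have hE : ∀ x ∈ Set.Icc Y (2 * Y), HasDerivAt (fun x => eC (-dualPhase c ℓ x))
      (2 * π * Complex.I * ((-(statPt c ℓ x ^ c) : ℝ) : ℂ) * eC (-dualPhase c ℓ x)) x := fun x hx =>
    (hasDerivAt_dualPhase hc hℓ (hx0 x hx)).neg.eC_comp
  refine ⟨fun x => √Y * (eC (-dualPhase c ℓ x) * GG a b c ℓ x),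
    fun x => √Y * (2 * π * Complex.I * (eC (-dualPhase c ℓ x) *
      ((∫ t in a..b, ((wt a b t * t ^ c : ℝ) : ℂ) * eC (x * t ^ c - ℓ * t)) -
        ((statPt c ℓ x ^ c : ℝ) : ℂ) * GG a b c ℓ x))), ?_, fun x hx => ⟨?_, ?_, ?_, ?_⟩⟩
  · intro x hx
    have hs : ContinuousAt (fun x => ((statPt c ℓ x ^ c : ℝ) : ℂ)) x := by
      have hx := hx0 x hx
      refine Complex.continuous_ofReal.continuousAt.comp ?_
      refine ContinuousAt.rpow_const ?_ (Or.inr (by linarith))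
      unfold statPt
      refine ContinuousAt.rpow_const ?_ (Or.inl (by positivity))
      exact continuousAt_const.div (by fun_prop) (by positivity)
    exact (continuousAt_const.mul (continuousAt_const.mul ((hE x hx).continuousAt.mul
      ((hG1 x).continuousAt.sub (hs.mul (hG x).continuousAt))))).continuousWithinAt
  · refine (((hE x hx).mul (hG x)).const_mul (√Y : ℂ)).congr_deriv ?_
    simp only [GG]
    push_cast
    ring
  · rw [norm_mul, norm_mul, norm_eC, one_mul, Complex.norm_real, Real.norm_eq_abs, abs_of_pos hsY]
    have := (H Y x ℓ hY hx.1 hx.2 h₁ h₂).1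
    calc √Y * ‖GG a b c ℓ x‖ ≤ √Y * (C / √Y) := by gcongr
      _ = C := by field_simp
      _ ≤ _ := by linarith
  · rw [norm_mul, norm_mul, norm_mul (eC _), norm_eC, one_mul, Complex.norm_real, Real.norm_eq_abs,
      abs_of_pos hsY]
    have : ‖(2 * π * Complex.I : ℂ)‖ = 2 * π := by simp [abs_of_pos Real.pi_pos]
    rw [this]
    have e : (∫ t in a..b, ((wt a b t * t ^ c : ℝ) : ℂ) * eC (x * t ^ c - ℓ * t)) -
        ((statPt c ℓ x ^ c : ℝ) : ℂ) * GG a b c ℓ x =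
        ∫ t in a..b, ((wt a b t * (t ^ c - statPt c ℓ x ^ c) : ℝ) : ℂ) * eC (x * t ^ c - ℓ * t) := by
      have ce : ContinuousOn (fun t => eC (x * t ^ c - ℓ * t)) (Set.Icc a b) :=
        continuous_eC.comp_continuousOn ((continuousOn_const.mul cp).sub (by fun_prop))
      have i1 := ((Complex.continuous_ofReal.comp_continuousOn (hw.mul cp)).mul ce
        ).intervalIntegrable_of_Icc (μ := volume) hab.le
      have i2 := ((Complex.continuous_ofReal.comp_continuousOn hw).mul ce
        ).intervalIntegrable_of_Icc (μ := volume) hab.le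
      rw [GG, ← intervalIntegral.integral_const_mul]
      refine (intervalIntegral.integral_sub i1 (i2.const_mul _)).symm.trans ?_
      congr 1; ext t
      simp only [Function.comp_apply, Pi.mul_apply]
      push_cast; ring
    rw [e]
    have h4 := (H Y x ℓ hY hx.1 hx.2 h₁ h₂).2
    calc _ ≤ √Y * (2 * π * (C / (Y * √Y))) := by gcongr
      _ = 2 * π * C / Y := by field_simp
      _ ≤ _ := by
        gcongr
        linarith [Real.pi_lt_d2]
  · have : eC (-dualPhase c ℓ x) * eC (dualPhase c ℓ x) = 1 := by
      rw [← eC_add, neg_add_cancel, eC_zero]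
    linear_combination (-(√Y : ℂ) * GG a b c ℓ x) * this

/-- The weighted exponential sum over `n / P ∈ [a, b]`. -/
noncomputable def TW (a b c P x : ℝ) : ℂ :=
  ∑ n ∈ range (⌊b * P⌋₊ + 1), (bump a b (n / P) : ℂ) * eC (x * ((n : ℝ) / P) ^ c)

open scoped FourierTransform in
lemma fourier_bump_eq {a b c P : ℝ} (hab : a < b) (hP : 0 < P) (x k : ℝ) :
    𝓕 (fun y : ℝ => (bump a b (y / P) : ℂ) * eC (x * (y / P) ^ c)) k = P * GG a b c (k * P) x := by
  rw [Real.fourier_real_eq_integral_exp_smul]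
  set g : ℝ → ℂ := fun v => Complex.exp (↑(-2 * π * v * k) * Complex.I) •
    ((bump a b (v / P) : ℂ) * eC (x * (v / P) ^ c))
  have hsupp : ∀ v, v ∉ Set.Ioc (a * P) (b * P) → g v = 0 := fun v hv => by
    simp only [g]
    rw [bump_eq_zero hab.le, Complex.ofReal_zero, zero_mul, smul_zero]
    rintro ⟨h1, h2⟩
    exact hv ⟨(lt_div_iff₀ hP).1 h1, ((div_lt_iff₀ hP).1 h2).le⟩
  rw [← setIntegral_eq_integral_of_forall_compl_eq_zero hsupp,
    ← intervalIntegral.integral_of_le (by nlinarith)]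
  have h1 : ∫ v in a * P..b * P, g v = ∫ v in a * P..b * P,
      (fun t => (bump a b t : ℂ) * eC (x * t ^ c - k * P * t)) (v / P) := by
    congr 1; ext v
    simp only [g, smul_eq_mul]
    rw [eC_sub, ← eC_neg]
    have : Complex.exp (↑(-2 * π * v * k) * Complex.I) = eC (-(k * P * (v / P))) := by
      rw [eC, show 2 * π * -(k * P * (v / P)) = -2 * π * v * k by field_simp]
    rw [this]; ring
  rw [h1, intervalIntegral.integral_comp_div
    (fun t => (bump a b t : ℂ) * eC (x * t ^ c - k * P * t)) hP.ne', mul_div_cancel_right₀ _ hP.ne',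
    mul_div_cancel_right₀ _ hP.ne', Complex.real_smul, GG]
  congr 1
  refine intervalIntegral.integral_congr fun t ht => ?_
  rw [Set.uIcc_of_le hab.le] at ht
  simp only [bump_eq_wt ht]

lemma poisson_bump {a b c P x : ℝ} (ha : 0 < a) (hab : a < b) (hc : 0 ≤ c) (hP : 0 < P)
    (hs : Summable fun k : ℤ => (P : ℂ) * GG a b c (k * P) x) :
    TW a b c P x = ∑' k : ℤ, (P : ℂ) * GG a b c (k * P) x := by
  set f : ℝ → ℂ := fun y => (bump a b (y / P) : ℂ) * eC (x * (y / P) ^ c) with hf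
  have hcont : Continuous f := by
    refine (Complex.continuous_ofReal.comp ((continuous_bump a b).comp (by fun_prop))).mul
      (continuous_eC.comp (continuous_const.mul ?_))
    exact (Real.continuous_rpow_const hc).comp (by fun_prop)
  have hzero : ∀ y, y ∉ Set.Ioo (a * P) (b * P) → f y = 0 := fun y hy => by
    simp only [f]
    rw [bump_eq_zero hab.le, Complex.ofReal_zero, zero_mul]
    rintro ⟨h1, h2⟩
    exact hy ⟨(lt_div_iff₀ hP).1 h1, (div_lt_iff₀ hP).1 h2⟩
  have hO : f =O[Filter.cocompact ℝ] fun x : ℝ => |x| ^ (-(2 : ℝ)) := by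
    refine Filter.EventuallyEq.trans_isBigO (f₂ := fun _ => (0 : ℂ)) ?_ (Asymptotics.isBigO_zero _ _)
    filter_upwards [(isCompact_Icc (a := a * P) (b := b * P)).compl_mem_cocompact] with y hy
    exact hzero y fun h => hy (Set.Ioo_subset_Icc_self h)
  have hF : ∀ k : ℤ, FourierTransform.fourier f k = P * GG a b c (k * P) x := fun k =>
    fourier_bump_eq hab hP x k
  have hsum : Summable fun n : ℤ => FourierTransform.fourier f n := by simpa only [hF] using hs
  have := Real.tsum_eq_tsum_fourier_of_rpow_decay_of_summable hcont one_lt_two hO hsum 0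
  simp only [zero_add, hF, QuotientAddGroup.mk_zero, fourier_eval_zero, mul_one] at this
  rw [← this, tsum_eq_sum (s := (range (⌊b * P⌋₊ + 1)).map Nat.castEmbedding)]
  · rw [sum_map, TW]
    refine sum_congr rfl fun n _ => ?_
    simp [f]
  · intro k hk
    refine hzero k fun h => hk ?_
    have hk0 : 0 ≤ k := by
      have : (0:ℝ) < k := lt_trans (by positivity) h.1
      exact_mod_cast this.le
    lift k to ℕ using hk0
    simp only [mem_map, mem_range, Nat.castEmbedding_apply, Nat.cast_inj, exists_eq_right]
    refine Nat.lt_succ_of_le (Nat.le_floor ?_)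
    exact_mod_cast h.2.le

lemma summable_inv_one_add_abs_sq : Summable fun k : ℤ => 1 / (1 + |(k : ℝ)|) ^ 2 := by
  have h : Summable fun n : ℕ => 1 / (1 + |(n : ℝ)|) ^ 2 := by
    have := (summable_nat_add_iff 1).2 (Real.summable_one_div_nat_pow.2 one_lt_two)
    refine this.congr fun n => ?_
    push_cast
    rw [abs_of_nonneg (by positivity), add_comm]
  exact Summable.of_nat_of_neg (by simpa using h) (by simpa using h)

/-- The dual range of summation. -/
noncomputable def dualRange (a b c P Y : ℝ) : Finset ℕ :=
  Finset.Icc ⌈c * a ^ (c - 1) / 2 * Y / P⌉₊ ⌊4 * c * b ^ (c - 1) * Y / P⌋₊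

/-- Van der Corput's B-process for the weighted monomial sums. -/
lemma b_process {a b c : ℝ} (ha : 0 < a) (hab : a < b) (hc : 1 < c) : ∃ C : ℝ, 0 < C ∧
    ∀ P Y : ℝ, 1 ≤ P → 1 ≤ Y → Y ≤ P ^ 2 → ∃ A A' : ℕ → ℝ → ℂ,
      (∀ k ∈ dualRange a b c P Y, ContinuousOn (A' k) (Set.Icc Y (2 * Y)) ∧
        ∀ x ∈ Set.Icc Y (2 * Y), HasDerivAt (A k) (A' k x) x ∧ ‖A k x‖ ≤ C ∧ ‖A' k x‖ ≤ C / Y) ∧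
      ∀ x ∈ Set.Icc Y (2 * Y), ‖TW a b c P x‖ ≤ P / √Y *
        (‖∑ k ∈ dualRange a b c P Y, A k x * eC (dualPhase c (k * P) x)‖ + C) := by
  set c₁ := c * a ^ (c - 1) / 2 with hc₁
  set c₂ := 4 * c * b ^ (c - 1) with hc₂
  have hb : 0 < b := ha.trans hab
  have h1 : 0 < c₁ := by positivity
  have h2 : 0 < c₂ := by positivity
  obtain ⟨C₁, hC₁, H₁⟩ := GG_nonstationary ha hab hc
  obtain ⟨C₂, hC₂, H₂⟩ := dual_amplitude (c₂ := c₂) ha hab hc h1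
  set S := ∑' k : ℤ, 1 / (1 + |(k : ℝ)|) ^ 2
  have hS : 0 ≤ S := tsum_nonneg fun k => by positivity
  refine ⟨C₁ * S + C₂, by positivity, fun P Y hP hY hYP => ?_⟩
  have hP0 : 0 < P := by linarith
  have hY0 : 0 < Y := by linarith
  have hsY : 0 < √Y := Real.sqrt_pos.2 hY0
  have hsP : √Y ≤ P := (Real.sqrt_le_left hP0.le).2 hYP
  have hmem : ∀ k : ℕ, k ∈ dualRange a b c P Y ↔ c₁ * Y ≤ k * P ∧ k * P ≤ c₂ * Y := fun k => by
    rw [dualRange, Finset.mem_Icc, Nat.ceil_le, Nat.le_floor_iff (by positivity), div_le_iff₀ hP0,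
      le_div_iff₀ hP0]
  choose! A A' hA using fun (k : ℕ) (hk : k ∈ dualRange a b c P Y) =>
    H₂ Y (k * P) hY0 ((hmem k).1 hk).1 ((hmem k).1 hk).2
  refine ⟨A, A', fun k hk => ⟨(hA k hk).1, fun x hx => ⟨((hA k hk).2 x hx).1,
    ((hA k hk).2 x hx).2.1.trans (by linarith [mul_nonneg hC₁.le hS]),
    ((hA k hk).2 x hx).2.2.1.trans (by gcongr; linarith [mul_nonneg hC₁.le hS])⟩⟩, fun x hx => ?_⟩
  set I : ℤ → ℂ := fun k => (P : ℂ) * GG a b c (k * P) x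
  set s : Finset ℤ := (dualRange a b c P Y).map Nat.castEmbedding
  set J : ℤ → ℂ := fun k => if k ∈ s then 0 else I k
  have hJ : ∀ k, ‖J k‖ ≤ C₁ * (P / √Y) * (1 / (1 + |(k : ℝ)|) ^ 2) := by
    intro k
    by_cases hk : k ∈ s
    · simp only [J, if_pos hk, norm_zero]; positivity
    · simp only [J, if_neg hk, I]
      have hout : (k : ℝ) * P < c₁ * Y ∨ c₂ * Y < k * P := by
        by_contra! hcon
        apply hk
        have hk0 : 0 ≤ k := by
          have : (0:ℝ) < k * P := lt_of_lt_of_le (by positivity) hcon.1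
          exact_mod_cast (pos_of_mul_pos_left this hP0.le).le
        lift k to ℕ using hk0
        simp only [s, mem_map, Nat.castEmbedding_apply, Nat.cast_inj, exists_eq_right]
        exact (hmem k).2 (by exact_mod_cast hcon)
      have h3 := H₁ Y x (k * P) hY0 hx.1 hx.2 hout
      rw [norm_mul, Complex.norm_real, Real.norm_eq_abs, abs_of_pos hP0]
      have h4 : √Y * (1 + |(k : ℝ)|) ^ 2 ≤ (Y + |(k : ℝ) * P|) ^ 2 := by
        have hY1 : 1 ≤ √Y := Real.one_le_sqrt.2 hY
        have hYY : √Y ^ 2 = Y := Real.sq_sqrt hY0.le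
        have hk0 := abs_nonneg (k : ℝ)
        have e1 : √Y * (1 + |(k : ℝ)|) ≤ Y + |(k : ℝ) * P| := by
          rw [abs_mul, abs_of_pos hP0]
          nlinarith [mul_le_mul_of_nonneg_left hsP hk0]
        calc √Y * (1 + |(k : ℝ)|) ^ 2 ≤ √Y ^ 2 * (1 + |(k : ℝ)|) ^ 2 := by
              gcongr; nlinarith
          _ = (√Y * (1 + |(k : ℝ)|)) ^ 2 := by ring
          _ ≤ _ := by gcongr
      calc P * ‖GG a b c (k * P) x‖ ≤ P * (C₁ / (Y + |(k : ℝ) * P|) ^ 2) := by gcongr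
        _ ≤ P * (C₁ / (√Y * (1 + |(k : ℝ)|) ^ 2)) := by gcongr
        _ = _ := by field_simp
  have hJs : Summable J := Summable.of_norm_bounded (summable_inv_one_add_abs_sq.mul_left _) hJ
  have hfin : Summable fun k => if k ∈ s then I k else 0 :=
    summable_of_ne_finset_zero (s := s) fun k hk => if_neg hk
  have hIJ : I = fun k => J k + if k ∈ s then I k else 0 := by
    ext k; by_cases hk : k ∈ s <;> simp [J, hk]
  have hIs : Summable I := by rw [hIJ]; exact hJs.add hfin
  have hT : TW a b c P x = (∑' k, J k) + ∑ k ∈ s, I k := by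
    rw [poisson_bump ha hab (by linarith) hP0 hIs]
    change ∑' k, I k = _
    conv_lhs => rw [hIJ]
    rw [hJs.tsum_add hfin, tsum_eq_sum (s := s) fun k hk => if_neg hk]
    congr 1
    exact sum_congr rfl fun k hk => if_pos hk
  have hJb : ‖∑' k, J k‖ ≤ C₁ * (P / √Y) * S := by
    refine (tsum_of_norm_bounded (summable_inv_one_add_abs_sq.mul_left _).hasSum hJ).trans ?_
    rw [tsum_mul_left]
  have hIsum : ∑ k ∈ s, I k = ((P / √Y : ℝ) : ℂ) * ∑ k ∈ dualRange a b c P Y, A k x *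
      eC (dualPhase c (k * P) x) := by
    simp only [s]
    rw [sum_map, mul_sum]
    refine sum_congr rfl fun k hk => ?_
    rw [← ((hA k hk).2 x hx).2.2.2]
    simp only [I, Nat.castEmbedding_apply, Int.cast_natCast]
    have : (√Y : ℂ) ≠ 0 := by exact_mod_cast hsY.ne'
    push_cast
    field_simp
  rw [hT, hIsum]
  refine (norm_add_le _ _).trans ?_
  rw [norm_mul, Complex.norm_real, Real.norm_eq_abs, abs_of_pos (by positivity)]
  have : 0 ≤ P / √Y * C₂ := by positivity
  nlinarith

open scoped ComplexConjugate in
lemma norm_pow_four_sum {ι : Type*} (s : Finset ι) (f : ι → ℂ) :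
    ((‖∑ k ∈ s, f k‖ ^ 4 : ℝ) : ℂ) = ∑ q ∈ s ×ˢ s ×ˢ s ×ˢ s,
      f q.1 * f q.2.1 * conj (f q.2.2.1) * conj (f q.2.2.2) := by
  have h : ((‖∑ k ∈ s, f k‖ ^ 4 : ℝ) : ℂ) =
      (∑ k ∈ s, f k) * (∑ k ∈ s, f k) * conj (∑ k ∈ s, f k) * conj (∑ k ∈ s, f k) := by
    have := Complex.mul_conj' (∑ k ∈ s, f k)
    push_cast
    linear_combination (-(‖∑ k ∈ s, f k‖ : ℂ) ^ 2 - (∑ k ∈ s, f k) * conj (∑ k ∈ s, f k)) * this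
  rw [h, map_sum, sum_product]
  simp only [sum_product]
  simp only [mul_assoc, ← mul_sum, ← sum_mul]

/-- Number of quadruples with small alternating sum. -/
noncomputable def quadCount (s : Finset ℕ) (u : ℕ → ℝ) (δ : ℝ) : ℕ :=
  #{q ∈ s ×ˢ s ×ˢ s ×ˢ s | |u q.1 + u q.2.1 - u q.2.2.1 - u q.2.2.2| ≤ δ}

lemma quadCount_mono {s t : Finset ℕ} (hst : s ⊆ t) (u : ℕ → ℝ) {δ δ' : ℝ} (h : δ ≤ δ') :
    quadCount s u δ ≤ quadCount t u δ' := by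
  refine card_le_card fun q hq => ?_
  simp only [mem_filter, mem_product] at hq ⊢
  exact ⟨⟨hst hq.1.1, hst hq.1.2.1, hst hq.1.2.2.1, hst hq.1.2.2.2⟩, hq.2.trans h⟩

lemma quadCount_le (s : Finset ℕ) (u : ℕ → ℝ) (δ : ℝ) : quadCount s u δ ≤ #s ^ 4 := by
  refine (card_filter_le _ _).trans (le_of_eq ?_)
  simp only [card_product]
  ring

lemma continuous_expSum (s : Finset ℕ) (w u : ℕ → ℝ) :
    Continuous fun x : ℝ => ∑ n ∈ s, (w n : ℂ) * eC (x * u n) :=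
  continuous_finsetSum _ fun _ _ =>
    continuous_const.mul (continuous_eC.comp (continuous_id.mul continuous_const))

lemma cos_ge_of_abs_le {t : ℝ} (ht : |t| ≤ π / 4) : 7 / 10 ≤ Real.cos t := by
  have h1 : Real.cos (π / 4) ≤ Real.cos t := by
    rw [← Real.cos_abs t]
    exact Real.cos_le_cos_of_nonneg_of_le_pi (abs_nonneg t) (by linarith [Real.pi_pos]) ht
  rw [Real.cos_pi_div_four] at h1
  have : (7 / 5 : ℝ) ≤ √2 := Real.le_sqrt_of_sq_le (by norm_num)
  linarith

lemma norm_integral_eC_ge {X u : ℝ} (hX : 0 < X) (hu : |u| ≤ 1 / (8 * X)) :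
    7 / 10 * X ≤ ‖∫ x in (0:ℝ)..X, eC (x * u)‖ := by
  have hc : Continuous fun x : ℝ => eC (x * u) := continuous_eC.comp (by fun_prop)
  have h1 : (∫ x in (0:ℝ)..X, eC (x * u)).re = ∫ x in (0:ℝ)..X, (eC (x * u)).re := by
    exact (Complex.reCLM.intervalIntegral_comp_comm (hc.intervalIntegrable 0 X)).symm
  refine le_trans ?_ ((le_abs_self _).trans (Complex.abs_re_le_norm _))
  rw [h1]
  have h2 : ∫ x in (0:ℝ)..X, (7 / 10 : ℝ) = 7 / 10 * X := by simp; ring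
  rw [← h2]
  refine intervalIntegral.integral_mono_on hX.le (by simp)
    ((Complex.continuous_re.comp hc).intervalIntegrable 0 X) fun x hx => ?_
  rw [eC, Complex.exp_ofReal_mul_I_re]
  apply cos_ge_of_abs_le
  rw [abs_mul, abs_of_pos Real.two_pi_pos, abs_mul, abs_of_nonneg hx.1]
  have : x * |u| ≤ 1 / 8 := by
    calc x * |u| ≤ X * (1 / (8 * X)) := by gcongr; exact hx.2
      _ = 1 / 8 := by field_simp
  nlinarith [Real.pi_pos]

open scoped ComplexConjugate in
lemma eC_quad (x a b c d : ℝ) : eC (x * a) * eC (x * b) * conj (eC (x * c)) * conj (eC (x * d)) =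
    eC (x * (a + b - c - d)) := by
  rw [← eC_neg, ← eC_neg, ← eC_add, ← eC_add, ← eC_add]; congr 1; ring

open scoped ComplexConjugate in
/-- Counting quadruples by a fourth moment. -/
lemma quadCount_le_fourth_moment {s t : Finset ℕ} (hst : s ⊆ t) {u w : ℕ → ℝ} (hw : ∀ n, 0 ≤ w n)
    {w₀ : ℝ} (hw₀ : 0 < w₀) (hws : ∀ n ∈ s, w₀ ≤ w n) {X : ℝ} (hX : 0 < X) :
    w₀ ^ 4 * X * quadCount s u (1 / (8 * X)) ≤
      5 * ∫ x in (0:ℝ)..X, ‖∑ n ∈ t, (w n : ℂ) * eC (x * u n)‖ ^ 4 := by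
  set T : ℝ → ℂ := fun x => ∑ n ∈ t, (w n : ℂ) * eC (x * u n) with hT
  have hTc : Continuous T := continuous_expSum t w u
  set W : ℕ × ℕ × ℕ × ℕ → ℝ := fun q => w q.1 * w q.2.1 * w q.2.2.1 * w q.2.2.2
  set V : ℕ × ℕ × ℕ × ℕ → ℝ := fun q => u q.1 + u q.2.1 - u q.2.2.1 - u q.2.2.2
  have hW : ∀ q, 0 ≤ W q := fun q =>
    mul_nonneg (mul_nonneg (mul_nonneg (hw _) (hw _)) (hw _)) (hw _)
  have hexp : ∀ x, ((‖T x‖ ^ 4 : ℝ) : ℂ) = ∑ q ∈ t ×ˢ t ×ˢ t ×ˢ t, (W q : ℂ) * eC (x * V q) := by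
    intro x
    rw [hT, norm_pow_four_sum]
    refine sum_congr rfl fun q _ => ?_
    rw [← eC_quad]
    simp only [map_mul, Complex.conj_ofReal, W]
    push_cast; ring
  -- the double integral
  set I : ℕ × ℕ × ℕ × ℕ → ℂ := fun q => ∫ x in (0:ℝ)..X, eC (x * V q)
  have hI : ∀ q, ∫ y in (0:ℝ)..X, eC (-(y * V q)) = conj (I q) := by
    intro q
    simp only [I, eC_neg]
    rw [intervalIntegral.integral_of_le hX.le, intervalIntegral.integral_of_le hX.le]
    exact integral_conj
  have hcy : ∀ q, Continuous fun y : ℝ => eC (-(y * V q)) := fun q => continuous_eC.comp (by fun_prop)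
  have hcx : ∀ q, Continuous fun y : ℝ => eC (y * V q) := fun q => continuous_eC.comp (by fun_prop)
  have hinner : ∀ x, ((∫ y in (0:ℝ)..X, ‖T (x - y)‖ ^ 4 : ℝ) : ℂ) =
      ∑ q ∈ t ×ˢ t ×ˢ t ×ˢ t, (W q : ℂ) * conj (I q) * eC (x * V q) := by
    intro x
    rw [← intervalIntegral.integral_ofReal]
    simp only [hexp]
    have e : ∀ y q, (W q : ℂ) * eC ((x - y) * V q) = (W q * eC (x * V q)) * eC (-(y * V q)) := by
      intro y q
      rw [mul_assoc, ← eC_add]; congr 2; ring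
    simp only [e]
    rw [intervalIntegral.integral_finsetSum]
    swap
    · exact fun q _ => (continuous_const.mul (hcy q)).intervalIntegrable 0 X
    refine sum_congr rfl fun q _ => ?_
    rw [intervalIntegral.integral_const_mul, hI]; ring
  have houter : ((∫ x in (0:ℝ)..X, ∫ y in (0:ℝ)..X, ‖T (x - y)‖ ^ 4 : ℝ) : ℂ) =
      ((∑ q ∈ t ×ˢ t ×ˢ t ×ˢ t, W q * ‖I q‖ ^ 2 : ℝ) : ℂ) := by
    rw [← intervalIntegral.integral_ofReal]
    simp only [hinner]
    rw [intervalIntegral.integral_finsetSum]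
    swap
    · exact fun q _ => (continuous_const.mul (hcx q)).intervalIntegrable 0 X
    push_cast
    refine sum_congr rfl fun q _ => ?_
    rw [intervalIntegral.integral_const_mul, mul_assoc]
    congr 1
    rw [mul_comm, Complex.mul_conj']
  have houter' := Complex.ofReal_injective houter
  -- lower bound
  have hlow : w₀ ^ 4 * (7 / 10 * X) ^ 2 * quadCount s u (1 / (8 * X)) ≤
      ∑ q ∈ t ×ˢ t ×ˢ t ×ˢ t, W q * ‖I q‖ ^ 2 := by
    calc _ = ∑ q ∈ s ×ˢ s ×ˢ s ×ˢ s with |V q| ≤ 1 / (8 * X), w₀ ^ 4 * (7 / 10 * X) ^ 2 := by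
          rw [sum_const, nsmul_eq_mul, mul_comm]; rfl
      _ ≤ ∑ q ∈ s ×ˢ s ×ˢ s ×ˢ s with |V q| ≤ 1 / (8 * X), W q * ‖I q‖ ^ 2 := by
          refine sum_le_sum fun q hq => ?_
          simp only [mem_filter, mem_product] at hq
          have h1 := hws _ hq.1.1
          have h2 := hws _ hq.1.2.1
          have h3 := hws _ hq.1.2.2.1
          have h4 := hws _ hq.1.2.2.2
          have h5 := norm_integral_eC_ge hX hq.2
          have : w₀ ^ 4 ≤ W q := by
            calc w₀ ^ 4 = w₀ * w₀ * w₀ * w₀ := by ring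
              _ ≤ _ := by simp only [W]; have := hw q.1; have := hw q.2.1; have := hw q.2.2.1; gcongr
          have := hW q
          gcongr
      _ ≤ _ := by
          refine sum_le_sum_of_subset_of_nonneg (fun q hq => ?_) fun q _ _ =>
            mul_nonneg (hW q) (by positivity)
          simp only [mem_filter, mem_product] at hq ⊢
          exact ⟨hst hq.1.1, hst hq.1.2.1, hst hq.1.2.2.1, hst hq.1.2.2.2⟩
  -- upper bound
  have hTneg : ∀ x, ‖T (-x)‖ = ‖T x‖ := by
    intro x
    have : T (-x) = conj (T x) := by
      simp only [hT, map_sum, map_mul, Complex.conj_ofReal]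
      refine sum_congr rfl fun n _ => ?_
      rw [neg_mul, eC_neg]
    rw [this, Complex.norm_conj]
  have hF : Continuous fun x => ‖T x‖ ^ 4 := (hTc.norm).pow 4
  set M := ∫ x in (0:ℝ)..X, ‖T x‖ ^ 4
  have hup : ∀ x ∈ Set.Icc 0 X, ∫ y in (0:ℝ)..X, ‖T (x - y)‖ ^ 4 ≤ 2 * M := by
    intro x hx
    rw [intervalIntegral.integral_comp_sub_left (fun y => ‖T y‖ ^ 4) x, sub_zero]
    have hM2 : ∫ y in (-X)..0, ‖T y‖ ^ 4 = M := by
      have := intervalIntegral.integral_comp_neg (fun y => ‖T y‖ ^ 4) (a := 0) (b := X)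
      simp only [neg_zero, hTneg] at this
      exact this.symm
    have h2 : ∫ y in (-X)..X, ‖T y‖ ^ 4 = 2 * M := by
      rw [← intervalIntegral.integral_add_adjacent_intervals (hF.intervalIntegrable (-X) 0)
        (hF.intervalIntegrable 0 X), hM2]; ring
    rw [← h2]
    refine intervalIntegral.integral_mono_interval (by linarith [hx.1]) (by linarith [hX]) hx.2
      (Filter.Eventually.of_forall fun y => by positivity) (hF.intervalIntegrable _ _)
  have hup2 : ∫ x in (0:ℝ)..X, ∫ y in (0:ℝ)..X, ‖T (x - y)‖ ^ 4 ≤ X * (2 * M) := by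
    have : ∫ x in (0:ℝ)..X, (2 * M) = X * (2 * M) := by simp; ring
    rw [← this]
    refine intervalIntegral.integral_mono_on hX.le ?_ (by simp) hup
    refine Continuous.intervalIntegrable ?_ 0 X
    refine intervalIntegral.continuous_parametric_intervalIntegral_of_continuous' ?_ 0 X
    exact hF.comp (by fun_prop)
  rw [houter'] at hup2
  have h6 := hlow.trans hup2
  have hM0 : 0 ≤ M := intervalIntegral.integral_nonneg hX.le fun x _ => by positivity
  have h7 : X * (w₀ ^ 4 * X * quadCount s u (1 / (8 * X))) ≤ X * (5 * M) := by nlinarith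
  exact le_of_mul_le_mul_left h7 hX

lemma osc_dual_real {g Y D η : ℝ} (hg : 0 < g) (hY : 0 < Y) (hη : η ≠ 0) {h h₁ : ℝ → ℝ}
    (hc : ContinuousOn h₁ (Set.Icc Y (2 * Y)))
    (hd : ∀ x ∈ Set.Icc Y (2 * Y), HasDerivAt h (h₁ x) x ∧ |h x| ≤ D ∧ |h₁ x| ≤ D / Y) :
    ‖∫ x in Y..(2 * Y), (h x : ℂ) * eC (η * x ^ (-g))‖ ≤
      (g + 4) * 2 ^ (g + 1) / g * D * Y / (|η| * Y ^ (-g)) := by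
  have hx0 : ∀ x ∈ Set.Icc Y (2 * Y), 0 < x := fun x hx => hY.trans_le hx.1
  have hYY : Y ≤ 2 * Y := by linarith
  have hD : 0 ≤ D := (abs_nonneg _).trans (hd Y ⟨le_rfl, hYY⟩).2.1
  set m : ℝ := |η| * g * (2 * Y) ^ (-g - 1) with hm
  have hη' : 0 < |η| := abs_pos.2 hη
  have hm0 : 0 < m := by positivity
  have hψ₁ : ∀ x ∈ Set.Icc Y (2 * Y), m ≤ |η * (-g * x ^ (-g - 1))| := by
    intro x hx
    have := hx0 x hx
    rw [abs_mul, abs_mul, abs_neg, abs_of_pos hg, abs_of_pos (Real.rpow_pos_of_pos this _), hm, mul_assoc]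
    gcongr ?_ * (?_ * ?_)
    exact Real.rpow_le_rpow_of_nonpos this hx.2 (by linarith)
  have hne : ∀ x ∈ Set.Icc Y (2 * Y), η * (-g * x ^ (-g - 1)) ≠ 0 := fun x hx =>
    abs_pos.1 (hm0.trans_le (hψ₁ x hx))
  have key := osc_ibp hYY (ψ := fun x => η * x ^ (-g)) (ψ₁ := fun x => η * (-g * x ^ (-g - 1)))
    (ψ₂ := fun x => η * (-g * ((-g - 1) * x ^ (-g - 1 - 1)))) (h := h) (h₁ := h₁)
    (fun x hx => (Real.hasDerivAt_rpow_const (Or.inl (hx0 x hx).ne')).const_mul η)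
    (fun x hx => ((Real.hasDerivAt_rpow_const (Or.inl (hx0 x hx).ne')).const_mul (-g)).const_mul η)
    (fun x hx => (hd x hx).1)
    (continuousOn_const.mul (continuousOn_const.mul (continuousOn_const.mul
      (continuousOn_id.rpow_const fun x hx => Or.inl (hx0 x hx).ne')))) hc hne
  have hbd : ∀ x ∈ Set.Icc Y (2 * Y), |h x / (η * (-g * x ^ (-g - 1)))| ≤ D / m := fun x hx => by
    rw [abs_div]
    exact div_le_div₀ hD (hd x hx).2.1 hm0 (hψ₁ x hx)
  have hint : ‖∫ x in Y..(2 * Y), ((h₁ x / (η * (-g * x ^ (-g - 1))) -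
      h x * (η * (-g * ((-g - 1) * x ^ (-g - 1 - 1)))) / (η * (-g * x ^ (-g - 1))) ^ 2 : ℝ) : ℂ) *
        eC (η * x ^ (-g))‖ ≤ (D * (g + 2) / Y / m) * |2 * Y - Y| := by
    refine intervalIntegral.norm_integral_le_of_norm_le_const fun x hx => ?_
    rw [Set.uIoc_of_le hYY] at hx
    have hx : x ∈ Set.Icc Y (2 * Y) := ⟨hx.1.le, hx.2⟩
    have hx1 := hx0 x hx
    rw [norm_mul, norm_eC, mul_one, Complex.norm_real, Real.norm_eq_abs]
    have e : h₁ x / (η * (-g * x ^ (-g - 1))) -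
      h x * (η * (-g * ((-g - 1) * x ^ (-g - 1 - 1)))) / (η * (-g * x ^ (-g - 1))) ^ 2 =
        (h₁ x + h x * (g + 1) / x) / (η * (-g * x ^ (-g - 1))) := by
      rw [Real.rpow_sub_one hx1.ne' (-g - 1)]
      have : x ^ (-g - 1) ≠ 0 := by positivity
      field_simp
      ring
    rw [e, abs_div]
    refine div_le_div₀ (by positivity) ?_ hm0 (hψ₁ x hx)
    calc |h₁ x + h x * (g + 1) / x| ≤ |h₁ x| + |h x * (g + 1) / x| := abs_add_le _ _
      _ ≤ D / Y + D * (g + 1) / Y := by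
          refine add_le_add (hd x hx).2.2 ?_
          rw [abs_div, abs_mul, abs_of_pos (by linarith : 0 < g + 1), abs_of_pos hx1]
          refine div_le_div₀ (by positivity) ?_ hY hx.1
          have := (hd x hx).2.1
          gcongr
      _ = _ := by ring
  have e2 : (g + 4) * 2 ^ (g + 1) / g * D * Y / (|η| * Y ^ (-g)) = D * (g + 4) / m := by
    rw [hm, Real.mul_rpow (by norm_num) hY.le, Real.rpow_sub_one hY.ne',
      show -g - 1 = -(g + 1) by ring, Real.rpow_neg (by norm_num : (0:ℝ) ≤ 2)]
    have : (2:ℝ) ^ (g + 1) ≠ 0 := by positivity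
    have : Y ^ (-g) ≠ 0 := by positivity
    field_simp
  rw [e2]
  refine key.trans ((add_le_add (add_le_add (hbd _ ⟨le_rfl, hYY⟩) (hbd _ ⟨hYY, le_rfl⟩)) hint).trans
    (le_of_eq ?_))
  rw [show 2 * Y - Y = Y by ring, abs_of_pos hY]
  field_simp
  ring

lemma osc_dual {g : ℝ} (hg : 0 < g) : ∃ C : ℝ, 0 < C ∧ ∀ Y D : ℝ, 0 < Y → ∀ B B' : ℝ → ℂ,
    ContinuousOn B' (Set.Icc Y (2 * Y)) →
    (∀ x ∈ Set.Icc Y (2 * Y), HasDerivAt B (B' x) x ∧ ‖B x‖ ≤ D ∧ ‖B' x‖ ≤ D / Y) → ∀ η : ℝ,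
    ‖∫ x in Y..(2 * Y), B x * eC (η * x ^ (-g))‖ ≤ C * (D * Y) / (1 + |η| * Y ^ (-g)) := by
  set K := (g + 4) * 2 ^ (g + 1) / g with hK
  have hK0 : 0 < K := by positivity
  refine ⟨2 * K + 1, by positivity, fun Y D hY B B' hc hd η => ?_⟩
  have hYY : Y ≤ 2 * Y := by linarith
  have hD : 0 ≤ D := (norm_nonneg _).trans (hd Y ⟨le_rfl, hYY⟩).2.1
  have h1 : ‖∫ x in Y..(2 * Y), B x * eC (η * x ^ (-g))‖ ≤ D * Y := by
    have := intervalIntegral.norm_integral_le_of_norm_le_const (a := Y) (b := 2 * Y) (C := D)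
      (f := fun x => B x * eC (η * x ^ (-g))) fun x hx => by
        rw [Set.uIoc_of_le hYY] at hx
        rw [norm_mul, norm_eC, mul_one]
        exact (hd x ⟨hx.1.le, hx.2⟩).2.1
    rwa [show 2 * Y - Y = Y by ring, abs_of_pos hY] at this
  rw [le_div_iff₀ (by positivity)]
  rcases eq_or_ne η 0 with rfl | hη
  · rw [abs_zero, zero_mul, add_zero, mul_one]
    nlinarith [mul_nonneg hD hY.le]
  have hv : 0 < |η| * Y ^ (-g) := by have := abs_pos.2 hη; positivity
  have hre := osc_dual_real (h := fun x => (B x).re) (h₁ := fun x => (B' x).re) (D := D) hg hY hη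
    (Complex.continuous_re.comp_continuousOn hc) fun x hx =>
      ⟨Complex.reCLM.hasFDerivAt.comp_hasDerivAt x (hd x hx).1,
        (Complex.abs_re_le_norm _).trans (hd x hx).2.1, (Complex.abs_re_le_norm _).trans (hd x hx).2.2⟩
  have him := osc_dual_real (h := fun x => (B x).im) (h₁ := fun x => (B' x).im) (D := D) hg hY hη
    (Complex.continuous_im.comp_continuousOn hc) fun x hx =>
      ⟨Complex.imCLM.hasFDerivAt.comp_hasDerivAt x (hd x hx).1,
        (Complex.abs_im_le_norm _).trans (hd x hx).2.1, (Complex.abs_im_le_norm _).trans (hd x hx).2.2⟩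
  have hBc : ContinuousOn B (Set.Icc Y (2 * Y)) := fun x hx =>
    (hd x hx).1.continuousAt.continuousWithinAt
  have hec : ContinuousOn (fun x : ℝ => eC (η * x ^ (-g))) (Set.Icc Y (2 * Y)) :=
    continuous_eC.comp_continuousOn (continuousOn_const.mul
      (continuousOn_id.rpow_const fun x hx => Or.inl (hY.trans_le hx.1).ne'))
  have hsplit : ∫ x in Y..(2 * Y), B x * eC (η * x ^ (-g)) =
      (∫ x in Y..(2 * Y), ((B x).re : ℂ) * eC (η * x ^ (-g))) +
        Complex.I * ∫ x in Y..(2 * Y), ((B x).im : ℂ) * eC (η * x ^ (-g)) := by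
    rw [← intervalIntegral.integral_const_mul, ← intervalIntegral.integral_add]
    · refine intervalIntegral.integral_congr fun x _ => ?_
      conv_lhs => rw [← Complex.re_add_im (B x)]
      ring
    · refine ContinuousOn.intervalIntegrable_of_Icc hYY (ContinuousOn.mul ?_ hec)
      exact Complex.continuous_ofReal.comp_continuousOn (Complex.continuous_re.comp_continuousOn hBc)
    · refine ContinuousOn.intervalIntegrable_of_Icc hYY (continuousOn_const.mul (ContinuousOn.mul ?_ hec))
      exact Complex.continuous_ofReal.comp_continuousOn (Complex.continuous_im.comp_continuousOn hBc)
  have h2 : ‖∫ x in Y..(2 * Y), B x * eC (η * x ^ (-g))‖ ≤ 2 * (K * D * Y / (|η| * Y ^ (-g))) := by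
    rw [hsplit]
    refine (norm_add_le _ _).trans ?_
    rw [norm_mul, Complex.norm_I, one_mul]
    linarith
  have h3 : ‖∫ x in Y..(2 * Y), B x * eC (η * x ^ (-g))‖ * (|η| * Y ^ (-g)) ≤ 2 * (K * D * Y) := by
    rw [← mul_div_assoc, le_div_iff₀ hv] at h2
    exact h2
  linarith

lemma inv_one_add_le_dyadic {t : ℝ} (ht : 0 ≤ t) (J : ℕ) : 1 / (1 + t) ≤
    (∑ j ∈ range J, if t ≤ 2 ^ j then 2 * (1 / 2 : ℝ) ^ j else 0) + 2 * (1 / 2) ^ J := by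
  induction J with
  | zero => simp; rw [inv_le_comm₀ (by positivity) (by norm_num)]; linarith
  | succ J ih =>
    rw [sum_range_succ, pow_succ]
    split_ifs with h
    · have : (0:ℝ) < (1 / 2) ^ J := by positivity
      linarith
    · have h1 : 0 ≤ ∑ j ∈ range J, if t ≤ 2 ^ j then 2 * (1 / 2 : ℝ) ^ j else 0 :=
        sum_nonneg fun j _ => by split_ifs <;> positivity
      have h2 : 1 / (1 + t) ≤ (1 / 2) ^ J := by
        rw [one_div_pow]
        exact one_div_le_one_div_of_le (by positivity) (by linarith)
      linarith

lemma sum_quad_le {s : Finset ℕ} {u : ℕ → ℝ} {M κ V : ℝ} {J : ℕ} (hV : 0 < V) (hM : 0 ≤ M)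
    (hκ : 0 ≤ κ) (hκ1 : κ ≤ 1) (hu : ∀ n ∈ s, |u n| ≤ 1) (hJ : V ≤ 2 ^ J)
    (H : ∀ δ : ℝ, 0 < δ → quadCount s u δ ≤ M * (δ + κ)) :
    ∑ q ∈ s ×ˢ s ×ˢ s ×ˢ s, 1 / (1 + V * |u q.1 + u q.2.1 - u q.2.2.1 - u q.2.2.2|) ≤
      M * ((2 * J + 10) / V + 4 * κ) := by
  set U : ℕ × ℕ × ℕ × ℕ → ℝ := fun q => u q.1 + u q.2.1 - u q.2.2.1 - u q.2.2.2
  have hcard : (#(s ×ˢ s ×ˢ s ×ˢ s) : ℝ) ≤ M * 5 := by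
    have h1 : #(s ×ˢ s ×ˢ s ×ˢ s) = quadCount s u 4 := by
      rw [quadCount, filter_true_of_mem]
      intro q hq
      simp only [mem_product] at hq
      have h1 := abs_le.1 (hu _ hq.1)
      have h2 := abs_le.1 (hu _ hq.2.1)
      have h3 := abs_le.1 (hu _ hq.2.2.1)
      have h4 := abs_le.1 (hu _ hq.2.2.2)
      rw [abs_le]; constructor <;> linarith
    rw [h1]
    refine (H 4 (by norm_num)).trans ?_
    gcongr; linarith
  calc ∑ q ∈ s ×ˢ s ×ˢ s ×ˢ s, 1 / (1 + V * |U q|)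
      ≤ ∑ q ∈ s ×ˢ s ×ˢ s ×ˢ s, ((∑ j ∈ range J,
        if V * |U q| ≤ 2 ^ j then 2 * (1 / 2 : ℝ) ^ j else 0) + 2 * (1 / 2) ^ J) :=
        sum_le_sum fun q _ => inv_one_add_le_dyadic (by positivity) J
    _ = (∑ j ∈ range J, 2 * (1 / 2 : ℝ) ^ j * quadCount s u (2 ^ j / V)) +
        #(s ×ˢ s ×ˢ s ×ˢ s) * (2 * (1 / 2) ^ J) := by
        rw [sum_add_distrib, sum_comm, sum_const, nsmul_eq_mul]
        congr 1
        refine sum_congr rfl fun j _ => ?_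
        rw [← sum_filter, sum_const, nsmul_eq_mul, mul_comm, quadCount]
        congr 3
        ext q
        rw [mem_filter, mem_filter, le_div_iff₀ hV, mul_comm]
    _ ≤ (∑ j ∈ range J, 2 * (1 / 2 : ℝ) ^ j * (M * (2 ^ j / V + κ))) + M * 5 * (2 * (1 / V)) := by
        have h2 : (1 / 2 : ℝ) ^ J ≤ 1 / V := by
          rw [one_div_pow]; exact one_div_le_one_div_of_le hV hJ
        gcongr with j _
        exact H _ (by positivity)
    _ = M * (2 * J / V + 2 * κ * (∑ j ∈ range J, (1 / 2 : ℝ) ^ j) + 10 / V) := by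
        have : ∀ j : ℕ, 2 * (1 / 2 : ℝ) ^ j * (M * (2 ^ j / V + κ)) =
            M * (2 / V) + M * (2 * κ) * (1 / 2) ^ j := by
          intro j
          have : (1 / 2 : ℝ) ^ j * 2 ^ j = 1 := by rw [← mul_pow]; norm_num
          linear_combination (2 * M / V) * this
        simp only [this, sum_add_distrib, ← mul_sum, sum_const, card_range, nsmul_eq_mul]
        ring
    _ ≤ M * (2 * J / V + 2 * κ * 2 + 10 / V) := by
        have : ∑ j ∈ range J, (1 / 2 : ℝ) ^ j ≤ 2 := by
          rw [geom_sum_eq (by norm_num), div_le_iff_of_neg (by norm_num)]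
          have : (0:ℝ) < (1 / 2) ^ J := by positivity
          linarith
        gcongr
    _ = _ := by ring

/-- The hypothesis that quadruples of `c`-th powers are essentially equidistributed, up to a
loss of `P ^ β`. -/
def QuadBound (β : ℝ) : Prop := ∀ c Λ : ℝ, 1 < c → 1 ≤ Λ → ∃ C : ℝ, 0 < C ∧ ∀ P δ : ℝ, 1 ≤ P → 0 < δ →
  quadCount (Finset.Icc ⌈P / Λ⌉₊ ⌊Λ * P⌋₊) (fun n => ((n : ℝ) / P) ^ c) δ ≤
    C * P ^ (4 + β) * (δ + (P ^ 2)⁻¹)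

lemma exists_dyadic_ge {V : ℝ} (hV : 0 < V) : ∃ J : ℕ, V ≤ 2 ^ J ∧ (J : ℝ) ≤ 1 + 2 * |Real.log V| := by
  refine ⟨Nat.log 2 ⌊V⌋₊ + 1, ?_, ?_⟩
  · have h1 : ⌊V⌋₊ + 1 ≤ 2 ^ (Nat.log 2 ⌊V⌋₊ + 1) := Nat.lt_pow_succ_log_self (by norm_num) _
    have h2 := Nat.lt_floor_add_one V
    have h3 : ((⌊V⌋₊ + 1 : ℕ) : ℝ) ≤ ((2 ^ (Nat.log 2 ⌊V⌋₊ + 1) : ℕ) : ℝ) := by exact_mod_cast h1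
    push_cast at h3
    linarith
  · push_cast
    rcases lt_or_ge V 1 with h | h
    · rw [Nat.floor_eq_zero.2 h]; simp
    have hn : 1 ≤ ⌊V⌋₊ := Nat.one_le_floor_iff V |>.2 h
    have h1 : 2 ^ Nat.log 2 ⌊V⌋₊ ≤ ⌊V⌋₊ := Nat.pow_log_le_self 2 (by omega)
    have h2 : (2:ℝ) ^ Nat.log 2 ⌊V⌋₊ ≤ V := by
      have : ((2 ^ Nat.log 2 ⌊V⌋₊ : ℕ) : ℝ) ≤ (⌊V⌋₊ : ℝ) := by exact_mod_cast h1
      push_cast at this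
      exact this.trans (Nat.floor_le hV.le)
    have h3 := Real.log_le_log (by positivity) h2
    rw [Real.log_pow] at h3
    have h4 := Real.log_two_gt_d9
    have h5 := le_abs_self (Real.log V)
    have h6 : (0:ℝ) ≤ (Nat.log 2 ⌊V⌋₊ : ℝ) := by positivity
    nlinarith

open scoped ComplexConjugate in
lemma fourth_moment_osc {g : ℝ} (hg : 0 < g) : ∃ C : ℝ, 0 < C ∧ ∀ Y D : ℝ, 0 < Y → ∀ s : Finset ℕ,
    ∀ A A' : ℕ → ℝ → ℂ, (∀ k ∈ s, ContinuousOn (A' k) (Set.Icc Y (2 * Y)) ∧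
      ∀ x ∈ Set.Icc Y (2 * Y), HasDerivAt (A k) (A' k x) x ∧ ‖A k x‖ ≤ D ∧ ‖A' k x‖ ≤ D / Y) →
    ∀ w : ℕ → ℝ, ∫ x in Y..(2 * Y), ‖∑ k ∈ s, A k x * eC (x ^ (-g) * w k)‖ ^ 4 ≤
      C * (D ^ 4 * Y) * ∑ q ∈ s ×ˢ s ×ˢ s ×ˢ s,
        1 / (1 + Y ^ (-g) * |w q.1 + w q.2.1 - w q.2.2.1 - w q.2.2.2|) := by
  obtain ⟨C, hC, h⟩ := osc_dual hg
  refine ⟨4 * C, by positivity, fun Y D hY s A A' hA w => ?_⟩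
  have hYY : Y ≤ 2 * Y := by linarith
  set W : ℕ × ℕ × ℕ × ℕ → ℝ := fun q => w q.1 + w q.2.1 - w q.2.2.1 - w q.2.2.2
  set B : ℕ × ℕ × ℕ × ℕ → ℝ → ℂ := fun q x =>
    A q.1 x * A q.2.1 x * star (A q.2.2.1 x) * star (A q.2.2.2 x)
  set B' : ℕ × ℕ × ℕ × ℕ → ℝ → ℂ := fun q x =>
    ((A' q.1 x * A q.2.1 x + A q.1 x * A' q.2.1 x) * star (A q.2.2.1 x) +
      A q.1 x * A q.2.1 x * star (A' q.2.2.1 x)) * star (A q.2.2.2 x) +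
      A q.1 x * A q.2.1 x * star (A q.2.2.1 x) * star (A' q.2.2.2 x)
  have hAc : ∀ k ∈ s, ContinuousOn (A k) (Set.Icc Y (2 * Y)) := fun k hk x hx =>
    ((hA k hk).2 x hx).1.continuousAt.continuousWithinAt
  have hec : ∀ r : ℝ, ContinuousOn (fun x : ℝ => eC (x ^ (-g) * r)) (Set.Icc Y (2 * Y)) := fun r =>
    continuous_eC.comp_continuousOn ((continuousOn_id.rpow_const
      fun x hx => Or.inl (hY.trans_le hx.1).ne').mul continuousOn_const)
  have hexp : ∀ x, ((‖∑ k ∈ s, A k x * eC (x ^ (-g) * w k)‖ ^ 4 : ℝ) : ℂ) =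
      ∑ q ∈ s ×ˢ s ×ˢ s ×ˢ s, B q x * eC (x ^ (-g) * W q) := by
    intro x
    rw [norm_pow_four_sum]
    refine sum_congr rfl fun q _ => ?_
    rw [← eC_quad]
    simp only [map_mul, B, starRingEnd_apply]
    ring
  have hBc : ∀ q ∈ s ×ˢ s ×ˢ s ×ˢ s, ContinuousOn (B q) (Set.Icc Y (2 * Y)) := by
    intro q hq
    simp only [mem_product] at hq
    exact (((hAc _ hq.1).mul (hAc _ hq.2.1)).mul (hAc _ hq.2.2.1).star).mul (hAc _ hq.2.2.2).star
  have hint : ((∫ x in Y..(2 * Y), ‖∑ k ∈ s, A k x * eC (x ^ (-g) * w k)‖ ^ 4 : ℝ) : ℂ) =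
      ∑ q ∈ s ×ˢ s ×ˢ s ×ˢ s, ∫ x in Y..(2 * Y), B q x * eC (W q * x ^ (-g)) := by
    rw [← intervalIntegral.integral_ofReal]
    simp only [hexp]
    rw [intervalIntegral.integral_finsetSum]
    · simp only [mul_comm (W _)]
    · exact fun q hq => ((hBc q hq).mul (hec _)).intervalIntegrable_of_Icc hYY
  have hq : ∀ q ∈ s ×ˢ s ×ˢ s ×ˢ s, ‖∫ x in Y..(2 * Y), B q x * eC (W q * x ^ (-g))‖ ≤
      C * (4 * D ^ 4 * Y) / (1 + |W q| * Y ^ (-g)) := by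
    intro q hq
    have hq' := hq
    simp only [mem_product] at hq
    obtain ⟨h1, h2, h3, h4⟩ := hq
    refine h Y (4 * D ^ 4) hY (B q) (B' q) ?_ (fun x hx => ?_) (W q)
    · exact (((((hA _ h1).1.mul (hAc _ h2)).add ((hAc _ h1).mul (hA _ h2).1)).mul
        (hAc _ h3).star).add (((hAc _ h1).mul (hAc _ h2)).mul (hA _ h3).1.star)).mul
        (hAc _ h4).star |>.add ((((hAc _ h1).mul (hAc _ h2)).mul (hAc _ h3).star).mul (hA _ h4).1.star)
    · obtain ⟨d1, e1, f1⟩ := (hA _ h1).2 x hx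
      obtain ⟨d2, e2, f2⟩ := (hA _ h2).2 x hx
      obtain ⟨d3, e3, f3⟩ := (hA _ h3).2 x hx
      obtain ⟨d4, e4, f4⟩ := (hA _ h4).2 x hx
      have hD : 0 ≤ D := (norm_nonneg _).trans e1
      refine ⟨((d1.mul d2).mul d3.star).mul d4.star, ?_, ?_⟩
      · simp only [B, norm_mul, norm_star]
        calc _ ≤ D * D * D * D := by gcongr
          _ ≤ _ := by nlinarith [pow_nonneg hD 4]
      · have p1 : ‖A' q.1 x * A q.2.1 x * star (A q.2.2.1 x) * star (A q.2.2.2 x)‖ ≤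
            D / Y * D * D * D := by simp only [norm_mul, norm_star]; gcongr
        have p2 : ‖A q.1 x * A' q.2.1 x * star (A q.2.2.1 x) * star (A q.2.2.2 x)‖ ≤
            D * (D / Y) * D * D := by simp only [norm_mul, norm_star]; gcongr
        have p3 : ‖A q.1 x * A q.2.1 x * star (A' q.2.2.1 x) * star (A q.2.2.2 x)‖ ≤
            D * D * (D / Y) * D := by simp only [norm_mul, norm_star]; gcongr
        have p4 : ‖A q.1 x * A q.2.1 x * star (A q.2.2.1 x) * star (A' q.2.2.2 x)‖ ≤
            D * D * D * (D / Y) := by simp only [norm_mul, norm_star]; gcongr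
        have e : B' q x = A' q.1 x * A q.2.1 x * star (A q.2.2.1 x) * star (A q.2.2.2 x) +
            A q.1 x * A' q.2.1 x * star (A q.2.2.1 x) * star (A q.2.2.2 x) +
            A q.1 x * A q.2.1 x * star (A' q.2.2.1 x) * star (A q.2.2.2 x) +
            A q.1 x * A q.2.1 x * star (A q.2.2.1 x) * star (A' q.2.2.2 x) := by
          simp only [B']; ring
        rw [e]
        refine (norm_add_le _ _).trans ((add_le_add ((norm_add_le _ _).trans (add_le_add
          ((norm_add_le _ _).trans (add_le_add p1 p2)) p3)) p4).trans (le_of_eq ?_))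
        field_simp; ring
  have h0 : 0 ≤ ∫ x in Y..(2 * Y), ‖∑ k ∈ s, A k x * eC (x ^ (-g) * w k)‖ ^ 4 :=
    intervalIntegral.integral_nonneg hYY fun x _ => by positivity
  calc _ = ‖((∫ x in Y..(2 * Y), ‖∑ k ∈ s, A k x * eC (x ^ (-g) * w k)‖ ^ 4 : ℝ) : ℂ)‖ := by
        rw [Complex.norm_real, Real.norm_of_nonneg h0]
    _ ≤ ∑ q ∈ s ×ˢ s ×ˢ s ×ˢ s, C * (4 * D ^ 4 * Y) / (1 + |W q| * Y ^ (-g)) := by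
        rw [hint]; exact (norm_sum_le _ _).trans (sum_le_sum hq)
    _ = _ := by
        rw [mul_sum]
        refine sum_congr rfl fun q _ => ?_
        rw [mul_comm (|W q|)]; ring

lemma dual_sum_fourth {β a b c : ℝ} (H : QuadBound β) (ha : 0 < a) (hab : a < b)
    (hc : 1 < c) : ∃ C : ℝ, 0 < C ∧ ∀ P Y D : ℝ, 1 ≤ P → 1 ≤ Y → Y ≤ P ^ 2 → 0 ≤ D →
    ∀ A A' : ℕ → ℝ → ℂ, (∀ k ∈ dualRange a b c P Y, ContinuousOn (A' k) (Set.Icc Y (2 * Y)) ∧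
      ∀ x ∈ Set.Icc Y (2 * Y), HasDerivAt (A k) (A' k x) x ∧ ‖A k x‖ ≤ D ∧ ‖A' k x‖ ≤ D / Y) →
    ∫ x in Y..(2 * Y), ‖∑ k ∈ dualRange a b c P Y, A k x * eC (dualPhase c (k * P) x)‖ ^ 4 ≤
      C * D ^ 4 * ((1 + Real.log P) * (Y / P) ^ (4 + β) * P ^ 2 / Y) := by
  set c₁ := c * a ^ (c - 1) / 2 with hc₁
  set c₂ := 4 * c * b ^ (c - 1) with hc₂
  have hb : 0 < b := ha.trans hab
  have h1 : 0 < c₁ := by positivity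
  have h2 : 0 < c₂ := by positivity
  have h12 : c₁ ≤ c₂ := by
    have : a ^ (c - 1) ≤ b ^ (c - 1) := Real.rpow_le_rpow ha.le hab.le (by linarith)
    have := Real.rpow_pos_of_pos hb (c - 1)
    rw [hc₁, hc₂]; nlinarith
  set d := c / (c - 1) with hd
  have hc1 : 0 < c - 1 := by linarith
  have hd1 : 1 < d := by rw [hd, lt_div_iff₀ hc1]; linarith
  obtain ⟨C₁, hC₁, H₁⟩ := H d (c₂ / c₁) hd1 ((one_le_div h1).2 h12)
  obtain ⟨C₃, hC₃, H₃⟩ := fourth_moment_osc (g := d - 1) (by linarith)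
  set κ := (c - 1) * c ^ (-d) * c₂ ^ d with hκ
  have hκ0 : 0 < κ := by positivity
  set C₄ := (20 + 4 * |Real.log κ|) / κ with hC₄
  have hC₄0 : 0 < C₄ := by positivity
  refine ⟨C₃ * (C₁ * c₂ ^ (4 + β) * (C₄ + 4 / c₂ ^ 2)), by positivity,
    fun P Y D hP hY hYP hD A A' hA => ?_⟩
  have hP0 : 0 < P := by linarith
  have hY0 : 0 < Y := by linarith
  have hlP : 0 ≤ Real.log P := Real.log_nonneg hP
  set K := c₂ * Y / P with hK
  have hK0 : 0 < K := by positivity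
  set s := dualRange a b c P Y with hs
  set w : ℕ → ℝ := fun k => -((c - 1) * c ^ (-d) * (k * P) ^ d)
  set u : ℕ → ℝ := fun k => ((k : ℝ) / K) ^ d
  have hph : ∀ k : ℕ, ∀ x, dualPhase c (k * P) x = x ^ (-(d - 1)) * w k := by
    intro k x
    rw [dualPhase, neg_sub, mul_comm]
  have hwu : ∀ k : ℕ, w k * Y ^ (-(d - 1)) = -(κ * Y * u k) := by
    intro k
    have e : (k : ℝ) * P = c₂ * Y * (k / K) := by rw [hK]; field_simp
    simp only [w, u]
    rw [e, Real.mul_rpow (by positivity) (by positivity), Real.mul_rpow h2.le hY0.le, hκ, neg_sub,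
      Real.rpow_sub hY0, Real.rpow_one]
    have := Real.rpow_pos_of_pos hY0 d
    field_simp
  have hW : ∀ q : ℕ × ℕ × ℕ × ℕ, Y ^ (-(d - 1)) * |w q.1 + w q.2.1 - w q.2.2.1 - w q.2.2.2| =
      κ * Y * |u q.1 + u q.2.1 - u q.2.2.1 - u q.2.2.2| := by
    intro q
    rw [← abs_of_pos (by positivity : 0 < Y ^ (-(d - 1))), ← abs_mul,
      ← abs_of_pos (by positivity : 0 < κ * Y), ← abs_mul, ← abs_neg]
    congr 1
    linear_combination (-1) * hwu q.1 - hwu q.2.1 + hwu q.2.2.1 + hwu q.2.2.2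
  have hmain := H₃ Y D hY0 s A A' hA w
  simp only [hph]
  refine hmain.trans ?_
  simp only [hW]
  have hS : ∑ q ∈ s ×ˢ s ×ˢ s ×ˢ s, 1 / (1 + κ * Y * |u q.1 + u q.2.1 - u q.2.2.1 - u q.2.2.2|) ≤
      C₁ * K ^ (4 + β) * (C₄ * (1 + Real.log P) / Y + 4 * (K ^ 2)⁻¹) := by
    have hmem : ∀ k ∈ s, 1 ≤ K ∧ (k : ℝ) ≤ K := by
      intro k hk
      rw [hs, dualRange, Finset.mem_Icc] at hk
      have hk2 : (k : ℝ) ≤ K := (Nat.le_floor_iff hK0.le).1 hk.2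
      have hk1 : 1 ≤ k := (Nat.one_le_ceil_iff.2 (by positivity)).trans hk.1
      have : (1:ℝ) ≤ k := by exact_mod_cast hk1
      exact ⟨this.trans hk2, hk2⟩
    by_cases hK1 : 1 ≤ K
    · obtain ⟨J, hJ, hJ'⟩ := exists_dyadic_ge (V := κ * Y) (by positivity)
      have hlY : |Real.log (κ * Y)| ≤ |Real.log κ| + 2 * Real.log P := by
        rw [Real.log_mul hκ0.ne' hY0.ne']
        refine (abs_add_le _ _).trans ?_
        rw [abs_of_nonneg (Real.log_nonneg hY)]
        have := Real.log_le_log hY0 hYP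
        rw [Real.log_pow] at this
        push_cast at this
        linarith
      refine (sum_quad_le (M := C₁ * K ^ (4 + β)) (κ := (K ^ 2)⁻¹) (J := J) (by positivity)
        (by positivity) (by positivity) (inv_le_one_of_one_le₀ (one_le_pow₀ hK1)) (fun n hn => ?_)
        hJ fun δ hδ => ?_).trans ?_
      · have := hmem n hn
        rw [abs_of_nonneg (by positivity)]
        exact Real.rpow_le_one (by positivity) ((div_le_one hK0).2 this.2) (by linarith)
      · refine le_trans ?_ (H₁ K δ hK1 hδ)
        have : s ⊆ Finset.Icc ⌈K / (c₂ / c₁)⌉₊ ⌊c₂ / c₁ * K⌋₊ := by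
          rw [hs, dualRange]
          refine Finset.Icc_subset_Icc (Nat.ceil_le_ceil ?_) (Nat.floor_le_floor ?_)
          · rw [hK]; apply le_of_eq; field_simp; rw [hc₁]; ring
          · exact le_mul_of_one_le_left hK0.le ((one_le_div h1).2 h12)
        exact_mod_cast quadCount_mono this u le_rfl
      · have e : (2 * J + 10) / (κ * Y) ≤ C₄ * (1 + Real.log P) / Y := by
          have e2 : C₄ * (1 + Real.log P) / Y =
              (20 + 4 * |Real.log κ|) * (1 + Real.log P) / (κ * Y) := by
            rw [hC₄]; field_simp
          rw [e2]
          gcongr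
          nlinarith [abs_nonneg (Real.log κ)]
        exact mul_le_mul_of_nonneg_left (add_le_add e le_rfl) (by positivity)
    · have : s = ∅ := Finset.eq_empty_of_forall_notMem fun k hk => hK1 (hmem k hk).1
      rw [this]; simp only [empty_product, sum_empty]
      positivity
  have hKr : K ^ (4 + β) = c₂ ^ (4 + β) * (Y / P) ^ (4 + β) := by
    rw [hK, mul_div_assoc, Real.mul_rpow h2.le (by positivity)]
  calc _ ≤ C₃ * (D ^ 4 * Y) * (C₁ * K ^ (4 + β) * (C₄ * (1 + Real.log P) / Y + 4 * (K ^ 2)⁻¹)) := by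
        gcongr
    _ ≤ C₃ * (D ^ 4 * Y) * (C₁ * K ^ (4 + β) * (C₄ * (1 + Real.log P) * P ^ 2 / Y ^ 2 +
        4 / c₂ ^ 2 * (1 + Real.log P) * P ^ 2 / Y ^ 2)) := by
        gcongr ?_ * (?_ * (?_ + ?_))
        · rw [div_le_div_iff₀ hY0 (by positivity)]
          have : 0 ≤ C₄ * (1 + Real.log P) * Y := by positivity
          nlinarith
        · rw [hK]
          have e : 4 * ((c₂ * Y / P) ^ 2)⁻¹ = 4 / c₂ ^ 2 * P ^ 2 / Y ^ 2 := by field_simp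
          rw [e]
          gcongr
          have : 0 < 4 / c₂ ^ 2 := by positivity
          nlinarith
    _ = _ := by rw [hKr]; field_simp

lemma TW_fourth_dyadic {β a b c : ℝ} (H : QuadBound β) (ha : 0 < a) (hab : a < b)
    (hc : 1 < c) : ∃ C : ℝ, 0 < C ∧ ∀ P Y : ℝ, 1 ≤ P → 1 ≤ Y → Y ≤ P ^ 2 →
    ∫ x in Y..(2 * Y), ‖TW a b c P x‖ ^ 4 ≤
      C * (1 + Real.log P) * (P ^ 4 + (Y / P) ^ β * Y * P ^ 2) := by
  obtain ⟨C, hC, h⟩ := b_process ha hab hc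
  obtain ⟨C₂, hC₂, h₂⟩ := dual_sum_fourth H ha hab hc
  refine ⟨8 * (C₂ * C ^ 4) + 8 * C ^ 4, by positivity, fun P Y hP hY hYP => ?_⟩
  have hP0 : 0 < P := by linarith
  have hY0 : 0 < Y := by linarith
  have hYY : Y ≤ 2 * Y := by linarith
  have hlP : 0 ≤ Real.log P := Real.log_nonneg hP
  obtain ⟨A, A', hA, hT⟩ := h P Y hP hY hYP
  have hS := h₂ P Y C hP hY hYP hC.le A A' hA
  set S : ℝ → ℂ := fun x => ∑ k ∈ dualRange a b c P Y, A k x * eC (dualPhase c (k * P) x)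
  have hSc : ContinuousOn S (Set.Icc Y (2 * Y)) := by
    refine continuousOn_finsetSum _ fun k hk => ContinuousOn.mul (fun x hx =>
      ((hA k hk).2 x hx).1.continuousAt.continuousWithinAt) (continuous_eC.comp_continuousOn ?_)
    exact continuousOn_const.mul
      (continuousOn_id.rpow_const fun x hx => Or.inl (hY0.trans_le hx.1).ne')
  have hTc : Continuous (TW a b c P) := continuous_expSum _ _ _
  have hi : IntervalIntegrable (fun x => ‖S x‖ ^ 4) volume Y (2 * Y) :=
    (hSc.norm.pow 4).intervalIntegrable_of_Icc hYY
  calc ∫ x in Y..(2 * Y), ‖TW a b c P x‖ ^ 4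
      ≤ ∫ x in Y..(2 * Y), 8 * (P ^ 4 / Y ^ 2) * (‖S x‖ ^ 4 + C ^ 4) := by
        refine intervalIntegral.integral_mono_on hYY ((hTc.norm.pow 4).intervalIntegrable _ _)
          ((hi.add intervalIntegrable_const).const_mul _) fun x hx => ?_
        have h1 : (‖S x‖ + C) ^ 4 ≤ 8 * (‖S x‖ ^ 4 + C ^ 4) := by
          have := norm_nonneg (S x)
          nlinarith [sq_nonneg (‖S x‖ - C), sq_nonneg (‖S x‖ + C), sq_nonneg (‖S x‖ ^ 2 - C ^ 2),
            mul_nonneg this hC.le]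
        have h2 : (√Y) ^ 4 = Y ^ 2 := by
          rw [show 4 = 2 * 2 by norm_num, pow_mul, Real.sq_sqrt hY0.le]
        calc ‖TW a b c P x‖ ^ 4 ≤ (P / √Y * (‖S x‖ + C)) ^ 4 := by
              gcongr; exact hT x hx
          _ = P ^ 4 / Y ^ 2 * (‖S x‖ + C) ^ 4 := by rw [mul_pow, div_pow, h2]
          _ ≤ P ^ 4 / Y ^ 2 * (8 * (‖S x‖ ^ 4 + C ^ 4)) := by gcongr
          _ = _ := by ring
    _ = 8 * (P ^ 4 / Y ^ 2) * ((∫ x in Y..(2 * Y), ‖S x‖ ^ 4) + Y * C ^ 4) := by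
        rw [intervalIntegral.integral_const_mul, intervalIntegral.integral_add hi
          intervalIntegrable_const, intervalIntegral.integral_const, smul_eq_mul]
        ring
    _ ≤ 8 * (P ^ 4 / Y ^ 2) * (C₂ * C ^ 4 * ((1 + Real.log P) * (Y / P) ^ (4 + β) * P ^ 2 / Y) +
        Y * C ^ 4) := by gcongr
    _ = 8 * (C₂ * C ^ 4) * (1 + Real.log P) * ((Y / P) ^ β * Y * P ^ 2) + 8 * C ^ 4 * 1 * (P ^ 4 / Y) := by
        rw [Real.rpow_add (by positivity), show (4:ℝ) = ((4:ℕ):ℝ) by norm_num, Real.rpow_natCast]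
        field_simp
    _ ≤ 8 * (C₂ * C ^ 4) * (1 + Real.log P) * (P ^ 4 + (Y / P) ^ β * Y * P ^ 2) +
        8 * C ^ 4 * (1 + Real.log P) * (P ^ 4 + (Y / P) ^ β * Y * P ^ 2) := by
        have e1 : P ^ 4 / Y ≤ P ^ 4 + (Y / P) ^ β * Y * P ^ 2 :=
          (div_le_self (by positivity) hY).trans (le_add_of_nonneg_right (by positivity))
        gcongr
        · exact le_add_of_nonneg_left (by positivity)
        · linarith
    _ = _ := by ring

lemma integral_le_dyadic {f : ℝ → ℝ} (hf : Continuous f) (hf0 : ∀ x, 0 ≤ f x) {G : ℝ} :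
    ∀ (J : ℕ) {X : ℝ}, 1 ≤ X → X ≤ 2 ^ J →
      (∀ Y : ℝ, 1 ≤ Y → Y ≤ X → ∫ x in Y..(2 * Y), f x ≤ G) →
      ∫ x in (0:ℝ)..X, f x ≤ (∫ x in (0:ℝ)..1, f x) + J * G := by
  intro J
  induction J with
  | zero =>
    intro X h1 h2 _
    rw [pow_zero] at h2
    rw [le_antisymm h2 h1]; simp
  | succ J ih =>
    intro X h1 h2 hG
    set Y := max 1 (X / 2)
    have hY1 : 1 ≤ Y := le_max_left _ _
    have hYX : Y ≤ X := max_le h1 (by linarith)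
    have hY2 : X ≤ 2 * Y := by have := le_max_right 1 (X / 2); linarith
    have hYJ : Y ≤ 2 ^ J := max_le (one_le_pow₀ (by norm_num)) (by rw [pow_succ] at h2; linarith)
    have i1 := ih hY1 hYJ fun Z hZ1 hZ2 => hG Z hZ1 (hZ2.trans hYX)
    have i2 := hG Y hY1 hYX
    have i3 : ∫ x in Y..X, f x ≤ ∫ x in Y..(2 * Y), f x :=
      intervalIntegral.integral_mono_interval le_rfl hYX hY2
        (Filter.Eventually.of_forall hf0) (hf.intervalIntegrable _ _)
    rw [← intervalIntegral.integral_add_adjacent_intervals (hf.intervalIntegrable 0 Y)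
      (hf.intervalIntegrable Y X)]
    push_cast
    linarith

lemma norm_TW_le {a b c : ℝ} (hb : 0 < b) (hab : a ≤ b) : ∃ C : ℝ, 0 < C ∧ ∀ P x : ℝ, 1 ≤ P →
    ‖TW a b c P x‖ ≤ C * P := by
  obtain ⟨B, hB1, hB⟩ := wt_bounds a b
  have hbump : ∀ t, |bump a b t| ≤ B := by
    intro t
    by_cases ht : t ∈ Set.Icc a b
    · rw [bump_eq_wt ht]; exact (hB t ht).1
    · rw [bump_eq_zero hab fun h => ht (Set.Ioo_subset_Icc_self h), abs_zero]; linarith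
  refine ⟨B * (b + 1), by positivity, fun P x hP => ?_⟩
  calc ‖TW a b c P x‖ ≤ ∑ n ∈ range (⌊b * P⌋₊ + 1), B := by
        refine norm_sum_le_of_le _ fun n _ => ?_
        rw [norm_mul, norm_eC, mul_one, Complex.norm_real]
        exact hbump _
    _ = (⌊b * P⌋₊ + 1 : ℝ) * B := by simp
    _ ≤ (b * P + P) * B := by
        gcongr
        exact Nat.floor_le (by positivity)
    _ = _ := by ring

lemma quadCount_le_of_scale {β c Λ η : ℝ} (H : QuadBound β) (hβ : 0 ≤ β) (hc : 1 < c) (hΛ : 1 ≤ Λ)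
    (hη0 : 0 ≤ η) : ∃ C : ℝ, 0 < C ∧ ∀ P X : ℝ, 1 ≤ P → 1 ≤ X → X ≤ P ^ (2 - η) →
    quadCount (Finset.Icc ⌈P / Λ⌉₊ ⌊Λ * P⌋₊) (fun n => ((n : ℝ) / P) ^ c) (1 / (8 * X)) ≤
      C * (1 + 4 * Real.log P) ^ 2 * (P ^ 4 * (1 + P ^ ((1 - η) * β - η))) * (1 / X) := by
  have hΛ0 : 0 < Λ := by linarith
  set a := 1 / (2 * Λ) with ha
  set b := 2 * Λ with hb
  have ha0 : 0 < a := by positivity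
  have hab : a < b := by
    rw [ha, hb, div_lt_iff₀ (by positivity)]; nlinarith
  obtain ⟨C₁, hC₁, h₁⟩ := TW_fourth_dyadic H ha0 hab hc
  obtain ⟨C₂, hC₂, h₂⟩ := norm_TW_le (c := c) (by linarith : 0 < b) hab.le
  refine ⟨8 ^ 4 * 5 * (C₂ ^ 4 + C₁), by positivity, fun P X hP hX1 hX2 => ?_⟩
  have hP0 : 0 < P := by linarith
  have hlP : 0 ≤ Real.log P := Real.log_nonneg hP
  set s := Finset.Icc ⌈P / Λ⌉₊ ⌊Λ * P⌋₊ with hs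
  set u : ℕ → ℝ := fun n => ((n : ℝ) / P) ^ c with hu
  set E := P ^ ((1 - η) * β - η) with hE
  have hE0 : 0 < E := by positivity
  have hX0 : 0 < X := by linarith
  have hXP : X ≤ P ^ 2 := by
    refine hX2.trans ?_
    rw [← Real.rpow_natCast]
    exact Real.rpow_le_rpow_of_exponent_le hP (by push_cast; linarith)
  have hblock : ∀ Y : ℝ, 1 ≤ Y → Y ≤ X → ∫ x in Y..(2 * Y), ‖TW a b c P x‖ ^ 4 ≤
      C₁ * (1 + 4 * Real.log P) * (P ^ 4 * (1 + E)) := by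
    intro Y hY1 hY2
    have hY0 : 0 < Y := by linarith
    refine (h₁ P Y hP hY1 (hY2.trans hXP)).trans ?_
    have e1 : (Y / P) ^ β ≤ P ^ ((1 - η) * β) := by
      rw [Real.rpow_mul hP0.le]
      refine Real.rpow_le_rpow (by positivity) ?_ hβ
      rw [div_le_iff₀ hP0]
      refine (hY2.trans hX2).trans (le_of_eq ?_)
      rw [show (2 - η) = (1 - η) + 1 by ring, Real.rpow_add_one hP0.ne']
    have e2 : (Y / P) ^ β * Y * P ^ 2 ≤ P ^ 4 * E := by
      calc (Y / P) ^ β * Y * P ^ 2 ≤ P ^ ((1 - η) * β) * P ^ (2 - η) * P ^ 2 := by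
            gcongr; exact hY2.trans hX2
        _ = P ^ 4 * E := by
            rw [hE, ← Real.rpow_natCast, ← Real.rpow_natCast, ← Real.rpow_add hP0,
              ← Real.rpow_add hP0, ← Real.rpow_add hP0]
            congr 1; push_cast; ring
    have e3 : P ^ 4 + (Y / P) ^ β * Y * P ^ 2 ≤ P ^ 4 * (1 + E) := by linarith
    gcongr
    linarith
  obtain ⟨J, hJ, hJ'⟩ := exists_dyadic_ge hX0
  have hJ2 : (J : ℝ) ≤ 1 + 4 * Real.log P := by
    rw [abs_of_nonneg (Real.log_nonneg hX1)] at hJ'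
    have := Real.log_le_log hX0 hXP
    rw [Real.log_pow] at this
    push_cast at this
    linarith
  have hTc : Continuous (TW a b c P) := continuous_expSum _ _ _
  have hI := integral_le_dyadic (f := fun x => ‖TW a b c P x‖ ^ 4) (hTc.norm.pow 4)
    (fun x => by positivity) J hX1 hJ hblock
  have hI0 : ∫ x in (0:ℝ)..1, ‖TW a b c P x‖ ^ 4 ≤ (C₂ * P) ^ 4 := by
    have := intervalIntegral.integral_mono_on (μ := volume) zero_le_one
      ((hTc.norm.pow 4).intervalIntegrable 0 1)
      (intervalIntegrable_const (c := (C₂ * P) ^ 4)) fun x _ =>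
        pow_le_pow_left₀ (norm_nonneg _) (h₂ P x hP) 4
    simpa using this
  have hst : s ⊆ range (⌊b * P⌋₊ + 1) := by
    intro n hn
    rw [hs, Finset.mem_Icc] at hn
    rw [Finset.mem_range, Nat.lt_succ_iff]
    refine hn.2.trans (Nat.floor_le_floor ?_)
    rw [hb]; nlinarith
  have hq := quadCount_le_fourth_moment hst (u := u) (w := fun n => bump a b (n / P))
    (fun n => pow_nonneg (le_max_right _ _) 3) (w₀ := 1 / 8) (by norm_num) (fun n hn => ?_) hX0
  swap
  · rw [hs, Finset.mem_Icc, Nat.ceil_le, Nat.le_floor_iff (by positivity), div_le_iff₀ hΛ0] at hn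
    have t1 : 1 / Λ ≤ (n : ℝ) / P := by
      rw [div_le_div_iff₀ hΛ0 hP0]; linarith [hn.1]
    have t2 : (n : ℝ) / P ≤ Λ := by rw [div_le_iff₀ hP0]; exact hn.2
    have t3 : 1 / Λ - a = a := by rw [ha, hb]; field_simp; norm_num
    have t4 : (1 / 2 : ℝ) ≤ (n / P - a) * (b - n / P) := by
      calc (1 / 2 : ℝ) = a * Λ := by rw [ha, hb]; field_simp
        _ ≤ _ := mul_le_mul (by linarith) (by rw [hb]; linarith) hΛ0.le (by linarith)
    calc (1 / 8 : ℝ) = (1 / 2) ^ 3 := by norm_num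
      _ ≤ _ := pow_le_pow_left₀ (by norm_num) (t4.trans (le_max_left _ _)) 3
  have hq2 : (1 / 8) ^ 4 * X * quadCount s u (1 / (8 * X)) ≤
      5 * ∫ x in (0:ℝ)..X, ‖TW a b c P x‖ ^ 4 := hq
  have hI2 : ∫ x in (0:ℝ)..X, ‖TW a b c P x‖ ^ 4 ≤
      (C₂ ^ 4 + C₁) * (1 + 4 * Real.log P) ^ 2 * (P ^ 4 * (1 + E)) := by
    refine hI.trans ?_
    have f1 : (C₂ * P) ^ 4 ≤ C₂ ^ 4 * (1 + 4 * Real.log P) ^ 2 * (P ^ 4 * (1 + E)) := by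
      calc (C₂ * P) ^ 4 = C₂ ^ 4 * 1 * (P ^ 4 * 1) := by ring
        _ ≤ _ := by
          gcongr
          · exact one_le_pow₀ (by linarith)
          · linarith
    have f2 : (J : ℝ) * (C₁ * (1 + 4 * Real.log P) * (P ^ 4 * (1 + E))) ≤
        (1 + 4 * Real.log P) * (C₁ * (1 + 4 * Real.log P) * (P ^ 4 * (1 + E))) := by gcongr
    linarith
  rw [mul_one_div, le_div_iff₀ hX0]
  have hq3 := hq2.trans (mul_le_mul_of_nonneg_left hI2 (by norm_num))
  rw [show (1 / 8 : ℝ) ^ 4 * X * quadCount s u (1 / (8 * X)) =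
    (quadCount s u (1 / (8 * X)) * X) / 8 ^ 4 by ring, div_le_iff₀ (by norm_num)] at hq3
  refine hq3.trans (le_of_eq ?_)
  ring

lemma quadBound_improve {β : ℝ} (hβ : 0 < β) (hβ2 : β ≤ 2) (H : QuadBound β) :
    QuadBound (β - β ^ 2 / 8) := by
  intro c Λ hc hΛ
  have hΛ0 : 0 < Λ := by linarith
  set η := β / 4 with hη
  have hη0 : 0 < η := by positivity
  obtain ⟨C₁, hC₁, h₁⟩ := quadCount_le_of_scale (η := η) H hβ.le hc hΛ hη0.le
  set ε := β ^ 2 / 16 with hε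
  have hε0 : 0 < ε := by positivity
  set L := 1 + 4 / ε with hL
  have hL0 : 0 < L := by positivity
  set C := C₁ * 16 * L ^ 2 with hC
  refine ⟨C + 128 * Λ ^ 4, by positivity, fun P δ hP hδ => ?_⟩
  have hP0 : 0 < P := by linarith
  have hlP : 0 ≤ Real.log P := Real.log_nonneg hP
  set s := Finset.Icc ⌈P / Λ⌉₊ ⌊Λ * P⌋₊ with hs
  set u : ℕ → ℝ := fun n => ((n : ℝ) / P) ^ c with hu
  have hPβ : P ^ 4 ≤ P ^ (4 + (β - β ^ 2 / 8)) := by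
    rw [← Real.rpow_natCast]
    refine Real.rpow_le_rpow_of_exponent_le hP ?_
    push_cast
    nlinarith
  rcases le_or_gt (1 / 8) δ with hδ8 | hδ8
  · have h1 : (quadCount s u δ : ℝ) ≤ (#s : ℝ) ^ 4 := by exact_mod_cast quadCount_le s u δ
    have h2 : (#s : ℝ) ≤ 2 * Λ * P := by
      have h3 : #s ≤ ⌊Λ * P⌋₊ + 1 := by rw [hs, Nat.card_Icc]; omega
      have h4 : (#s : ℝ) ≤ ⌊Λ * P⌋₊ + 1 := by exact_mod_cast h3
      have := Nat.floor_le (by positivity : 0 ≤ Λ * P)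
      nlinarith
    calc (quadCount s u δ : ℝ) ≤ (2 * Λ * P) ^ 4 := h1.trans (by gcongr)
      _ = 128 * Λ ^ 4 * P ^ 4 * (1 / 8) := by ring
      _ ≤ (C + 128 * Λ ^ 4) * P ^ (4 + (β - β ^ 2 / 8)) * (δ + (P ^ 2)⁻¹) := by
          gcongr
          · exact le_add_of_nonneg_left (by positivity)
          · exact hδ8.trans (le_add_of_nonneg_right (by positivity))
  set E := P ^ ((1 - η) * β - η) with hE
  have hE0 : 0 < E := by positivity
  have hη2 : η ≤ 1 / 2 := by rw [hη]; linarith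
  have key := fun X => h₁ P X hP
  set X := min (1 / (8 * δ)) (P ^ (2 - η)) with hX
  have hX1 : 1 ≤ X := by
    refine le_min ?_ (Real.one_le_rpow hP (by linarith))
    rw [le_div_iff₀ (by positivity)]; linarith
  have hX0 : 0 < X := by linarith
  have hδX : δ ≤ 1 / (8 * X) := by
    have : X ≤ 1 / (8 * δ) := min_le_left _ _
    rw [le_div_iff₀ (by positivity)] at this ⊢
    linarith
  have hinv : 1 / X ≤ 8 * (δ + (P ^ 2)⁻¹) * P ^ η := by
    have hPη : 1 ≤ P ^ η := Real.one_le_rpow hP hη0.le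
    rcases min_choice (1 / (8 * δ)) (P ^ (2 - η)) with h | h
    · rw [hX, h, one_div_one_div]
      have : 0 < (P ^ 2)⁻¹ := by positivity
      nlinarith [mul_le_mul_of_nonneg_left hPη (by positivity : 0 ≤ 8 * (δ + (P ^ 2)⁻¹))]
    · rw [hX, h, Real.rpow_sub hP0, one_div_div, show (2:ℝ) = ((2:ℕ):ℝ) by norm_num,
        Real.rpow_natCast, div_eq_inv_mul]
      have : 0 < (P ^ 2)⁻¹ := by positivity
      gcongr
      linarith
  have hlog : 1 + 4 * Real.log P ≤ L * P ^ ε := by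
    have g1 := Real.log_le_rpow_div hP0.le hε0
    have g2 : 1 ≤ P ^ ε := Real.one_le_rpow hP hε0.le
    have g3 : L * P ^ ε = P ^ ε + 4 * (P ^ ε / ε) := by rw [hL]; ring
    linarith
  have hE2 : P ^ η * (1 + E) ≤ 2 * P ^ ((1 - η) * β) := by
    have g1 : P ^ η ≤ P ^ ((1 - η) * β) := Real.rpow_le_rpow_of_exponent_le hP (by
      rw [hη] at hη2 ⊢; nlinarith)
    have g2 : P ^ η * E = P ^ ((1 - η) * β) := by
      rw [hE, ← Real.rpow_add hP0]; congr 1; ring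
    linarith
  calc (quadCount s u δ : ℝ) ≤ quadCount s u (1 / (8 * X)) := by
        exact_mod_cast quadCount_mono (Subset.refl s) u hδX
    _ ≤ C₁ * (1 + 4 * Real.log P) ^ 2 * (P ^ 4 * (1 + E)) * (1 / X) :=
        key X hX1 (min_le_right _ _)
    _ ≤ C₁ * (L * P ^ ε) ^ 2 * (P ^ 4 * (1 + E)) *
          (8 * (δ + (P ^ 2)⁻¹) * P ^ η) := by gcongr
    _ = C₁ * 8 * L ^ 2 * (P ^ ε) ^ 2 * P ^ 4 * (P ^ η * (1 + E)) *
          (δ + (P ^ 2)⁻¹) := by ring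
    _ ≤ C₁ * 8 * L ^ 2 * (P ^ ε) ^ 2 * P ^ 4 * (2 * P ^ ((1 - η) * β)) *
          (δ + (P ^ 2)⁻¹) := by gcongr
    _ = C * ((P ^ ε) ^ 2 * P ^ 4 * P ^ ((1 - η) * β)) * (δ + (P ^ 2)⁻¹) := by rw [hC]; ring
    _ = C * P ^ (4 + (β - β ^ 2 / 8)) * (δ + (P ^ 2)⁻¹) := by
        congr 2
        rw [← Real.rpow_natCast, ← Real.rpow_natCast, ← Real.rpow_mul hP0.le, ← Real.rpow_add hP0,
          ← Real.rpow_add hP0]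
        congr 1
        rw [hε, hη]; push_cast; ring
    _ ≤ _ := by
        gcongr
        exact le_add_of_nonneg_right (by positivity)

lemma quadBound_two : QuadBound 2 := by
  intro c Λ _ hΛ
  have hΛ0 : 0 < Λ := by linarith
  refine ⟨16 * Λ ^ 4, by positivity, fun P δ hP hδ => ?_⟩
  have hP0 : 0 < P := by linarith
  set s := Finset.Icc ⌈P / Λ⌉₊ ⌊Λ * P⌋₊ with hs
  have h1 : (quadCount s (fun n => ((n : ℝ) / P) ^ c) δ : ℝ) ≤ (#s : ℝ) ^ 4 := by
    exact_mod_cast quadCount_le s _ δ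
  have h2 : (#s : ℝ) ≤ 2 * Λ * P := by
    have h3 : #s ≤ ⌊Λ * P⌋₊ + 1 := by rw [hs, Nat.card_Icc]; omega
    have h4 : (#s : ℝ) ≤ ⌊Λ * P⌋₊ + 1 := by exact_mod_cast h3
    have := Nat.floor_le (by positivity : 0 ≤ Λ * P)
    nlinarith
  calc (quadCount s (fun n => ((n : ℝ) / P) ^ c) δ : ℝ) ≤ (2 * Λ * P) ^ 4 := h1.trans (by gcongr)
    _ = 16 * Λ ^ 4 * P ^ 6 * (P ^ 2)⁻¹ := by field_simp; norm_num
    _ ≤ 16 * Λ ^ 4 * P ^ 6 * (δ + (P ^ 2)⁻¹) := by gcongr; linarith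
    _ = _ := by
        rw [show (4 + 2 : ℝ) = ((6:ℕ) : ℝ) by norm_num, Real.rpow_natCast]

lemma QuadBound.mono {β β' : ℝ} (h : β ≤ β') (H : QuadBound β) : QuadBound β' := by
  intro c Λ hc hΛ
  obtain ⟨C, hC, hb⟩ := H c Λ hc hΛ
  refine ⟨C, hC, fun P δ hP hδ => (hb P δ hP hδ).trans ?_⟩
  gcongr

lemma quadBound_of_pos {β : ℝ} (hβ : 0 < β) : QuadBound β := by
  set S : Set ℝ := {b | 0 < b ∧ b ≤ 2 ∧ QuadBound b}
  have hne : S.Nonempty := ⟨2, by norm_num, le_rfl, quadBound_two⟩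
  have hbdd : BddBelow S := ⟨0, fun b hb => hb.1.le⟩
  by_contra hcon
  have hlow : ∀ b ∈ S, β ≤ b := fun b hb => by
    by_contra! h
    exact hcon (hb.2.2.mono h.le)
  have hβb : β ≤ sInf S := le_csInf hne hlow
  set m := sInf S
  have hm0 : 0 < m := hβ.trans_le hβb
  obtain ⟨b, hb, hbm⟩ := exists_lt_of_csInf_lt hne (show sInf S < m + m ^ 2 / 8 by
    have : 0 < m ^ 2 / 8 := by positivity
    change m < _; linarith)
  have hmb : m ≤ b := csInf_le hbdd hb
  have hb' : b - b ^ 2 / 8 ∈ S := by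
    refine ⟨?_, ?_, quadBound_improve hb.1 hb.2.1 hb.2.2⟩
    · nlinarith [hb.1, hb.2.1]
    · nlinarith [hb.1, hb.2.1]
  have := csInf_le hbdd hb'
  change m ≤ _ at this
  nlinarith

lemma one_add_log_pow_le (k : ℕ) {η : ℝ} (hη : 0 < η) :
    ∃ C : ℝ, 0 < C ∧ ∀ X : ℝ, 1 ≤ X → (1 + Real.log X) ^ k ≤ C * X ^ η := by
  have hd : 0 < η / (k + 1) := by positivity
  refine ⟨(1 + 1 / (η / (k + 1))) ^ k, by positivity, fun X hX => ?_⟩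
  have h0 : 0 < X := by linarith
  have h1 := Real.log_le_rpow_div h0.le hd
  have h2 : 1 ≤ X ^ (η / (k + 1)) := Real.one_le_rpow hX hd.le
  have hl := Real.log_nonneg hX
  calc (1 + Real.log X) ^ k ≤ ((1 + 1 / (η / (k + 1))) * X ^ (η / (k + 1))) ^ k := by
        gcongr
        rw [add_mul, one_mul, one_div_mul_eq_div]; linarith
    _ = (1 + 1 / (η / (k + 1))) ^ k * X ^ (η / (k + 1) * k) := by
        rw [mul_pow, ← Real.rpow_natCast (X ^ _), ← Real.rpow_mul h0.le]
    _ ≤ _ := by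
        gcongr
        rw [div_mul_eq_mul_div, div_le_iff₀ (by positivity)]; nlinarith

lemma monomial_sum_saving {c : ℝ} (hc1 : 1 < c) (hc3 : c < 3) (hc2 : c ≠ 2) :
    ∃ C : ℝ, 0 < C ∧ ∀ (X M γ : ℝ) (a b : ℕ), 1 ≤ X → X ^ (49 / 100 : ℝ) ≤ M →
      X ^ (39 / 100 : ℝ) ≤ |γ| * M ^ c → |γ| * M ^ c ≤ X ^ (211 / 100 : ℝ) →
      M ≤ a → (b : ℝ) ≤ 8 * M → ‖∑ n ∈ Ico a b, eC (γ * (n : ℝ) ^ c)‖ ≤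
        C * (M * X ^ (-(1 / 100) : ℝ)) := by
  obtain ⟨C₃, hC₃, H₃⟩ := monomial_sum_bound (by norm_num) diffTest_three
    (by exact_mod_cast hc3) (fallFac_three_ne_zero hc1 hc2)
  obtain ⟨C₅, hC₅, H₅⟩ := monomial_sum_bound (by norm_num) diffTest_five
    (by push_cast; linarith) (fallFac_five_ne_zero hc1 hc3 hc2)
  refine ⟨2 * (C₃ + C₅), by positivity, fun X M γ a b hX hM hT1 hT2 ha hb => ?_⟩
  have hX0 : 0 < X := by linarith
  have hM1 : 1 ≤ M := (Real.one_le_rpow hX (by norm_num)).trans hM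
  have hM0 : 0 < M := by linarith
  have hγ : γ ≠ 0 := by
    rintro rfl
    have := Real.rpow_pos_of_pos hX0 (39 / 100)
    simp at hT1; linarith
  set R := |γ| * M ^ c with hR
  have hR0 : 0 < R := by positivity
  have e : ∀ k : ℝ, |γ| * M ^ (c - k) = R * M ^ (-k) := fun k => by
    rw [hR, mul_assoc, ← Real.rpow_add hM0, ← sub_eq_add_neg]
  have hS : 0 ≤ M * X ^ (-(1 / 100) : ℝ) := by positivity
  rcases le_total R (M ^ (2 : ℝ)) with h | h
  · have := H₃ M γ a b hM0 hγ ha hb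
    push_cast at this
    rw [e] at this
    have h1 : (R * M ^ (-3 : ℝ)) ^ (1 / 6 : ℝ) ≤ X ^ (-(1 / 100) : ℝ) := by
      calc (R * M ^ (-3 : ℝ)) ^ (1 / 6 : ℝ) ≤ (M ^ (2 : ℝ) * M ^ (-3 : ℝ)) ^ (1 / 6 : ℝ) := by gcongr
        _ = M ^ (-(1 / 6) : ℝ) := by
          rw [← Real.rpow_add hM0, ← Real.rpow_mul hM0.le]; norm_num
        _ ≤ (X ^ (49 / 100 : ℝ)) ^ (-(1 / 6) : ℝ) :=
          Real.rpow_le_rpow_of_nonpos (by positivity) hM (by norm_num)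
        _ ≤ _ := by
          rw [← Real.rpow_mul hX0.le]
          exact Real.rpow_le_rpow_of_exponent_le hX (by norm_num)
    have h2 : M ^ (1 / 2 : ℝ) * (R * M ^ (-3 : ℝ)) ^ (-(1 / 6) : ℝ) ≤ M * X ^ (-(1 / 100) : ℝ) := by
      calc M ^ (1 / 2 : ℝ) * (R * M ^ (-3 : ℝ)) ^ (-(1 / 6) : ℝ) = M * R ^ (-(1 / 6) : ℝ) := by
            rw [Real.mul_rpow hR0.le (by positivity), ← Real.rpow_mul hM0.le, mul_left_comm,
              ← Real.rpow_add hM0, mul_comm]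
            norm_num
        _ ≤ M * (X ^ (39 / 100 : ℝ)) ^ (-(1 / 6) : ℝ) := by
            gcongr ?_ * ?_
            exact Real.rpow_le_rpow_of_nonpos (by positivity) hT1 (by norm_num)
        _ ≤ _ := by
          rw [← Real.rpow_mul hX0.le]
          gcongr ?_ * ?_
          exact Real.rpow_le_rpow_of_exponent_le hX (by norm_num)
    calc _ ≤ _ := this
      _ ≤ C₃ * (M * X ^ (-(1 / 100) : ℝ) + M * X ^ (-(1 / 100) : ℝ)) := by gcongr
      _ ≤ _ := by nlinarith
  · have := H₅ M γ a b hM0 hγ ha hb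
    push_cast at this
    rw [e] at this
    have h1 : (R * M ^ (-5 : ℝ)) ^ (1 / 30 : ℝ) ≤ X ^ (-(1 / 100) : ℝ) := by
      calc (R * M ^ (-5 : ℝ)) ^ (1 / 30 : ℝ)
          ≤ (X ^ (211 / 100 : ℝ) * (X ^ (49 / 100 : ℝ)) ^ (-5 : ℝ)) ^ (1 / 30 : ℝ) := by
            gcongr ?_ ^ (1 / 30 : ℝ)
            gcongr ?_ * ?_
            exact Real.rpow_le_rpow_of_nonpos (by positivity) hM (by norm_num)
        _ ≤ _ := by
          rw [← Real.rpow_mul hX0.le, ← Real.rpow_add hX0, ← Real.rpow_mul hX0.le]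
          exact Real.rpow_le_rpow_of_exponent_le hX (by norm_num)
    have h2 : M ^ (7 / 8 : ℝ) * (R * M ^ (-5 : ℝ)) ^ (-(1 / 30) : ℝ) ≤
        M * X ^ (-(1 / 100) : ℝ) := by
      calc M ^ (7 / 8 : ℝ) * (R * M ^ (-5 : ℝ)) ^ (-(1 / 30) : ℝ)
          ≤ M ^ (7 / 8 : ℝ) * (M ^ (2 : ℝ) * M ^ (-5 : ℝ)) ^ (-(1 / 30) : ℝ) := by
            gcongr ?_ * ?_
            exact Real.rpow_le_rpow_of_nonpos (by positivity) (by gcongr) (by norm_num)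
        _ = M * M ^ (-(1 / 40) : ℝ) := by
            rw [← Real.rpow_add hM0, ← Real.rpow_mul hM0.le, ← Real.rpow_add hM0]
            nth_rw 2 [← Real.rpow_one M]
            rw [← Real.rpow_add hM0]; norm_num
        _ ≤ M * (X ^ (49 / 100 : ℝ)) ^ (-(1 / 40) : ℝ) := by
            gcongr ?_ * ?_
            exact Real.rpow_le_rpow_of_nonpos (by positivity) hM (by norm_num)
        _ ≤ _ := by
          rw [← Real.rpow_mul hX0.le]
          gcongr ?_ * ?_
          exact Real.rpow_le_rpow_of_exponent_le hX (by norm_num)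
    calc _ ≤ _ := this
      _ ≤ C₅ * (M * X ^ (-(1 / 100) : ℝ) + M * X ^ (-(1 / 100) : ℝ)) := by gcongr
      _ ≤ _ := by nlinarith

lemma sum_card_divisors_sq_le (N : ℕ) :
    ∑ l ∈ Icc 1 N, (#l.divisors : ℝ) ^ 2 ≤ N * (1 + Real.log N) ^ 3 := by
  set S : Finset (Σ _ : ℕ, ℕ × ℕ) := (Icc 1 N).sigma fun l => l.divisors ×ˢ l.divisors
  set T : Finset (Σ _ : ℕ × ℕ × ℕ, ℕ) := (Icc 1 N ×ˢ Icc 1 N ×ˢ Icc 1 N).sigma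
    fun q => Icc 1 (N / (q.1 * q.2.1 * q.2.2))
  have hle : #S ≤ #T := by
    refine Finset.card_le_card_of_injOn
      (fun q => ⟨(q.2.1.gcd q.2.2, q.2.1 / q.2.1.gcd q.2.2, q.2.2 / q.2.1.gcd q.2.2),
        q.1 / q.2.1.lcm q.2.2⟩) ?_ ?_
    · rintro ⟨l, a, b⟩ hq
      simp only [S, Finset.mem_coe, mem_sigma, mem_Icc, mem_product, Nat.mem_divisors] at hq
      obtain ⟨⟨hl1, hlN⟩, ⟨ha, -⟩, ⟨hb, -⟩⟩ := hq
      have ha0 := Nat.pos_of_dvd_of_pos ha hl1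
      have hb0 := Nat.pos_of_dvd_of_pos hb hl1
      have hg0 : 0 < a.gcd b := Nat.gcd_pos_of_pos_left _ ha0
      have hga := Nat.le_of_dvd ha0 (Nat.gcd_dvd_left a b)
      have hgb := Nat.le_of_dvd hb0 (Nat.gcd_dvd_right a b)
      have hal := Nat.le_of_dvd hl1 ha
      have hbl := Nat.le_of_dvd hl1 hb
      have hlc : a.gcd b * (a / a.gcd b) * (b / a.gcd b) = a.lcm b := by
        rw [Nat.mul_div_cancel' (Nat.gcd_dvd_left a b), Nat.lcm,
          Nat.mul_div_assoc _ (Nat.gcd_dvd_right a b)]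
      have hld : a.lcm b ∣ l := Nat.lcm_dvd ha hb
      have hlc0 : 0 < a.lcm b := Nat.lcm_pos ha0 hb0
      simp only [T, Finset.mem_coe, mem_sigma, mem_product, mem_Icc, hlc]
      refine ⟨⟨⟨hg0, by omega⟩, ⟨Nat.div_pos hga hg0, (Nat.div_le_self _ _).trans (by omega)⟩,
        ⟨Nat.div_pos hgb hg0, (Nat.div_le_self _ _).trans (by omega)⟩⟩,
        Nat.div_pos (Nat.le_of_dvd hl1 hld) hlc0, Nat.div_le_div_right hlN⟩
    · rintro ⟨l, a, b⟩ hq ⟨l', a', b'⟩ hq' h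
      simp only [S, Finset.mem_coe, mem_sigma, mem_Icc, mem_product, Nat.mem_divisors] at hq hq'
      simp only [Sigma.mk.injEq, Prod.mk.injEq, heq_eq_eq] at h
      obtain ⟨⟨h1, h2, h3⟩, h4⟩ := h
      have ea : a = a' := by
        rw [← Nat.mul_div_cancel' (Nat.gcd_dvd_left a b), h2, h1,
          Nat.mul_div_cancel' (Nat.gcd_dvd_left a' b')]
      have eb : b = b' := by
        rw [← Nat.mul_div_cancel' (Nat.gcd_dvd_right a b), h3, h1,
          Nat.mul_div_cancel' (Nat.gcd_dvd_right a' b')]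
      subst ea eb
      have el : l = l' := by
        rw [← Nat.mul_div_cancel' (Nat.lcm_dvd hq.2.1.1 hq.2.2.1), h4,
          Nat.mul_div_cancel' (Nat.lcm_dvd hq'.2.1.1 hq'.2.2.1)]
      rw [el]
  have hS : ∑ l ∈ Icc 1 N, (#l.divisors : ℝ) ^ 2 = (#S : ℝ) := by
    simp [S, card_sigma, pow_two]
  have hh : ∑ i ∈ Icc 1 N, ((i : ℝ))⁻¹ ≤ 1 + Real.log N := by
    have := harmonic_le_one_add_log N
    rw [harmonic_eq_sum_Icc] at this
    push_cast at this
    exact this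
  calc _ = (#S : ℝ) := hS
    _ ≤ #T := by exact_mod_cast hle
    _ = ∑ q ∈ Icc 1 N ×ˢ Icc 1 N ×ˢ Icc 1 N, ((N / (q.1 * q.2.1 * q.2.2) : ℕ) : ℝ) := by
      simp [T, card_sigma]
    _ ≤ ∑ q ∈ Icc 1 N ×ˢ Icc 1 N ×ˢ Icc 1 N, (N : ℝ) * ((q.1 : ℝ)⁻¹ * ((q.2.1 : ℝ)⁻¹ * (q.2.2 : ℝ)⁻¹)) := by
      refine sum_le_sum fun q _ => Nat.cast_div_le.trans (le_of_eq ?_)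
      push_cast
      rw [div_eq_mul_inv, mul_inv, mul_inv, mul_assoc]
    _ = N * (∑ i ∈ Icc 1 N, ((i : ℝ))⁻¹) ^ 3 := by
      rw [← mul_sum, pow_succ', pow_two, sum_mul_sum, sum_mul_sum, sum_product]
      simp_rw [sum_product, mul_sum]
    _ ≤ _ := by
      gcongr

open scoped ComplexConjugate in
lemma sq_norm_bilinear_le (s t : Finset ℕ) (a b : ℕ → ℂ) (K : ℕ → ℕ → ℂ) {D E : ℝ} (hE0 : 0 ≤ E)
    (hD : ∀ y ∈ t, ‖∑ x ∈ s, K x y * conj (K x y)‖ ≤ D)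
    (hE : ∀ y ∈ t, ∀ y' ∈ t, y ≠ y' → ‖∑ x ∈ s, K x y * conj (K x y')‖ ≤ E) :
    ‖∑ x ∈ s, ∑ y ∈ t, a x * b y * K x y‖ ^ 2 ≤
      (∑ x ∈ s, ‖a x‖ ^ 2) * (D * ∑ y ∈ t, ‖b y‖ ^ 2 + E * (∑ y ∈ t, ‖b y‖) ^ 2) := by
  have h1 : ‖∑ x ∈ s, ∑ y ∈ t, a x * b y * K x y‖ ≤
      ∑ x ∈ s, ‖a x‖ * ‖∑ y ∈ t, b y * K x y‖ := by
    refine (norm_sum_le _ _).trans (sum_le_sum fun x _ => ?_)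
    rw [← norm_mul, mul_sum]; simp only [mul_assoc]; rfl
  have h2 : ((∑ x ∈ s, ‖∑ y ∈ t, b y * K x y‖ ^ 2 : ℝ) : ℂ) =
      ∑ y ∈ t, ∑ y' ∈ t, b y * conj (b y') * ∑ x ∈ s, K x y * conj (K x y') := by
    push_cast
    calc _ = ∑ x ∈ s, ∑ y ∈ t, ∑ y' ∈ t, b y * conj (b y') * (K x y * conj (K x y')) := by
          refine sum_congr rfl fun x _ => ?_
          rw [← Complex.mul_conj', map_sum, sum_mul_sum]
          refine sum_congr rfl fun y _ => sum_congr rfl fun y' _ => ?_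
          rw [map_mul]; ring
      _ = _ := by
          rw [sum_comm]
          refine sum_congr rfl fun y _ => ?_
          rw [sum_comm]
          exact sum_congr rfl fun y' _ => (mul_sum _ _ _).symm
  have h3 : ∑ x ∈ s, ‖∑ y ∈ t, b y * K x y‖ ^ 2 ≤
      D * ∑ y ∈ t, ‖b y‖ ^ 2 + E * (∑ y ∈ t, ‖b y‖) ^ 2 := by
    calc _ = ‖((∑ x ∈ s, ‖∑ y ∈ t, b y * K x y‖ ^ 2 : ℝ) : ℂ)‖ := by
          rw [Complex.norm_real, Real.norm_of_nonneg (by positivity)]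
      _ ≤ ∑ y ∈ t, ∑ y' ∈ t, ((if y = y' then D * ‖b y‖ ^ 2 else 0) + E * (‖b y‖ * ‖b y'‖)) := by
          rw [h2]
          refine (norm_sum_le _ _).trans (sum_le_sum fun y hy => (norm_sum_le _ _).trans
            (sum_le_sum fun y' hy' => ?_))
          rw [norm_mul, norm_mul, RCLike.norm_conj]
          split_ifs with h
          · subst h
            have := mul_le_mul_of_nonneg_left (hD y hy) (by positivity : 0 ≤ ‖b y‖ * ‖b y‖)
            nlinarith [mul_nonneg hE0 (by positivity : 0 ≤ ‖b y‖ * ‖b y‖)]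
          · have := mul_le_mul_of_nonneg_left (hE y hy y' hy' h) (by positivity : 0 ≤ ‖b y‖ * ‖b y'‖)
            linarith
      _ = _ := by
          simp_rw [sum_add_distrib, ← mul_sum, ← sum_mul]
          rw [pow_two (∑ y ∈ t, ‖b y‖)]
          congr 1
          rw [mul_sum]
          exact sum_congr rfl fun y hy => by simp [hy]
  calc _ ≤ (∑ x ∈ s, ‖a x‖ * ‖∑ y ∈ t, b y * K x y‖) ^ 2 := by gcongr
    _ ≤ (∑ x ∈ s, ‖a x‖ ^ 2) * ∑ x ∈ s, ‖∑ y ∈ t, b y * K x y‖ ^ 2 := sum_mul_sq_le_sq_mul_sq _ _ _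
    _ ≤ _ := by gcongr

lemma abs_rpow_sub_rpow_ge {c : ℝ} (hc : 1 < c) {L : ℝ} (hL : 0 < L) {x y : ℕ} (hx : L ≤ x)
    (hy : L ≤ y) (hxy : x ≠ y) : L ^ (c - 1) ≤ |(x : ℝ) ^ c - (y : ℝ) ^ c| := by
  wlog h : y < x generalizing x y with H
  · rw [abs_sub_comm]; exact H hy hx hxy.symm (by omega)
  have h1 : ((y : ℝ) + 1) ≤ x := by exact_mod_cast h
  have hy0 : 0 < (y : ℝ) := hL.trans_le hy
  have h2 : (y : ℝ) ^ c ≤ (x : ℝ) ^ (c - 1) * y := by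
    calc (y : ℝ) ^ c = (y : ℝ) ^ (c - 1) * y := by
          rw [← Real.rpow_add_one hy0.ne']; norm_num
      _ ≤ _ := by gcongr
  have h3 : (x : ℝ) ^ c = (x : ℝ) ^ (c - 1) * x := by
    rw [← Real.rpow_add_one (by linarith : (x : ℝ) ≠ 0)]; norm_num
  have h4 : L ^ (c - 1) ≤ (x : ℝ) ^ (c - 1) := by gcongr
  refine le_trans ?_ (le_abs_self _)
  rw [h3]
  nlinarith [Real.rpow_pos_of_pos hL (c - 1)]

lemma filter_mul_Ioc_eq_Ico {M A N y y' : ℕ} (hy : 0 < y) (hy' : 0 < y') :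
    ((Ico M (2 * M)).filter fun x => (A < x * y ∧ x * y ≤ N) ∧ A < x * y' ∧ x * y' ≤ N) =
      Ico (max M (max (A / y + 1) (A / y' + 1))) (min (2 * M) (min (N / y + 1) (N / y' + 1))) := by
  ext x
  simp only [mem_filter, mem_Ico, max_le_iff, lt_min_iff, Nat.lt_succ_iff, Nat.succ_le_iff,
    Nat.le_div_iff_mul_le hy, Nat.le_div_iff_mul_le hy', Nat.div_lt_iff_lt_mul hy,
    Nat.div_lt_iff_lt_mul hy']
  tauto

open scoped ComplexConjugate in
lemma bilinear_sum_bound {c : ℝ} (hc1 : 1 < c) (hc3 : c < 3) (hc2 : c ≠ 2) :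
    ∃ C : ℝ, 0 < C ∧ ∀ (X γ : ℝ) (M L A N : ℕ) (a b : ℕ → ℂ), 1 ≤ X → 16 ^ 3 ≤ X ^ (1 / 100 : ℝ) →
      X ^ (9 / 10 : ℝ) ≤ |γ| * X ^ c → |γ| * X ^ c ≤ X ^ (21 / 10 : ℝ) → 1 ≤ L → L ≤ M →
      (M : ℝ) * L ≤ X → X ≤ 16 * ((M : ℝ) * L) →
      ‖∑ x ∈ Ico M (2 * M), ∑ y ∈ Ico L (2 * L),
        a x * b y * if A < x * y ∧ x * y ≤ N then eC (γ * ((x * y : ℕ) : ℝ) ^ c) else 0‖ ^ 2 ≤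
      C * ((∑ x ∈ Ico M (2 * M), ‖a x‖ ^ 2) * (∑ y ∈ Ico L (2 * L), ‖b y‖ ^ 2) *
        (M * (1 + L * X ^ (-(1 / 100) : ℝ)))) := by
  obtain ⟨C, hC, H⟩ := monomial_sum_saving hc1 hc3 hc2
  refine ⟨1 + C, by positivity, fun X γ M L A N a b hX hX0 hT1 hT2 hL hLM hX1 hX2 => ?_⟩
  have hX' : 0 < X := by linarith
  have hL' : (1 : ℝ) ≤ L := by exact_mod_cast hL
  have hLM' : (L : ℝ) ≤ M := by exact_mod_cast hLM
  have hM' : (1 : ℝ) ≤ M := hL'.trans hLM'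
  have hLX : (L : ℝ) ≤ X ^ (1 / 2 : ℝ) := by
    rw [← Real.sqrt_eq_rpow]
    exact Real.le_sqrt_of_sq_le (by nlinarith)
  have hMX : X ^ (49 / 100 : ℝ) ≤ M := by
    have h1 : X ^ (1 / 2 : ℝ) ≤ 4 * M := by
      rw [← Real.sqrt_eq_rpow, Real.sqrt_le_left (by positivity)]
      nlinarith
    have h2 : X ^ (1 / 2 : ℝ) = X ^ (49 / 100 : ℝ) * X ^ (1 / 100 : ℝ) := by
      rw [← Real.rpow_add hX']; norm_num
    have h3 := Real.rpow_pos_of_pos hX' (49 / 100)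
    nlinarith
  have h16 : (16 : ℝ) ^ c ≤ X ^ (1 / 100 : ℝ) := by
    refine le_trans ?_ hX0
    rw [← Real.rpow_natCast 16 3]
    exact Real.rpow_le_rpow_of_exponent_le (by norm_num) (by push_cast; linarith)
  have hoff : ∀ y ∈ Ico L (2 * L), ∀ y' ∈ Ico L (2 * L), y ≠ y' →
      X ^ (39 / 100 : ℝ) ≤ |γ * ((y : ℝ) ^ c - (y' : ℝ) ^ c)| * (M : ℝ) ^ c ∧
      |γ * ((y : ℝ) ^ c - (y' : ℝ) ^ c)| * (M : ℝ) ^ c ≤ X ^ (211 / 100 : ℝ) := by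
    intro y hy y' hy' hne
    rw [mem_Ico] at hy hy'
    have hyL : (L : ℝ) ≤ y := by exact_mod_cast hy.1
    have hyL' : (L : ℝ) ≤ y' := by exact_mod_cast hy'.1
    have hyU : (y : ℝ) ≤ 2 * L := by exact_mod_cast hy.2.le
    have hyU' : (y' : ℝ) ≤ 2 * L := by exact_mod_cast hy'.2.le
    rw [abs_mul, mul_assoc]
    constructor
    · have h1 := abs_rpow_sub_rpow_ge hc1 (by linarith : (0 : ℝ) < L) hyL hyL' hne
      have h2 : X ^ c ≤ 16 ^ c * ((L : ℝ) ^ (c - 1) * (M : ℝ) ^ c) * L := by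
        have e : (L : ℝ) ^ c = (L : ℝ) ^ (c - 1) * L := by
          rw [← Real.rpow_add_one (by positivity)]; norm_num
        calc X ^ c ≤ (16 * ((M : ℝ) * L)) ^ c := by gcongr
          _ = _ := by
            rw [Real.mul_rpow (by norm_num) (by positivity),
              Real.mul_rpow (by positivity) (by positivity), e]; ring
      have h3 : X ^ (9 / 10 : ℝ) = X ^ (39 / 100 : ℝ) * X ^ (1 / 100 : ℝ) * X ^ (1 / 2 : ℝ) := by
        rw [← Real.rpow_add hX', ← Real.rpow_add hX']; norm_num
      have h4 : X ^ (39 / 100 : ℝ) * X ^ (1 / 100 : ℝ) * X ^ (1 / 2 : ℝ) ≤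
          (|γ| * ((L : ℝ) ^ (c - 1) * (M : ℝ) ^ c)) * X ^ (1 / 100 : ℝ) * X ^ (1 / 2 : ℝ) := by
        calc _ ≤ |γ| * X ^ c := h3 ▸ hT1
          _ ≤ |γ| * (16 ^ c * ((L : ℝ) ^ (c - 1) * (M : ℝ) ^ c) * L) := by gcongr
          _ = (|γ| * ((L : ℝ) ^ (c - 1) * (M : ℝ) ^ c)) * 16 ^ c * L := by ring
          _ ≤ _ := by gcongr
      have h5 := le_of_mul_le_mul_right (le_of_mul_le_mul_right h4 (by positivity)) (by positivity)
      refine h5.trans ?_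
      gcongr
    · have h1 : |(y : ℝ) ^ c - (y' : ℝ) ^ c| ≤ (2 * L) ^ c := by
        have u1 : (y : ℝ) ^ c ≤ (2 * L) ^ c := by gcongr
        have u2 : (y' : ℝ) ^ c ≤ (2 * L) ^ c := by gcongr
        have u3 : 0 ≤ (y : ℝ) ^ c := by positivity
        have u4 : 0 ≤ (y' : ℝ) ^ c := by positivity
        rw [abs_le]; constructor <;> linarith
      calc _ ≤ |γ| * ((2 * L) ^ c * (M : ℝ) ^ c) := by gcongr
        _ = |γ| * (2 ^ c * ((M : ℝ) * L) ^ c) := by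
          rw [Real.mul_rpow (by norm_num) (by positivity),
              Real.mul_rpow (by positivity) (by positivity)]; ring
        _ ≤ |γ| * (16 ^ c * X ^ c) := by gcongr; norm_num
        _ = 16 ^ c * (|γ| * X ^ c) := by ring
        _ ≤ X ^ (1 / 100 : ℝ) * X ^ (21 / 10 : ℝ) := by gcongr
        _ = _ := by rw [← Real.rpow_add hX']; norm_num
  have key := sq_norm_bilinear_le (Ico M (2 * M)) (Ico L (2 * L)) a b
    (fun x y => if A < x * y ∧ x * y ≤ N then eC (γ * ((x * y : ℕ) : ℝ) ^ c) else 0)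
    (D := M) (E := C * (M * X ^ (-(1 / 100) : ℝ))) (by positivity) ?_ ?_
  · refine key.trans ?_
    have hb : (∑ y ∈ Ico L (2 * L), ‖b y‖) ^ 2 ≤ L * ∑ y ∈ Ico L (2 * L), ‖b y‖ ^ 2 := by
      have := sq_sum_le_card_mul_sum_sq (s := Ico L (2 * L)) (f := fun y => ‖b y‖)
      rw [Nat.card_Ico, show 2 * L - L = L by omega] at this
      exact this
    calc _ ≤ (∑ x ∈ Ico M (2 * M), ‖a x‖ ^ 2) * (M * ∑ y ∈ Ico L (2 * L), ‖b y‖ ^ 2 +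
          C * (M * X ^ (-(1 / 100) : ℝ)) * (L * ∑ y ∈ Ico L (2 * L), ‖b y‖ ^ 2)) := by gcongr
      _ = ((∑ x ∈ Ico M (2 * M), ‖a x‖ ^ 2) * (∑ y ∈ Ico L (2 * L), ‖b y‖ ^ 2)) *
          (M * (1 + C * (L * X ^ (-(1 / 100) : ℝ)))) := by ring
      _ ≤ ((∑ x ∈ Ico M (2 * M), ‖a x‖ ^ 2) * (∑ y ∈ Ico L (2 * L), ‖b y‖ ^ 2)) *
          (M * ((1 + C) * (1 + L * X ^ (-(1 / 100) : ℝ)))) := by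
        gcongr
        have : 0 ≤ L * X ^ (-(1 / 100) : ℝ) := by positivity
        nlinarith
      _ = _ := by ring
  · intro y _
    refine (norm_sum_le _ _).trans ?_
    calc _ ≤ ∑ x ∈ Ico M (2 * M), (1 : ℝ) := by
          refine sum_le_sum fun x _ => ?_
          split_ifs <;> simp [norm_eC]
      _ = M := by rw [sum_const, Nat.card_Ico, show 2 * M - M = M by omega]; simp
  · intro y hy y' hy' hne
    have h := hoff y hy y' hy' hne
    rw [mem_Ico] at hy hy'
    have e : ∀ x : ℕ, (if A < x * y ∧ x * y ≤ N then eC (γ * ((x * y : ℕ) : ℝ) ^ c) else 0) *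
        conj (if A < x * y' ∧ x * y' ≤ N then eC (γ * ((x * y' : ℕ) : ℝ) ^ c) else 0) =
        if (A < x * y ∧ x * y ≤ N) ∧ A < x * y' ∧ x * y' ≤ N then
          eC (γ * ((y : ℝ) ^ c - (y' : ℝ) ^ c) * (x : ℝ) ^ c) else 0 := by
      intro x
      by_cases h1 : A < x * y ∧ x * y ≤ N <;> by_cases h2 : A < x * y' ∧ x * y' ≤ N <;>
        simp only [h1, h2, and_self, if_true, if_false, and_true, and_false,
          map_zero, mul_zero, zero_mul]
      rw [← eC_neg, ← eC_add]
      push_cast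
      rw [Real.mul_rpow (by positivity) (by positivity), Real.mul_rpow (by positivity) (by positivity)]
      congr 1; ring
    simp only [e]
    rw [← sum_filter, filter_mul_Ioc_eq_Ico (by omega) (by omega)]
    refine H X M _ _ _ hX hMX h.1 h.2 ?_ ?_
    · exact_mod_cast le_max_left _ _
    · have : min (2 * M) (min (N / y + 1) (N / y' + 1)) ≤ 8 * M := (min_le_left _ _).trans (by omega)
      exact_mod_cast this

lemma sum_divisorsAntidiagonal_eq_sum_ite {A N B : ℕ} (hB : N < B) (g : ℕ → ℕ → ℂ) :
    ∑ n ∈ Ioc A N, ∑ p ∈ n.divisorsAntidiagonal, g p.1 p.2 =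
      ∑ x ∈ Ico 1 B, ∑ y ∈ Ico 1 B, if A < x * y ∧ x * y ≤ N then g x y else 0 := by
  rw [← sum_product', ← sum_filter, sum_sigma']
  refine sum_nbij' (fun q => q.2) (fun p => ⟨p.1 * p.2, p⟩) ?_ ?_ ?_ ?_ ?_
  · rintro ⟨n, x, y⟩ h
    simp only [mem_sigma, mem_Ioc, Nat.mem_divisorsAntidiagonal] at h
    obtain ⟨⟨h1, h2⟩, rfl, h3⟩ := h
    have hx : 0 < x := Nat.pos_of_ne_zero (by rintro rfl; simp at h3)
    have hy : 0 < y := Nat.pos_of_ne_zero (by rintro rfl; simp at h3)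
    have := Nat.le_mul_of_pos_right x hy
    have := Nat.le_mul_of_pos_left y hx
    simp only [mem_filter, mem_product, mem_Ico]
    omega
  · rintro ⟨x, y⟩ h
    simp only [mem_filter, mem_product, mem_Ico] at h
    simp only [mem_sigma, mem_Ioc, Nat.mem_divisorsAntidiagonal]
    refine ⟨h.2, trivial, ?_⟩
    have := h.2.1; omega
  · rintro ⟨n, x, y⟩ h
    simp only [mem_sigma, mem_Ioc, Nat.mem_divisorsAntidiagonal] at h
    obtain ⟨_, rfl, _⟩ := h
    rfl
  · intros; rfl
  · intros; rfl

lemma sum_Ico_one_two_pow (f : ℕ → ℂ) (K : ℕ) :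
    ∑ x ∈ Ico 1 (2 ^ K), f x = ∑ i ∈ range K, ∑ x ∈ Ico (2 ^ i) (2 * 2 ^ i), f x := by
  induction K with
  | zero => simp
  | succ K ih =>
    rw [sum_range_succ, ← ih, ← pow_succ', sum_Ico_consecutive _ Nat.one_le_two_pow
      (Nat.pow_le_pow_right (by norm_num) (by omega))]

lemma bilinear_block_bound {c : ℝ} (hc1 : 1 < c) (hc3 : c < 3) (hc2 : c ≠ 2) :
    ∃ C : ℝ, 0 < C ∧ ∀ (X γ W : ℝ) (M L A N : ℕ) (a b : ℕ → ℂ), 1 ≤ X →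
      16 ^ 3 ≤ X ^ (1 / 100 : ℝ) → 0 ≤ W →
      X ^ (9 / 10 : ℝ) ≤ |γ| * X ^ c → |γ| * X ^ c ≤ X ^ (21 / 10 : ℝ) →
      X ^ (1 / 10 : ℝ) ≤ 2 * M → X ^ (1 / 10 : ℝ) ≤ 2 * L →
      (M : ℝ) * L ≤ X → X ≤ 16 * ((M : ℝ) * L) →
      ∑ x ∈ Ico M (2 * M), ‖a x‖ ^ 2 ≤ M * W → ∑ y ∈ Ico L (2 * L), ‖b y‖ ^ 2 ≤ L * W →
      ‖∑ x ∈ Ico M (2 * M), ∑ y ∈ Ico L (2 * L),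
        a x * b y * if A < x * y ∧ x * y ≤ N then eC (γ * ((x * y : ℕ) : ℝ) ^ c) else 0‖ ≤
      C * (W * X ^ (1 - 1 / 200 : ℝ)) := by
  obtain ⟨C, hC, H⟩ := bilinear_sum_bound hc1 hc3 hc2
  refine ⟨√(3 * C), by positivity, fun X γ W M L A N a b hX hX0 hW hT1 hT2 => ?_⟩
  wlog hLM : L ≤ M generalizing M L a b with h
  · intro hM hL h1 h2 ha hb
    have := h L M b a (by omega) hL hM (by linarith) (by linarith) hb ha
    rw [sum_comm] at this
    simpa only [mul_comm] using this
  · intro hM hL h1 h2 ha hb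
    have hX' : 0 < X := by linarith
    have hL1 : 1 ≤ L := by
      have := Real.one_le_rpow hX (show (0 : ℝ) ≤ 1 / 10 by norm_num)
      have : (0 : ℝ) < L := by linarith
      exact_mod_cast this
    have := H X γ M L A N a b hX hX0 hT1 hT2 hL1 hLM h1 h2
    have hLi : 1 ≤ L * (2 * X ^ (-(1 / 100) : ℝ)) := by
      have e : X ^ (1 / 10 : ℝ) * X ^ (-(1 / 100) : ℝ) = X ^ (9 / 100 : ℝ) := by
        rw [← Real.rpow_add hX']; norm_num
      have := Real.one_le_rpow hX (show (0 : ℝ) ≤ 9 / 100 by norm_num)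
      have := Real.rpow_pos_of_pos hX' (-(1 / 100))
      nlinarith
    rw [← Real.sqrt_sq hW, show X ^ (1 - 1 / 200 : ℝ) = √(X ^ (2 : ℝ) * X ^ (-(1 / 100) : ℝ)) by
      rw [← Real.rpow_add hX', Real.sqrt_eq_rpow, ← Real.rpow_mul hX'.le]; norm_num,
      ← Real.sqrt_mul (by positivity), ← Real.sqrt_mul (by positivity)]
    refine Real.le_sqrt_of_sq_le (this.trans ?_)
    calc _ ≤ C * ((M * W) * (L * W) * (M * (L * (2 * X ^ (-(1 / 100) : ℝ)) +
          L * X ^ (-(1 / 100) : ℝ)))) := by gcongr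
      _ = 3 * C * (W ^ 2 * (((M : ℝ) * L) ^ 2 * X ^ (-(1 / 100) : ℝ))) := by ring
      _ ≤ 3 * C * (W ^ 2 * (X ^ 2 * X ^ (-(1 / 100) : ℝ))) := by gcongr
      _ = _ := by rw [← Real.rpow_natCast X 2]; norm_num

lemma typeII_sum_bound {c : ℝ} (hc1 : 1 < c) (hc3 : c < 3) (hc2 : c ≠ 2) :
    ∃ C : ℝ, 0 < C ∧ ∀ (X γ W : ℝ) (a b : ℕ → ℂ), 1 ≤ X →
      16 ^ 3 ≤ X ^ (1 / 100 : ℝ) → 0 ≤ W →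
      X ^ (9 / 10 : ℝ) ≤ |γ| * X ^ c → |γ| * X ^ c ≤ X ^ (21 / 10 : ℝ) →
      (∀ x : ℕ, (x : ℝ) ≤ X ^ (1 / 10 : ℝ) → a x = 0) →
      (∀ x : ℕ, (x : ℝ) ≤ X ^ (1 / 10 : ℝ) → b x = 0) →
      (∀ M : ℕ, 1 ≤ M → (M : ℝ) ≤ X → ∑ x ∈ Ico M (2 * M), ‖a x‖ ^ 2 ≤ M * W) →
      (∀ M : ℕ, 1 ≤ M → (M : ℝ) ≤ X → ∑ x ∈ Ico M (2 * M), ‖b x‖ ^ 2 ≤ M * W) →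
      ‖∑ n ∈ Ioc ⌊X / 2⌋₊ ⌊X⌋₊, ∑ p ∈ n.divisorsAntidiagonal,
        a p.1 * b p.2 * eC (γ * ((p.1 * p.2 : ℕ) : ℝ) ^ c)‖ ≤
      C * ((1 + Real.log X) ^ 2 * (W * X ^ (1 - 1 / 200 : ℝ))) := by
  obtain ⟨C, hC, H⟩ := bilinear_block_bound hc1 hc3 hc2
  refine ⟨4 * C, by positivity, fun X γ W a b hX hX0 hW hT1 hT2 ha hb hWa hWb => ?_⟩
  have hX' : 0 < X := by linarith
  have hlog := Real.log_nonneg hX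
  set A := ⌊X / 2⌋₊ with hA
  set N := ⌊X⌋₊ with hN
  set K := Nat.log 2 N + 1 with hK
  have hNX : (N : ℝ) ≤ X := Nat.floor_le hX'.le
  have hAX : X / 2 < A + 1 := Nat.lt_floor_add_one _
  have hN1 : 1 ≤ N := Nat.le_floor (by exact_mod_cast hX)
  have hKN : N < 2 ^ K := Nat.lt_pow_succ_log_self (by norm_num) N
  have hKl : (K : ℝ) ≤ 2 * (1 + Real.log X) := by
    have h1 : ((2 ^ Nat.log 2 N : ℕ) : ℝ) ≤ X :=
      le_trans (by exact_mod_cast Nat.pow_log_le_self 2 (by omega)) hNX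
    push_cast at h1
    have h2 := Real.log_le_log (by positivity) h1
    rw [Real.log_pow] at h2
    have h3 := Real.log_two_gt_d9
    have h4 : (0 : ℝ) ≤ (Nat.log 2 N : ℝ) := by positivity
    rw [hK]; push_cast
    nlinarith
  set B := C * (W * X ^ (1 - 1 / 200 : ℝ)) with hB
  have hB0 : 0 ≤ B := by positivity
  have hblock : ∀ i j : ℕ, ‖∑ x ∈ Ico (2 ^ i) (2 * 2 ^ i), ∑ y ∈ Ico (2 ^ j) (2 * 2 ^ j),
      a x * b y * if A < x * y ∧ x * y ≤ N then eC (γ * ((x * y : ℕ) : ℝ) ^ c) else 0‖ ≤ B := by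
    intro i j
    by_cases hne : ∃ x ∈ Ico (2 ^ i) (2 * 2 ^ i), ∃ y ∈ Ico (2 ^ j) (2 * 2 ^ j),
        a x * b y * (if A < x * y ∧ x * y ≤ N then eC (γ * ((x * y : ℕ) : ℝ) ^ c) else 0) ≠ 0
    · obtain ⟨x, hx, y, hy, h⟩ := hne
      have hax : a x ≠ 0 := by rintro h0; simp [h0] at h
      have hby : b y ≠ 0 := by rintro h0; simp [h0] at h
      have hxy : A < x * y ∧ x * y ≤ N := by
        by_contra h0; simp [h0] at h
      rw [mem_Ico] at hx hy
      have hx1 : ((2 ^ i : ℕ) : ℝ) ≤ x := by exact_mod_cast hx.1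
      have hy1 : ((2 ^ j : ℕ) : ℝ) ≤ y := by exact_mod_cast hy.1
      have hx2 : (x : ℝ) ≤ 2 * (2 ^ i : ℕ) := by exact_mod_cast hx.2.le
      have hy2 : (y : ℝ) ≤ 2 * (2 ^ j : ℕ) := by exact_mod_cast hy.2.le
      have hxa : X ^ (1 / 10 : ℝ) < x := by
        by_contra! h0; exact hax (ha x h0)
      have hyb : X ^ (1 / 10 : ℝ) < y := by
        by_contra! h0; exact hby (hb y h0)
      have hlow : X / 2 ≤ (x : ℝ) * y := hAX.le.trans (by exact_mod_cast hxy.1)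
      have hup : (x : ℝ) * y ≤ X := le_trans (by exact_mod_cast hxy.2) hNX
      have h1x : (1 : ℝ) ≤ x := le_trans (by exact_mod_cast Nat.one_le_two_pow) hx1
      have h1y : (1 : ℝ) ≤ y := le_trans (by exact_mod_cast Nat.one_le_two_pow) hy1
      have hML : ((2 ^ i : ℕ) : ℝ) * (2 ^ j : ℕ) ≤ x * y := by gcongr
      have hMLup : (x : ℝ) * y ≤ 2 * (2 ^ i : ℕ) * (2 * (2 ^ j : ℕ)) := by gcongr
      refine H X γ W _ _ A N a b hX hX0 hW hT1 hT2 (by linarith) (by linarith)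
        (hML.trans hup) (by linarith) (hWa _ Nat.one_le_two_pow ?_) (hWb _ Nat.one_le_two_pow ?_)
      · nlinarith
      · nlinarith
    · push Not at hne
      rw [sum_eq_zero fun x hx => sum_eq_zero fun y hy => hne x hx y hy, norm_zero]
      exact hB0
  rw [sum_divisorsAntidiagonal_eq_sum_ite hKN fun x y => a x * b y * eC (γ * ((x * y : ℕ) : ℝ) ^ c)]
  have e : ∀ x y : ℕ, (if A < x * y ∧ x * y ≤ N then a x * b y * eC (γ * ((x * y : ℕ) : ℝ) ^ c)
      else 0) = a x * b y * if A < x * y ∧ x * y ≤ N then eC (γ * ((x * y : ℕ) : ℝ) ^ c) else 0 :=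
    fun x y => by split_ifs <;> simp
  simp only [e]
  rw [sum_Ico_one_two_pow]
  simp only [sum_Ico_one_two_pow (fun y => _ * _ * _)]
  calc _ = ‖∑ i ∈ range K, ∑ j ∈ range K, ∑ x ∈ Ico (2 ^ i) (2 * 2 ^ i),
        ∑ y ∈ Ico (2 ^ j) (2 * 2 ^ j), a x * b y *
          if A < x * y ∧ x * y ≤ N then eC (γ * ((x * y : ℕ) : ℝ) ^ c) else 0‖ := by
        congr 1
        exact sum_congr rfl fun i _ => sum_comm
    _ ≤ ∑ i ∈ range K, ∑ j ∈ range K, B :=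
        (norm_sum_le _ _).trans (sum_le_sum fun i _ => (norm_sum_le _ _).trans
          (sum_le_sum fun j _ => hblock i j))
    _ = (K : ℝ) ^ 2 * B := by simp; ring
    _ ≤ (2 * (1 + Real.log X)) ^ 2 * B := by gcongr
    _ = _ := by rw [hB]; ring

lemma norm_sum_Ico_mul_le {w : ℕ → ℝ} (hw : Monotone w) (hw0 : ∀ n, 0 ≤ w n) {f : ℕ → ℂ} {a b : ℕ}
    {S : ℝ} (hS : ∀ t, a ≤ t → ‖∑ m ∈ Ico t b, f m‖ ≤ S) :
    ‖∑ m ∈ Ico a b, (w m : ℂ) * f m‖ ≤ w b * S := by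
  have hS0 : 0 ≤ S := (norm_nonneg _).trans (hS a le_rfl)
  rcases le_total b a with hab | hab
  · rw [Ico_eq_empty (by omega)]; simpa using mul_nonneg (hw0 b) hS0
  have key : ∀ k, a + k ≤ b → ‖∑ m ∈ Ico (b - k) b, ((w m - w (b - k) : ℝ) : ℂ) * f m‖ ≤
      (w b - w (b - k)) * S := by
    intro k
    induction k with
    | zero => intro; simp
    | succ k ih =>
      intro hk
      have ih := ih (by omega)
      have hs := hS (b - k) (by omega)
      obtain ⟨t, ht⟩ : ∃ t, b - (k + 1) = t := ⟨_, rfl⟩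
      have hb : b - k = t + 1 := by omega
      rw [hb] at ih hs
      rw [ht, sum_eq_sum_Ico_succ_bot (by omega)]
      have e : ∑ m ∈ Ico (t + 1) b, ((w m - w t : ℝ) : ℂ) * f m =
          ∑ m ∈ Ico (t + 1) b, ((w m - w (t + 1) : ℝ) : ℂ) * f m +
            ((w (t + 1) - w t : ℝ) : ℂ) * ∑ m ∈ Ico (t + 1) b, f m := by
        rw [mul_sum, ← sum_add_distrib]
        exact sum_congr rfl fun m _ => by push_cast; ring
      rw [e, sub_self, Complex.ofReal_zero, zero_mul, zero_add]
      have h1 : 0 ≤ w (t + 1) - w t := sub_nonneg.2 (hw (by omega))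
      calc _ ≤ (w b - w (t + 1)) * S + (w (t + 1) - w t) * S := by
            refine (norm_add_le _ _).trans (add_le_add ih ?_)
            rw [norm_mul, Complex.norm_real, Real.norm_of_nonneg h1]
            gcongr
        _ = _ := by ring
  have h := key (b - a) (by omega)
  rw [show b - (b - a) = a by omega] at h
  have e : ∑ m ∈ Ico a b, (w m : ℂ) * f m = ∑ m ∈ Ico a b, ((w m - w a : ℝ) : ℂ) * f m +
      (w a : ℂ) * ∑ m ∈ Ico a b, f m := by
    rw [mul_sum, ← sum_add_distrib]
    exact sum_congr rfl fun m _ => by push_cast; ring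
  rw [e]
  calc _ ≤ (w b - w a) * S + w a * S := by
        refine (norm_add_le _ _).trans (add_le_add h ?_)
        rw [norm_mul, Complex.norm_real, Real.norm_of_nonneg (hw0 a)]
        exact mul_le_mul_of_nonneg_left (hS a le_rfl) (hw0 a)
    _ = _ := by ring

lemma typeI_sum_bound {c : ℝ} (hc1 : 1 < c) (hc3 : c < 3) (hc2 : c ≠ 2) :
    ∃ C : ℝ, 0 < C ∧ ∀ (X γ G : ℝ) (v : ℕ → ℂ) (w : ℕ → ℝ), 1 ≤ X →
      16 ^ 3 ≤ X ^ (1 / 100 : ℝ) → 0 ≤ G →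
      X ^ (9 / 10 : ℝ) ≤ |γ| * X ^ c → |γ| * X ^ c ≤ X ^ (21 / 10 : ℝ) →
      Monotone w → (∀ n, 0 ≤ w n) →
      (∀ d : ℕ, X ^ (1 / 5 : ℝ) < d → v d = 0) → (∀ d : ℕ, (d : ℝ) ≤ X → ‖v d‖ ≤ G) →
      ‖∑ n ∈ Ioc ⌊X / 2⌋₊ ⌊X⌋₊, ∑ p ∈ n.divisorsAntidiagonal,
        v p.1 * w p.2 * eC (γ * ((p.1 * p.2 : ℕ) : ℝ) ^ c)‖ ≤
      C * (G * w (⌊X⌋₊ + 1) * (1 + Real.log X) * X ^ (1 - 1 / 100 : ℝ)) := by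
  obtain ⟨C, hC, H⟩ := monomial_sum_saving hc1 hc3 hc2
  refine ⟨C, hC, fun X γ G v w hX hX0 hG hT1 hT2 hw hw0 hv0 hv => ?_⟩
  have hX' : 0 < X := by linarith
  set A := ⌊X / 2⌋₊ with hA
  set N := ⌊X⌋₊ with hN
  have hNX : (N : ℝ) ≤ X := Nat.floor_le hX'.le
  have hAX : X / 2 < A + 1 := Nat.lt_floor_add_one _
  have hN1 : 1 ≤ N := Nat.le_floor (by exact_mod_cast hX)
  have h4 : (4 : ℝ) ^ c ≤ X ^ (1 / 100 : ℝ) := by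
    refine le_trans ?_ (le_trans (by norm_num : (4 : ℝ) ^ (3 : ℕ) ≤ 16 ^ 3) hX0)
    rw [← Real.rpow_natCast 4 3]
    exact Real.rpow_le_rpow_of_exponent_le (by norm_num) (by push_cast; linarith)
  have hinner : ∀ d ∈ Ico 1 (N + 1), (d : ℝ) ≤ X ^ (1 / 5 : ℝ) →
      ‖∑ m ∈ Ico (A / d + 1) (N / d + 1), (w m : ℂ) * eC (γ * ((d * m : ℕ) : ℝ) ^ c)‖ ≤
      w (N + 1) * (C * (X * (d : ℝ)⁻¹ * X ^ (-(1 / 100) : ℝ))) := by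
    intro d hd hdX
    have hd1 : 1 ≤ d := (mem_Ico.1 hd).1
    have hd0 : (0 : ℝ) < d := by exact_mod_cast hd1
    have hdX1 : (d : ℝ) ≤ X := hdX.trans
      ((Real.rpow_le_rpow_of_exponent_le hX (by norm_num)).trans_eq (Real.rpow_one X))
    have hXd : 1 ≤ X / d := (one_le_div hd0).2 hdX1
    refine (norm_sum_Ico_mul_le hw hw0 (S := C * (X * (d : ℝ)⁻¹ * X ^ (-(1 / 100) : ℝ))) ?_).trans ?_
    · intro t ht
      have hφ : |γ * (d : ℝ) ^ c| * (X / d / 4) ^ c = |γ| * X ^ c / 4 ^ c := by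
        rw [Real.div_rpow (by positivity) (by norm_num), Real.div_rpow hX'.le hd0.le, abs_mul,
          abs_of_nonneg (by positivity : 0 ≤ (d : ℝ) ^ c)]
        have : (d : ℝ) ^ c ≠ 0 := by positivity
        field_simp
      have h := H X (X / d / 4) (γ * (d : ℝ) ^ c) t (N / d + 1) hX ?_ ?_ ?_ ?_ ?_
      · have e : ∀ m : ℕ, eC (γ * ((d * m : ℕ) : ℝ) ^ c) = eC (γ * (d : ℝ) ^ c * (m : ℝ) ^ c) := by
          intro m
          push_cast
          rw [Real.mul_rpow (by positivity) (by positivity), mul_assoc]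
        simp only [e]
        refine h.trans ?_
        gcongr
        rw [div_div, div_eq_mul_inv, mul_inv]
        gcongr
        have := inv_pos.2 hd0
        linarith
      · rw [div_div, le_div_iff₀ (by positivity)]
        calc X ^ (49 / 100 : ℝ) * (d * 4) ≤ X ^ (49 / 100 : ℝ) * (X ^ (1 / 5 : ℝ) *
              X ^ (1 / 100 : ℝ)) := by
              gcongr
              exact le_trans (by norm_num) hX0
          _ ≤ X ^ (1 : ℝ) := by
              rw [← Real.rpow_add hX', ← Real.rpow_add hX']
              exact Real.rpow_le_rpow_of_exponent_le hX (by norm_num)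
          _ = X := Real.rpow_one X
      · rw [hφ, le_div_iff₀ (by positivity)]
        calc X ^ (39 / 100 : ℝ) * 4 ^ c ≤ X ^ (39 / 100 : ℝ) * X ^ (1 / 100 : ℝ) := by gcongr
          _ ≤ X ^ (9 / 10 : ℝ) := by
              rw [← Real.rpow_add hX']
              exact Real.rpow_le_rpow_of_exponent_le hX (by norm_num)
          _ ≤ _ := hT1
      · rw [hφ]
        calc |γ| * X ^ c / 4 ^ c ≤ |γ| * X ^ c :=
              div_le_self (by positivity) (Real.one_le_rpow (by norm_num) (by linarith))
          _ ≤ X ^ (21 / 10 : ℝ) := hT2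
          _ ≤ _ := Real.rpow_le_rpow_of_exponent_le hX (by norm_num)
      · have h1 : A + 1 ≤ d * t := by
          have := Nat.lt_mul_div_succ A hd1
          have := Nat.mul_le_mul_left d ht
          omega
        have h2 : (A : ℝ) + 1 ≤ d * t := by exact_mod_cast h1
        rw [div_div, div_le_iff₀ (by positivity)]
        have : (0 : ℝ) ≤ d * t := by positivity
        linarith
      · have h1 : ((N / d : ℕ) : ℝ) ≤ N / d := Nat.cast_div_le
        have h2 : (N : ℝ) / d ≤ X / d := by gcongr
        push_cast
        linarith
    · have : N / d + 1 ≤ N + 1 := by have := Nat.div_le_self N d; omega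
      gcongr
      exact hw this
  rw [sum_divisorsAntidiagonal_eq_sum_ite (Nat.lt_succ_self N)
    fun x y => v x * w y * eC (γ * ((x * y : ℕ) : ℝ) ^ c)]
  have hterm : ∀ d ∈ Ico 1 (N + 1), ‖∑ m ∈ Ico 1 (N + 1), if A < d * m ∧ d * m ≤ N then
      v d * w m * eC (γ * ((d * m : ℕ) : ℝ) ^ c) else 0‖ ≤
      G * (w (N + 1) * (C * (X * (d : ℝ)⁻¹ * X ^ (-(1 / 100) : ℝ)))) := by
    intro d hd
    have hd' := mem_Ico.1 hd
    have hdX : (d : ℝ) ≤ X := le_trans (by exact_mod_cast (by omega : d ≤ N)) hNX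
    have hwN := hw0 (N + 1)
    have e : (Ico 1 (N + 1)).filter (fun m => A < d * m ∧ d * m ≤ N) =
        Ico (A / d + 1) (N / d + 1) := by
      ext m
      simp only [mem_filter, mem_Ico, Nat.lt_succ_iff, Nat.succ_le_iff,
        Nat.div_lt_iff_lt_mul hd'.1, Nat.le_div_iff_mul_le hd'.1, mul_comm d m]
      constructor
      · rintro ⟨_, h⟩; exact h
      · rintro ⟨h1, h2⟩
        have hm : 0 < m := Nat.pos_of_ne_zero (by rintro rfl; simp at h1)
        have := Nat.le_mul_of_pos_right m hd'.1
        exact ⟨⟨hm, by omega⟩, h1, h2⟩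
    rw [← sum_filter, e]
    simp only [mul_assoc (v d)]
    rw [← mul_sum, norm_mul]
    by_cases h : X ^ (1 / 5 : ℝ) < d
    · rw [hv0 d h, norm_zero, zero_mul]; positivity
    · exact mul_le_mul (hv d hdX) (hinner d hd (not_lt.1 h)) (norm_nonneg _) hG
  have hh : ∑ i ∈ Ico 1 (N + 1), ((i : ℝ))⁻¹ ≤ 1 + Real.log X := by
    have := harmonic_le_one_add_log N
    rw [harmonic_eq_sum_Icc] at this
    push_cast at this
    exact this.trans (by gcongr)
  calc _ ≤ _ := (norm_sum_le _ _).trans (sum_le_sum hterm)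
    _ = G * w (N + 1) * C * (X * X ^ (-(1 / 100) : ℝ)) * ∑ i ∈ Ico 1 (N + 1), ((i : ℝ))⁻¹ := by
        rw [mul_sum]; exact sum_congr rfl fun d _ => by ring
    _ ≤ G * w (N + 1) * C * (X * X ^ (-(1 / 100) : ℝ)) * (1 + Real.log X) := by
        have := hw0 (N + 1)
        gcongr
    _ = _ := by
        rw [sub_eq_add_neg, Real.rpow_add hX', Real.rpow_one]; ring

noncomputable def truncate (f : ArithmeticFunction ℝ) (U : ℝ) : ArithmeticFunction ℝ :=
  ⟨fun n => if (n : ℝ) ≤ U then f n else 0, by simp⟩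

lemma truncate_apply (f : ArithmeticFunction ℝ) (U : ℝ) (n : ℕ) :
    truncate f U n = if (n : ℝ) ≤ U then f n else 0 := rfl

lemma arithmeticFunction_sub_apply (f g : ArithmeticFunction ℝ) (n : ℕ) : (f - g) n = f n - g n := by
  rw [sub_eq_add_neg, ArithmeticFunction.add_apply, sub_eq_add_neg]; rfl

lemma abs_truncate_le (f : ArithmeticFunction ℝ) (U : ℝ) (n : ℕ) : |truncate f U n| ≤ |f n| := by
  rw [truncate_apply]; split_ifs <;> simp

lemma abs_sub_truncate_le (f : ArithmeticFunction ℝ) (U : ℝ) (n : ℕ) :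
    |(f - truncate f U) n| ≤ |f n| := by
  rw [arithmeticFunction_sub_apply, truncate_apply]; split_ifs <;> simp

lemma sub_truncate_eq_zero (f : ArithmeticFunction ℝ) {U : ℝ} {n : ℕ} (h : (n : ℝ) ≤ U) :
    (f - truncate f U) n = 0 := by
  rw [arithmeticFunction_sub_apply, truncate_apply, if_pos h, sub_self]

open ArithmeticFunction in
lemma vaughan_identity (f g : ArithmeticFunction ℝ) :
    (vonMangoldt : ArithmeticFunction ℝ) = f + g * ArithmeticFunction.log -
      f * g * (zeta : ArithmeticFunction ℝ) +
      (vonMangoldt - f) * (((moebius : ArithmeticFunction ℝ) - g) * (zeta : ArithmeticFunction ℝ)) := by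
  have h1 : (vonMangoldt : ArithmeticFunction ℝ) * (zeta : ArithmeticFunction ℝ) = ArithmeticFunction.log :=
    vonMangoldt_mul_zeta
  have h2 : (moebius : ArithmeticFunction ℝ) * (zeta : ArithmeticFunction ℝ) = 1 :=
    coe_moebius_mul_coe_zeta
  rw [← h1, sub_mul _ g, h2]
  ring

lemma sum_arithmeticFunction_mul (f g : ArithmeticFunction ℝ) (F : ℕ → ℂ) (s : Finset ℕ) :
    ∑ n ∈ s, ((f * g) n : ℂ) * F n =
      ∑ n ∈ s, ∑ p ∈ n.divisorsAntidiagonal, (f p.1 : ℂ) * g p.2 * F (p.1 * p.2) := by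
  refine sum_congr rfl fun n _ => ?_
  rw [ArithmeticFunction.mul_apply, Complex.ofReal_sum, sum_mul]
  refine sum_congr rfl fun p hp => ?_
  rw [(Nat.mem_divisorsAntidiagonal.1 hp).1]
  push_cast; rfl

lemma abs_moebius_le (n : ℕ) : |((ArithmeticFunction.moebius : ArithmeticFunction ℝ)) n| ≤ 1 := by
  rw [ArithmeticFunction.intCoe_apply]
  exact_mod_cast ArithmeticFunction.abs_moebius_le_one

lemma abs_mul_moebius_le_log {f g : ArithmeticFunction ℝ}
    (hf : ∀ n, |f n| ≤ ArithmeticFunction.vonMangoldt n) (hg : ∀ n, |g n| ≤ 1) (n : ℕ) :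
    |(f * g) n| ≤ Real.log n := by
  rw [← ArithmeticFunction.vonMangoldt_sum, ArithmeticFunction.mul_apply,
    ← Nat.map_div_right_divisors, sum_map]
  refine (abs_sum_le_sum_abs _ _).trans (sum_le_sum fun d _ => ?_)
  rw [abs_mul]
  exact (mul_le_of_le_one_right (abs_nonneg _) (hg _)).trans (hf _)

lemma abs_mul_zeta_le_card_divisors {g : ArithmeticFunction ℝ} (hg : ∀ n, |g n| ≤ 1) (n : ℕ) :
    |(g * (ArithmeticFunction.zeta : ArithmeticFunction ℝ)) n| ≤ #n.divisors := by
  rw [ArithmeticFunction.coe_mul_zeta_apply]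
  refine (abs_sum_le_sum_abs _ _).trans ((sum_le_sum fun d _ => hg d).trans ?_)
  simp

lemma sum_vonMangoldt_eC_bound {c : ℝ} (hc1 : 1 < c) (hc3 : c < 3) (hc2 : c ≠ 2) :
    ∃ C : ℝ, 0 < C ∧ ∀ X γ : ℝ, 1 ≤ X → 16 ^ 3 ≤ X ^ (1 / 100 : ℝ) →
      X ^ (9 / 10 : ℝ) ≤ |γ| * X ^ c → |γ| * X ^ c ≤ X ^ (21 / 10 : ℝ) →
      ‖∑ n ∈ Ioc ⌊X / 2⌋₊ ⌊X⌋₊, (ArithmeticFunction.vonMangoldt n : ℂ) * eC (γ * (n : ℝ) ^ c)‖ ≤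
      C * X ^ (1 - 1 / 250 : ℝ) := by
  obtain ⟨C₁, hC₁, H₁⟩ := typeI_sum_bound hc1 hc3 hc2
  obtain ⟨C₂, hC₂, H₂⟩ := typeII_sum_bound hc1 hc3 hc2
  obtain ⟨D, hD, HD⟩ := one_add_log_pow_le 5 (show (0 : ℝ) < 1 / 1000 by norm_num)
  refine ⟨(2 * C₁ + 16 * C₂) * D, by positivity, fun X γ hX hX0 hT1 hT2 => ?_⟩
  have hX' : 0 < X := by linarith
  have hlog := Real.log_nonneg hX
  set l := 1 + Real.log X with hl
  have hl1 : 1 ≤ l := by linarith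
  set U := X ^ (1 / 10 : ℝ) with hU
  have hUX : U * 4096 ≤ X := by
    calc U * 4096 ≤ U * X ^ (1 / 100 : ℝ) := by gcongr; linarith
      _ ≤ X ^ (1 : ℝ) := by
        rw [hU, ← Real.rpow_add hX']
        exact Real.rpow_le_rpow_of_exponent_le hX (by norm_num)
      _ = X := Real.rpow_one X
  have hU1 : 1 ≤ U := Real.one_le_rpow hX (by norm_num)
  have hNX : (⌊X⌋₊ : ℝ) ≤ X := Nat.floor_le hX'.le
  have hlog2 : ∀ n : ℕ, (n : ℝ) ≤ 2 * X → Real.log n ≤ l := by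
    intro n hn
    rcases Nat.eq_zero_or_pos n with rfl | h0
    · simp; linarith
    have h1 := Real.log_le_log (by exact_mod_cast h0) hn
    rw [Real.log_mul (by norm_num) hX'.ne'] at h1
    have := Real.log_two_lt_d9
    linarith
  set Λ₁ := truncate ArithmeticFunction.vonMangoldt U with hΛ₁
  set μ₁ := truncate (ArithmeticFunction.moebius : ArithmeticFunction ℝ) U with hμ₁
  set ζ : ArithmeticFunction ℝ := (ArithmeticFunction.zeta : ArithmeticFunction ℝ) with hζ
  set F : ℕ → ℂ := fun n => eC (γ * (n : ℝ) ^ c) with hF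
  set s := Ioc ⌊X / 2⌋₊ ⌊X⌋₊ with hs
  have hμ1 : ∀ n, |μ₁ n| ≤ 1 := fun n => (abs_truncate_le _ _ _).trans (abs_moebius_le n)
  have hΛ1 : ∀ n, |Λ₁ n| ≤ ArithmeticFunction.vonMangoldt n := fun n =>
    (abs_truncate_le _ _ _).trans (abs_of_nonneg ArithmeticFunction.vonMangoldt_nonneg).le
  have e0 : ∑ n ∈ s, (Λ₁ n : ℂ) * F n = 0 := by
    refine sum_eq_zero fun n hn => ?_
    have h1 : X / 2 < n := (Nat.floor_lt' (by have := (mem_Ioc.1 hn).1; omega)).1 (mem_Ioc.1 hn).1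
    rw [hΛ₁, truncate_apply, if_neg (by linarith)]; simp
  have hdecomp : ∑ n ∈ s, (ArithmeticFunction.vonMangoldt n : ℂ) * F n =
      ∑ n ∈ s, ((μ₁ * ArithmeticFunction.log) n : ℂ) * F n - ∑ n ∈ s, ((Λ₁ * μ₁ * ζ) n : ℂ) * F n +
      ∑ n ∈ s, (((ArithmeticFunction.vonMangoldt - Λ₁) *
        (((ArithmeticFunction.moebius : ArithmeticFunction ℝ) - μ₁) * ζ)) n : ℂ) * F n := by
    rw [← zero_add (∑ n ∈ s, ((μ₁ * ArithmeticFunction.log) n : ℂ) * F n), ← e0,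
      ← sum_add_distrib, ← sum_sub_distrib, ← sum_add_distrib]
    refine sum_congr rfl fun n _ => ?_
    conv_lhs => rw [vaughan_identity Λ₁ μ₁]
    rw [ArithmeticFunction.add_apply, arithmeticFunction_sub_apply, ArithmeticFunction.add_apply]
    push_cast
    ring
  have hX99 : X ^ (1 - 1 / 100 : ℝ) ≤ X ^ (1 - 1 / 200 : ℝ) :=
    Real.rpow_le_rpow_of_exponent_le hX (by norm_num)
  have b1 : ‖∑ n ∈ s, ((μ₁ * ArithmeticFunction.log) n : ℂ) * F n‖ ≤
      C₁ * (l ^ 5 * X ^ (1 - 1 / 200 : ℝ)) := by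
    rw [sum_arithmeticFunction_mul]
    refine (H₁ X γ 1 (fun n => μ₁ n) (fun n => ArithmeticFunction.log n) hX hX0 zero_le_one hT1 hT2
      ?_ ?_ ?_ ?_).trans ?_
    · intro a b hab
      simp only [ArithmeticFunction.log_apply]
      rcases Nat.eq_zero_or_pos a with rfl | h0
      · simpa using Real.log_natCast_nonneg b
      · exact Real.log_le_log (by exact_mod_cast h0) (by exact_mod_cast hab)
    · intro n; simpa using Real.log_natCast_nonneg n
    · intro d hd
      have : U ≤ X ^ (1 / 5 : ℝ) := Real.rpow_le_rpow_of_exponent_le hX (by norm_num)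
      rw [hμ₁, truncate_apply, if_neg (by linarith)]; simp
    · intro d _
      rw [Complex.norm_real]; exact hμ1 d
    · have h1 : ArithmeticFunction.log (⌊X⌋₊ + 1) ≤ l := by
        rw [ArithmeticFunction.log_apply]
        exact hlog2 _ (by push_cast; linarith)
      have h2 : (0 : ℝ) ≤ ArithmeticFunction.log (⌊X⌋₊ + 1) := by
        rw [ArithmeticFunction.log_apply]; exact Real.log_natCast_nonneg _
      calc _ ≤ C₁ * (1 * l * l * X ^ (1 - 1 / 200 : ℝ)) := by gcongr
        _ = C₁ * (l ^ 2 * X ^ (1 - 1 / 200 : ℝ)) := by ring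
        _ ≤ _ := by
            gcongr C₁ * (l ^ ?_ * _)
            norm_num
  have b2 : ‖∑ n ∈ s, ((Λ₁ * μ₁ * ζ) n : ℂ) * F n‖ ≤ C₁ * (l ^ 5 * X ^ (1 - 1 / 200 : ℝ)) := by
    rw [sum_arithmeticFunction_mul]
    have hζv : ∀ n, ζ n = if n = 0 then 0 else 1 := fun n => by
      rw [hζ, ArithmeticFunction.natCoe_apply, ArithmeticFunction.zeta_apply]; split_ifs <;> simp
    refine (H₁ X γ l (fun n => (Λ₁ * μ₁) n) (fun n => ζ n) hX hX0 (by linarith) hT1 hT2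
      ?_ ?_ ?_ ?_).trans ?_
    · intro a b hab
      simp only [hζv]
      split_ifs <;> first | omega | norm_num
    · intro n; rw [hζv]; split_ifs <;> norm_num
    · intro d hd
      norm_cast
      rw [ArithmeticFunction.mul_apply]
      refine sum_eq_zero fun p hp => ?_
      have hpd := (Nat.mem_divisorsAntidiagonal.1 hp).1
      by_contra hne
      have h1 : (p.1 : ℝ) ≤ U := by
        by_contra h0; rw [hΛ₁, truncate_apply, if_neg h0] at hne; simp at hne
      have h2 : (p.2 : ℝ) ≤ U := by
        by_contra h0; 
        rw [hμ₁, show truncate _ U p.2 = 0 from if_neg h0] at hne; simp at hne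
      have h3 : (d : ℝ) ≤ U * U := by
        rw [← hpd]; push_cast; gcongr
      rw [hU, ← Real.rpow_add hX'] at h3
      norm_num at h3 hd
      linarith
    · intro d hd
      rw [Complex.norm_real]
      exact (abs_mul_moebius_le_log hΛ1 hμ1 d).trans (hlog2 d (by linarith))
    · rw [hζv, if_neg (by omega)]
      calc _ ≤ C₁ * (l * 1 * l * X ^ (1 - 1 / 200 : ℝ)) := by gcongr
        _ = C₁ * (l ^ 2 * X ^ (1 - 1 / 200 : ℝ)) := by ring
        _ ≤ _ := by
            gcongr C₁ * (l ^ ?_ * _)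
            norm_num
  have b3 : ‖∑ n ∈ s, (((ArithmeticFunction.vonMangoldt - Λ₁) *
        (((ArithmeticFunction.moebius : ArithmeticFunction ℝ) - μ₁) * ζ)) n : ℂ) * F n‖ ≤
      16 * C₂ * (l ^ 5 * X ^ (1 - 1 / 200 : ℝ)) := by
    rw [sum_arithmeticFunction_mul]
    refine (H₂ X γ (16 * l ^ 3) (fun n => (ArithmeticFunction.vonMangoldt - Λ₁) n)
      (fun n => (((ArithmeticFunction.moebius : ArithmeticFunction ℝ) - μ₁) * ζ) n) hX hX0
      (by positivity) hT1 hT2 ?_ ?_ ?_ ?_).trans (le_of_eq (by ring))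
    · intro n hn
      rw [hΛ₁, sub_truncate_eq_zero _ hn]; simp
    · intro n hn
      norm_cast
      rw [hζ, ArithmeticFunction.coe_mul_zeta_apply]
      refine sum_eq_zero fun d hd => sub_truncate_eq_zero _ ?_
      exact le_trans (by exact_mod_cast Nat.divisor_le hd) hn
    · intro M hM hMX
      calc _ ≤ ∑ n ∈ Ico M (2 * M), l ^ 2 := by
            refine sum_le_sum fun n hn => ?_
            rw [Complex.norm_real, Real.norm_eq_abs]
            have h1 : (n : ℝ) ≤ 2 * M := by exact_mod_cast (mem_Ico.1 hn).2.le
            have : |(ArithmeticFunction.vonMangoldt - Λ₁) n| ≤ l :=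
              (abs_sub_truncate_le _ _ _).trans
                ((abs_of_nonneg ArithmeticFunction.vonMangoldt_nonneg).le.trans
                  (ArithmeticFunction.vonMangoldt_le_log.trans (hlog2 n (by linarith))))
            gcongr
        _ = M * l ^ 2 := by rw [sum_const, Nat.card_Ico, show 2 * M - M = M by omega]; simp
        _ ≤ M * (16 * l ^ 3) := by
            gcongr
            nlinarith [pow_le_pow_right₀ hl1 (show 2 ≤ 3 by norm_num)]
    · intro M hM hMX
      have hM0 : (0 : ℝ) < M := by exact_mod_cast hM
      calc _ ≤ ∑ n ∈ Ico M (2 * M), (#n.divisors : ℝ) ^ 2 := by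
            refine sum_le_sum fun n hn => ?_
            rw [Complex.norm_real, Real.norm_eq_abs]
            gcongr
            exact abs_mul_zeta_le_card_divisors (fun n => (abs_sub_truncate_le _ _ _).trans
              (abs_moebius_le n)) n
        _ ≤ ∑ n ∈ Icc 1 (2 * M), (#n.divisors : ℝ) ^ 2 := by
            refine sum_le_sum_of_subset_of_nonneg (fun n hn => ?_) fun _ _ _ => by positivity
            rw [mem_Ico] at hn; rw [mem_Icc]; omega
        _ ≤ (2 * M : ℕ) * (1 + Real.log (2 * M : ℕ)) ^ 3 := sum_card_divisors_sq_le _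
        _ ≤ (2 * M : ℕ) * (2 * l) ^ 3 := by
            have : Real.log (2 * M : ℕ) ≤ l := hlog2 _ (by push_cast; linarith)
            have := Real.log_natCast_nonneg (2 * M)
            gcongr
            linarith
        _ = _ := by push_cast; ring
  rw [hdecomp]
  calc _ ≤ C₁ * (l ^ 5 * X ^ (1 - 1 / 200 : ℝ)) + C₁ * (l ^ 5 * X ^ (1 - 1 / 200 : ℝ)) +
        16 * C₂ * (l ^ 5 * X ^ (1 - 1 / 200 : ℝ)) :=
        (norm_add_le _ _).trans (add_le_add ((norm_sub_le _ _).trans (add_le_add b1 b2)) b3)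
    _ = (2 * C₁ + 16 * C₂) * (l ^ 5 * X ^ (1 - 1 / 200 : ℝ)) := by ring
    _ ≤ (2 * C₁ + 16 * C₂) * (D * X ^ (1 / 1000 : ℝ) * X ^ (1 - 1 / 200 : ℝ)) := by
        gcongr; exact HD X hX
    _ = (2 * C₁ + 16 * C₂) * D * X ^ (1 / 1000 + (1 - 1 / 200) : ℝ) := by
        rw [Real.rpow_add hX']; ring
    _ ≤ _ := by
        gcongr ?_ * ?_
        exact Real.rpow_le_rpow_of_exponent_le hX (by norm_num)

lemma sum_log_prime_le {X : ℝ} (hX : 0 ≤ X) :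
    ∑ p ∈ (Ioc ⌊X / 2⌋₊ ⌊X⌋₊).filter Nat.Prime, Real.log p ≤ 2 * X := by
  have h := Chebyshev.theta_le_log4_mul_x hX
  have h4 : Real.log 4 ≤ 2 := by
    have e : Real.log 4 = 2 * Real.log 2 := by
      rw [show (4 : ℝ) = 2 ^ 2 by norm_num, Real.log_pow]; norm_num
    have := Real.log_two_lt_d9
    linarith
  calc _ ≤ Chebyshev.theta X := by
        refine sum_le_sum_of_subset_of_nonneg (fun p hp => ?_) fun p _ _ => Real.log_natCast_nonneg p
        simp only [mem_filter, mem_Ioc] at hp ⊢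
        exact ⟨⟨hp.2.pos, hp.1.2⟩, hp.2⟩
    _ ≤ Real.log 4 * X := h
    _ ≤ _ := by gcongr

lemma norm_sum_log_prime_mul_le {X : ℝ} (hX : 0 ≤ X) {f : ℕ → ℂ} (hf : ∀ n, ‖f n‖ ≤ 1) :
    ‖∑ p ∈ (Ioc ⌊X / 2⌋₊ ⌊X⌋₊).filter Nat.Prime, (Real.log p : ℂ) * f p‖ ≤ 2 * X := by
  refine (norm_sum_le _ _).trans (le_trans (sum_le_sum fun p _ => ?_) (sum_log_prime_le hX))
  rw [norm_mul, Complex.norm_real, Real.norm_of_nonneg (Real.log_natCast_nonneg p)]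
  exact mul_le_of_le_one_right (Real.log_natCast_nonneg p) (hf p)

lemma sum_prime_eC_bound {c : ℝ} (hc1 : 1 < c) (hc3 : c < 3) (hc2 : c ≠ 2) :
    ∃ C : ℝ, 0 < C ∧ ∀ X γ : ℝ, 1 ≤ X →
      X ^ (9 / 10 : ℝ) ≤ |γ| * X ^ c → |γ| * X ^ c ≤ X ^ (21 / 10 : ℝ) →
      ‖∑ p ∈ (Ioc ⌊X / 2⌋₊ ⌊X⌋₊).filter Nat.Prime, (Real.log p : ℂ) * eC (γ * (p : ℝ) ^ c)‖ ≤
      C * X ^ (1 - 1 / 250 : ℝ) := by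
  obtain ⟨C, hC, H⟩ := sum_vonMangoldt_eC_bound hc1 hc3 hc2
  obtain ⟨D, HD⟩ := Chebyshev.psi_sub_theta_le_mul_sqrt
  refine ⟨C + |D| + 2 * 16 ^ 3, by positivity, fun X γ hX hT1 hT2 => ?_⟩
  have hX' : 0 < X := by linarith
  have hXp : 0 < X ^ (1 - 1 / 250 : ℝ) := by positivity
  rcases le_total (16 ^ 3) (X ^ (1 / 100 : ℝ)) with h | h
  · have h1 := H X γ hX h hT1 hT2
    rw [← sum_filter_add_sum_filter_not _ Nat.Prime] at h1
    set T := ∑ x ∈ (Ioc ⌊X / 2⌋₊ ⌊X⌋₊).filter fun x => ¬ Nat.Prime x,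
      (ArithmeticFunction.vonMangoldt x : ℂ) * eC (γ * (x : ℝ) ^ c) with hT
    have h2 : ‖T‖ ≤ |D| * X ^ (1 - 1 / 250 : ℝ) := by
      calc ‖T‖ ≤ ∑ x ∈ (Ioc 0 ⌊X⌋₊).filter fun x => ¬ Nat.Prime x,
            ArithmeticFunction.vonMangoldt x := by
            refine (norm_sum_le _ _).trans ?_
            simp only [norm_mul, norm_eC, mul_one, Complex.norm_real,
              Real.norm_of_nonneg ArithmeticFunction.vonMangoldt_nonneg]
            refine sum_le_sum_of_subset_of_nonneg (fun p hp => ?_) fun p _ _ =>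
              ArithmeticFunction.vonMangoldt_nonneg
            simp only [mem_filter, mem_Ioc] at hp ⊢
            exact ⟨⟨by omega, hp.1.2⟩, hp.2⟩
        _ ≤ D * √X := by
            rw [← Chebyshev.psi_sub_theta_eq_sum_not_prime]; exact HD X
        _ ≤ |D| * X ^ (1 - 1 / 250 : ℝ) := by
            rw [Real.sqrt_eq_rpow]
            gcongr ?_ * ?_
            · exact le_abs_self D
            · exact Real.rpow_le_rpow_of_exponent_le hX (by norm_num)
    have h3 : ∑ p ∈ (Ioc ⌊X / 2⌋₊ ⌊X⌋₊).filter Nat.Prime, (Real.log p : ℂ) * eC (γ * (p : ℝ) ^ c) =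
        ∑ p ∈ (Ioc ⌊X / 2⌋₊ ⌊X⌋₊).filter Nat.Prime,
          (ArithmeticFunction.vonMangoldt p : ℂ) * eC (γ * (p : ℝ) ^ c) :=
      sum_congr rfl fun p hp => by
        rw [ArithmeticFunction.vonMangoldt_apply_prime (mem_filter.1 hp).2]
    rw [h3]
    have h4 := norm_sub_le (∑ p ∈ (Ioc ⌊X / 2⌋₊ ⌊X⌋₊).filter Nat.Prime,
          (ArithmeticFunction.vonMangoldt p : ℂ) * eC (γ * (p : ℝ) ^ c) + T) T
    rw [add_sub_cancel_right] at h4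
    nlinarith
  · refine (norm_sum_log_prime_mul_le hX'.le fun n => (norm_eC _).le).trans ?_
    have e : X = X ^ (1 / 250 : ℝ) * X ^ (1 - 1 / 250 : ℝ) := by
      rw [← Real.rpow_add hX']; norm_num
    have h1 : X ^ (1 / 250 : ℝ) ≤ 16 ^ 3 :=
      (Real.rpow_le_rpow_of_exponent_le hX (by norm_num)).trans h
    have := mul_le_mul_of_nonneg_right h1 hXp.le
    have := mul_nonneg hC.le hXp.le
    have := mul_nonneg (abs_nonneg D) hXp.le
    linarith

lemma norm_eC_sub_one (x : ℝ) : ‖eC x - 1‖ = 2 * |sin (π * x)| := by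
  have := Complex.norm_exp_I_mul_ofReal_sub_one (2 * π * x)
  rw [eC, mul_comm, this, norm_mul, Real.norm_eq_abs, Real.norm_eq_abs, abs_of_pos two_pos,
    mul_assoc, mul_div_cancel_left₀ _ two_ne_zero]

lemma norm_eC_sub_le (x y : ℝ) : ‖eC x - eC y‖ ≤ 2 * π * |x - y| := by
  have e : eC x - eC y = eC y * (eC (x - y) - 1) := by
    rw [mul_sub, ← eC_add, mul_one]; congr 2; ring
  rw [e, norm_mul, norm_eC, one_mul, norm_eC_sub_one]
  have := Real.abs_sin_le_abs (x := π * (x - y))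
  rw [abs_mul, abs_of_pos Real.pi_pos] at this
  linarith

lemma eC_natCast_mul (j : ℕ) (u : ℝ) : eC (j * u) = eC u ^ j := by
  induction j with
  | zero => simp [eC_zero]
  | succ j ih => rw [pow_succ, ← ih, ← eC_add]; congr 1; push_cast; ring

open scoped ComplexConjugate in
lemma sq_norm_geom_eC (K : ℕ) (u : ℝ) : ((‖∑ j ∈ range K, eC (j * u)‖ ^ 2 : ℝ) : ℂ) =
    ∑ j ∈ range K, ∑ j' ∈ range K, eC (((j : ℝ) - j') * u) := by
  push_cast
  rw [← Complex.mul_conj', map_sum, sum_mul_sum]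
  refine sum_congr rfl fun j _ => sum_congr rfl fun j' _ => ?_
  rw [← eC_sub, sub_mul]

lemma norm_geom_eC_le (K : ℕ) {u θ : ℝ} (hθ : 0 < θ) (h1 : θ ≤ |u|) (h2 : |u| ≤ 1 - θ) :
    ‖∑ j ∈ range K, eC (j * u)‖ ≤ 1 / (2 * θ) := by
  have hs : 2 * θ ≤ |sin (π * u)| := by
    have := two_mul_le_sin_pi hθ.le h1 h2
    rcases abs_choice u with h | h <;> rw [h] at this
    · exact this.trans (le_abs_self _)
    · rw [mul_neg, Real.sin_neg] at this; exact this.trans (neg_le_abs _)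
  have hne : eC u ≠ 1 := by
    intro h
    have := norm_eC_sub_one u
    rw [h] at this; simp at this
    rw [this] at hs; simp at hs; linarith
  simp_rw [eC_natCast_mul]
  rw [geom_sum_eq hne, norm_div, norm_eC_sub_one]
  have h3 : ‖eC u ^ K - 1‖ ≤ 2 := by
    refine (norm_sub_le _ _).trans ?_
    rw [norm_pow, norm_eC]; norm_num
  calc _ ≤ 2 / (2 * (2 * θ)) := by gcongr
    _ = _ := by field_simp

lemma norm_geom_eC_ge {K : ℕ} (hK : 0 < K) {u : ℝ} (m : ℤ) (hu : |u - m| ≤ 1 / (8 * K)) :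
    7 / 10 * K ≤ ‖∑ j ∈ range K, eC (j * u)‖ := by
  have hK' : (0 : ℝ) < K := by exact_mod_cast hK
  have e : ∀ j : ℕ, eC (j * u) = eC (j * (u - m)) := fun j => by
    have : (j : ℝ) * u = j * (u - m) + ((j * m : ℤ) : ℝ) := by push_cast; ring
    rw [this, eC_add, eC_intCast, mul_one]
  refine le_trans ?_ ((le_abs_self _).trans (Complex.abs_re_le_norm _))
  rw [Complex.re_sum]
  calc 7 / 10 * (K : ℝ) = ∑ j ∈ range K, (7 / 10 : ℝ) := by simp; ring
    _ ≤ _ := by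
      refine sum_le_sum fun j hj => ?_
      rw [e, eC, Complex.exp_ofReal_mul_I_re]
      apply cos_ge_of_abs_le
      have hj' : (j : ℝ) ≤ K := by exact_mod_cast (mem_range.1 hj).le
      rw [abs_mul, abs_of_pos Real.two_pi_pos, abs_mul, Nat.abs_cast]
      calc 2 * π * (j * |u - m|) ≤ 2 * π * (K * (1 / (8 * K))) := by gcongr
        _ = π / 4 := by field_simp; norm_num

/-- The Fejér kernels centred at the `K`-th roots of unity form a partition of unity. -/
lemma sum_fejer {K : ℕ} (hK : 0 < K) (t : ℝ) :
    ∑ l ∈ range K, ‖∑ j ∈ range K, eC (j * (t - l / K))‖ ^ 2 = (K : ℝ) ^ 2 := by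
  have hK' : (K : ℝ) ≠ 0 := by exact_mod_cast hK.ne'
  apply Complex.ofReal_injective
  rw [Complex.ofReal_sum]
  simp_rw [sq_norm_geom_eC]
  rw [sum_comm]
  have h : ∀ j ∈ range K, ∑ l ∈ range K, ∑ j' ∈ range K, eC (((j : ℝ) - j') * (t - l / K)) = K := by
    intro j hj
    rw [sum_comm, sum_eq_single j]
    · simp [eC_zero]
    · intro j' hj' hne
      set z := eC (-((j : ℝ) - j') / K) with hz
      have e : ∀ l : ℕ, eC (((j : ℝ) - j') * (t - l / K)) = eC (((j : ℝ) - j') * t) * z ^ l := by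
        intro l
        rw [hz, ← eC_natCast_mul, ← eC_add]; congr 1; ring
      simp_rw [e]
      rw [← mul_sum]
      have hz1 : z ≠ 1 := by
        intro h
        have h1 := norm_eC_sub_one (-((j : ℝ) - j') / K)
        rw [← hz, h] at h1; simp at h1
        obtain ⟨n, hn⟩ := Real.sin_eq_zero_iff.1 h1
        have hpi := Real.pi_ne_zero
        have h2 : (n * K : ℝ) = j' - j := by
          field_simp at hn
          linarith
        have h3 : n * K = j' - j := by exact_mod_cast h2
        have h4 := mem_range.1 hj
        have h5 := mem_range.1 hj'
        have h6 : n = 0 := by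
          by_contra h0
          rcases lt_or_gt_of_ne h0 with h0 | h0
          · nlinarith
          · nlinarith
        rw [h6] at h3
        omega
      have hzK : z ^ K = 1 := by
        rw [hz, ← eC_natCast_mul, mul_div_cancel₀ _ hK']
        have : -((j : ℝ) - j') = ((j' - j : ℤ) : ℝ) := by push_cast; ring
        rw [this, eC_intCast]
      rw [geom_sum_eq hz1, hzK]; simp
    · intro h; exact absurd hj h
  rw [sum_congr rfl h]
  simp; ring

lemma fejer_approx {α δ : ℝ} (hα0 : 0 ≤ α) (hα1 : α ≤ 1) (hδ : 0 < δ) {K : ℕ} (hK : 0 < K)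
    {t : ℝ} (h1 : δ ≤ Int.fract t) (h2 : Int.fract t ≤ 1 - δ) :
    ‖eC (-Int.fract t * α) - ((K : ℂ) ^ 2)⁻¹ * ∑ l ∈ range K, eC (-((l : ℝ) / K) * α) *
      (‖∑ j ∈ range K, eC (j * (t - l / K))‖ ^ 2 : ℝ)‖ ≤ π * δ + 2 / (K * δ ^ 2) := by
  have hK' : (0 : ℝ) < K := by exact_mod_cast hK
  have hKc : (K : ℂ) ≠ 0 := by exact_mod_cast hK.ne'
  have hs := sum_fejer hK t
  have e : eC (-Int.fract t * α) - ((K : ℂ) ^ 2)⁻¹ * ∑ l ∈ range K, eC (-((l : ℝ) / K) * α) *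
      (‖∑ j ∈ range K, eC (j * (t - l / K))‖ ^ 2 : ℝ) = ((K : ℂ) ^ 2)⁻¹ * ∑ l ∈ range K,
      (eC (-Int.fract t * α) - eC (-((l : ℝ) / K) * α)) *
      (‖∑ j ∈ range K, eC (j * (t - l / K))‖ ^ 2 : ℝ) := by
    simp_rw [sub_mul]
    rw [sum_sub_distrib, ← mul_sum, ← Complex.ofReal_sum, hs, mul_sub]
    push_cast
    field_simp
  rw [e, norm_mul, norm_inv, norm_pow, Complex.norm_natCast]
  have hterm : ∀ l ∈ range K, ‖(eC (-Int.fract t * α) - eC (-((l : ℝ) / K) * α)) *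
      ((‖∑ j ∈ range K, eC (j * (t - l / K))‖ ^ 2 : ℝ) : ℂ)‖ ≤
      π * δ * ‖∑ j ∈ range K, eC (j * (t - l / K))‖ ^ 2 + 2 * (1 / δ) ^ 2 := by
    intro l hl
    rw [norm_mul, Complex.norm_real, Real.norm_of_nonneg (by positivity)]
    have hl1 : (l : ℝ) / K ≤ 1 := by
      rw [div_le_one hK']; exact_mod_cast (mem_range.1 hl).le
    have hl0 : 0 ≤ (l : ℝ) / K := by positivity
    set u := Int.fract t - l / K with hu
    rcases le_total |u| (δ / 2) with h | h
    · have h3 : ‖eC (-Int.fract t * α) - eC (-((l : ℝ) / K) * α)‖ ≤ π * δ := by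
        refine (norm_eC_sub_le _ _).trans ?_
        rw [← sub_mul, abs_mul, abs_of_nonneg hα0, show -Int.fract t - -((l : ℝ) / K) = -u by
          rw [hu]; ring, abs_neg]
        calc 2 * π * (|u| * α) ≤ 2 * π * (δ / 2 * 1) := by gcongr
          _ = _ := by ring
      calc _ ≤ π * δ * ‖∑ j ∈ range K, eC (j * (t - l / K))‖ ^ 2 := by gcongr
        _ ≤ _ := le_add_of_nonneg_right (by positivity)
    · have h3 : ‖eC (-Int.fract t * α) - eC (-((l : ℝ) / K) * α)‖ ≤ 2 := by
        refine (norm_sub_le _ _).trans ?_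
        rw [norm_eC, norm_eC]; norm_num
      have h4 : ‖∑ j ∈ range K, eC (j * (t - l / K))‖ ≤ 1 / δ := by
        have e2 : ∀ j : ℕ, eC (j * (t - l / K)) = eC (j * u) := fun j => by
          have : (j : ℝ) * (t - l / K) = j * u + ((j * ⌊t⌋ : ℤ) : ℝ) := by
            rw [hu, Int.fract]; push_cast; ring
          rw [this, eC_add, eC_intCast, mul_one]
        simp_rw [e2]
        have hu2 : |u| ≤ 1 - δ / 2 := by rw [abs_le]; constructor <;> linarith
        refine (norm_geom_eC_le K (half_pos hδ) h hu2).trans_eq ?_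
        congr 1; ring
      calc _ ≤ 2 * (1 / δ) ^ 2 := by gcongr
        _ ≤ _ := le_add_of_nonneg_left (by positivity)
  calc _ ≤ ((K : ℝ) ^ 2)⁻¹ * (π * δ * K ^ 2 + K * (2 * (1 / δ) ^ 2)) := by
        gcongr
        refine (norm_sum_le _ _).trans ((sum_le_sum hterm).trans ?_)
        rw [sum_add_distrib, ← mul_sum, hs]; simp
    _ = _ := by field_simp

lemma norm_sum_floor_le (s : Finset ℕ) {w t : ℕ → ℝ} (hw : ∀ n, 0 ≤ w n) {α δ B : ℝ} (hα0 : 0 ≤ α)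
    (hα1 : α ≤ 1) (hδ : 0 < δ) {K : ℕ} (hK : 0 < K)
    (hB : ∀ h : ℤ, |h| < K → ‖∑ n ∈ s, (w n : ℂ) * eC ((α + h) * t n)‖ ≤ B) :
    ‖∑ n ∈ s, (w n : ℂ) * eC (⌊t n⌋ * α)‖ ≤ K * B + (π * δ + 2 / (K * δ ^ 2)) * ∑ n ∈ s, w n +
      2 * ∑ n ∈ s.filter (fun n => ¬ (δ ≤ Int.fract (t n) ∧ Int.fract (t n) ≤ 1 - δ)), w n := by
  have hK' : (0 : ℝ) < K := by exact_mod_cast hK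
  set G : ℝ → ℂ := fun x => ((K : ℂ) ^ 2)⁻¹ * ∑ l ∈ range K, eC (-((l : ℝ) / K) * α) *
      (‖∑ j ∈ range K, eC (j * (x - l / K))‖ ^ 2 : ℝ) with hG
  have e : ∀ n, eC (⌊t n⌋ * α) = eC (α * t n) * G (t n) +
      eC (α * t n) * (eC (-Int.fract (t n) * α) - G (t n)) := by
    intro n
    rw [← mul_add, add_sub_cancel, ← eC_add]
    congr 1; rw [Int.fract]; ring
  have hGn : ∀ x, ‖G x‖ ≤ 1 := by
    intro x
    rw [hG]
    simp only
    rw [norm_mul, norm_inv, norm_pow, Complex.norm_natCast, inv_mul_le_iff₀ (by positivity), mul_one,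
      ← sum_fejer hK x]
    refine (norm_sum_le _ _).trans (sum_le_sum fun l _ => ?_)
    rw [norm_mul, norm_eC, one_mul, Complex.norm_real, Real.norm_of_nonneg (by positivity)]
  have hmain : ‖∑ n ∈ s, (w n : ℂ) * (eC (α * t n) * G (t n))‖ ≤ K * B := by
    have e2 : ∑ n ∈ s, (w n : ℂ) * (eC (α * t n) * G (t n)) = ((K : ℂ) ^ 2)⁻¹ * ∑ l ∈ range K,
        ∑ j ∈ range K, ∑ j' ∈ range K, eC (-((l : ℝ) / K) * α) * eC (-((j : ℝ) - j') * (l / K)) *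
        ∑ n ∈ s, (w n : ℂ) * eC ((α + ((j - j' : ℤ) : ℝ)) * t n) := by
      calc _ = ∑ n ∈ s, ((K : ℂ) ^ 2)⁻¹ * ∑ l ∈ range K, ∑ j ∈ range K, ∑ j' ∈ range K,
            eC (-((l : ℝ) / K) * α) * eC (-((j : ℝ) - j') * (l / K)) *
            ((w n : ℂ) * eC ((α + ((j - j' : ℤ) : ℝ)) * t n)) := by
            refine sum_congr rfl fun n _ => ?_
            rw [hG]
            simp only [sq_norm_geom_eC]
            rw [← mul_assoc, mul_comm, mul_assoc, sum_mul]
            congr 1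
            refine sum_congr rfl fun l _ => ?_
            rw [mul_assoc, sum_mul, mul_sum]
            refine sum_congr rfl fun j _ => ?_
            rw [sum_mul, mul_sum]
            refine sum_congr rfl fun j' _ => ?_
            have : eC (((j : ℝ) - j') * (t n - l / K)) * eC (α * t n) =
                eC (-((j : ℝ) - j') * (l / K)) * eC ((α + ((j - j' : ℤ) : ℝ)) * t n) := by
              rw [← eC_add, ← eC_add]; congr 1; push_cast; ring
            rw [mul_left_comm _ (w n : ℂ), this]; ring
        _ = _ := by
            rw [← mul_sum]
            congr 1
            rw [sum_comm]
            refine sum_congr rfl fun l _ => ?_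
            rw [sum_comm]
            refine sum_congr rfl fun j _ => ?_
            rw [sum_comm]
            exact sum_congr rfl fun j' _ => (mul_sum _ _ _).symm
    rw [e2, norm_mul, norm_inv, norm_pow, Complex.norm_natCast, inv_mul_le_iff₀ (by positivity)]
    calc _ ≤ ∑ l ∈ range K, ∑ j ∈ range K, ∑ j' ∈ range K, B := by
          refine (norm_sum_le _ _).trans (sum_le_sum fun l _ => (norm_sum_le _ _).trans
            (sum_le_sum fun j hj => (norm_sum_le _ _).trans (sum_le_sum fun j' hj' => ?_)))
          rw [norm_mul, norm_mul, norm_eC, norm_eC, one_mul, one_mul]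
          refine hB _ ?_
          have := mem_range.1 hj; have := mem_range.1 hj'
          rw [abs_lt]; constructor <;> omega
      _ = _ := by simp; ring
  have hrest : ‖∑ n ∈ s, (w n : ℂ) * (eC (α * t n) * (eC (-Int.fract (t n) * α) - G (t n)))‖ ≤
      (π * δ + 2 / (K * δ ^ 2)) * ∑ n ∈ s, w n +
      2 * ∑ n ∈ s.filter (fun n => ¬ (δ ≤ Int.fract (t n) ∧ Int.fract (t n) ≤ 1 - δ)), w n := by
    rw [mul_sum, mul_sum, sum_filter, ← sum_add_distrib]
    refine (norm_sum_le _ _).trans (sum_le_sum fun n _ => ?_)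
    rw [norm_mul, norm_mul, norm_eC, one_mul, Complex.norm_real, Real.norm_of_nonneg (hw n)]
    have hn := hw n
    by_cases h : δ ≤ Int.fract (t n) ∧ Int.fract (t n) ≤ 1 - δ
    · rw [if_neg (not_not.2 h), add_zero, mul_comm]
      gcongr
      exact fejer_approx hα0 hα1 hδ hK h.1 h.2
    · rw [if_pos h, mul_comm]
      have : ‖eC (-Int.fract (t n) * α) - G (t n)‖ ≤ 2 := by
        refine (norm_sub_le _ _).trans ?_
        rw [norm_eC]; linarith [hGn (t n)]
      calc _ ≤ 2 * w n := by gcongr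
        _ ≤ _ := le_add_of_nonneg_left (by positivity)
  simp_rw [e, mul_add, sum_add_distrib]
  calc _ ≤ _ := norm_add_le _ _
    _ ≤ _ := by linarith

lemma card_Ioc_half_le {X : ℝ} (hX : 0 ≤ X) : ((Ioc ⌊X / 2⌋₊ ⌊X⌋₊).card : ℝ) ≤ X := by
  rw [Nat.card_Ioc]
  exact le_trans (by exact_mod_cast Nat.sub_le _ _) (Nat.floor_le hX)

lemma dyadic_monomial_saving {c : ℝ} (hc1 : 1 < c) (hc3 : c < 206 / 100) (hc2 : c ≠ 2) :
    ∃ C : ℝ, 0 < C ∧ ∀ X h : ℝ, 1 ≤ X → 1 ≤ |h| → |h| ≤ X ^ (1 / 100 : ℝ) →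
      ‖∑ n ∈ Ioc ⌊X / 2⌋₊ ⌊X⌋₊, eC (h * (n : ℝ) ^ c)‖ ≤ C * X ^ (99 / 100 : ℝ) := by
  obtain ⟨C, hC, h⟩ := monomial_sum_saving hc1 (by linarith : c < 3) hc2
  refine ⟨C + 4, by linarith, fun X r hX hr1 hr2 => ?_⟩
  have hX0 : 0 < X := by linarith
  rcases lt_or_ge X 4 with h4 | h4
  · refine (norm_sum_eC_le_card _ _).trans ((card_Ioc_half_le hX0.le).trans ?_)
    calc X ≤ 4 := h4.le
      _ ≤ (C + 4) * 1 := by linarith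
      _ ≤ _ := by
        gcongr
        exact Real.one_le_rpow hX (by norm_num)
  · have e1 : X * X ^ (-(1 / 100) : ℝ) = X ^ (99 / 100 : ℝ) := by
      rw [← Real.rpow_one_add' hX0.le (by norm_num)]; norm_num
    have hhalf : X ^ (49 / 100 : ℝ) ≤ X / 2 := by
      have h2 : (2 : ℝ) ≤ X ^ (1 / 2 : ℝ) := by
        rw [← Real.sqrt_eq_rpow]
        exact Real.le_sqrt_of_sq_le (by linarith)
      have h3 : X ^ (1 / 2 : ℝ) * X ^ (1 / 2 : ℝ) = X := by
        rw [← Real.rpow_add hX0]; norm_num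
      have h5 : X ^ (49 / 100 : ℝ) ≤ X ^ (1 / 2 : ℝ) :=
        Real.rpow_le_rpow_of_exponent_le hX (by norm_num)
      nlinarith
    have h6 : X / 2 ≤ (X / 2) ^ c := by
      conv_lhs => rw [← Real.rpow_one (X / 2)]
      exact Real.rpow_le_rpow_of_exponent_le (by linarith) hc1.le
    rw [Ioc_eq_Ico_succ]
    refine (h X (X / 2) r _ _ hX hhalf ?_ ?_ ?_ ?_).trans ?_
    · calc X ^ (39 / 100 : ℝ) ≤ X ^ (49 / 100 : ℝ) :=
            Real.rpow_le_rpow_of_exponent_le hX (by norm_num)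
        _ ≤ 1 * (X / 2) ^ c := by linarith
        _ ≤ _ := by gcongr
    · calc |r| * (X / 2) ^ c ≤ X ^ (1 / 100 : ℝ) * X ^ c := by gcongr; linarith
        _ = X ^ (1 / 100 + c) := by rw [← Real.rpow_add hX0]
        _ ≤ _ := Real.rpow_le_rpow_of_exponent_le hX (by linarith)
    · push_cast; exact (Nat.lt_floor_add_one _).le
    · push_cast
      have := Nat.floor_le hX0.le
      linarith
    · rw [← e1]
      have : 0 ≤ X ^ (-(1 / 100) : ℝ) := by positivity
      calc C * (X / 2 * X ^ (-(1 / 100) : ℝ)) ≤ C * (X * X ^ (-(1 / 100) : ℝ)) := by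
            gcongr; linarith
        _ ≤ _ := by gcongr; linarith

lemma card_fract_near_int_le {c : ℝ} (hc1 : 1 < c) (hc3 : c < 206 / 100) (hc2 : c ≠ 2) :
    ∃ C : ℝ, 0 < C ∧ ∀ X : ℝ, 1 ≤ X →
      (((Ioc ⌊X / 2⌋₊ ⌊X⌋₊).filter (fun n : ℕ => ¬ (X ^ (-(1 / 1000) : ℝ) ≤ Int.fract ((n : ℝ) ^ c) ∧
        Int.fract ((n : ℝ) ^ c) ≤ 1 - X ^ (-(1 / 1000) : ℝ)))).card : ℝ)
        ≤ C * X ^ (999 / 1000 : ℝ) := by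
  obtain ⟨C, hC, hsav⟩ := dyadic_monomial_saving hc1 hc3 hc2
  refine ⟨3 * (16 + C), by positivity, fun X hX => ?_⟩
  have hX0 : 0 < X := by linarith
  set s := Ioc ⌊X / 2⌋₊ ⌊X⌋₊ with hs
  set δ := X ^ (-(1 / 1000) : ℝ) with hδ
  set Y := X ^ (1 / 1000 : ℝ) with hY
  have hYδ : Y * δ = 1 := by rw [hY, hδ, ← Real.rpow_add hX0]; norm_num
  have hδ0 : 0 < δ := by positivity
  have hXY : X = X ^ (999 / 1000 : ℝ) * Y := by
    rw [hY, ← Real.rpow_add hX0]; norm_num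
  have hZ0 : 0 ≤ X ^ (999 / 1000 : ℝ) := by positivity
  set bad := s.filter (fun n : ℕ => ¬ (δ ≤ Int.fract ((n : ℝ) ^ c) ∧
        Int.fract ((n : ℝ) ^ c) ≤ 1 - δ)) with hbad
  have hcs : (s.card : ℝ) ≤ X := card_Ioc_half_le hX0.le
  rcases lt_or_ge Y 8 with h8 | h8
  · have h1 : (bad.card : ℝ) ≤ s.card := by exact_mod_cast card_filter_le _ _
    have h2 : X ≤ X ^ (999 / 1000 : ℝ) * 8 := hXY.le.trans (by gcongr)
    nlinarith
  set H := ⌊Y / 8⌋₊ with hH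
  have hHpos : 0 < H := Nat.floor_pos.2 (by linarith)
  have hH0 : (0 : ℝ) < H := by exact_mod_cast hHpos
  have hH1 : (H : ℝ) ≤ Y / 8 := Nat.floor_le (by positivity)
  have hH2 : Y / 16 ≤ H := by
    have := Nat.lt_floor_add_one (Y / 8)
    have h1 : (1 : ℝ) ≤ H := by exact_mod_cast hHpos
    rw [← hH] at this
    linarith
  have hδH : δ ≤ 1 / (8 * H) := by
    rw [le_div_iff₀ (by positivity)]
    calc δ * (8 * H) ≤ δ * (8 * (Y / 8)) := by gcongr
      _ = 1 := by linarith
  have hlow : ∀ n ∈ bad, (7 / 10 * H : ℝ) ^ 2 ≤ ‖∑ j ∈ range H, eC (j * (n : ℝ) ^ c)‖ ^ 2 := by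
    intro n hn
    have hn := (mem_filter.1 hn).2
    have hf0 := Int.fract_nonneg ((n : ℝ) ^ c)
    have hf1 := Int.fract_lt_one ((n : ℝ) ^ c)
    have hex : ∃ m : ℤ, |(n : ℝ) ^ c - m| ≤ 1 / (8 * H) := by
      rw [not_and_or, not_le, not_le] at hn
      rcases hn with h | h
      · refine ⟨⌊(n : ℝ) ^ c⌋, le_trans ?_ hδH⟩
        rw [Int.self_sub_floor, abs_of_nonneg hf0]; exact h.le
      · refine ⟨⌊(n : ℝ) ^ c⌋ + 1, le_trans ?_ hδH⟩
        have := Int.self_sub_floor ((n : ℝ) ^ c)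
        push_cast
        rw [abs_le]; constructor <;> linarith
    obtain ⟨m, hm⟩ := hex
    have := norm_geom_eC_ge hHpos m hm
    gcongr
  have hup : ∑ n ∈ s, ‖∑ j ∈ range H, eC (j * (n : ℝ) ^ c)‖ ^ 2 ≤
      H * X + H ^ 2 * (C * X ^ (99 / 100 : ℝ)) := by
    have e : ((∑ n ∈ s, ‖∑ j ∈ range H, eC (j * (n : ℝ) ^ c)‖ ^ 2 : ℝ) : ℂ) =
        ∑ j ∈ range H, ∑ j' ∈ range H, ∑ n ∈ s, eC (((j : ℝ) - j') * (n : ℝ) ^ c) := by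
      rw [Complex.ofReal_sum]
      simp_rw [sq_norm_geom_eC]
      rw [sum_comm]
      exact sum_congr rfl fun j _ => sum_comm
    have hnn : 0 ≤ ∑ n ∈ s, ‖∑ j ∈ range H, eC (j * (n : ℝ) ^ c)‖ ^ 2 := by positivity
    rw [← Real.norm_of_nonneg hnn, ← Complex.norm_real, e]
    calc _ ≤ ∑ j ∈ range H, ∑ j' ∈ range H, ((if j = j' then X else 0) + C * X ^ (99 / 100 : ℝ)) := by
          refine (norm_sum_le _ _).trans (sum_le_sum fun j hj => (norm_sum_le _ _).trans
            (sum_le_sum fun j' hj' => ?_))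
          have hj := mem_range.1 hj
          have hj' := mem_range.1 hj'
          have hCX : 0 ≤ C * X ^ (99 / 100 : ℝ) := by positivity
          split_ifs with h
          · have := norm_sum_eC_le_card s (fun n => ((j : ℝ) - j') * (n : ℝ) ^ c)
            linarith
          · rw [zero_add]
            have hne : ((j : ℤ) - j') ≠ 0 := by omega
            refine hsav X _ hX ?_ ?_
            · have := Int.one_le_abs hne
              exact_mod_cast this
            · have h1 : |(j : ℤ) - j'| ≤ H := by rw [abs_le]; constructor <;> omega
              have h2 : |(j : ℝ) - j'| ≤ H := by exact_mod_cast h1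
              have h3 : Y ≤ X ^ (1 / 100 : ℝ) :=
                Real.rpow_le_rpow_of_exponent_le hX (by norm_num)
              linarith
      _ = _ := by
          simp only [sum_add_distrib, sum_ite_eq, sum_const, card_range, nsmul_eq_mul]
          rw [sum_congr rfl (fun j hj => if_pos hj)]
          simp; ring
  have h1 : (bad.card : ℝ) * (7 / 10 * H : ℝ) ^ 2 ≤ H * X + H ^ 2 * (C * X ^ (99 / 100 : ℝ)) := by
    rw [← nsmul_eq_mul, ← sum_const]
    refine (sum_le_sum hlow).trans ((sum_le_sum_of_subset_of_nonneg (filter_subset _ _)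
      fun _ _ _ => by positivity).trans hup)
  have h2 : X ^ (99 / 100 : ℝ) ≤ X ^ (999 / 1000 : ℝ) :=
    Real.rpow_le_rpow_of_exponent_le hX (by norm_num)
  have h3 : H * X ≤ H ^ 2 * (16 * X ^ (999 / 1000 : ℝ)) := by
    rw [sq, mul_assoc]
    gcongr
    calc X = X ^ (999 / 1000 : ℝ) * Y := hXY
      _ ≤ X ^ (999 / 1000 : ℝ) * (16 * H) := by gcongr; linarith
      _ = _ := by ring
  have h4 : H ^ 2 * (C * X ^ (99 / 100 : ℝ)) ≤ H ^ 2 * (C * X ^ (999 / 1000 : ℝ)) := by gcongr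
  have h5 : (H : ℝ) ^ 2 * (49 / 100 * bad.card) ≤ H ^ 2 * ((16 + C) * X ^ (999 / 1000 : ℝ)) := by
    linarith
  have h6 := le_of_mul_le_mul_left h5 (by positivity)
  have : 0 ≤ (16 + C) * X ^ (999 / 1000 : ℝ) := by positivity
  linarith

/-- The sup norm bound on the minor arcs for a dyadic block. -/
lemma sup_bound {c : ℝ} (hc1 : 1 < c) (hc3 : c < 206 / 100) (hc2 : c ≠ 2) :
    ∃ C : ℝ, 0 < C ∧ ∀ X α : ℝ, 1 ≤ X → X ^ (9 / 10 - c) ≤ α → α ≤ 1 - X ^ (9 / 10 - c) →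
      ‖∑ p ∈ (Ioc ⌊X / 2⌋₊ ⌊X⌋₊).filter Nat.Prime, (Real.log p : ℂ) * eC (⌊(p : ℝ) ^ c⌋ * α)‖
        ≤ C * X ^ (1 - 1 / 2000 : ℝ) := by
  obtain ⟨C₁, hC₁, hbad⟩ := card_fract_near_int_le hc1 hc3 hc2
  obtain ⟨C₂, hC₂, hexp⟩ := sum_prime_eC_bound hc1 (by linarith : c < 3) hc2
  obtain ⟨C₃, hC₃, hlog⟩ := one_add_log_pow_le 1 (by norm_num : (0 : ℝ) < 1 / 2000)
  refine ⟨C₂ + (π + 4) * 2 + 2 * (C₁ * C₃), by positivity, fun X α hX hα1 hα2 => ?_⟩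
  have hX0 : 0 < X := by linarith
  have hτ : 0 < X ^ (9 / 10 - c) := by positivity
  set δ := X ^ (-(1 / 1000) : ℝ) with hδ
  set Y := X ^ (3 / 1000 : ℝ) with hY
  have hY1 : 1 ≤ Y := Real.one_le_rpow hX (by norm_num)
  have hδ0 : 0 < δ := by positivity
  set K := ⌊Y⌋₊ with hK
  have hKpos : 0 < K := Nat.floor_pos.2 hY1
  have hK1 : (1 : ℝ) ≤ K := by exact_mod_cast hKpos
  have hKY : (K : ℝ) ≤ Y := Nat.floor_le (by positivity)
  have hYK : Y / 2 ≤ K := by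
    have := Nat.lt_floor_add_one Y
    rw [← hK] at this
    linarith
  set s := (Ioc ⌊X / 2⌋₊ ⌊X⌋₊).filter Nat.Prime with hs
  have hmem : ∀ n ∈ s, (n : ℝ) ≤ X := fun n hn =>
    (Nat.le_floor_iff hX0.le).1 (mem_Ioc.1 (mem_filter.1 hn).1).2
  have key := norm_sum_floor_le s (w := fun n => Real.log n) (t := fun n => (n : ℝ) ^ c)
    (fun n => Real.log_natCast_nonneg n) (α := α) (δ := δ) (B := C₂ * X ^ (1 - 1 / 250 : ℝ))
    (by linarith) (by linarith) hδ0 hKpos ?_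
  swap
  · intro h hh
    have hXc : X ^ (9 / 10 - c) * X ^ c = X ^ (9 / 10 : ℝ) := by
      rw [← Real.rpow_add hX0]; congr 1; ring
    have hlow : X ^ (9 / 10 - c) ≤ |α + h| := by
      rcases lt_trichotomy h 0 with h0 | h0 | h0
      · have : (h : ℝ) ≤ -1 := by exact_mod_cast (by omega : h ≤ -1)
        rw [abs_of_nonpos (by linarith)]; linarith
      · rw [h0]; simp only [Int.cast_zero, add_zero]; exact hα1.trans (le_abs_self _)
      · have : (1 : ℝ) ≤ h := by exact_mod_cast h0
        rw [abs_of_nonneg (by linarith)]; linarith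
    have hhi : |α + h| ≤ K := by
      rw [abs_lt] at hh
      have h1 : (h : ℝ) + 1 ≤ K := by exact_mod_cast (by omega : h + 1 ≤ (K : ℤ))
      have h2 : -(K : ℝ) ≤ h := by exact_mod_cast hh.1.le
      rw [abs_le]; constructor <;> linarith
    refine hexp X (α + h) hX ?_ ?_
    · rw [← hXc]; gcongr
    · calc |α + h| * X ^ c ≤ Y * X ^ c := by gcongr; linarith
        _ = X ^ (3 / 1000 + c) := by rw [hY, ← Real.rpow_add hX0]
        _ ≤ _ := Real.rpow_le_rpow_of_exponent_le hX (by linarith)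
  refine key.trans ?_
  have hE : X ^ (999 / 1000 : ℝ) ≤ X ^ (1 - 1 / 2000 : ℝ) :=
    Real.rpow_le_rpow_of_exponent_le hX (by norm_num)
  have t1 : K * (C₂ * X ^ (1 - 1 / 250 : ℝ)) ≤ C₂ * X ^ (1 - 1 / 2000 : ℝ) := by
    calc K * (C₂ * X ^ (1 - 1 / 250 : ℝ)) ≤ Y * (C₂ * X ^ (1 - 1 / 250 : ℝ)) := by gcongr
      _ = C₂ * X ^ (999 / 1000 : ℝ) := by
        rw [hY, mul_left_comm, ← Real.rpow_add hX0]; norm_num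
      _ ≤ _ := by gcongr
  have t2 : (π * δ + 2 / (K * δ ^ 2)) * ∑ n ∈ s, Real.log n ≤ (π + 4) * 2 * X ^ (1 - 1 / 2000 : ℝ) := by
    have h1 : 2 / (K * δ ^ 2) ≤ 4 * δ := by
      rw [div_le_iff₀ (by positivity)]
      have h2 : Y * δ ^ 2 * δ = 1 := by
        rw [hY, hδ, ← Real.rpow_natCast, ← Real.rpow_mul hX0.le, ← Real.rpow_add hX0,
          ← Real.rpow_add hX0]
        norm_num
      calc (2 : ℝ) = 4 * δ * (Y / 2 * δ ^ 2) := by linarith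
        _ ≤ _ := by gcongr
    have h3 : δ * X = X ^ (999 / 1000 : ℝ) := by
      rw [hδ, ← Real.rpow_add_one hX0.ne']; norm_num
    calc _ ≤ (π * δ + 4 * δ) * (2 * X) := by
          gcongr
          exact sum_log_prime_le hX0.le
      _ = (π + 4) * 2 * X ^ (999 / 1000 : ℝ) := by rw [← h3]; ring
      _ ≤ _ := by gcongr
  have t3 : ∑ n ∈ s.filter (fun n : ℕ => ¬ (δ ≤ Int.fract ((n : ℝ) ^ c) ∧
      Int.fract ((n : ℝ) ^ c) ≤ 1 - δ)), Real.log n ≤ C₁ * C₃ * X ^ (1 - 1 / 2000 : ℝ) := by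
    calc _ ≤ ∑ n ∈ s.filter (fun n : ℕ => ¬ (δ ≤ Int.fract ((n : ℝ) ^ c) ∧
          Int.fract ((n : ℝ) ^ c) ≤ 1 - δ)), C₃ * X ^ (1 / 2000 : ℝ) := by
          refine sum_le_sum fun n hn => ?_
          have hn := (mem_filter.1 hn).1
          have hp := (mem_filter.1 hn).2
          have h1 := hlog X hX
          rw [pow_one] at h1
          have h2 : Real.log n ≤ Real.log X :=
            Real.log_le_log (by exact_mod_cast hp.pos) (hmem n hn)
          linarith
      _ ≤ C₁ * X ^ (999 / 1000 : ℝ) * (C₃ * X ^ (1 / 2000 : ℝ)) := by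
          rw [sum_const, nsmul_eq_mul]
          gcongr
          refine le_trans ?_ (hbad X hX)
          exact_mod_cast card_le_card (filter_subset_filter _ (filter_subset _ _))
      _ = _ := by
          rw [mul_mul_mul_comm, ← Real.rpow_add hX0]; norm_num
  calc _ ≤ C₂ * X ^ (1 - 1 / 2000 : ℝ) + (π + 4) * 2 * X ^ (1 - 1 / 2000 : ℝ) +
        2 * (C₁ * C₃ * X ^ (1 - 1 / 2000 : ℝ)) := by gcongr
    _ = _ := by ring

lemma integral_eC_intCast_mul (k : ℤ) : ∫ x in (0 : ℝ)..1, eC (k * x) = if k = 0 then 1 else 0 := by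
  split_ifs with h
  · simp [h, eC_zero]
  · have hk : (2 * π * k * Complex.I : ℂ) ≠ 0 := by
      have : (π : ℂ) ≠ 0 := by exact_mod_cast Real.pi_ne_zero
      have : (k : ℂ) ≠ 0 := by exact_mod_cast h
      simp [*]
    have e : ∀ x : ℝ, eC (k * x) = Complex.exp (2 * π * k * Complex.I * x) := fun x => by
      rw [eC]; congr 1; push_cast; ring
    simp_rw [e]
    rw [integral_exp_mul_complex hk, ← e, ← e]
    simp [eC_intCast, eC_zero]

open scoped ComplexConjugate in
/-- The fourth moment is bounded by the number of solutions of the associated inequality. -/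
lemma fourth_moment_le (s : Finset ℕ) {w t : ℕ → ℝ} {L : ℝ} (hw : ∀ n, 0 ≤ w n)
    (hL : ∀ n ∈ s, w n ≤ L) :
    ∫ α in (0 : ℝ)..1, ‖∑ n ∈ s, (w n : ℂ) * eC (⌊t n⌋ * α)‖ ^ 4 ≤ L ^ 4 * quadCount s t 2 := by
  set W : ℕ × ℕ × ℕ × ℕ → ℝ := fun q => w q.1 * w q.2.1 * w q.2.2.1 * w q.2.2.2 with hW
  set k : ℕ × ℕ × ℕ × ℕ → ℤ := fun q => ⌊t q.1⌋ + ⌊t q.2.1⌋ - ⌊t q.2.2.1⌋ - ⌊t q.2.2.2⌋ with hk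
  have e : ∀ α : ℝ, ((‖∑ n ∈ s, (w n : ℂ) * eC (⌊t n⌋ * α)‖ ^ 4 : ℝ) : ℂ) =
      ∑ q ∈ s ×ˢ s ×ˢ s ×ˢ s, (W q : ℂ) * eC (k q * α) := by
    intro α
    rw [norm_pow_four_sum]
    refine sum_congr rfl fun q _ => ?_
    have : eC (k q * α) = eC (⌊t q.1⌋ * α) * eC (⌊t q.2.1⌋ * α) * conj (eC (⌊t q.2.2.1⌋ * α)) *
        conj (eC (⌊t q.2.2.2⌋ * α)) := by
      rw [← eC_add, ← eC_sub, ← eC_sub]; congr 1; simp only [hk]; push_cast; ring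
    rw [this]
    simp only [hW, map_mul, Complex.conj_ofReal]
    push_cast
    ring
  have hint : ∀ q, IntervalIntegrable (fun α : ℝ => (W q : ℂ) * eC (k q * α)) volume 0 1 := fun q =>
    (continuous_const.mul (continuous_eC.comp (continuous_const.mul continuous_id))).intervalIntegrable _ _
  have e2 : ∫ α in (0 : ℝ)..1, ‖∑ n ∈ s, (w n : ℂ) * eC (⌊t n⌋ * α)‖ ^ 4 =
      ∑ q ∈ s ×ˢ s ×ˢ s ×ˢ s, if k q = 0 then W q else 0 := by
    apply Complex.ofReal_injective
    rw [← intervalIntegral.integral_ofReal]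
    simp_rw [e]
    rw [intervalIntegral.integral_finsetSum fun q _ => hint q, Complex.ofReal_sum]
    refine sum_congr rfl fun q _ => ?_
    rw [intervalIntegral.integral_const_mul, integral_eC_intCast_mul]
    split_ifs <;> simp
  rw [e2, ← sum_filter]
  have hsub : (s ×ˢ s ×ˢ s ×ˢ s).filter (fun q => k q = 0) ⊆
      (s ×ˢ s ×ˢ s ×ˢ s).filter (fun q => |t q.1 + t q.2.1 - t q.2.2.1 - t q.2.2.2| ≤ 2) := by
    intro q hq
    rw [mem_filter] at hq ⊢
    refine ⟨hq.1, ?_⟩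
    have h : (⌊t q.1⌋ + ⌊t q.2.1⌋ - ⌊t q.2.2.1⌋ - ⌊t q.2.2.2⌋ : ℝ) = 0 := by exact_mod_cast hq.2
    have h1 := Int.floor_le (t q.1)
    have h2 := Int.floor_le (t q.2.1)
    have h3 := Int.floor_le (t q.2.2.1)
    have h4 := Int.floor_le (t q.2.2.2)
    have h5 := Int.lt_floor_add_one (t q.1)
    have h6 := Int.lt_floor_add_one (t q.2.1)
    have h7 := Int.lt_floor_add_one (t q.2.2.1)
    have h8 := Int.lt_floor_add_one (t q.2.2.2)
    rw [abs_le]; constructor <;> linarith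
  calc _ ≤ ∑ q ∈ (s ×ˢ s ×ˢ s ×ˢ s).filter (fun q => k q = 0), L ^ 4 := by
        refine sum_le_sum fun q hq => ?_
        obtain ⟨h1, h2, h3, h4⟩ : q.1 ∈ s ∧ q.2.1 ∈ s ∧ q.2.2.1 ∈ s ∧ q.2.2.2 ∈ s := by
          simpa only [mem_product] using (mem_filter.1 hq).1
        have a1 := hL _ h1
        have a2 := hL _ h2
        have a3 := hL _ h3
        have a4 := hL _ h4
        have hL0 : 0 ≤ L := (hw _).trans a1
        calc W q ≤ L * L * L * L := by
              simp only [hW]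
              have b1 := hw q.1
              have b2 := hw q.2.1
              have b3 := hw q.2.2.1
              have b4 := hw q.2.2.2
              gcongr
          _ = L ^ 4 := by ring
    _ = L ^ 4 * (((s ×ˢ s ×ˢ s ×ˢ s).filter (fun q => k q = 0)).card : ℝ) := by
        rw [sum_const, nsmul_eq_mul, mul_comm]
    _ ≤ _ := by
        rcases s.eq_empty_or_nonempty with rfl | ⟨n, hn⟩
        · simp [quadCount]
        · have : 0 ≤ L := (hw n).trans (hL n hn)
          gcongr
          exact card_le_card hsub

lemma prime_fourth_moment_le {c β : ℝ} (hc1 : 1 < c) (hβ : 0 < β) :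
    ∃ C : ℝ, 0 < C ∧ ∀ X : ℝ, 1 ≤ X →
      ∫ α in (0 : ℝ)..1, ‖∑ p ∈ (Ioc ⌊X / 2⌋₊ ⌊X⌋₊).filter Nat.Prime,
        (Real.log p : ℂ) * eC (⌊(p : ℝ) ^ c⌋ * α)‖ ^ 4
        ≤ C * (1 + Real.log X) ^ 4 * (X ^ β * (X ^ (4 - c) + X ^ 2)) := by
  obtain ⟨C, hC, h⟩ := quadBound_of_pos hβ c 2 hc1 (by norm_num)
  refine ⟨2 * C, by positivity, fun X hX => ?_⟩
  have hX0 : 0 < X := by linarith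
  have hlog : 0 ≤ Real.log X := Real.log_nonneg hX
  refine (fourth_moment_le _ (w := fun n => Real.log n) (t := fun n => (n : ℝ) ^ c)
    (fun n => Real.log_natCast_nonneg n) (L := 1 + Real.log X) ?_).trans ?_
  · intro n hn
    have hp := (mem_filter.1 hn).2
    have h1 := (Nat.le_floor_iff hX0.le).1 (mem_Ioc.1 (mem_filter.1 hn).1).2
    have := Real.log_le_log (by exact_mod_cast hp.pos : (0 : ℝ) < n) h1
    linarith
  · have hXc : 0 < X ^ c := by positivity
    have hsub : (Ioc ⌊X / 2⌋₊ ⌊X⌋₊).filter Nat.Prime ⊆ Finset.Icc ⌈X / 2⌉₊ ⌊2 * X⌋₊ := by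
      intro n hn
      have hn := mem_Ioc.1 (mem_filter.1 hn).1
      rw [mem_Icc]
      refine ⟨(Nat.ceil_le_floor_add_one _).trans hn.1, hn.2.trans (Nat.floor_le_floor (by linarith))⟩
    have hq : quadCount ((Ioc ⌊X / 2⌋₊ ⌊X⌋₊).filter Nat.Prime) (fun n => (n : ℝ) ^ c) 2 ≤
        quadCount (Finset.Icc ⌈X / 2⌉₊ ⌊2 * X⌋₊) (fun n => ((n : ℝ) / X) ^ c) (2 / X ^ c) := by
      refine card_le_card fun q hq => ?_
      simp only [mem_filter, mem_product] at hq ⊢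
      refine ⟨⟨hsub (mem_filter.2 hq.1.1), hsub (mem_filter.2 hq.1.2.1),
        hsub (mem_filter.2 hq.1.2.2.1), hsub (mem_filter.2 hq.1.2.2.2)⟩, ?_⟩
      simp_rw [Real.div_rpow (Nat.cast_nonneg _) hX0.le]
      rw [← add_div, ← sub_div, ← sub_div, abs_div, abs_of_pos hXc]
      gcongr
      exact hq.2
    have h2 := h X (2 / X ^ c) hX (by positivity)
    have e : C * X ^ (4 + β) * (2 / X ^ c + (X ^ 2)⁻¹) =
        C * (X ^ β * (2 * X ^ (4 - c) + X ^ 2)) := by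
      rw [Real.rpow_add hX0, Real.rpow_sub hX0]
      norm_num
      field_simp
    have h3 : X ^ β * (2 * X ^ (4 - c) + X ^ 2) ≤ 2 * (X ^ β * (X ^ (4 - c) + X ^ 2)) := by
      have : 0 ≤ X ^ β * X ^ 2 := by positivity
      linarith
    calc _ ≤ (1 + Real.log X) ^ 4 * (C * (2 * (X ^ β * (X ^ (4 - c) + X ^ 2)))) := by
          gcongr
          refine le_trans (by exact_mod_cast hq) (h2.trans ?_)
          rw [e]
          gcongr
      _ = _ := by ring

open scoped ComplexConjugate in
lemma sum_sq_norm_integral_le (s : Finset ℕ) {t : ℕ → ℝ} {h : ℝ → ℂ} (hh : Continuous h)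
    {G m : ℝ → ℝ} (hG : Continuous G) (hm : Continuous m) {a b : ℝ} (ha : 0 ≤ a) (hab : a ≤ b)
    (hb : b ≤ 1) (hhG : ∀ α, 0 ≤ α → α ≤ 1 → ‖h α‖ ≤ G α)
    (hT : ∀ θ, |θ| ≤ 1 → ‖∑ n ∈ s, eC (θ * t n)‖ ≤ m θ) :
    ∑ n ∈ s, ‖∫ α in a..b, h α * eC (α * t n)‖ ^ 2 ≤
      ∫ α in a..b, ∫ β in a..b, G α * G β * m (α - β) := by
  have hc : ∀ n, Continuous fun α : ℝ => h α * eC (α * t n) := fun n =>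
    hh.mul (continuous_eC.comp (continuous_id.mul continuous_const))
  have hF : ∀ n, Continuous (Function.uncurry fun α β : ℝ =>
      h α * eC (α * t n) * conj (h β * eC (β * t n))) := fun n =>
    ((hc n).comp continuous_fst).mul (Complex.continuous_conj.comp ((hc n).comp continuous_snd))
  have hFi : ∀ n, Continuous fun α : ℝ => ∫ β in a..b,
      h α * eC (α * t n) * conj (h β * eC (β * t n)) := fun n =>
    intervalIntegral.continuous_parametric_intervalIntegral_of_continuous' (hF n) a b
  have hGm : Continuous (Function.uncurry fun α β : ℝ => G α * G β * m (α - β)) := by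
    simp only [Function.uncurry_def]; fun_prop
  have e : ((∑ n ∈ s, ‖∫ α in a..b, h α * eC (α * t n)‖ ^ 2 : ℝ) : ℂ) =
      ∫ α in a..b, ∫ β in a..b, h α * conj (h β) * ∑ n ∈ s, eC ((α - β) * t n) := by
    rw [Complex.ofReal_sum]
    calc _ = ∑ n ∈ s, ∫ α in a..b, ∫ β in a..b, h α * eC (α * t n) * conj (h β * eC (β * t n)) := by
          refine sum_congr rfl fun n _ => ?_
          push_cast
          rw [← Complex.mul_conj', ← intervalIntegral.intervalIntegral_conj,
            ← intervalIntegral.integral_mul_const]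
          simp_rw [intervalIntegral.integral_const_mul]
      _ = _ := by
          rw [← intervalIntegral.integral_finsetSum fun n _ => (hFi n).intervalIntegrable _ _]
          congr 1; funext α
          have hFa : ∀ n, Continuous fun β : ℝ => h α * eC (α * t n) * conj (h β * eC (β * t n)) :=
            fun n => (hF n).comp (Continuous.prodMk_right α)
          rw [← intervalIntegral.integral_finsetSum fun n _ => (hFa n).intervalIntegrable _ _]
          congr 1; funext β
          rw [mul_sum]
          refine sum_congr rfl fun n _ => ?_
          rw [sub_mul, eC_sub, map_mul]; ring
  have hnn : 0 ≤ ∑ n ∈ s, ‖∫ α in a..b, h α * eC (α * t n)‖ ^ 2 := by positivity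
  rw [← Real.norm_of_nonneg hnn, ← Complex.norm_real, e]
  refine intervalIntegral.norm_integral_le_of_norm_le hab (ae_of_all _ fun α hα => ?_)
    ((intervalIntegral.continuous_parametric_intervalIntegral_of_continuous' hGm a b).intervalIntegrable _ _)
  refine intervalIntegral.norm_integral_le_of_norm_le hab (ae_of_all _ fun β hβ => ?_)
    ((hGm.comp (Continuous.prodMk_right α)).intervalIntegrable _ _)
  rw [norm_mul, norm_mul, RCLike.norm_conj]
  have h1 := hhG α (by linarith [hα.1]) (by linarith [hα.2])
  have h2 := hhG β (by linarith [hβ.1]) (by linarith [hβ.2])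
  have h3 := hT (α - β) (by rw [abs_le]; constructor <;> linarith [hα.1, hα.2, hβ.1, hβ.2])
  have h4 := (norm_nonneg _).trans h1
  have h5 := (norm_nonneg _).trans h2
  gcongr

/-- The fractional parts are removed by a Taylor expansion. -/
lemma norm_sum_mul_integral_le {s' s : Finset ℕ} (hs : s' ⊆ s) {w t f : ℕ → ℝ} (hf : ∀ n, |f n| ≤ 1)
    {g : ℝ → ℂ} (hg : Continuous g) {m : ℝ → ℝ} (hm : Continuous m) {a b : ℝ} (ha : 0 ≤ a)
    (hab : a ≤ b) (hb : b ≤ 1) (hT : ∀ θ, |θ| ≤ 1 → ‖∑ n ∈ s, eC (θ * t n)‖ ≤ m θ) :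
    ‖∑ n ∈ s', (w n : ℂ) * ∫ α in a..b, g α * eC ((t n - f n) * α)‖ ≤ Real.exp (2 * π) *
      (√(∑ n ∈ s', w n ^ 2) * √(∫ α in a..b, ∫ β in a..b, ‖g α‖ * ‖g β‖ * m (α - β))) := by
  set Q := ∫ α in a..b, ∫ β in a..b, ‖g α‖ * ‖g β‖ * m (α - β) with hQ
  set z : ℕ → ℂ := fun n => -(2 * π * f n : ℝ) * Complex.I with hz
  have hzn : ∀ n, ‖z n‖ ≤ 2 * π := by
    intro n
    simp only [hz]
    rw [norm_mul, norm_neg, Complex.norm_I, mul_one, Complex.norm_real, Real.norm_eq_abs, abs_mul,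
      abs_of_pos Real.two_pi_pos]
    have := hf n
    have := Real.two_pi_pos
    nlinarith
  have hsum : ∀ n, HasSum (fun k : ℕ => (z n ^ k / k.factorial) *
      ∫ α in a..b, (g α * (α : ℂ) ^ k) * eC (α * t n)) (∫ α in a..b, g α * eC ((t n - f n) * α)) := by
    intro n
    have key := intervalIntegral.hasSum_integral_of_dominated_convergence (μ := volume) (a := a) (b := b)
      (F := fun (k : ℕ) (α : ℝ) => (z n ^ k / k.factorial) * ((g α * (α : ℂ) ^ k) * eC (α * t n)))
      (f := fun α => g α * eC ((t n - f n) * α))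
      (fun k α => ‖g α‖ * ((2 * π) ^ k / k.factorial)) ?_ ?_ ?_ ?_ ?_
    · simpa only [intervalIntegral.integral_const_mul] using key
    · intro k
      refine Continuous.aestronglyMeasurable ?_
      exact continuous_const.mul ((hg.mul (Complex.continuous_ofReal.pow k)).mul
        (continuous_eC.comp (continuous_id.mul continuous_const)))
    · refine fun k => ae_of_all _ fun α hα => ?_
      rw [Set.uIoc_of_le hab] at hα
      have h0 : 0 ≤ α := by linarith [hα.1]
      have h1 : α ≤ 1 := by linarith [hα.2]
      rw [norm_mul, norm_mul, norm_mul, norm_eC, norm_div, norm_pow, norm_pow, Complex.norm_real,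
        Real.norm_of_nonneg h0, Complex.norm_natCast, mul_one, mul_comm]
      have h2 : α ^ k ≤ 1 := pow_le_one₀ h0 h1
      have h3 := hzn n
      have h4 : ‖g α‖ * α ^ k ≤ ‖g α‖ := mul_le_of_le_one_right (norm_nonneg _) h2
      gcongr
    · exact ae_of_all _ fun α _ => (NormedSpace.expSeries_div_hasSum_exp (2 * π)).summable.mul_left _
    · have : (fun α => ∑' k : ℕ, ‖g α‖ * ((2 * π) ^ k / k.factorial)) =
          fun α => ‖g α‖ * ∑' k : ℕ, ((2 * π) ^ k / k.factorial) := by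
        funext α; rw [tsum_mul_left]
      rw [this]
      exact (hg.norm.mul continuous_const).intervalIntegrable _ _
    · refine ae_of_all _ fun α _ => ?_
      have h1 := (NormedSpace.expSeries_div_hasSum_exp (z n * α)).mul_left (g α * eC (α * t n))
      have e1 : g α * eC (α * t n) * NormedSpace.exp (z n * α) = g α * eC ((t n - f n) * α) := by
        rw [← Complex.exp_eq_exp_ℂ, mul_assoc]
        congr 1
        rw [eC, eC, ← Complex.exp_add]
        congr 1
        simp only [hz]; push_cast; ring
      rw [e1] at h1
      refine h1.congr_fun fun k => ?_
      rw [mul_pow]; ring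
  have hpow : ∀ k : ℕ, √(∑ n ∈ s', ‖∫ α in a..b, (g α * (α : ℂ) ^ k) * eC (α * t n)‖ ^ 2) ≤ √Q := by
    intro k
    apply Real.sqrt_le_sqrt
    refine (sum_le_sum_of_subset_of_nonneg hs fun _ _ _ => by positivity).trans ?_
    refine sum_sq_norm_integral_le s (hg.mul (Complex.continuous_ofReal.pow k)) hg.norm hm ha hab hb
      (fun α h0 h1 => ?_) hT
    rw [Pi.mul_apply, Pi.pow_apply, norm_mul, norm_pow, Complex.norm_real, Real.norm_of_nonneg h0]
    exact mul_le_of_le_one_right (norm_nonneg _) (pow_le_one₀ h0 h1)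
  have htot : HasSum (fun k : ℕ => ∑ n ∈ s', (w n : ℂ) * ((z n ^ k / k.factorial) *
      ∫ α in a..b, (g α * (α : ℂ) ^ k) * eC (α * t n)))
      (∑ n ∈ s', (w n : ℂ) * ∫ α in a..b, g α * eC ((t n - f n) * α)) :=
    hasSum_sum fun n _ => (hsum n).mul_left _
  have hexp : HasSum (fun k : ℕ => (2 * π) ^ k / k.factorial * (√(∑ n ∈ s', w n ^ 2) * √Q))
      (Real.exp (2 * π) * (√(∑ n ∈ s', w n ^ 2) * √Q)) := by
    rw [Real.exp_eq_exp_ℝ]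
    exact (NormedSpace.expSeries_div_hasSum_exp (2 * π)).mul_right _
  refine htot.norm_le_of_bounded hexp fun k => ?_
  calc _ ≤ ∑ n ∈ s', (2 * π) ^ k / k.factorial *
        (|w n| * ‖∫ α in a..b, (g α * (α : ℂ) ^ k) * eC (α * t n)‖) := by
        refine (norm_sum_le _ _).trans (sum_le_sum fun n _ => ?_)
        rw [norm_mul, norm_mul, norm_div, norm_pow, Complex.norm_real, Complex.norm_natCast,
          Real.norm_eq_abs, mul_left_comm]
        have := hzn n
        gcongr
    _ ≤ _ := by
        rw [← mul_sum]
        gcongr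
        refine (Real.sum_mul_le_sqrt_mul_sqrt _ _ _).trans ?_
        simp_rw [sq_abs]
        exact mul_le_mul_of_nonneg_left (hpow k) (Real.sqrt_nonneg _)

/-- Schur's test for a symmetric difference kernel. -/
lemma schur_test {G m : ℝ → ℝ} (hG : Continuous G) (hm : Continuous m) (hm0 : ∀ θ, 0 ≤ m θ)
    (hme : ∀ θ, m (-θ) = m θ) {a b M : ℝ} (hab : a ≤ b)
    (hM : ∀ α, a ≤ α → α ≤ b → ∫ β in a..b, m (α - β) ≤ M) :
    ∫ α in a..b, ∫ β in a..b, G α * G β * m (α - β) ≤ M * ∫ α in a..b, G α ^ 2 := by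
  have hF : Continuous (Function.uncurry fun α β : ℝ => G α ^ 2 * m (α - β)) := by
    simp only [Function.uncurry_def]; fun_prop
  have hF' : Continuous (Function.uncurry fun α β : ℝ => G β ^ 2 * m (α - β)) := by
    simp only [Function.uncurry_def]; fun_prop
  have hGm : Continuous (Function.uncurry fun α β : ℝ => G α * G β * m (α - β)) := by
    simp only [Function.uncurry_def]; fun_prop
  have hI : ∀ {F : ℝ → ℝ → ℝ}, Continuous (Function.uncurry F) →
      IntervalIntegrable (fun α => ∫ β in a..b, F α β) volume a b := fun h =>
    (intervalIntegral.continuous_parametric_intervalIntegral_of_continuous' h a b).intervalIntegrable _ _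
  have hI' : ∀ {F : ℝ → ℝ → ℝ}, Continuous (Function.uncurry F) → ∀ α,
      IntervalIntegrable (F α) volume a b := fun h α =>
    (h.comp (Continuous.prodMk_right α)).intervalIntegrable _ _
  have hswap : ∫ α in a..b, ∫ β in a..b, G β ^ 2 * m (α - β) =
      ∫ α in a..b, ∫ β in a..b, G α ^ 2 * m (α - β) := by
    rw [intervalIntegral_intervalIntegral_swap]
    · refine intervalIntegral.integral_congr fun β _ => intervalIntegral.integral_congr fun α _ => ?_
      rw [← hme, neg_sub]
    · exact (hF'.continuousOn.integrableOn_compact (isCompact_uIcc.prod isCompact_uIcc)).mono_set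
        (Set.prod_mono Set.uIoc_subset_uIcc Set.uIoc_subset_uIcc)
  have h1 : ∫ α in a..b, ∫ β in a..b, G α ^ 2 * m (α - β) ≤ M * ∫ α in a..b, G α ^ 2 := by
    rw [← intervalIntegral.integral_const_mul]
    refine intervalIntegral.integral_mono_on hab (hI hF) ((continuous_const.mul
      (hG.pow 2)).intervalIntegrable _ _) fun α hα => ?_
    rw [intervalIntegral.integral_const_mul, mul_comm]
    exact mul_le_mul_of_nonneg_right (hM α hα.1 hα.2) (sq_nonneg _)
  have h2 : 2 * ∫ α in a..b, ∫ β in a..b, G α * G β * m (α - β) ≤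
      (∫ α in a..b, ∫ β in a..b, G α ^ 2 * m (α - β)) +
      ∫ α in a..b, ∫ β in a..b, G β ^ 2 * m (α - β) := by
    rw [← intervalIntegral.integral_add (hI hF) (hI hF'), ← intervalIntegral.integral_const_mul]
    refine intervalIntegral.integral_mono_on hab ((hI hGm).const_mul 2) ((hI hF).add (hI hF'))
      fun α _ => ?_
    rw [← intervalIntegral.integral_add (hI' hF α) (hI' hF' α), ← intervalIntegral.integral_const_mul]
    refine intervalIntegral.integral_mono_on hab ((hI' hGm α).const_mul 2)
      ((hI' hF α).add (hI' hF' α)) fun β _ => ?_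
    have := hm0 (α - β)
    nlinarith [mul_nonneg (sq_nonneg (G α - G β)) this]
  linarith

lemma integral_inv_one_add_le {A : ℝ} (hA : 0 < A) {α : ℝ} (h0 : 0 ≤ α) (h1 : α ≤ 1) :
    ∫ β in (0 : ℝ)..1, (1 + A * |α - β|)⁻¹ ≤ 2 * Real.log (1 + A) / A := by
  have hc : Continuous fun β : ℝ => (1 + A * |α - β|)⁻¹ :=
    Continuous.inv₀ (by fun_prop) fun β => by positivity
  rw [← intervalIntegral.integral_add_adjacent_intervals (hc.intervalIntegrable 0 α)
    (hc.intervalIntegrable α 1)]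
  have e1 : ∫ β in (0 : ℝ)..α, (1 + A * |α - β|)⁻¹ = Real.log (1 + A * α) / A := by
    rw [intervalIntegral.integral_eq_sub_of_hasDerivAt
      (f := fun β => -(Real.log (1 + A * (α - β)) / A)) (f' := fun β => (1 + A * |α - β|)⁻¹)]
    · simp
    · intro β hβ
      rw [Set.uIcc_of_le h0] at hβ
      have hp : 0 ≤ α - β := by linarith [hβ.2]
      have hne : 1 + A * (α - β) ≠ 0 := by positivity
      rw [abs_of_nonneg hp]
      have := ((((hasDerivAt_id β).const_sub α).const_mul A).const_add 1).log hne
      convert! (this.div_const A).neg using 1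
      simp only [id]
      field_simp
    · exact hc.intervalIntegrable _ _
  have e2 : ∫ β in α..1, (1 + A * |α - β|)⁻¹ = Real.log (1 + A * (1 - α)) / A := by
    rw [intervalIntegral.integral_eq_sub_of_hasDerivAt
      (f := fun β => Real.log (1 + A * (β - α)) / A) (f' := fun β => (1 + A * |α - β|)⁻¹)]
    · simp
    · intro β hβ
      rw [Set.uIcc_of_le h1] at hβ
      have hp : 0 ≤ β - α := by linarith [hβ.1]
      have hne : 1 + A * (β - α) ≠ 0 := by positivity
      rw [abs_sub_comm, abs_of_nonneg hp]
      have := ((((hasDerivAt_id β).sub_const α).const_mul A).const_add 1).log hne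
      convert! this.div_const A using 1
      simp only [id]
      field_simp
    · exact hc.intervalIntegrable _ _
  rw [e1, e2, ← add_div]
  have h2 : Real.log (1 + A * α) ≤ Real.log (1 + A) :=
    Real.log_le_log (by positivity) (by nlinarith)
  have h3 : Real.log (1 + A * (1 - α)) ≤ Real.log (1 + A) :=
    Real.log_le_log (by nlinarith [mul_nonneg hA.le (sub_nonneg.2 h1)]) (by nlinarith)
  gcongr
  linarith

lemma le_of_sq_le_mul_add_sq {x a b : ℝ} (ha : 0 ≤ a) (hb : 0 ≤ b) (h : x ^ 2 ≤ a * x + b ^ 2) :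
    x ≤ a + b := by
  by_contra! hx
  nlinarith

/-- A Halász-type inequality: the fifth moment on `[a, b]` is controlled by the supremum on `[a, b]`
and the fourth moment on `[0, 1]`. -/
lemma fifth_moment_le {s' s : Finset ℕ} (hs : s' ⊆ s) {w t : ℕ → ℝ} {A B D E V a b : ℝ}
    (hA : 0 < A) (hD : 0 ≤ D) (hE : 0 ≤ E) (hB : ∑ n ∈ s', w n ^ 2 ≤ B)
    (ha : 0 ≤ a) (hab : a ≤ b) (hb : b ≤ 1)
    (hT : ∀ θ, |θ| ≤ 1 → ‖∑ n ∈ s, eC (θ * t n)‖ ≤ D * (1 + A * |θ|)⁻¹ + E)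
    (hV : ∀ α, a ≤ α → α ≤ b → ‖∑ n ∈ s', (w n : ℂ) * eC (⌊t n⌋ * α)‖ ≤ V) :
    ∫ α in a..b, ‖∑ n ∈ s', (w n : ℂ) * eC (⌊t n⌋ * α)‖ ^ 5 ≤
      Real.exp (2 * π) ^ 2 * B * (D * (2 * Real.log (1 + A) / A)) * V ^ 3 +
      Real.exp (2 * π) * √(B * E) *
        ∫ α in (0 : ℝ)..1, ‖∑ n ∈ s', (w n : ℂ) * eC (⌊t n⌋ * α)‖ ^ 4 := by
  set S : ℝ → ℂ := fun α => ∑ n ∈ s', (w n : ℂ) * eC (⌊t n⌋ * α) with hSdef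
  have hS : Continuous S := continuous_finsetSum _ fun _ _ =>
    continuous_const.mul (continuous_eC.comp (continuous_const.mul continuous_id))
  set I := ∫ α in a..b, ‖S α‖ ^ 5 with hI
  set J := ∫ α in (0 : ℝ)..1, ‖S α‖ ^ 4 with hJ
  set g : ℝ → ℂ := fun α => (‖S α‖ : ℂ) ^ 3 * (starRingEnd ℂ) (S α) with hg
  have hgc : Continuous g := by
    simp only [hg]
    exact ((Complex.continuous_ofReal.comp hS.norm).pow 3).mul (Complex.continuous_conj.comp hS)
  have hgn : ∀ α, ‖g α‖ = ‖S α‖ ^ 4 := fun α => by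
    simp only [hg]
    rw [norm_mul, norm_pow, Complex.norm_real, norm_norm, RCLike.norm_conj]; ring
  have hI0 : 0 ≤ I := intervalIntegral.integral_nonneg hab fun _ _ => by positivity
  have hJ0 : 0 ≤ J := intervalIntegral.integral_nonneg zero_le_one fun _ _ => by positivity
  have hB0 : 0 ≤ B := (sum_nonneg fun _ _ => sq_nonneg _).trans hB
  have hV0 : 0 ≤ V := (norm_nonneg _).trans (hV a le_rfl hab)
  have hcn : Continuous fun θ : ℝ => (1 + A * |θ|)⁻¹ :=
    Continuous.inv₀ (by fun_prop) fun β => by positivity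
  have hm : Continuous fun θ : ℝ => D * (1 + A * |θ|)⁻¹ + E := (hcn.const_mul D).add_const E
  have hfr : ∀ n, |Int.fract (t n)| ≤ 1 := fun n => by
    rw [abs_of_nonneg (Int.fract_nonneg _)]; exact (Int.fract_lt_one _).le
  have key := norm_sum_mul_integral_le hs (w := w) (t := t) hfr hgc hm ha hab hb hT
  set Q := ∫ α in a..b, ∫ β in a..b, ‖g α‖ * ‖g β‖ * (D * (1 + A * |α - β|)⁻¹ + E) with hQ
  have eI : (I : ℂ) = ∑ n ∈ s', (w n : ℂ) * ∫ α in a..b, g α * eC ((t n - Int.fract (t n)) * α) := by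
    simp_rw [← intervalIntegral.integral_const_mul]
    rw [← intervalIntegral.integral_finsetSum, hI, ← intervalIntegral.integral_ofReal]
    · refine intervalIntegral.integral_congr fun α _ => ?_
      have e1 : ((‖S α‖ ^ 5 : ℝ) : ℂ) = g α * S α := by
        simp only [hg]
        rw [mul_assoc, mul_comm ((starRingEnd ℂ) (S α)), Complex.mul_conj']
        push_cast; ring
      rw [e1, hSdef]
      simp only
      rw [mul_sum]
      refine sum_congr rfl fun n _ => ?_
      rw [Int.self_sub_fract]; ring
    · intro n _
      exact (continuous_const.mul (hgc.mul (continuous_eC.comp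
        (continuous_const.mul continuous_id)))).intervalIntegrable _ _
  have hIle : I ≤ Real.exp (2 * π) * (√B * √Q) := by
    rw [← Real.norm_of_nonneg hI0, ← Complex.norm_real, eI]
    refine key.trans ?_
    gcongr
  have hQle : Q ≤ D * (2 * Real.log (1 + A) / A) * V ^ 3 * I + E * J ^ 2 := by
    have hF1 : Continuous (Function.uncurry fun α β : ℝ => ‖g α‖ * ‖g β‖ * (D * (1 + A * |α - β|)⁻¹)) := by
      simp only [Function.uncurry_def]
      have h2 : Continuous fun p : ℝ × ℝ => (1 + A * |p.1 - p.2|)⁻¹ :=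
        hcn.comp (continuous_fst.sub continuous_snd)
      fun_prop
    have hF2 : Continuous (Function.uncurry fun α β : ℝ => ‖g α‖ * ‖g β‖ * E) := by
      simp only [Function.uncurry_def]; fun_prop
    have eQ : Q = (∫ α in a..b, ∫ β in a..b, ‖g α‖ * ‖g β‖ * (D * (1 + A * |α - β|)⁻¹)) +
        ∫ α in a..b, ∫ β in a..b, ‖g α‖ * ‖g β‖ * E := by
      rw [← intervalIntegral.integral_add]
      · refine intervalIntegral.integral_congr fun α _ => ?_
        rw [← intervalIntegral.integral_add]
        · refine intervalIntegral.integral_congr fun β _ => ?_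
          ring
        · exact (hF1.comp (Continuous.prodMk_right α)).intervalIntegrable _ _
        · exact (hF2.comp (Continuous.prodMk_right α)).intervalIntegrable _ _
      · exact (intervalIntegral.continuous_parametric_intervalIntegral_of_continuous' hF1 a
          b).intervalIntegrable _ _
      · exact (intervalIntegral.continuous_parametric_intervalIntegral_of_continuous' hF2 a
          b).intervalIntegrable _ _
    have hL : 0 ≤ Real.log (1 + A) := Real.log_nonneg (by linarith)
    have hQ1 : ∫ α in a..b, ∫ β in a..b, ‖g α‖ * ‖g β‖ * (D * (1 + A * |α - β|)⁻¹) ≤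
        D * (2 * Real.log (1 + A) / A) * V ^ 3 * I := by
      refine (schur_test (m := fun θ => D * (1 + A * |θ|)⁻¹) hgc.norm (hcn.const_mul D)
        (fun θ => by positivity) (fun θ => by simp only [abs_neg]) hab
        (M := D * (2 * Real.log (1 + A) / A)) fun α h0 h1 => ?_).trans ?_
      · rw [intervalIntegral.integral_const_mul]
        refine mul_le_mul_of_nonneg_left (le_trans ?_ (integral_inv_one_add_le hA
          (by linarith) (by linarith) : ∫ β in (0 : ℝ)..1, (1 + A * |α - β|)⁻¹ ≤ _)) hD
        refine intervalIntegral.integral_mono_interval ha hab hb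
          (ae_of_all _ fun β => by simp only [Pi.zero_apply]; positivity) ?_
        exact (hcn.comp (continuous_const.sub continuous_id)).intervalIntegrable _ _
      · rw [mul_assoc _ (V ^ 3)]
        refine mul_le_mul_of_nonneg_left ?_ (by positivity)
        rw [hI, ← intervalIntegral.integral_const_mul]
        refine intervalIntegral.integral_mono_on hab ((hgc.norm.pow 2).intervalIntegrable _ _)
          ((continuous_const.mul (hS.norm.pow 5)).intervalIntegrable _ _) fun α hα => ?_
        simp only [hgn]
        have := hV α hα.1 hα.2
        calc (‖S α‖ ^ 4) ^ 2 = ‖S α‖ ^ 3 * ‖S α‖ ^ 5 := by ring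
          _ ≤ _ := by gcongr
    have hQ2 : ∫ α in a..b, ∫ β in a..b, ‖g α‖ * ‖g β‖ * E ≤ E * J ^ 2 := by
      have e1 : ∫ α in a..b, ∫ β in a..b, ‖g α‖ * ‖g β‖ * E =
          E * (∫ α in a..b, ‖S α‖ ^ 4) ^ 2 := by
        simp_rw [intervalIntegral.integral_mul_const, intervalIntegral.integral_const_mul, hgn]
        rw [intervalIntegral.integral_mul_const]; ring
      rw [e1]
      have h0 : 0 ≤ ∫ α in a..b, ‖S α‖ ^ 4 := intervalIntegral.integral_nonneg hab fun _ _ => by positivity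
      have h1 : ∫ α in a..b, ‖S α‖ ^ 4 ≤ J :=
        intervalIntegral.integral_mono_interval ha hab hb
          (ae_of_all _ fun β => by simp only [Pi.zero_apply]; positivity)
          ((hS.norm.pow 4).intervalIntegrable _ _)
      gcongr
    linarith
  apply le_of_sq_le_mul_add_sq
  · have hL : 0 ≤ Real.log (1 + A) := Real.log_nonneg (by linarith)
    positivity
  · positivity
  have hQ0 : 0 ≤ Q := intervalIntegral.integral_nonneg hab fun α _ =>
    intervalIntegral.integral_nonneg hab fun β _ => by positivity
  calc I ^ 2 ≤ (Real.exp (2 * π) * (√B * √Q)) ^ 2 := by gcongr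
    _ = Real.exp (2 * π) ^ 2 * (B * Q) := by
        rw [mul_pow, mul_pow, Real.sq_sqrt hB0, Real.sq_sqrt hQ0]
    _ ≤ Real.exp (2 * π) ^ 2 * (B * (D * (2 * Real.log (1 + A) / A) * V ^ 3 * I + E * J ^ 2)) := by
        gcongr
    _ = _ := by
        rw [mul_pow, mul_pow, Real.sq_sqrt (by positivity)]; ring

lemma dyadic_weyl_kernel_bound {c : ℝ} (hc1 : 1 < c) (hc2 : c ≤ 21 / 10) (hc3 : c ≠ 2) :
    ∃ C : ℝ, 0 < C ∧ ∀ X θ : ℝ, 1 ≤ X → |θ| ≤ 1 →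
      ‖∑ n ∈ Ioc ⌊X / 2⌋₊ ⌊X⌋₊, eC (θ * (n : ℝ) ^ c)‖ ≤
        C * X * (1 + X ^ c * |θ|)⁻¹ + C * X ^ (17 / 20 : ℝ) := by
  obtain ⟨C, hC, h⟩ := dyadic_weyl_sum_bound hc1 hc2 hc3
  refine ⟨2 * C + 1, by positivity, fun X θ hX hθ => ?_⟩
  have hX0 : 0 < X := by linarith
  have hXc : 0 < X ^ c := by positivity
  have hE : 0 ≤ X ^ (17 / 20 : ℝ) := by positivity
  rcases eq_or_ne θ 0 with rfl | h0
  · have h1 := (norm_sum_eC_le_card (Ioc ⌊X / 2⌋₊ ⌊X⌋₊) (fun n => 0 * (n : ℝ) ^ c)).trans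
      (card_Ioc_half_le hX0.le)
    simp only [abs_zero, mul_zero, add_zero, inv_one, mul_one]
    nlinarith
  · have hθ0 := abs_pos.2 h0
    have hmin : min X (X ^ (1 - c) / |θ|) ≤ 2 * X * (1 + X ^ c * |θ|)⁻¹ := by
      rw [← div_eq_mul_inv, le_div_iff₀ (by positivity)]
      rcases le_total (X ^ c * |θ|) 1 with h1 | h1
      · calc _ ≤ X * (1 + 1) := by gcongr; exact min_le_left _ _
          _ = _ := by ring
      · calc _ ≤ X ^ (1 - c) / |θ| * (X ^ c * |θ| + X ^ c * |θ|) := by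
              gcongr
              exact min_le_right _ _
          _ = 2 * X := by
              rw [Real.rpow_sub hX0, Real.rpow_one]
              field_simp; ring
    have h2 := h X θ hX h0 hθ
    have hi : 0 ≤ X * (1 + X ^ c * |θ|)⁻¹ := by positivity
    calc _ ≤ C * (2 * X * (1 + X ^ c * |θ|)⁻¹ + X ^ (17 / 20 : ℝ)) := h2.trans (by gcongr)
      _ ≤ _ := by nlinarith

/-- The part of `SS` over the primes in the dyadic block `(X/2, X]`. -/
noncomputable def blockSum (c X α : ℝ) : ℂ :=
  ∑ p ∈ (Ioc ⌊X / 2⌋₊ ⌊X⌋₊).filter Nat.Prime, (Real.log p : ℂ) * eC (⌊(p : ℝ) ^ c⌋ * α)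

lemma block_fifth_moment_le {c : ℝ} (hc1 : 1 < c) (hc3 : c < 206 / 100) (hc2 : c ≠ 2) :
    ∃ C : ℝ, 0 < C ∧ ∀ X V a b : ℝ, 1 ≤ X → 0 ≤ a → a ≤ b → b ≤ 1 →
      (∀ α, a ≤ α → α ≤ b → ‖blockSum c X α‖ ≤ V) →
      ∫ α in a..b, ‖blockSum c X α‖ ^ 5 ≤ C * (1 + Real.log X) ^ 5 *
        (X ^ (2 - c) * V ^ 3 + X ^ (93 / 100 : ℝ) * (X ^ (4 - c) + X ^ 2)) := by
  obtain ⟨C₁, hC₁, hker⟩ := dyadic_weyl_kernel_bound hc1 (by linarith : c ≤ 21 / 10) hc2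
  obtain ⟨C₂, hC₂, hJ⟩ := prime_fourth_moment_le hc1 (by norm_num : (0 : ℝ) < 1 / 200)
  refine ⟨Real.exp (2 * π) ^ 2 * C₁ * 6 + Real.exp (2 * π) * √C₁ * C₂, by positivity,
    fun X V a b hX ha hab hb hV => ?_⟩
  have hX0 : 0 < X := by linarith
  have hV0 : 0 ≤ V := (norm_nonneg _).trans (hV a le_rfl hab)
  have hlog := Real.log_nonneg hX
  set l := 1 + Real.log X with hl
  have hl1 : 1 ≤ l := by linarith
  have hB : ∑ n ∈ (Ioc ⌊X / 2⌋₊ ⌊X⌋₊).filter Nat.Prime, Real.log n ^ 2 ≤ X * l ^ 2 := by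
    calc _ ≤ ∑ n ∈ (Ioc ⌊X / 2⌋₊ ⌊X⌋₊).filter Nat.Prime, l ^ 2 := by
          refine sum_le_sum fun n hn => ?_
          have hp := (mem_filter.1 hn).2
          have h1 := (Nat.le_floor_iff hX0.le).1 (mem_Ioc.1 (mem_filter.1 hn).1).2
          have h2 := Real.log_le_log (by exact_mod_cast hp.pos : (0 : ℝ) < n) h1
          have h3 := Real.log_natCast_nonneg n
          gcongr
          linarith
      _ ≤ _ := by
          rw [sum_const, nsmul_eq_mul]
          gcongr
          refine le_trans ?_ (card_Ioc_half_le hX0.le)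
          exact_mod_cast card_filter_le _ _
  have key := fifth_moment_le (filter_subset Nat.Prime (Ioc ⌊X / 2⌋₊ ⌊X⌋₊))
    (w := fun n => Real.log n) (t := fun n => (n : ℝ) ^ c) (A := X ^ c) (D := C₁ * X)
    (E := C₁ * X ^ (17 / 20 : ℝ)) (by positivity) (by positivity) (by positivity) hB ha hab hb
    (fun θ hθ => hker X θ hX hθ) hV
  refine key.trans ?_
  have hlg : Real.log (1 + X ^ c) ≤ 3 * l := by
    have h1 : 1 ≤ X ^ c := Real.one_le_rpow hX (by linarith)
    calc Real.log (1 + X ^ c) ≤ Real.log (2 * X ^ c) := Real.log_le_log (by positivity) (by linarith)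
      _ = Real.log 2 + c * Real.log X := by
          rw [Real.log_mul (by norm_num) (by positivity), Real.log_rpow hX0]
      _ ≤ 3 * l := by
          have := Real.log_two_lt_d9
          nlinarith
  have t1 : Real.exp (2 * π) ^ 2 * (X * l ^ 2) * (C₁ * X * (2 * Real.log (1 + X ^ c) / X ^ c)) * V ^ 3 ≤
      Real.exp (2 * π) ^ 2 * C₁ * 6 * l ^ 5 * (X ^ (2 - c) * V ^ 3) := by
    calc _ ≤ Real.exp (2 * π) ^ 2 * (X * l ^ 2) * (C₁ * X * (2 * (3 * l) / X ^ c)) * V ^ 3 := by gcongr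
      _ = Real.exp (2 * π) ^ 2 * C₁ * 6 * l ^ 3 * (X ^ (2 - c) * V ^ 3) := by
          rw [Real.rpow_sub hX0, Real.rpow_two]; field_simp; ring
      _ ≤ _ := by gcongr; norm_num
  have hsq : √(X * l ^ 2 * (C₁ * X ^ (17 / 20 : ℝ))) = √C₁ * l * X ^ (37 / 40 : ℝ) := by
    have e : X * l ^ 2 * (C₁ * X ^ (17 / 20 : ℝ)) = C₁ * (l * X ^ (37 / 40 : ℝ)) ^ 2 := by
      have : X * X ^ (17 / 20 : ℝ) = (X ^ (37 / 40 : ℝ)) ^ 2 := by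
        rw [← Real.rpow_natCast, ← Real.rpow_mul hX0.le, ← Real.rpow_one_add' hX0.le (by norm_num)]
        norm_num
      linear_combination l ^ 2 * C₁ * this
    rw [e, Real.sqrt_mul hC₁.le, Real.sqrt_sq (by positivity), mul_assoc]
  have t2 := hJ X hX
  rw [hsq]
  calc _ ≤ Real.exp (2 * π) ^ 2 * C₁ * 6 * l ^ 5 * (X ^ (2 - c) * V ^ 3) +
        Real.exp (2 * π) * (√C₁ * l * X ^ (37 / 40 : ℝ)) *
        (C₂ * l ^ 4 * (X ^ (1 / 200 : ℝ) * (X ^ (4 - c) + X ^ 2))) := by gcongr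
    _ = Real.exp (2 * π) ^ 2 * C₁ * 6 * (l ^ 5 * (X ^ (2 - c) * V ^ 3)) +
        Real.exp (2 * π) * √C₁ * C₂ * (l ^ 5 * (X ^ (93 / 100 : ℝ) * (X ^ (4 - c) + X ^ 2))) := by
        have : X ^ (93 / 100 : ℝ) = X ^ (37 / 40 : ℝ) * X ^ (1 / 200 : ℝ) := by
          rw [← Real.rpow_add hX0]; norm_num
        rw [this]; ring
    _ ≤ _ := by
        have h1 : 0 ≤ l ^ 5 * (X ^ (2 - c) * V ^ 3) := by positivity
        have h2 : 0 ≤ l ^ 5 * (X ^ (93 / 100 : ℝ) * (X ^ (4 - c) + X ^ 2)) := by positivity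
        have h3 : 0 ≤ Real.exp (2 * π) ^ 2 * C₁ * 6 := by positivity
        have h4 : 0 ≤ Real.exp (2 * π) * √C₁ * C₂ := by positivity
        nlinarith [mul_nonneg h3 h2, mul_nonneg h4 h1]

lemma minor_arc_block_le {c : ℝ} (hc1 : 1 < c) (hc3 : c < 206 / 100) (hc2 : c ≠ 2) :
    ∃ C : ℝ, 0 < C ∧ ∀ P X ε : ℝ, 1 ≤ X → X ≤ P → ε ≤ 1 / 100 → P ^ (1 - c - ε) ≤ 1 / 2 →
      ∫ α in P ^ (1 - c - ε)..1 - P ^ (1 - c - ε), ‖blockSum c X α‖ ^ 5 ≤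
        C * (1 + Real.log P) ^ 5 * P ^ (5 - c - 1 / 1000) := by
  obtain ⟨C₁, hC₁, hsup⟩ := sup_bound hc1 hc3 hc2
  obtain ⟨C₂, hC₂, hfif⟩ := block_fifth_moment_le hc1 hc3 hc2
  refine ⟨C₂ * (2 * (C₁ + 2) ^ 2 + 2), by positivity, fun P X ε hX hXP hε hτ => ?_⟩
  have hX0 : 0 < X := by linarith
  have hP : 1 ≤ P := hX.trans hXP
  have hP0 : 0 < P := by linarith
  set τ := P ^ (1 - c - ε) with hτdef
  have hτ0 : 0 < τ := by positivity
  set R := P ^ (1 - 1 / 2000 : ℝ) with hR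
  have hR0 : 0 < R := by positivity
  have htriv : ∀ α, ‖blockSum c X α‖ ≤ 2 * X := fun α =>
    norm_sum_log_prime_mul_le hX0.le fun _ => (norm_eC _).le
  have hsupR : ∀ α, τ ≤ α → α ≤ 1 - τ → ‖blockSum c X α‖ ≤ (C₁ + 2) * R := by
    intro α h1 h2
    rcases le_total X (P ^ (49 / 50 : ℝ)) with h | h
    · refine (htriv α).trans ?_
      have : P ^ (49 / 50 : ℝ) ≤ R := Real.rpow_le_rpow_of_exponent_le hP (by norm_num)
      nlinarith
    · have h3 : X ^ (9 / 10 - c) ≤ τ := by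
        calc X ^ (9 / 10 - c) ≤ (P ^ (49 / 50 : ℝ)) ^ (9 / 10 - c) :=
              Real.rpow_le_rpow_of_nonpos (by positivity) h (by linarith)
          _ = P ^ (49 / 50 * (9 / 10 - c)) := by rw [← Real.rpow_mul hP0.le]
          _ ≤ τ := Real.rpow_le_rpow_of_exponent_le hP (by linarith)
      have h4 := hsup X α hX (h3.trans h1) (h2.trans (by linarith))
      have h5 : X ^ (1 - 1 / 2000 : ℝ) ≤ R := by
        rw [hR]; gcongr
      refine h4.trans ?_
      gcongr
      linarith
  have key := hfif X (min (2 * X) ((C₁ + 2) * R)) τ (1 - τ) hX hτ0.le (by linarith) (by linarith)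
    fun α h1 h2 => le_min (htriv α) (hsupR α h1 h2)
  refine key.trans ?_
  set V := min (2 * X) ((C₁ + 2) * R) with hV
  have hV0 : 0 ≤ V := by positivity
  have hlogle : Real.log X ≤ Real.log P := Real.log_le_log hX0 hXP
  have hlog := Real.log_nonneg hX
  set Z := P ^ (5 - c - 1 / 1000) with hZ
  have hR2 : R ^ 2 = P ^ (2 - 1 / 1000 : ℝ) := by
    rw [hR, ← Real.rpow_natCast, ← Real.rpow_mul hP0.le]; norm_num
  have t1 : X ^ (2 - c) * V ^ 3 ≤ 2 * (C₁ + 2) ^ 2 * Z := by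
    calc X ^ (2 - c) * V ^ 3 = X ^ (2 - c) * (V * V ^ 2) := by ring
      _ ≤ X ^ (2 - c) * (2 * X * ((C₁ + 2) * R) ^ 2) := by
          gcongr
          · exact min_le_left _ _
          · exact min_le_right _ _
      _ = 2 * (C₁ + 2) ^ 2 * (X ^ (3 - c) * R ^ 2) := by
          have : X ^ (3 - c) = X ^ (2 - c) * X := by
            rw [← Real.rpow_add_one hX0.ne']; congr 1; ring
          rw [this]; ring
      _ ≤ 2 * (C₁ + 2) ^ 2 * (P ^ (3 - c) * R ^ 2) := by
          have : 0 ≤ 3 - c := by linarith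
          gcongr
      _ = _ := by
          rw [hR2, ← Real.rpow_add hP0, hZ]
          congr 2; ring
  have t2 : X ^ (93 / 100 : ℝ) * (X ^ (4 - c) + X ^ 2) ≤ 2 * Z := by
    have h1 : X ^ (93 / 100 : ℝ) * X ^ (4 - c) ≤ Z := by
      rw [← Real.rpow_add hX0]
      calc X ^ (93 / 100 + (4 - c)) ≤ P ^ (93 / 100 + (4 - c)) := by
            have : 0 ≤ 93 / 100 + (4 - c) := by linarith
            gcongr
        _ ≤ Z := Real.rpow_le_rpow_of_exponent_le hP (by linarith)
    have h2 : X ^ (93 / 100 : ℝ) * X ^ 2 ≤ Z := by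
      rw [← Real.rpow_two, ← Real.rpow_add hX0]
      calc X ^ (93 / 100 + 2 : ℝ) ≤ P ^ (93 / 100 + 2 : ℝ) := by
            gcongr
        _ ≤ Z := Real.rpow_le_rpow_of_exponent_le hP (by linarith)
    linarith
  have hlP : 0 ≤ 1 + Real.log P := by linarith
  calc _ ≤ C₂ * (1 + Real.log P) ^ 5 * (2 * (C₁ + 2) ^ 2 * Z + 2 * Z) := by gcongr
    _ = _ := by ring

lemma sum_primes_eq_sum_dyadic (f : ℕ → ℂ) (P : ℝ) (D : ℕ) :
    ∑ p ∈ (range (⌊P⌋₊ + 1)).filter Nat.Prime, f p =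
      (∑ j ∈ range D, ∑ p ∈ (Ioc ⌊P / 2 ^ j / 2⌋₊ ⌊P / 2 ^ j⌋₊).filter Nat.Prime, f p) +
        ∑ p ∈ (range (⌊P / 2 ^ D⌋₊ + 1)).filter Nat.Prime, f p := by
  induction D with
  | zero => simp
  | succ D ih =>
    rw [ih, sum_range_succ, add_assoc]
    congr 1
    have e : P / 2 ^ (D + 1) = P / 2 ^ D / 2 := by rw [pow_succ, div_div]
    rw [e, sum_filter, sum_filter, sum_filter, Ioc_eq_Ico_succ]
    refine ((add_comm _ _).trans
      (sum_range_add_sum_Ico (fun p => if p.Prime then f p else 0) ?_)).symm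
    rcases le_total 0 (P / 2 ^ D) with h | h
    · have := Nat.floor_le_floor (half_le_self h)
      omega
    · rw [Nat.floor_of_nonpos h, Nat.floor_of_nonpos (by linarith)]

lemma SS_eq_sum_blockSum {P : ℝ} (hP : 1 ≤ P) (c : ℝ) : ∃ D : ℕ, (D : ℝ) ≤ 2 * (1 + Real.log P) ∧
    (∀ j < D, 1 ≤ P / 2 ^ j) ∧ ∀ α, SS c P α = ∑ j ∈ range D, blockSum c (P / 2 ^ j) α := by
  have hP0 : 0 < P := by linarith
  have hfl : ⌊P⌋₊ ≠ 0 := (Nat.floor_pos.2 hP).ne'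
  have hpow : ∀ j < Nat.log 2 ⌊P⌋₊ + 1, (2 : ℝ) ^ j ≤ P := fun j hj => by
    have h1 : 2 ^ j ≤ ⌊P⌋₊ := Nat.pow_le_of_le_log hfl (by omega)
    exact le_trans (by exact_mod_cast h1) (Nat.floor_le hP0.le)
  refine ⟨Nat.log 2 ⌊P⌋₊ + 1, ?_, fun j hj => ?_, fun α => ?_⟩
  · have h1 := Real.log_le_log (by positivity) (hpow _ (Nat.lt_succ_self _))
    rw [Real.log_pow] at h1
    have h2 := Real.log_two_gt_d9
    push_cast
    have h3 : (0 : ℝ) ≤ Nat.log 2 ⌊P⌋₊ := Nat.cast_nonneg _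
    nlinarith
  · rw [le_div_iff₀ (by positivity), one_mul]; exact hpow j hj
  · rw [SS, sum_primes_eq_sum_dyadic _ P (Nat.log 2 ⌊P⌋₊ + 1)]
    have h1 : ⌊P / 2 ^ (Nat.log 2 ⌊P⌋₊ + 1)⌋₊ = 0 := by
      rw [Nat.floor_eq_zero, div_lt_one (by positivity)]
      have h1 : ⌊P⌋₊ + 1 ≤ 2 ^ (Nat.log 2 ⌊P⌋₊ + 1) := Nat.lt_pow_succ_log_self (by norm_num) _
      exact (Nat.lt_floor_add_one P).trans_le (by exact_mod_cast h1)
    have h2 : (range (0 + 1)).filter Nat.Prime = ∅ := by decide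
    rw [h1, h2, sum_empty, add_zero]
    rfl

lemma continuous_blockSum (c X : ℝ) : Continuous (blockSum c X) :=
  continuous_finsetSum _ fun _ _ =>
    continuous_const.mul (continuous_eC.comp (continuous_const.mul continuous_id))

lemma minor_arc_fifth_moment_le {c : ℝ} (hc1 : 1 < c) (hc3 : c < 206 / 100) (hc2 : c ≠ 2) :
    ∃ C : ℝ, 0 < C ∧ ∀ P ε : ℝ, 1 ≤ P → ε ≤ 1 / 100 → P ^ (1 - c - ε) ≤ 1 / 2 →
      ∫ α in P ^ (1 - c - ε)..1 - P ^ (1 - c - ε), ‖SS c P α‖ ^ 5 ≤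
        C * P ^ (5 - c - 1 / 2000) := by
  obtain ⟨C₁, hC₁, hblock⟩ := minor_arc_block_le hc1 hc3 hc2
  obtain ⟨C₂, hC₂, hlog⟩ := one_add_log_pow_le 10 (by norm_num : (0 : ℝ) < 1 / 2000)
  refine ⟨32 * C₁ * C₂, by positivity, fun P ε hP hε hτ => ?_⟩
  have hP0 : 0 < P := by linarith
  have hl := Real.log_nonneg hP
  obtain ⟨D, hD, hDj, hSS⟩ := SS_eq_sum_blockSum hP c
  set τ := P ^ (1 - c - ε) with hτdef
  have hτ0 : 0 < τ := by positivity
  have hab : τ ≤ 1 - τ := by linarith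
  have hcs : ∀ j, Continuous fun α => ‖blockSum c (P / 2 ^ j) α‖ ^ 5 := fun j =>
    (continuous_blockSum _ _).norm.pow 5
  have hSc : Continuous fun α => ‖SS c P α‖ ^ 5 := by
    simp_rw [hSS]
    exact (continuous_finsetSum _ fun j _ => continuous_blockSum _ _).norm.pow 5
  have hpt : ∀ α, ‖SS c P α‖ ^ 5 ≤ (D : ℝ) ^ 4 * ∑ j ∈ range D, ‖blockSum c (P / 2 ^ j) α‖ ^ 5 := by
    intro α
    rw [hSS]
    rcases Nat.eq_zero_or_pos D with h0 | h0
    · subst h0; simp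
    · have h := pow_sum_div_card_le_sum_pow (s := range D) (f := fun j => ‖blockSum c (P / 2 ^ j) α‖)
        (fun j _ => norm_nonneg _) 4
      rw [card_range, div_le_iff₀ (by positivity)] at h
      calc _ ≤ (∑ j ∈ range D, ‖blockSum c (P / 2 ^ j) α‖) ^ 5 := by
            gcongr
            exact norm_sum_le _ _
        _ ≤ _ := by rw [mul_comm]; exact h
  calc ∫ α in τ..1 - τ, ‖SS c P α‖ ^ 5 ≤
        ∫ α in τ..1 - τ, (D : ℝ) ^ 4 * ∑ j ∈ range D, ‖blockSum c (P / 2 ^ j) α‖ ^ 5 :=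
        intervalIntegral.integral_mono_on hab (hSc.intervalIntegrable _ _)
          ((continuous_const.mul (continuous_finsetSum _ fun j _ => hcs j)).intervalIntegrable _ _)
          fun α _ => hpt α
    _ = (D : ℝ) ^ 4 * ∑ j ∈ range D, ∫ α in τ..1 - τ, ‖blockSum c (P / 2 ^ j) α‖ ^ 5 := by
        rw [intervalIntegral.integral_const_mul, intervalIntegral.integral_finsetSum fun j _ =>
          (hcs j).intervalIntegrable _ _]
    _ ≤ (D : ℝ) ^ 4 * ∑ j ∈ range D, C₁ * (1 + Real.log P) ^ 5 * P ^ (5 - c - 1 / 1000) := by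
        gcongr with j hj
        refine hblock P _ ε (hDj j (mem_range.1 hj)) ?_ hε hτ
        exact div_le_self hP0.le (one_le_pow₀ (by norm_num))
    _ = (D : ℝ) ^ 5 * (C₁ * (1 + Real.log P) ^ 5 * P ^ (5 - c - 1 / 1000)) := by
        rw [sum_const, card_range, nsmul_eq_mul]; ring
    _ ≤ (2 * (1 + Real.log P)) ^ 5 * (C₁ * (1 + Real.log P) ^ 5 * P ^ (5 - c - 1 / 1000)) := by
        gcongr
    _ = 32 * C₁ * (1 + Real.log P) ^ 10 * P ^ (5 - c - 1 / 1000) := by ring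
    _ ≤ 32 * C₁ * (C₂ * P ^ (1 / 2000 : ℝ)) * P ^ (5 - c - 1 / 1000) := by
        gcongr
        exact hlog P hP
    _ = 32 * C₁ * C₂ * (P ^ (1 / 2000 : ℝ) * P ^ (5 - c - 1 / 1000)) := by ring
    _ = _ := by
        rw [← Real.rpow_add hP0]; congr 2; ring

theorem stmt_2 (c : ℝ) (hc1 : 1 < c) (hc2 : c < 4109054 / 1999527) (hc3 : c ≠ 2) :
    ∃ ε₀ > 0, ∀ ε : ℝ, 0 < ε → ε ≤ ε₀ →
      ∃ ε' > 0, ∃ C > 0, ∃ N₀ : ℕ, ∀ N : ℕ, N₀ ≤ N →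
        ∀ P τ : ℝ, P = (N : ℝ) ^ (1 / c) → τ = P ^ (1 - c - ε) →
          ‖∫ α in τ..(1 - τ), (SS c P α) ^ 5 * eC (-(N : ℝ) * α)‖
            ≤ C * (N : ℝ) ^ (5 / c - 1 - ε') := by
  have hc0 : 0 < c := by linarith
  obtain ⟨C, hC, hmain⟩ := minor_arc_fifth_moment_le hc1 (hc2.trans (by norm_num)) hc3
  refine ⟨1 / 100, by norm_num, fun ε hε0 hε => ⟨1 / (2000 * c), by positivity, C, hC, ?_⟩⟩
  have hlim : Filter.Tendsto (fun N : ℕ => (N : ℝ) ^ (-((c - 1 + ε) / c))) Filter.atTop (nhds 0) :=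
    (tendsto_rpow_neg_atTop (by have := sub_pos.2 hc1; positivity)).comp tendsto_natCast_atTop_atTop
  obtain ⟨N₀, hN₀⟩ := Filter.eventually_atTop.1
    (hlim.eventually (ge_mem_nhds (by norm_num : (0 : ℝ) < 1 / 2)))
  refine ⟨max N₀ 1, fun N hN P τ hP hτ => ?_⟩
  have hN1 : (1 : ℝ) ≤ N := by exact_mod_cast (le_max_right _ _).trans hN
  have hN0 : (0 : ℝ) ≤ N := by linarith
  have hP1 : 1 ≤ P := by rw [hP]; exact Real.one_le_rpow hN1 (by positivity)
  have hτ2 : P ^ (1 - c - ε) ≤ 1 / 2 := by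
    have h1 := hN₀ N ((le_max_left _ _).trans hN)
    rw [hP, ← Real.rpow_mul hN0]
    convert! h1 using 2
    ring
  have h := hmain P ε hP1 hε hτ2
  rw [← hτ] at h hτ2
  have hcont : Continuous fun α => ‖SS c P α‖ ^ 5 := by
    refine Continuous.pow (Continuous.norm ?_) 5
    exact continuous_finsetSum _ fun _ _ =>
      continuous_const.mul (continuous_eC.comp (continuous_const.mul continuous_id))
  refine (intervalIntegral.norm_integral_le_of_norm_le (by linarith) (ae_of_all _ fun α _ => ?_)
    (hcont.intervalIntegrable _ _)).trans (h.trans_eq ?_)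
  · rw [norm_mul, norm_eC, mul_one, norm_pow]
  · rw [hP, ← Real.rpow_mul hN0]
    congr 2
    field_simp
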